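/- Let p < q < r be distinct prime numbers. Let H be a semisimple Hopf algebra over ℂ of dimension pqr, and let V be a simple left H-module. Then the dimension of V over ℂ divides pqr. -/

import Mathlib

open TensorProduct Coalgebra HopfAlgebra

noncomputable section

set_option linter.unusedSectionVars false
set_option linter.unusedSimpArgs false

namespace FinHopf

variable {H : Type*} [Ring H] [HopfAlgebra ℂ H]

/-- The left convolution action `x ↦ x₁ f(x₂)` of a functional. -/
def lact (f : H →ₗ[ℂ] ℂ) : H →ₗ[ℂ] H :=
  (TensorProduct.rid ℂ H).toLinearMap ∘ₗ f.lTensor H ∘ₗ comul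

/-- The right convolution action `x ↦ f(x₁) x₂` of a functional. -/
def ract (f : H →ₗ[ℂ] ℂ) : H →ₗ[ℂ] H :=
  (TensorProduct.lid ℂ H).toLinearMap ∘ₗ f.rTensor H ∘ₗ comul

/-- The convolution product of functionals. -/
def conv (f g : H →ₗ[ℂ] ℂ) : H →ₗ[ℂ] ℂ :=
  LinearMap.mul' ℂ ℂ ∘ₗ TensorProduct.map f g ∘ₗ comul

variable [FiniteDimensional ℂ H]

variable (H) in
/-- Index type of the regular comatrix. -/
abbrev Ix := Fin (Module.finrank ℂ H)

/-- Entries of the comatrix of the regular corepresentation. -/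
def cm (i j : Ix H) : H :=
  TensorProduct.lid ℂ H (((Module.finBasis ℂ H).coord i).rTensor H
    (comul (Module.finBasis ℂ H j)))

lemma comul_finBasis (j : Ix H) :
    comul (R := ℂ) (Module.finBasis ℂ H j) = ∑ i, Module.finBasis ℂ H i ⊗ₜ[ℂ] cm i j := by
  set b := Module.finBasis ℂ H
  have key : ∀ t : H ⊗[ℂ] H,
      t = ∑ i, b i ⊗ₜ[ℂ] (TensorProduct.lid ℂ H ((b.coord i).rTensor H t)) := by
    intro t
    induction t with
    | zero => simp
    | add x y hx hy =>
      conv_lhs => rw [hx, hy]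
      simp [tmul_add, Finset.sum_add_distrib]
    | tmul x y =>
      simp only [LinearMap.rTensor_tmul, TensorProduct.lid_tmul, ← smul_tmul, ← sum_tmul]
      simp [b.sum_repr]
  exact key _

lemma comul_cm (k j : Ix H) :
    comul (R := ℂ) (cm k j : H) = ∑ i, cm k i ⊗ₜ[ℂ] cm i j := by
  have h := coassoc_apply (R := ℂ) (Module.finBasis ℂ H j)
  rw [comul_finBasis] at h
  simp only [map_sum, LinearMap.rTensor_tmul, LinearMap.lTensor_tmul, comul_finBasis,
    sum_tmul, TensorProduct.assoc_tmul] at h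
  have h2 := congrArg (fun t => TensorProduct.lid ℂ (H ⊗[ℂ] H)
    (((Module.finBasis ℂ H).coord k).rTensor (H ⊗[ℂ] H) t)) h
  simp only [map_sum, LinearMap.rTensor_tmul, TensorProduct.lid_tmul, Module.Basis.coord_apply,
    Module.Basis.repr_self, Finsupp.single_apply, ite_smul, one_smul, zero_smul,
    Finset.sum_ite_eq', Finset.mem_univ, if_true] at h2
  exact h2.symm

lemma counit_cm (i j : Ix H) : counit (R := ℂ) (cm i j : H) = if i = j then 1 else 0 := by
  have h := lTensor_counit_comul (R := ℂ) (Module.finBasis ℂ H j)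
  rw [comul_finBasis] at h
  have h2 := congrArg (fun t => TensorProduct.lid ℂ ℂ
    (((Module.finBasis ℂ H).coord i).rTensor ℂ t)) h
  simp only [map_sum, LinearMap.rTensor_tmul, LinearMap.lTensor_tmul, TensorProduct.lid_tmul,
    Module.Basis.coord_apply, Module.Basis.repr_self, Finsupp.single_apply, ite_smul, one_smul,
    zero_smul, Finset.sum_ite_eq', Finset.mem_univ, if_true] at h2
  simp [h2, eq_comm]

lemma finBasis_eq_sum_cm (j : Ix H) :
    Module.finBasis ℂ H j = ∑ i, counit (R := ℂ) (Module.finBasis ℂ H i) • cm i j := by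
  have h := rTensor_counit_comul (R := ℂ) (Module.finBasis ℂ H j)
  rw [comul_finBasis] at h
  have h2 := congrArg (TensorProduct.lid ℂ H) h
  simpa using h2.symm

lemma cm_ext {W : Type*} [AddCommGroup W] [Module ℂ W] {f g : H →ₗ[ℂ] W}
    (h : ∀ i j, f (cm i j) = g (cm i j)) : f = g := by
  refine (Module.finBasis ℂ H).ext fun j => ?_
  rw [finBasis_eq_sum_cm]
  simp [h]

lemma cm_ext_apply {W : Type*} [AddCommGroup W] [Module ℂ W] {f g : H →ₗ[ℂ] W}
    (h : ∀ i j, f (cm i j) = g (cm i j)) (x : H) : f x = g x := by rw [cm_ext h]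

lemma sum_antipode_cm_mul (i j : Ix H) :
    ∑ k, antipode ℂ (cm i k : H) * cm k j = if i = j then 1 else 0 := by
  have h := mul_antipode_rTensor_comul_apply (R := ℂ) (cm i j : H)
  rw [comul_cm, counit_cm] at h
  simp only [map_sum, LinearMap.rTensor_tmul, LinearMap.mul'_apply] at h
  rw [h]; split_ifs <;> simp

lemma sum_cm_mul_antipode (i j : Ix H) :
    ∑ k, (cm i k : H) * antipode ℂ (cm k j) = if i = j then 1 else 0 := by
  have h := mul_antipode_lTensor_comul_apply (R := ℂ) (cm i j : H)
  rw [comul_cm, counit_cm] at h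
  simp only [map_sum, LinearMap.lTensor_tmul, LinearMap.mul'_apply] at h
  rw [h]; split_ifs <;> simp

@[simp] lemma lact_cm (f : H →ₗ[ℂ] ℂ) (i j : Ix H) :
    lact f (cm i j : H) = ∑ k, f (cm k j) • cm i k := by
  simp [lact, comul_cm]

@[simp] lemma ract_cm (f : H →ₗ[ℂ] ℂ) (i j : Ix H) :
    ract f (cm i j : H) = ∑ k, f (cm i k) • cm k j := by
  simp [ract, comul_cm]

@[simp] lemma conv_cm (f g : H →ₗ[ℂ] ℂ) (i j : Ix H) :
    conv f g (cm i j : H) = ∑ k, f (cm i k) * g (cm k j) := by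
  simp [conv, comul_cm]

lemma lact_lact (f g : H →ₗ[ℂ] ℂ) (x : H) : lact f (lact g x) = lact (conv f g) x := by
  refine cm_ext_apply (f := lact f ∘ₗ lact g) (fun i j => ?_) x
  simp only [LinearMap.comp_apply, lact_cm, map_sum, map_smul, conv_cm, Finset.smul_sum, smul_smul,
    Finset.sum_smul]
  rw [Finset.sum_comm]
  simp_rw [mul_comm]

lemma ract_ract (f g : H →ₗ[ℂ] ℂ) (x : H) : ract f (ract g x) = ract (conv g f) x := by
  refine cm_ext_apply (f := ract f ∘ₗ ract g) (fun i j => ?_) x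
  simp only [LinearMap.comp_apply, ract_cm, map_sum, map_smul, conv_cm, Finset.smul_sum, smul_smul,
    Finset.sum_smul]
  rw [Finset.sum_comm]

lemma lact_ract (f g : H →ₗ[ℂ] ℂ) (x : H) : lact f (ract g x) = ract g (lact f x) := by
  refine cm_ext_apply (f := lact f ∘ₗ ract g) (g := ract g ∘ₗ lact f) (fun i j => ?_) x
  simp only [LinearMap.comp_apply, ract_cm, lact_cm, map_sum, map_smul, Finset.smul_sum, smul_smul]
  rw [Finset.sum_comm]
  simp_rw [mul_comm]

lemma apply_lact (f g : H →ₗ[ℂ] ℂ) (x : H) : f (lact g x) = conv f g x := by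
  refine cm_ext_apply (f := f ∘ₗ lact g) (fun i j => ?_) x
  simp [mul_comm]

lemma apply_ract (f g : H →ₗ[ℂ] ℂ) (x : H) : f (ract g x) = conv g f x := by
  refine cm_ext_apply (f := f ∘ₗ ract g) (fun i j => ?_) x
  simp

@[simp] lemma lact_counit (x : H) : lact (counit (R := ℂ)) x = x := by
  refine cm_ext_apply (g := LinearMap.id) (fun i j => ?_) x
  simp [counit_cm]

@[simp] lemma ract_counit (x : H) : ract (counit (R := ℂ)) x = x := by
  refine cm_ext_apply (g := LinearMap.id) (fun i j => ?_) x
  simp [counit_cm]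

@[simp] lemma conv_counit (f : H →ₗ[ℂ] ℂ) : conv f (counit (R := ℂ)) = f := by
  ext x; rw [← apply_lact, lact_counit]

@[simp] lemma counit_conv (f : H →ₗ[ℂ] ℂ) : conv (counit (R := ℂ)) f = f := by
  ext x; rw [← apply_ract, ract_counit]

lemma conv_assoc (f g h : H →ₗ[ℂ] ℂ) : conv (conv f g) h = conv f (conv g h) := by
  ext x; rw [← apply_lact, ← apply_lact, ← apply_lact, lact_lact]

lemma antipode_comul_cm (i j : Ix H) :
    comul (R := ℂ) (antipode ℂ (cm i j : H)) =
      ∑ k, antipode ℂ (cm k j : H) ⊗ₜ[ℂ] antipode ℂ (cm i k : H) := by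
  -- both sides are inverse to the matrix `Δ(u)`
  let M : Matrix (Ix H) (Ix H) (H ⊗[ℂ] H) := Matrix.of fun i j => comul (R := ℂ) (cm i j : H)
  let A : Matrix (Ix H) (Ix H) (H ⊗[ℂ] H) :=
    Matrix.of fun i j => comul (R := ℂ) (antipode ℂ (cm i j : H))
  let B : Matrix (Ix H) (Ix H) (H ⊗[ℂ] H) :=
    Matrix.of fun i j => ∑ k, antipode ℂ (cm k j : H) ⊗ₜ[ℂ] antipode ℂ (cm i k : H)
  have hA : A * M = 1 := by
    ext i j
    simp only [A, M, Matrix.mul_apply, Matrix.of_apply, ← Bialgebra.comul_mul, ← map_sum,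
      sum_antipode_cm_mul, Matrix.one_apply]
    split_ifs <;> simp
  have hB : M * B = 1 := by
    ext i j
    simp only [B, M, Matrix.mul_apply, Matrix.of_apply, comul_cm, Finset.sum_mul_sum,
      Algebra.TensorProduct.tmul_mul_tmul, Matrix.one_apply]
    calc ∑ x, ∑ a, ∑ b, (cm i a * antipode ℂ (cm b j)) ⊗ₜ[ℂ] (cm a x * antipode ℂ (cm x b) : H)
        = ∑ a, ∑ b, (cm i a * antipode ℂ (cm b j) : H) ⊗ₜ[ℂ]
            ∑ x, (cm a x * antipode ℂ (cm x b) : H) := by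
          rw [Finset.sum_comm]
          refine Finset.sum_congr rfl fun a _ => ?_
          rw [Finset.sum_comm]
          simp_rw [tmul_sum]
      _ = _ := by
          simp only [sum_cm_mul_antipode, tmul_ite, Finset.sum_ite_eq,
            Finset.mem_univ, if_true, ← sum_tmul]
          split_ifs <;> simp [Algebra.TensorProduct.one_def]
  have : A = B := left_inv_eq_right_inv hA hB
  exact congrFun (congrFun this i) j

end FinHopf

namespace FinHopf

variable {H : Type*} [Ring H] [HopfAlgebra ℂ H]

lemma exists_left_integral [IsSemisimpleRing H] :
    ∃ L : H, counit (R := ℂ) L = 1 ∧ ∀ x : H, x * L = counit (R := ℂ) x • L := by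
  let I : Ideal H := RingHom.ker (Bialgebra.counitAlgHom ℂ H)
  obtain ⟨J, hJ⟩ := exists_isCompl I
  have h1 : (1 : H) ∈ I ⊔ J := by rw [hJ.sup_eq_top]; trivial
  obtain ⟨i, hi, L, hL, hiL⟩ := Submodule.mem_sup.1 h1
  have hi0 : counit (R := ℂ) i = 0 := hi
  refine ⟨L, ?_, fun x => ?_⟩
  · have := congrArg (counit (R := ℂ)) hiL
    simpa [hi0] using this
  · have hmem : (x - algebraMap ℂ H (counit (R := ℂ) x)) * L ∈ I ⊓ J := by
      refine ⟨?_, J.smul_mem _ hL⟩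
      change Bialgebra.counitAlgHom ℂ H _ = 0
      rw [map_mul]; simp
    rw [hJ.inf_eq_bot, Submodule.mem_bot, sub_mul, sub_eq_zero] at hmem
    rw [hmem, Algebra.smul_def]

lemma exists_right_integral [IsSemisimpleRing H] :
    ∃ L : H, counit (R := ℂ) L = 1 ∧ ∀ x : H, L * x = counit (R := ℂ) x • L := by
  let ε : Hᵐᵒᵖ →ₐ[ℂ] ℂ := AlgHom.ofLinearMap
    ((counit (R := ℂ) (A := H)) ∘ₗ (MulOpposite.opLinearEquiv ℂ).symm.toLinearMap) (by simp)
    (by intro x y; simp [mul_comm])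
  have hε : ∀ x, ε x = counit (R := ℂ) (MulOpposite.unop x) := fun x => rfl
  let I : Ideal Hᵐᵒᵖ := RingHom.ker ε
  obtain ⟨J, hJ⟩ := exists_isCompl I
  have h1 : (1 : Hᵐᵒᵖ) ∈ I ⊔ J := by rw [hJ.sup_eq_top]; trivial
  obtain ⟨i, hi, L, hL, hiL⟩ := Submodule.mem_sup.1 h1
  have hi0 : ε i = 0 := hi
  have hL1 : ε L = 1 := by simpa [hi0] using congrArg ε hiL
  refine ⟨MulOpposite.unop L, hL1, fun x => ?_⟩
  have hmem : (MulOpposite.op x - algebraMap ℂ Hᵐᵒᵖ (counit (R := ℂ) x)) * L ∈ I ⊓ J := by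
    refine ⟨?_, J.smul_mem _ hL⟩
    change ε _ = 0
    rw [map_mul]; simp [hε]
  rw [hJ.inf_eq_bot, Submodule.mem_bot, sub_mul, sub_eq_zero] at hmem
  have := congrArg MulOpposite.unop hmem
  simpa [Algebra.smul_def, Algebra.commutes] using this

lemma exists_integral [IsSemisimpleRing H] :
    ∃ L : H, counit (R := ℂ) L = 1 ∧ (∀ x : H, x * L = counit (R := ℂ) x • L) ∧
      ∀ x : H, L * x = counit (R := ℂ) x • L := by
  obtain ⟨L, h1, hl⟩ := exists_left_integral (H := H)
  obtain ⟨L', h1', hr⟩ := exists_right_integral (H := H)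
  have : L = L' := by
    have a := hl L'
    have b := hr L
    rw [h1', one_smul] at a
    rw [h1, one_smul] at b
    rw [← a, b]
  subst this
  exact ⟨L, h1, hl, hr⟩

variable (H) in
/-- The normalized two-sided integral of a semisimple Hopf algebra. -/
def intg [IsSemisimpleRing H] : H := (exists_integral (H := H)).choose

section intg
variable [IsSemisimpleRing H]

@[simp] lemma counit_intg : counit (R := ℂ) (intg H) = 1 := (exists_integral (H := H)).choose_spec.1

@[simp] lemma mul_intg (x : H) : x * intg H = counit (R := ℂ) x • intg H :=
  (exists_integral (H := H)).choose_spec.2.1 x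

@[simp] lemma intg_mul (x : H) : intg H * x = counit (R := ℂ) x • intg H :=
  (exists_integral (H := H)).choose_spec.2.2 x

/-- `x ⊗ y ↦ x z S(y)`. -/
def adMap (z : H) : H ⊗[ℂ] H →ₗ[ℂ] H :=
  LinearMap.mul' ℂ H ∘ₗ TensorProduct.map (LinearMap.mulRight ℂ z) (antipode ℂ)

lemma adMap_tmul (z x y : H) : adMap z (x ⊗ₜ y) = x * z * antipode ℂ y := by
  simp [adMap]

/-- A nonzero two-sided ideal stable set contains a central idempotent. -/
lemma exists_central_idempotent (I : Ideal H) (hI : ∀ x ∈ I, ∀ y, x * y ∈ I) :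
    ∃ e ∈ I, (∀ x, x * e = e * x) ∧ ∀ x ∈ I, x * e = x := by
  obtain ⟨J, hJ⟩ := exists_isCompl I
  have h1 : (1 : H) ∈ I ⊔ J := by rw [hJ.sup_eq_top]; trivial
  obtain ⟨e, he, j, hj, hej⟩ := Submodule.mem_sup.1 h1
  have hright : ∀ x ∈ I, x * e = x := fun x hx => by
    have h0 : x * j ∈ I ⊓ J := ⟨hI x hx j, J.smul_mem x hj⟩
    rw [hJ.inf_eq_bot, Submodule.mem_bot] at h0
    calc x * e = x * (e + j) := by rw [mul_add, h0, add_zero]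
      _ = x := by rw [hej, mul_one]
  let I' : Ideal Hᵐᵒᵖ :=
    { carrier := {x | MulOpposite.unop x ∈ I}
      add_mem' := fun ha hb => I.add_mem ha hb
      zero_mem' := I.zero_mem
      smul_mem' := fun c x hx => hI _ hx _ }
  obtain ⟨J', hJ'⟩ := exists_isCompl I'
  have h1' : (1 : Hᵐᵒᵖ) ∈ I' ⊔ J' := by rw [hJ'.sup_eq_top]; trivial
  obtain ⟨e', he', j', hj', hej'⟩ := Submodule.mem_sup.1 h1'
  have hleft : ∀ x ∈ I, MulOpposite.unop e' * x = x := fun x hx => by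
    have h0 : MulOpposite.op x * j' ∈ I' ⊓ J' := ⟨I.smul_mem _ hx, J'.smul_mem _ hj'⟩
    rw [hJ'.inf_eq_bot, Submodule.mem_bot] at h0
    have h2 : MulOpposite.op x * e' = MulOpposite.op x := by
      calc MulOpposite.op x * e' = MulOpposite.op x * (e' + j') := by rw [mul_add, h0, add_zero]
      _ = _ := by rw [hej', mul_one]
    simpa using congrArg MulOpposite.unop h2
  have hee : MulOpposite.unop e' = e := by
    rw [← hright _ he', hleft _ he]
  rw [hee] at hleft
  refine ⟨e, he, fun x => ?_, hright⟩
  rw [← hleft (x * e) (I.smul_mem x he), ← mul_assoc, hright _ (hI e he x)]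

variable [FiniteDimensional ℂ H]

lemma comul_intg_mul_left (x : H) :
    comul (R := ℂ) (intg H) * (x ⊗ₜ 1) = comul (R := ℂ) (intg H) * (1 ⊗ₜ antipode ℂ x) := by
  refine cm_ext_apply
    (f := LinearMap.mulLeft ℂ (comul (R := ℂ) (intg H)) ∘ₗ (TensorProduct.mk ℂ H H).flip 1)
    (g := LinearMap.mulLeft ℂ (comul (R := ℂ) (intg H)) ∘ₗ TensorProduct.mk ℂ H H 1 ∘ₗ antipode ℂ)
    (fun i j => ?_) x
  simp only [LinearMap.comp_apply, LinearMap.flip_apply, TensorProduct.mk_apply,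
    LinearMap.mulLeft_apply]
  have h1 : ∑ k, comul (R := ℂ) (cm i k : H) * (1 ⊗ₜ antipode ℂ (cm k j)) = cm i j ⊗ₜ[ℂ] 1 := by
    simp only [comul_cm, Finset.sum_mul, Algebra.TensorProduct.tmul_mul_tmul, mul_one]
    rw [Finset.sum_comm]
    simp_rw [← tmul_sum, sum_cm_mul_antipode]
    simp [tmul_ite]
  rw [← h1, Finset.mul_sum]
  simp_rw [← mul_assoc, ← Bialgebra.comul_mul, intg_mul, map_smul, counit_cm, smul_mul_assoc]
  simp

lemma comul_intg_mul_right (x : H) :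
    (1 ⊗ₜ x) * comul (R := ℂ) (intg H) = (antipode ℂ x ⊗ₜ 1) * comul (R := ℂ) (intg H) := by
  refine cm_ext_apply
    (f := LinearMap.mulRight ℂ (comul (R := ℂ) (intg H)) ∘ₗ TensorProduct.mk ℂ H H 1)
    (g := LinearMap.mulRight ℂ (comul (R := ℂ) (intg H)) ∘ₗ (TensorProduct.mk ℂ H H).flip 1 ∘ₗ
      antipode ℂ) (fun i j => ?_) x
  simp only [LinearMap.comp_apply, LinearMap.flip_apply, TensorProduct.mk_apply,
    LinearMap.mulRight_apply]
  have h1 : ∑ k, (antipode ℂ (cm i k) ⊗ₜ 1) * comul (R := ℂ) (cm k j : H) = 1 ⊗ₜ[ℂ] cm i j := by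
    simp only [comul_cm, Finset.mul_sum, Algebra.TensorProduct.tmul_mul_tmul, one_mul]
    rw [Finset.sum_comm]
    simp_rw [← sum_tmul, sum_antipode_cm_mul]
    simp [ite_tmul]
  rw [← h1, Finset.sum_mul]
  simp_rw [mul_assoc, ← Bialgebra.comul_mul, mul_intg, map_smul, counit_cm, mul_smul_comm]
  simp

lemma adMap_intg_of_central (e : H) (he : ∀ x, x * e = e * x) :
    adMap e (comul (R := ℂ) (intg H)) = e := by
  have : adMap e = LinearMap.mulLeft ℂ e ∘ₗ LinearMap.mul' ℂ H ∘ₗ (antipode ℂ).lTensor H := by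
    ext x y; simp [adMap_tmul, he, mul_assoc]
  rw [this]
  simp

lemma antipode_injective : Function.Injective (antipode ℂ (A := H)) := by
  rw [← LinearMap.ker_eq_bot, LinearMap.ker_eq_bot']
  let I : Ideal H :=
    { carrier := {x | antipode ℂ x = 0}
      add_mem' := fun {a b} ha hb => by simp_all
      zero_mem' := by simp
      smul_mem' := fun c x hx => by
        simp only [Set.mem_ofPred_eq, smul_eq_mul] at hx ⊢
        rw [antipode_mul_antidistrib, hx, zero_mul] }
  obtain ⟨e, he, hc, hid⟩ := exists_central_idempotent I (fun x hx y => by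
    change antipode ℂ (x * y) = 0
    rw [antipode_mul_antidistrib, show antipode ℂ x = 0 from hx, mul_zero])
  have h0 : comul (R := ℂ) (intg H) * (e ⊗ₜ 1) = 0 := by
    rw [comul_intg_mul_left, show antipode ℂ e = 0 from he]; simp
  have h1 : adMap 1 (comul (R := ℂ) (intg H) * (e ⊗ₜ 1)) = adMap e (comul (R := ℂ) (intg H)) := by
    have : adMap (1 : H) ∘ₗ LinearMap.mulRight ℂ (e ⊗ₜ[ℂ] (1 : H)) = adMap e := by
      ext x y; simp [adMap_tmul]
    rw [← this]; rfl
  rw [h0, map_zero, adMap_intg_of_central e hc] at h1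
  intro x hx
  rw [← hid x hx, ← h1, mul_zero]

lemma antipode_bijective : Function.Bijective (antipode ℂ (A := H)) :=
  ⟨antipode_injective, (LinearMap.injective_iff_surjective (f := antipode ℂ (A := H))).1
    antipode_injective⟩

end intg

end FinHopf

namespace FinHopf

variable {H : Type*} [Ring H] [HopfAlgebra ℂ H] [IsSemisimpleRing H] [FiniteDimensional ℂ H]

variable (H) in
/-- The antipode as a linear equivalence. -/
def antipodeEquiv : H ≃ₗ[ℂ] H := LinearEquiv.ofBijective (antipode ℂ) antipode_bijective

variable (H) in
/-- The inverse of the antipode. -/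
def antipodeInv : H →ₗ[ℂ] H := (antipodeEquiv H).symm.toLinearMap

@[simp] lemma antipode_antipodeInv (x : H) : antipode ℂ (antipodeInv H x) = x :=
  (antipodeEquiv H).apply_symm_apply x

@[simp] lemma antipodeInv_antipode (x : H) : antipodeInv H (antipode ℂ x) = x :=
  (antipodeEquiv H).symm_apply_apply x

lemma sum_antipodeInv_cm_mul (i j : Ix H) :
    ∑ k, antipodeInv H (cm k j : H) * cm i k = if i = j then 1 else 0 := by
  apply antipode_injective
  simp only [map_sum, antipode_mul_antidistrib, antipode_antipodeInv, sum_antipode_cm_mul]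
  split_ifs <;> simp

lemma sum_cm_mul_antipodeInv (i j : Ix H) :
    ∑ k, (cm k j : H) * antipodeInv H (cm i k) = if i = j then 1 else 0 := by
  apply antipode_injective
  simp only [map_sum, antipode_mul_antidistrib, antipode_antipodeInv, sum_cm_mul_antipode]
  split_ifs <;> simp

/-- `x ⊗ y ↦ f(y) x`. -/
def evR (f : H →ₗ[ℂ] ℂ) : H ⊗[ℂ] H →ₗ[ℂ] H := (TensorProduct.rid ℂ H).toLinearMap ∘ₗ f.lTensor H

/-- `x ⊗ y ↦ f(x) y`. -/
def evL (f : H →ₗ[ℂ] ℂ) : H ⊗[ℂ] H →ₗ[ℂ] H := (TensorProduct.lid ℂ H).toLinearMap ∘ₗ f.rTensor H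

@[simp] lemma evR_tmul (f : H →ₗ[ℂ] ℂ) (x y : H) : evR f (x ⊗ₜ y) = f y • x := by simp [evR]
@[simp] lemma evL_tmul (f : H →ₗ[ℂ] ℂ) (x y : H) : evL f (x ⊗ₜ y) = f x • y := by simp [evL]
lemma lact_eq_evR (f : H →ₗ[ℂ] ℂ) (x : H) : lact f x = evR f (comul x) := rfl
lemma ract_eq_evL (f : H →ₗ[ℂ] ℂ) (x : H) : ract f x = evL f (comul x) := rfl

lemma antipode_mul_lact_intg (f : H →ₗ[ℂ] ℂ) (x : H) :
    antipode ℂ x * lact f (intg H) = lact (f ∘ₗ LinearMap.mulLeft ℂ x) (intg H) := by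
  have h := congrArg (evR f) (comul_intg_mul_right x)
  have h1 : evR f ∘ₗ LinearMap.mulLeft ℂ (1 ⊗ₜ[ℂ] x) = evR (f ∘ₗ LinearMap.mulLeft ℂ x) := by
    ext a b; simp
  have h2 : evR f ∘ₗ LinearMap.mulLeft ℂ (antipode ℂ x ⊗ₜ[ℂ] 1) =
      LinearMap.mulLeft ℂ (antipode ℂ x) ∘ₗ evR f := by
    ext a b; simp
  rw [lact_eq_evR, lact_eq_evR, ← h1]
  exact (LinearMap.congr_fun h2 _).symm.trans h.symm

lemma lact_intg_mul (f : H →ₗ[ℂ] ℂ) (x : H) :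
    lact f (intg H) * x = lact (f ∘ₗ LinearMap.mulRight ℂ (antipode ℂ x)) (intg H) := by
  have h := congrArg (evR f) (comul_intg_mul_left x)
  have h1 : evR f ∘ₗ LinearMap.mulRight ℂ (1 ⊗ₜ[ℂ] antipode ℂ x) =
      evR (f ∘ₗ LinearMap.mulRight ℂ (antipode ℂ x)) := by
    ext a b; simp
  have h2 : evR f ∘ₗ LinearMap.mulRight ℂ (x ⊗ₜ[ℂ] 1) = LinearMap.mulRight ℂ x ∘ₗ evR f := by
    ext a b; simp
  rw [lact_eq_evR, lact_eq_evR, ← h1]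
  exact (LinearMap.congr_fun h2 _).symm.trans h

lemma ract_intg_mul_antipode (f : H →ₗ[ℂ] ℂ) (x : H) :
    ract f (intg H) * antipode ℂ x = ract (f ∘ₗ LinearMap.mulRight ℂ x) (intg H) := by
  have h := congrArg (evL f) (comul_intg_mul_left x)
  have h1 : evL f ∘ₗ LinearMap.mulRight ℂ (x ⊗ₜ[ℂ] 1) = evL (f ∘ₗ LinearMap.mulRight ℂ x) := by
    ext a b; simp
  have h2 : evL f ∘ₗ LinearMap.mulRight ℂ (1 ⊗ₜ[ℂ] antipode ℂ x) =
      LinearMap.mulRight ℂ (antipode ℂ x) ∘ₗ evL f := by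
    ext a b; simp
  rw [ract_eq_evL, ract_eq_evL, ← h1]
  exact (LinearMap.congr_fun h2 _).symm.trans h.symm

lemma sum_antipodeInv_mul_lact (x : H) :
    ∑ a, antipodeInv H (Module.finBasis ℂ H a) * lact ((Module.finBasis ℂ H).coord a) x =
      counit (R := ℂ) x • 1 := by
  set b := Module.finBasis ℂ H
  refine cm_ext_apply (f := ∑ a, LinearMap.mulLeft ℂ (antipodeInv H (b a)) ∘ₗ lact (b.coord a))
    (g := (counit (R := ℂ)).smulRight 1) (fun i j => ?_) x |> Eq.trans (by simp)
  simp only [LinearMap.sum_apply, LinearMap.comp_apply, lact_cm, LinearMap.mulLeft_apply,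
    Finset.mul_sum, mul_smul_comm, ← smul_mul_assoc]
  rw [Finset.sum_comm]
  simp_rw [← Finset.sum_mul, ← map_smul, ← map_sum, Module.Basis.coord_apply, b.sum_repr,
    sum_antipodeInv_cm_mul]
  simp [counit_cm]

lemma sum_ract_mul_antipodeInv (x : H) :
    ∑ a, ract ((Module.finBasis ℂ H).coord a) x * antipodeInv H (Module.finBasis ℂ H a) =
      counit (R := ℂ) x • 1 := by
  set b := Module.finBasis ℂ H
  refine cm_ext_apply (f := ∑ a, LinearMap.mulRight ℂ (antipodeInv H (b a)) ∘ₗ ract (b.coord a))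
    (g := (counit (R := ℂ)).smulRight 1) (fun i j => ?_) x |> Eq.trans (by simp)
  simp only [LinearMap.sum_apply, LinearMap.comp_apply, ract_cm, LinearMap.mulRight_apply,
    Finset.sum_mul, smul_mul_assoc, ← mul_smul_comm]
  rw [Finset.sum_comm]
  simp_rw [← Finset.mul_sum, ← map_smul, ← map_sum, Module.Basis.coord_apply, b.sum_repr,
    sum_cm_mul_antipodeInv]
  simp [counit_cm]

/-- `lact` as a linear function of the functional. -/
def lactAt (x : H) : (H →ₗ[ℂ] ℂ) →ₗ[ℂ] H where
  toFun f := lact f x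
  map_add' f g := by simp [lact, LinearMap.lTensor_add]
  map_smul' c f := by simp [lact, LinearMap.lTensor_smul]

/-- `ract` as a linear function of the functional. -/
def ractAt (x : H) : (H →ₗ[ℂ] ℂ) →ₗ[ℂ] H where
  toFun f := ract f x
  map_add' f g := by simp [ract, LinearMap.rTensor_add]
  map_smul' c f := by simp [ract, LinearMap.rTensor_smul]

lemma lactAt_apply (x : H) (f : H →ₗ[ℂ] ℂ) : lactAt x f = lact f x := rfl
lemma ractAt_apply (x : H) (f : H →ₗ[ℂ] ℂ) : ractAt x f = ract f x := rfl

lemma lactAt_intg_bijective : Function.Bijective (lactAt (intg H)) := by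
  have hs : Function.Surjective (lactAt (intg H)) := by
    rw [← LinearMap.range_eq_top, eq_top_iff]
    rintro y -
    have hmul : ∀ z : H, ∀ w ∈ LinearMap.range (lactAt (intg H)),
        z * w ∈ LinearMap.range (lactAt (intg H)) := by
      rintro z _ ⟨f, rfl⟩
      rw [← antipode_antipodeInv z, lactAt_apply, antipode_mul_lact_intg]
      exact ⟨_, rfl⟩
    have h1 : (1 : H) ∈ LinearMap.range (lactAt (intg H)) := by
      have h := sum_antipodeInv_mul_lact (intg H)
      rw [counit_intg, one_smul] at h
      rw [← h]
      exact Submodule.sum_mem _ fun a _ => hmul _ _ ⟨_, rfl⟩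
    simpa using hmul y 1 h1
  refine ⟨(LinearMap.injective_iff_surjective_of_finrank_eq_finrank ?_).2 hs, hs⟩
  exact Subspace.dual_finrank_eq

lemma ractAt_intg_bijective : Function.Bijective (ractAt (intg H)) := by
  have hs : Function.Surjective (ractAt (intg H)) := by
    rw [← LinearMap.range_eq_top, eq_top_iff]
    rintro y -
    have hmul : ∀ z : H, ∀ w ∈ LinearMap.range (ractAt (intg H)),
        w * z ∈ LinearMap.range (ractAt (intg H)) := by
      rintro z _ ⟨f, rfl⟩
      rw [← antipode_antipodeInv z, ractAt_apply, ract_intg_mul_antipode]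
      exact ⟨_, rfl⟩
    have h1 : (1 : H) ∈ LinearMap.range (ractAt (intg H)) := by
      have h := sum_ract_mul_antipodeInv (intg H)
      rw [counit_intg, one_smul] at h
      rw [← h]
      exact Submodule.sum_mem _ fun a _ => hmul _ _ ⟨_, rfl⟩
    simpa using hmul y 1 h1
  refine ⟨(LinearMap.injective_iff_surjective_of_finrank_eq_finrank ?_).2 hs, hs⟩
  exact Subspace.dual_finrank_eq

lemma lact_intg_injective {f g : H →ₗ[ℂ] ℂ} (h : lact f (intg H) = lact g (intg H)) : f = g :=
  lactAt_intg_bijective.1 h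

lemma ract_intg_injective {f g : H →ₗ[ℂ] ℂ} (h : ract f (intg H) = ract g (intg H)) : f = g :=
  ractAt_intg_bijective.1 h

lemma exists_ract_intg_eq (x : H) : ∃ f : H →ₗ[ℂ] ℂ, ract f (intg H) = x :=
  ractAt_intg_bijective.2 x

variable (H) in
/-- The functional `λ` with `Λ₁ λ(Λ₂) = 1`. -/
def cointg : H →ₗ[ℂ] ℂ := (lactAt_intg_bijective.2 (1 : H)).choose

lemma lact_cointg_intg : lact (cointg H) (intg H) = 1 :=
  (lactAt_intg_bijective.2 (1 : H)).choose_spec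

lemma counit_lact (f : H →ₗ[ℂ] ℂ) (x : H) : counit (R := ℂ) (lact f x) = f x := by
  rw [apply_lact, counit_conv]

lemma counit_ract (f : H →ₗ[ℂ] ℂ) (x : H) : counit (R := ℂ) (ract f x) = f x := by
  rw [apply_ract, conv_counit]

@[simp] lemma cointg_intg : cointg H (intg H) = 1 := by
  rw [← counit_lact, lact_cointg_intg, Bialgebra.counit_one]

@[simp] lemma ract_one (f : H →ₗ[ℂ] ℂ) : ract f (1 : H) = f 1 • 1 := by
  simp [ract_eq_evL, Algebra.TensorProduct.one_def]

lemma lact_cointg (x : H) : lact (cointg H) x = cointg H x • 1 := by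
  obtain ⟨f, rfl⟩ := exists_ract_intg_eq x
  rw [lact_ract, lact_cointg_intg, apply_ract, ← apply_lact, lact_cointg_intg, ract_one]

lemma cointg_mul_eq_self (x : H) :
    lact (cointg H ∘ₗ LinearMap.mulLeft ℂ (antipodeInv H x)) (intg H) = x := by
  rw [← antipode_mul_lact_intg, lact_cointg_intg, mul_one, antipode_antipodeInv]

lemma mul_cointg_eq_self (x : H) :
    lact (cointg H ∘ₗ LinearMap.mulRight ℂ (antipode ℂ x)) (intg H) = x := by
  rw [← lact_intg_mul, lact_cointg_intg, one_mul]

lemma cointg_mul_comm (x y : H) :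
    cointg H (x * y) = cointg H (y * antipode ℂ (antipode ℂ x)) := by
  have h := (cointg_mul_eq_self (antipode ℂ x)).trans (mul_cointg_eq_self (antipode ℂ x)).symm
  simpa using LinearMap.congr_fun (lact_intg_injective h) y

lemma cointg_nondeg {x y : H} (h : ∀ z, cointg H (z * x) = cointg H (z * y)) : x = y := by
  rw [← antipode_antipodeInv x, ← antipode_antipodeInv y, ← mul_cointg_eq_self (antipodeInv H x),
    ← mul_cointg_eq_self (antipodeInv H y)]
  congr 2
  simp only [antipode_antipodeInv]
  congr 1
  ext z; simp [h]

/-- `x ⊗ y ↦ λ(S⁻¹(F x) y)`. -/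
def trForm (F : H →ₗ[ℂ] H) : H ⊗[ℂ] H →ₗ[ℂ] ℂ :=
  cointg H ∘ₗ LinearMap.mul' ℂ H ∘ₗ TensorProduct.map (antipodeInv H ∘ₗ F) LinearMap.id

@[simp] lemma trForm_tmul (F : H →ₗ[ℂ] H) (x y : H) :
    trForm F (x ⊗ₜ y) = cointg H (antipodeInv H (F x) * y) := by simp [trForm]

/-- Radford's trace formula `Tr F = λ(S⁻¹(F Λ₁) Λ₂)`. -/
lemma trace_eq_trForm (F : H →ₗ[ℂ] H) : LinearMap.trace ℂ H F = trForm F (comul (intg H)) := by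
  set b := Module.finBasis ℂ H
  have hF : F = ∑ a, (b.coord a).smulRight (F (b a)) := by
    refine b.ext fun i => ?_
    simp [Finsupp.single_apply]
  have key : ∀ (f : H →ₗ[ℂ] ℂ) (a : H), trForm (f.smulRight a) (comul (intg H)) = f a := by
    intro f a
    conv_rhs => rw [← cointg_mul_eq_self a, lact_eq_evR]
    have : trForm (f.smulRight a) = f ∘ₗ evR (cointg H ∘ₗ LinearMap.mulLeft ℂ (antipodeInv H a)) := by
      ext x y; simp [mul_comm]
    rw [this]; rfl
  have hsum : trForm F = ∑ a, trForm ((b.coord a).smulRight (F (b a))) := by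
    conv_lhs => rw [hF]
    ext x y
    simp [Finset.sum_mul]
  rw [hsum, LinearMap.sum_apply]
  simp_rw [key]
  conv_lhs => rw [hF]
  rw [map_sum]
  refine Finset.sum_congr rfl fun a _ => ?_
  exact LinearMap.trace_smulRight _ _

/-- Uniqueness of integrals. -/
lemma eq_smul_cointg {m : H →ₗ[ℂ] ℂ} (hm : ∀ x, lact m x = m x • 1) : m = m (intg H) • cointg H := by
  apply lact_intg_injective
  rw [hm, ← lactAt_apply (intg H) (m (intg H) • cointg H), map_smul, lactAt_apply, lact_cointg_intg]

variable (H) in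
/-- The distinguished grouplike element. -/
def dgl : H := ract (cointg H) (intg H)

lemma conv_cointg (f : H →ₗ[ℂ] ℂ) : conv (cointg H) f = f (dgl H) • cointg H := by
  rw [eq_smul_cointg (m := conv (cointg H) f), ← apply_ract]
  · rfl
  · intro x
    rw [← lact_lact, lact_cointg, apply_lact]

lemma eq_of_forall_functional {x y : H} (h : ∀ f : H →ₗ[ℂ] ℂ, f x = f y) : x = y := by
  rw [← sub_eq_zero]
  refine (Module.forall_dual_apply_eq_zero_iff ℂ _).1 fun f => ?_
  rw [map_sub, h, sub_self]

lemma ract_cointg (x : H) : ract (cointg H) x = cointg H x • dgl H := by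
  refine eq_of_forall_functional fun f => ?_
  rw [apply_ract, conv_cointg]
  simp [mul_comm]

lemma isGroupLikeElem_of_conv {g : H} (h1 : counit (R := ℂ) g = 1)
    (h2 : ∀ f k : H →ₗ[ℂ] ℂ, conv f k g = f g * k g) : IsGroupLikeElem ℂ g := by
  refine ⟨h1, ?_⟩
  set b := Module.finBasis ℂ H
  apply (b.tensorProduct b).repr.injective
  ext ⟨i, j⟩
  have h : ∀ t : H ⊗[ℂ] H, (b.tensorProduct b).repr t (i, j) =
      LinearMap.mul' ℂ ℂ (TensorProduct.map (b.coord i) (b.coord j) t) := by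
    intro t
    induction t with
    | zero => simp
    | add x y hx hy => simp [hx, hy]
    | tmul x y => simp [mul_comm]
  rw [h, h]
  exact (h2 (b.coord i) (b.coord j)).trans (by simp)

lemma isGroupLikeElem_dgl : IsGroupLikeElem ℂ (dgl H) := by
  refine isGroupLikeElem_of_conv ?_ fun f k => ?_
  · rw [dgl, counit_ract, cointg_intg]
  · have h : conv (cointg H) (conv f k) = (f (dgl H) * k (dgl H)) • cointg H := by
      rw [← conv_assoc, conv_cointg]
      ext x
      rw [← apply_ract, ract_eq_evL]
      have : evL (f (dgl H) • cointg H) = f (dgl H) • evL (cointg H) := by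
        ext; simp [mul_smul]
      rw [this, LinearMap.smul_apply, ← ract_eq_evL, ract_cointg]
      simp; ring
    rw [conv_cointg] at h
    simpa using LinearMap.congr_fun h (intg H)

lemma antipode_intg : antipode ℂ (intg H) = intg H := by
  have h2 : intg H * antipodeInv H (intg H) = intg H := by
    rw [intg_mul]
    have : counit (R := ℂ) (antipodeInv H (intg H)) = 1 := by
      rw [← counit_antipode (R := ℂ), antipode_antipodeInv, counit_intg]
    rw [this, one_smul]
  have h3 := congrArg (antipode ℂ) h2
  rw [antipode_mul_antidistrib, antipode_antipodeInv, intg_mul, counit_antipode, counit_intg,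
    one_smul] at h3
  exact h3.symm

end FinHopf

namespace FinHopf

open scoped Matrix ComplexOrder

section Semisimple

variable (A : Type*) [Ring A] [Algebra ℂ A] [FiniteDimensional ℂ A] [IsSemisimpleRing A]

/-- Index type of the simple modules of a semisimple algebra. -/
def Irr : Type := Fin (IsSemisimpleRing.exists_algEquiv_pi_matrix_of_isAlgClosed ℂ A).choose

instance : Fintype (Irr A) := inferInstanceAs (Fintype (Fin _))
instance : DecidableEq (Irr A) := inferInstanceAs (DecidableEq (Fin _))

variable {A}

/-- The degree of a simple module. -/
def deg (i : Irr A) : ℕ :=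
  (IsSemisimpleRing.exists_algEquiv_pi_matrix_of_isAlgClosed ℂ A).choose_spec.choose i

instance (i : Irr A) : NeZero (deg i) :=
  (IsSemisimpleRing.exists_algEquiv_pi_matrix_of_isAlgClosed ℂ A).choose_spec.choose_spec.1 i

lemma deg_pos (i : Irr A) : 0 < deg i := Nat.pos_of_ne_zero (NeZero.ne _)

variable (A) in
/-- A Wedderburn isomorphism. -/
def wedd : A ≃ₐ[ℂ] (∀ i : Irr A, Matrix (Fin (deg i)) (Fin (deg i)) ℂ) :=
  (IsSemisimpleRing.exists_algEquiv_pi_matrix_of_isAlgClosed ℂ A).choose_spec.choose_spec.2.some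

/-- The matrix representation on a simple module. -/
def rep (i : Irr A) : A →ₐ[ℂ] Matrix (Fin (deg i)) (Fin (deg i)) ℂ :=
  (Pi.evalAlgHom ℂ _ i).comp (wedd A).toAlgHom

/-- The irreducible character. -/
def chi (i : Irr A) : A →ₗ[ℂ] ℂ := Matrix.traceLinearMap (Fin (deg i)) ℂ ℂ ∘ₗ (rep i).toLinearMap

lemma chi_apply (i : Irr A) (x : A) : chi i x = (rep i x).trace := rfl

/-- The block inclusion, a section of `rep i`. -/
def lift (i : Irr A) : Matrix (Fin (deg i)) (Fin (deg i)) ℂ →ₗ[ℂ] A :=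
  (wedd A).symm.toLinearMap ∘ₗ LinearMap.single ℂ (fun i : Irr A => Matrix (Fin (deg i)) (Fin (deg i)) ℂ) i

lemma rep_lift (i j : Irr A) (M : Matrix (Fin (deg i)) (Fin (deg i)) ℂ) :
    rep j (lift i M) = Pi.single (M := fun i : Irr A => Matrix (Fin (deg i)) (Fin (deg i)) ℂ) i M j := by
  simp [rep, lift]

@[simp] lemma rep_lift_self (i : Irr A) (M : Matrix (Fin (deg i)) (Fin (deg i)) ℂ) :
    rep i (lift i M) = M := by simp [rep_lift]

lemma rep_lift_of_ne {i j : Irr A} (h : j ≠ i) (M : Matrix (Fin (deg i)) (Fin (deg i)) ℂ) :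
    rep j (lift i M) = 0 := by simp [rep_lift, h]

lemma rep_ext {x y : A} (h : ∀ i, rep i x = rep i y) : x = y := by
  apply (wedd A).injective
  funext i
  exact h i

lemma rep_surjective (i : Irr A) : Function.Surjective (rep i) := fun M => ⟨_, rep_lift_self i M⟩

lemma lift_mul_lift (i : Irr A) (M N : Matrix (Fin (deg i)) (Fin (deg i)) ℂ) :
    lift i M * lift i N = lift i (M * N) := by
  refine rep_ext fun j => ?_
  by_cases h : j = i
  · subst h; simp
  · simp [rep_lift_of_ne h]

lemma lift_mul_lift_of_ne {i j : Irr A} (h : i ≠ j) (M : Matrix (Fin (deg i)) (Fin (deg i)) ℂ)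
    (N : Matrix (Fin (deg j)) (Fin (deg j)) ℂ) : lift i M * lift j N = 0 := by
  refine rep_ext fun k => ?_
  by_cases hk : k = i
  · subst hk; simp [rep_lift_of_ne h]
  · simp [rep_lift_of_ne hk]

/-- The central idempotent of a block. -/
def cidem (i : Irr A) : A := lift i 1

lemma rep_cidem (i j : Irr A) : rep j (cidem i) = if j = i then 1 else 0 := by
  split_ifs with h
  · subst h; simp [cidem]
  · simp [cidem, rep_lift_of_ne h]

lemma cidem_mul_eq_lift (i : Irr A) (x : A) : cidem i * x = lift i (rep i x) := by
  refine rep_ext fun j => ?_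
  by_cases h : j = i
  · subst h; simp [rep_cidem]
  · simp [rep_cidem, h, rep_lift_of_ne h]

lemma cidem_comm (i : Irr A) (x : A) : cidem i * x = x * cidem i := by
  refine rep_ext fun j => ?_
  simp only [map_mul, rep_cidem]
  split_ifs <;> simp

lemma sum_cidem : ∑ i, cidem i = (1 : A) := by
  refine rep_ext fun j => ?_
  simp [rep_cidem]

@[simp] lemma chi_one (i : Irr A) : chi i (1 : A) = deg i := by simp [chi_apply]

lemma chi_mul_comm (i : Irr A) (x y : A) : chi i (x * y) = chi i (y * x) := by
  simp only [chi_apply, map_mul]; exact Matrix.trace_mul_comm _ _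

lemma chi_lift (i j : Irr A) (M : Matrix (Fin (deg i)) (Fin (deg i)) ℂ) :
    chi j (lift i M) = if j = i then M.trace else 0 := by
  split_ifs with h
  · subst h; simp [chi_apply]
  · simp [chi_apply, rep_lift_of_ne h]

/-- A primitive idempotent in a block. -/
def pidem (i : Irr A) : A := lift i (Matrix.single 0 0 1)

lemma chi_pidem (i j : Irr A) : chi j (pidem i : A) = if j = i then 1 else 0 := by
  rw [pidem, chi_lift]; simp

lemma pidem_mul_self (i : Irr A) : pidem i * pidem i = (pidem i : A) := by
  simp [pidem, lift_mul_lift]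

/-- The basis of matrix units. -/
def wbasis : Module.Basis (Σ i : Irr A, Fin (deg i) × Fin (deg i)) ℂ A :=
  (Pi.basis fun i : Irr A => Matrix.stdBasis ℂ (Fin (deg i)) (Fin (deg i))).map
    (wedd A).symm.toLinearEquiv

lemma wbasis_apply (i : Irr A) (a b : Fin (deg i)) :
    wbasis ⟨i, a, b⟩ = lift i (Matrix.single a b (1 : ℂ)) := by
  simp [wbasis, lift, Matrix.stdBasis_eq_single]

lemma wbasis_repr (x : A) (i : Irr A) (a b : Fin (deg i)) :
    wbasis.repr x ⟨i, a, b⟩ = rep i x a b := by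
  simp only [wbasis, Module.Basis.map_repr, LinearEquiv.trans_apply, Pi.basis_repr]
  simp only [Matrix.stdBasis, rep]
  rfl

lemma trace_eq_sum_rep (T : A →ₗ[ℂ] A) : LinearMap.trace ℂ A T =
    ∑ i : Irr A, ∑ a, ∑ b, rep i (T (lift i (Matrix.single a b 1))) a b := by
  rw [LinearMap.trace_eq_matrix_trace ℂ wbasis, Matrix.trace, Fintype.sum_sigma]
  refine Finset.sum_congr rfl fun i _ => ?_
  rw [Fintype.sum_prod_type]
  refine Finset.sum_congr rfl fun a _ => Finset.sum_congr rfl fun b _ => ?_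
  rw [Matrix.diag_apply, LinearMap.toMatrix_apply, wbasis_repr, wbasis_apply]

variable (A) in
lemma finrank_eq_sum_deg_sq : Module.finrank ℂ A = ∑ i : Irr A, deg i ^ 2 := by
  rw [Module.finrank_eq_card_basis (wbasis (A := A)), Fintype.card_sigma]
  simp [sq]

lemma trace_mulLeft (x : A) :
    LinearMap.trace ℂ A (LinearMap.mulLeft ℂ x) = ∑ i : Irr A, deg i * chi i x := by
  rw [trace_eq_sum_rep]
  refine Finset.sum_congr rfl fun i _ => ?_
  simp [chi_apply, Matrix.trace, Matrix.mul_apply, Matrix.single_apply, Finset.mul_sum]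

lemma trace_functional_eq {f : A →ₗ[ℂ] ℂ} (hf : ∀ x y, f (x * y) = f (y * x)) :
    f = ∑ i, f (pidem i) • chi i := by
  refine wbasis.ext ?_
  rintro ⟨i, a, b⟩
  rw [wbasis_apply]
  simp only [LinearMap.sum_apply, LinearMap.smul_apply, chi_lift, smul_eq_mul, mul_ite, mul_zero]
  rw [Finset.sum_ite_eq' Finset.univ i]
  have h : ∀ c d : Fin (deg i), lift i (Matrix.single c d (1 : ℂ)) =
      lift i (Matrix.single c 0 (1 : ℂ)) * lift i (Matrix.single 0 d (1 : ℂ)) := by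
    intro c d; rw [lift_mul_lift]; simp
  simp only [Finset.mem_univ, if_true]
  rw [h a b, hf, lift_mul_lift]
  by_cases hab : a = b
  · subst hab; simp [pidem]
  · simp [hab, Ne.symm hab]

lemma isScalar_of_forall_commute {d : ℕ} {M : Matrix (Fin d) (Fin d) ℂ} (h : ∀ N, N * M = M * N) :
    ∃ c : ℂ, M = c • 1 := by
  obtain ⟨c, hc⟩ := Matrix.mem_range_scalar_iff_commute_single'.2 (fun i j => h (Matrix.single i j 1))
  exact ⟨c, by rw [← hc, Matrix.smul_one_eq_diagonal]; rfl⟩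

lemma rep_of_central (i : Irr A) {z : A} (hz : ∀ x, x * z = z * x) :
    ∃ c : ℂ, rep i z = c • 1 := by
  refine isScalar_of_forall_commute fun N => ?_
  obtain ⟨x, rfl⟩ := rep_surjective i N
  rw [← map_mul, hz, map_mul]

lemma eq_of_central_of_chi {x y : A} (hx : ∀ z, z * x = x * z) (hy : ∀ z, z * y = y * z)
    (h : ∀ i : Irr A, chi i x = chi i y) : x = y := by
  refine rep_ext fun i => ?_
  obtain ⟨c, hc⟩ := rep_of_central i hx
  obtain ⟨c', hc'⟩ := rep_of_central i hy
  have := h i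
  rw [chi_apply, chi_apply, hc, hc', Matrix.trace_smul, Matrix.trace_smul, Matrix.trace_one] at this
  have hd : (Fintype.card (Fin (deg i)) : ℂ) ≠ 0 := by simp [(deg_pos i).ne']
  rw [hc, hc', mul_right_cancel₀ hd this]

lemma matrix_algHom_eq_conj {d : ℕ} [NeZero d]
    (φ : Matrix (Fin d) (Fin d) ℂ →ₐ[ℂ] Matrix (Fin d) (Fin d) ℂ) :
    ∃ t : (Matrix (Fin d) (Fin d) ℂ)ˣ, ∀ M, φ M = t.val * M * t⁻¹.val := by
  let φ' : Matrix (Fin d) (Fin d) ℂ ≃ₐ[ℂ] Matrix (Fin d) (Fin d) ℂ :=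
    AlgEquiv.ofBijective φ φ.bijective
  obtain ⟨T, hT⟩ := ((Matrix.toLinAlgEquiv'.symm.trans φ').trans
    Matrix.toLinAlgEquiv').eq_linearEquivConjAlgEquiv
  let t : (Matrix (Fin d) (Fin d) ℂ)ˣ :=
    ⟨LinearMap.toMatrixAlgEquiv' T.toLinearMap, LinearMap.toMatrixAlgEquiv' T.symm.toLinearMap, by
      rw [← LinearMap.toMatrixAlgEquiv'_comp]; simp, by
      rw [← LinearMap.toMatrixAlgEquiv'_comp]; simp⟩
  refine ⟨t, fun M => ?_⟩
  have h := congrArg LinearMap.toMatrixAlgEquiv' (DFunLike.congr_fun hT (Matrix.toLinAlgEquiv' M))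
  have h1 : LinearMap.toMatrixAlgEquiv' (Matrix.toLinAlgEquiv' (φ M)) = φ M := by simp
  rw [← h1]
  simp only [AlgEquiv.trans_apply, AlgEquiv.symm_apply_apply] at h
  refine h.trans ?_
  simp [t, LinearEquiv.conjAlgEquiv_apply, LinearMap.toMatrixAlgEquiv'_comp, mul_assoc]

/-- An automorphism either twists the block of `i` to another block or is inner on it. -/
lemma aut_block_dichotomy (T : A ≃ₐ[ℂ] A) (i : Irr A) :
    rep i (T (cidem i)) = 0 ∨
      ∃ t : (Matrix (Fin (deg i)) (Fin (deg i)) ℂ)ˣ, ∀ x, rep i (T x) = t.val * rep i x * t⁻¹.val := by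
  obtain ⟨c, hc⟩ := rep_of_central i (z := T (cidem i)) (fun x => by
    obtain ⟨y, rfl⟩ := T.surjective x
    rw [← map_mul, ← map_mul, cidem_comm])
  have hidem : rep i (T (cidem i)) * rep i (T (cidem i)) = rep i (T (cidem i)) := by
    rw [← map_mul, ← map_mul, cidem, lift_mul_lift, mul_one]
  have hc2 : c * c = c := by
    rw [hc] at hidem
    have := congrFun (congrFun hidem 0) 0
    simpa using this
  rcases (IsIdempotentElem.iff_eq_zero_or_one (p := c)).1 hc2 with h0 | h1
  · left; rw [hc, h0, zero_smul]
  · right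
    rw [h1, one_smul] at hc
    let φ : Matrix (Fin (deg i)) (Fin (deg i)) ℂ →ₐ[ℂ] Matrix (Fin (deg i)) (Fin (deg i)) ℂ :=
      AlgHom.ofLinearMap ((rep i).toLinearMap ∘ₗ T.toLinearMap ∘ₗ lift i) hc (fun M N => by
        simp [← lift_mul_lift])
    obtain ⟨t, ht⟩ := matrix_algHom_eq_conj φ
    refine ⟨t, fun x => ?_⟩
    rw [← ht]
    change _ = rep i (T (lift i (rep i x)))
    rw [← cidem_mul_eq_lift, map_mul, map_mul, hc, one_mul]

lemma trace_inv_of_pow_eq_one {d : ℕ} (t : (Matrix (Fin d) (Fin d) ℂ)ˣ) {m : ℕ} (hm : m ≠ 0)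
    (ht : t ^ m = 1) : t⁻¹.val.trace = star t.val.trace := by
  let G : Matrix (Fin d) (Fin d) ℂ := ∑ k ∈ Finset.range m, (t.val ^ k)ᴴ * t.val ^ k
  have hG : G.PosDef := by
    obtain ⟨m, rfl⟩ := Nat.exists_eq_succ_of_ne_zero hm
    simp only [G, Finset.sum_range_succ']
    refine Matrix.PosDef.posSemidef_add ?_ (by simpa using Matrix.PosDef.one)
    exact Matrix.posSemidef_sum _ fun k _ => Matrix.posSemidef_conjTranspose_mul_self _
  have htm : t.val ^ m = 1 := by rw [← Units.val_pow_eq_pow_val, ht, Units.val_one]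
  have hshift : t.valᴴ * G * t.val = G := by
    have h1 : t.valᴴ * G * t.val = ∑ k ∈ Finset.range m, (t.val ^ (k + 1))ᴴ * t.val ^ (k + 1) := by
      simp only [G, Finset.mul_sum, Finset.sum_mul]
      refine Finset.sum_congr rfl fun k _ => ?_
      rw [pow_succ, Matrix.conjTranspose_mul]; simp only [mul_assoc]
    have h2 := Finset.sum_range_succ' (fun k => (t.val ^ k)ᴴ * t.val ^ k) m
    rw [Finset.sum_range_succ, htm] at h2
    rw [h1]
    simpa [G] using h2.symm
  have hu : IsUnit G := hG.isUnit
  obtain ⟨g, hg⟩ := hu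
  rw [← hg] at hshift
  have h3 : t.valᴴ = g.val * t⁻¹.val * g⁻¹.val := by
    have : t.valᴴ * g.val * t.val * t⁻¹.val * g⁻¹.val = g.val * t⁻¹.val * g⁻¹.val := by rw [hshift]
    simpa [mul_assoc] using this
  rw [← Matrix.trace_conjTranspose, h3, Matrix.trace_mul_comm, ← mul_assoc]
  simp

lemma trace_mul_trace_inv_nonneg {d : ℕ} (t : (Matrix (Fin d) (Fin d) ℂ)ˣ) {m : ℕ} (hm : m ≠ 0)
    {c : ℂ} (ht : t.val ^ m = c • 1) :
    ∃ r : ℝ, 0 ≤ r ∧ t.val.trace * t⁻¹.val.trace = r := by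
  rcases Nat.eq_zero_or_pos d with rfl | hd
  · exact ⟨0, le_rfl, by simp [Matrix.trace]⟩
  have : NeZero d := ⟨hd.ne'⟩
  have hc : c ≠ 0 := by
    rintro rfl
    rw [zero_smul, ← Units.val_pow_eq_pow_val] at ht
    exact (t ^ m).ne_zero ht
  obtain ⟨z, hz⟩ := IsAlgClosed.exists_pow_nat_eq c (Nat.pos_of_ne_zero hm)
  have hz0 : z ≠ 0 := by rintro rfl; rw [zero_pow hm] at hz; exact hc hz.symm
  let s : (Matrix (Fin d) (Fin d) ℂ)ˣ := ⟨z⁻¹ • t.val, z • t⁻¹.val, by simp [hz0], by simp [hz0]⟩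
  have hs : s ^ m = 1 := by
    apply Units.ext
    rw [Units.val_pow_eq_pow_val]
    simp only [s, smul_pow, ht, smul_smul, inv_pow, hz]
    simp [hc]
  have h := trace_inv_of_pow_eq_one s hm hs
  refine ⟨Complex.normSq s.val.trace, Complex.normSq_nonneg _, ?_⟩
  have h2 : t.val.trace * t⁻¹.val.trace = s.val.trace * s⁻¹.val.trace := by
    change _ = (z⁻¹ • t.val).trace * (z • t⁻¹.val).trace
    rw [Matrix.trace_smul, Matrix.trace_smul]
    simp only [smul_eq_mul]; field_simp
  rw [h2, h]
  exact Complex.mul_conj _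

lemma exists_chi_eq_of_algHom (e : A →ₐ[ℂ] ℂ) :
    ∃ i : Irr A, deg i = 1 ∧ ∀ x, e x = chi i x := by
  have h := trace_functional_eq (f := e.toLinearMap) (fun x y => by simp [mul_comm])
  have hid : ∀ i : Irr A, e (pidem i) = 0 ∨ e (pidem i) = 1 := fun i =>
    (IsIdempotentElem.iff_eq_zero_or_one (p := e (pidem i))).1 (by
      rw [IsIdempotentElem, ← map_mul, pidem_mul_self])
  have h1 : ∑ i : Irr A, e (pidem i) * deg i = 1 := by
    have := LinearMap.congr_fun h 1
    simpa using this.symm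
  choose c hc using fun i => show ∃ c : ℕ, e (pidem i) = c by
    rcases hid i with h | h
    · exact ⟨0, by simpa using h⟩
    · exact ⟨1, by simpa using h⟩
  have h2 : ∑ i : Irr A, c i * deg i = 1 := by
    have : ((∑ i : Irr A, c i * deg i : ℕ) : ℂ) = 1 := by
      push_cast; simpa [hc] using h1
    exact_mod_cast this
  obtain ⟨i, -, hi⟩ : ∃ i ∈ Finset.univ, c i * deg i ≠ 0 := by
    by_contra! hne
    rw [Finset.sum_eq_zero hne] at h2
    exact zero_ne_one h2
  have hle := Finset.single_le_sum (f := fun i : Irr A => c i * deg i) (fun _ _ => Nat.zero_le _)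
    (Finset.mem_univ i)
  simp only [h2] at hle
  have hone : c i * deg i = 1 := by omega
  have hother : ∀ j, j ≠ i → c j = 0 := by
    intro j hj
    rw [← Finset.add_sum_erase _ _ (Finset.mem_univ i), hone, Nat.add_eq_left,
      Finset.sum_eq_zero_iff] at h2
    have := h2 j (by simp [hj])
    rcases Nat.mul_eq_zero.1 this with h | h
    · exact h
    · exact absurd h (deg_pos j).ne'
  refine ⟨i, Nat.eq_one_of_mul_eq_one_left hone, fun x => ?_⟩
  have := LinearMap.congr_fun h x
  simp only [AlgHom.toLinearMap_apply, LinearMap.sum_apply, LinearMap.smul_apply, hc] at this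
  rw [this, Finset.sum_eq_single i]
  · rw [Nat.eq_one_of_mul_eq_one_right hone]; simp
  · intro j _ hj; simp [hother j hj]
  · simp

/-- The trace of a finite order automorphism fixing a one-dimensional block is at least `1`. -/
lemma rep_aut_pow {T : A ≃ₐ[ℂ] A} {i : Irr A} {t : (Matrix (Fin (deg i)) (Fin (deg i)) ℂ)ˣ}
    (ht : ∀ x, rep i (T x) = t.val * rep i x * t⁻¹.val) (k : ℕ) (x : A) :
    rep i ((T ^ k) x) = (t ^ k).val * rep i x * (t ^ k)⁻¹.val := by
  induction k generalizing x with
  | zero => simp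
  | succ k ih =>
    rw [pow_succ, AlgEquiv.mul_apply, ih, ht, pow_succ]
    simp [mul_assoc]

lemma one_le_trace_of_pow_eq_one (T : A ≃ₐ[ℂ] A) {m : ℕ} (hm : m ≠ 0) (hT : T ^ m = 1)
    {e : A →ₐ[ℂ] ℂ} (he : ∀ x, e (T x) = e x) :
    ∃ r : ℝ, 1 ≤ r ∧ LinearMap.trace ℂ A T.toLinearMap = r := by
  have hblock : ∀ i : Irr A, ∃ r : ℝ, 0 ≤ r ∧
      ∑ a, ∑ b, rep i (T (lift i (Matrix.single a b 1))) a b = r := by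
    intro i
    rcases aut_block_dichotomy T i with h | ⟨t, ht⟩
    · refine ⟨0, le_rfl, ?_⟩
      rw [Complex.ofReal_zero]
      refine Finset.sum_eq_zero fun a _ => Finset.sum_eq_zero fun b _ => ?_
      have : lift i (Matrix.single a b (1 : ℂ)) = cidem i * lift i (Matrix.single a b (1 : ℂ)) := by
        rw [cidem, lift_mul_lift, one_mul]
      rw [this, map_mul, map_mul, h, zero_mul, Matrix.zero_apply]
    · obtain ⟨c, hc⟩ := isScalar_of_forall_commute (M := t.val ^ m) (fun N => by
        obtain ⟨x, rfl⟩ := rep_surjective i N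
        have := rep_aut_pow ht m x
        rw [hT, AlgEquiv.one_apply] at this
        rw [← Units.val_pow_eq_pow_val]
        conv_lhs => rw [this]
        simp [mul_assoc])
      obtain ⟨r, hr, h⟩ := trace_mul_trace_inv_nonneg t hm hc
      refine ⟨r, hr, ?_⟩
      rw [← h]
      simp only [ht, rep_lift_self]
      simp [Matrix.trace, Finset.sum_mul_sum, Matrix.mul_apply, Matrix.single_apply, ite_and]
  choose r hr hrs using hblock
  refine ⟨∑ i, r i, ?_, ?_⟩
  · obtain ⟨i, hi, hei⟩ := exists_chi_eq_of_algHom e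
    have h1 : r i = 1 := by
      have h := hrs i
      have : Subsingleton (Fin (deg i)) := by rw [hi]; infer_instance
      rw [Fintype.sum_subsingleton _ 0, Fintype.sum_subsingleton _ 0] at h
      have h2 : chi i (T (lift i (Matrix.single 0 0 1))) = 1 := by
        rw [← hei, he, hei, chi_lift]; simp
      rw [chi_apply, Matrix.trace, Fintype.sum_subsingleton _ 0, Matrix.diag_apply, h] at h2
      exact_mod_cast h2
    rw [← h1]
    exact Finset.single_le_sum (fun j _ => hr j) (Finset.mem_univ i)
  · rw [trace_eq_sum_rep]
    push_cast
    exact Finset.sum_congr rfl fun i _ => hrs i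

end Semisimple

end FinHopf

namespace FinHopf

variable {H : Type*} [Ring H] [HopfAlgebra ℂ H] [FiniteDimensional ℂ H]

lemma lact_antipode (f : H →ₗ[ℂ] ℂ) (x : H) :
    lact f (antipode ℂ x) = antipode ℂ (ract (f ∘ₗ antipode ℂ) x) := by
  refine cm_ext_apply (f := lact f ∘ₗ antipode ℂ) (g := antipode ℂ ∘ₗ ract (f ∘ₗ antipode ℂ))
    (fun i j => ?_) x
  simp [lact, antipode_comul_cm]

lemma ract_antipode (f : H →ₗ[ℂ] ℂ) (x : H) :
    ract f (antipode ℂ x) = antipode ℂ (lact (f ∘ₗ antipode ℂ) x) := by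
  refine cm_ext_apply (f := ract f ∘ₗ antipode ℂ) (g := antipode ℂ ∘ₗ lact (f ∘ₗ antipode ℂ))
    (fun i j => ?_) x
  simp [ract, antipode_comul_cm]

lemma ract_mul_groupLike (f : H →ₗ[ℂ] ℂ) {g : H} (hg : IsGroupLikeElem ℂ g) (x : H) :
    ract f (x * g) = ract (f ∘ₗ LinearMap.mulRight ℂ g) x * g := by
  refine cm_ext_apply (f := ract f ∘ₗ LinearMap.mulRight ℂ g)
    (g := LinearMap.mulRight ℂ g ∘ₗ ract (f ∘ₗ LinearMap.mulRight ℂ g)) (fun i j => ?_) x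
  simp [ract, comul_cm, Finset.sum_mul, hg.comul_eq_tmul_self]

lemma trace_comp_idem_involution {V : Type*} [AddCommGroup V] [Module ℂ V] [FiniteDimensional ℂ V]
    {P T : V →ₗ[ℂ] V} (hP : P * P = P) (hT : T * T = 1) (hPT : P * T = T * P) :
    ∃ z : ℤ, LinearMap.trace ℂ V (P * T) = z := by
  have hidem : ∀ Q : V →ₗ[ℂ] V, Q * Q = Q → ∃ n : ℕ, LinearMap.trace ℂ V Q = n := fun Q hQ =>
    ⟨_, (LinearMap.IsIdempotentElem.isProj_range Q hQ).trace⟩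
  obtain ⟨a, ha⟩ := hidem ((1 / 2 : ℂ) • (P * (1 + T))) (by
    simp only [mul_add, mul_one, smul_mul_smul_comm, add_mul]
    rw [show P * T * P = P * T by rw [mul_assoc, ← hPT, ← mul_assoc, hP],
      show P * (P * T) = P * T by rw [← mul_assoc, hP], hP,
      show P * T * (P * T) = P by
        rw [hPT, mul_assoc, ← mul_assoc P T P, hPT, mul_assoc T P P, hP, ← mul_assoc, hT, one_mul]]
    module)
  obtain ⟨b, hb⟩ := hidem ((1 / 2 : ℂ) • (P * (1 - T))) (by
    simp only [mul_sub, mul_one, smul_mul_smul_comm, sub_mul]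
    rw [show P * T * P = P * T by rw [mul_assoc, ← hPT, ← mul_assoc, hP],
      show P * (P * T) = P * T by rw [← mul_assoc, hP], hP,
      show P * T * (P * T) = P by
        rw [hPT, mul_assoc, ← mul_assoc P T P, hPT, mul_assoc T P P, hP, ← mul_assoc, hT, one_mul]]
    module)
  refine ⟨a - b, ?_⟩
  have : P * T = (1 / 2 : ℂ) • (P * (1 + T)) - (1 / 2 : ℂ) • (P * (1 - T)) := by
    rw [← smul_sub, mul_add, mul_sub]; module
  rw [this, map_sub, ha, hb]; push_cast; rfl

/-- The regular character. -/
def regChar (H : Type*) [Ring H] [Algebra ℂ H] : H →ₗ[ℂ] ℂ :=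
  LinearMap.trace ℂ H ∘ₗ LinearMap.mul ℂ H

lemma regChar_apply (x : H) : regChar H x = LinearMap.trace ℂ H (LinearMap.mulLeft ℂ x) := rfl

@[simp] lemma regChar_one : regChar H (1 : H) = Module.finrank ℂ H := by
  rw [regChar_apply, LinearMap.mulLeft_one, LinearMap.trace_id]

/-- The Galois map `y ⊗ z ↦ y₁ ⊗ y₂ z`. -/
def galMap (H : Type*) [Ring H] [HopfAlgebra ℂ H] : H ⊗[ℂ] H →ₗ[ℂ] H ⊗[ℂ] H :=
  TensorProduct.lift ((LinearMap.mul ℂ (H ⊗[ℂ] H)).compl₁₂ (comul (R := ℂ))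
    (TensorProduct.mk ℂ H H 1))

lemma galMap_tmul (y z : H) : galMap H (y ⊗ₜ z) = comul (R := ℂ) y * (1 ⊗ₜ z) := by simp [galMap]

lemma galMap_surjective : Function.Surjective (galMap H) := by
  rw [← LinearMap.range_eq_top, eq_top_iff, ← TensorProduct.span_tmul_eq_top, Submodule.span_le]
  rintro _ ⟨y, z, rfl⟩
  let G : H →ₗ[ℂ] (H ⊗[ℂ] H) ⧸ LinearMap.range (galMap H) :=
    (LinearMap.range (galMap H)).mkQ ∘ₗ (TensorProduct.mk ℂ H H).flip z
  have hG : G = 0 := by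
    refine cm_ext fun i j => ?_
    simp only [G, LinearMap.comp_apply, LinearMap.flip_apply, TensorProduct.mk_apply,
      LinearMap.zero_apply, Submodule.mkQ_apply, Submodule.Quotient.mk_eq_zero]
    refine ⟨∑ k, cm i k ⊗ₜ (antipode ℂ (cm k j) * z), ?_⟩
    simp only [map_sum, galMap_tmul, comul_cm, Finset.sum_mul,
      Algebra.TensorProduct.tmul_mul_tmul, mul_one, ← mul_assoc]
    rw [Finset.sum_comm]
    simp_rw [← tmul_sum, ← Finset.sum_mul, sum_cm_mul_antipode]
    simp [tmul_ite]
  have := LinearMap.congr_fun hG y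
  simpa [G, Submodule.Quotient.mk_eq_zero] using this

lemma galMap_mul (x : H) (w : H ⊗[ℂ] H) :
    galMap H ((x ⊗ₜ 1) * w) = comul (R := ℂ) x * galMap H w := by
  induction w with
  | zero => simp
  | add a b ha hb => rw [mul_add, map_add, ha, hb, map_add, mul_add]
  | tmul y z => simp [galMap_tmul, mul_assoc]

lemma trace_mulLeft_tmul (x y : H) :
    LinearMap.trace ℂ (H ⊗[ℂ] H) (LinearMap.mulLeft ℂ (x ⊗ₜ[ℂ] y)) = regChar H x * regChar H y := by
  have : LinearMap.mulLeft ℂ (x ⊗ₜ[ℂ] y) =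
      TensorProduct.map (LinearMap.mulLeft ℂ x) (LinearMap.mulLeft ℂ y) := by
    ext; simp
  rw [this, LinearMap.trace_tensorProduct']; rfl

lemma conv_regChar_self : conv (regChar H) (regChar H) = (Module.finrank ℂ H : ℂ) • regChar H := by
  ext x
  let e : H ⊗[ℂ] H ≃ₗ[ℂ] H ⊗[ℂ] H := LinearEquiv.ofBijective (galMap H)
    ⟨LinearMap.injective_iff_surjective.2 galMap_surjective, galMap_surjective⟩
  have h1 : ∀ w : H ⊗[ℂ] H, LinearMap.mul' ℂ ℂ (TensorProduct.map (regChar H) (regChar H) w) =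
      LinearMap.trace ℂ (H ⊗[ℂ] H) (LinearMap.mulLeft ℂ w) := by
    intro w
    induction w with
    | zero => simp
    | add a b ha hb =>
      rw [map_add, map_add, ha, hb, ← map_add]
      congr 1
      ext; simp [add_mul]
    | tmul y z => rw [trace_mulLeft_tmul]; simp
  have h2 : LinearMap.mulLeft ℂ (comul (R := ℂ) x) = e.conj (LinearMap.mulLeft ℂ (x ⊗ₜ[ℂ] 1)) := by
    refine LinearMap.ext fun w => ?_
    obtain ⟨v, rfl⟩ := e.surjective w
    rw [LinearEquiv.conj_apply_apply, e.symm_apply_apply]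
    exact (galMap_mul x v).symm
  change LinearMap.mul' ℂ ℂ (TensorProduct.map (regChar H) (regChar H) (comul x)) = _
  rw [h1, h2, LinearMap.trace_conj', trace_mulLeft_tmul, regChar_one]
  simp [mul_comm]

variable [IsSemisimpleRing H]

lemma regChar_intg : regChar H (intg H) = 1 := by
  rw [regChar_apply]
  have : LinearMap.mulLeft ℂ (intg H) = (counit (R := ℂ)).smulRight (intg H) := by ext; simp
  rw [this, LinearMap.trace_smulRight, counit_intg]

lemma ract_cointg_antipode (x : H) :
    ract (cointg H ∘ₗ antipode ℂ) x = cointg H (antipode ℂ x) • 1 := by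
  apply antipode_injective
  rw [← lact_antipode, lact_cointg, map_smul, antipode_one]

lemma cointg_antipode (x : H) : cointg H (antipode ℂ x) = cointg H (x * dgl H) := by
  have h : cointg H ∘ₗ antipode ℂ = cointg H ∘ₗ LinearMap.mulRight ℂ (dgl H) := by
    apply ract_intg_injective
    rw [ract_cointg_antipode, antipode_intg, cointg_intg, one_smul]
    have h2 := ract_mul_groupLike (cointg H) isGroupLikeElem_dgl (intg H)
    rw [ract_cointg, intg_mul, isGroupLikeElem_dgl.counit_eq_one, one_smul, cointg_intg, one_smul] at h2
    have h3 := congrArg (· * antipode ℂ (dgl H)) h2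
    simpa [mul_assoc, isGroupLikeElem_dgl.mul_antipode_cancel] using h3
  exact LinearMap.congr_fun h x

lemma mul_dgl (y : H) :
    y * dgl H = dgl H * antipode ℂ (antipode ℂ (antipode ℂ (antipode ℂ y))) := by
  refine cointg_nondeg fun x => ?_
  rw [← mul_assoc, ← cointg_antipode, antipode_mul_antidistrib, cointg_mul_comm,
    ← antipode_mul_antidistrib, cointg_antipode, mul_assoc, cointg_mul_comm, mul_assoc]

variable (H) in
/-- The square of the antipode as an algebra automorphism. -/
def antipodeSq : H ≃ₐ[ℂ] H :=
  AlgEquiv.ofLinearEquiv ((antipodeEquiv H).trans (antipodeEquiv H))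
    (by simp [antipodeEquiv]) (by intro x y; simp [antipodeEquiv, antipode_mul_antidistrib])

@[simp] lemma antipodeSq_apply (x : H) : antipodeSq H x = antipode ℂ (antipode ℂ x) := rfl

lemma groupLike_finite : Finite (GroupLike ℂ H) :=
  (linearIndep_groupLikeVal (R := ℂ) (A := H)).finite

lemma antipodeSq_finite_order : ∃ m ≠ 0, antipodeSq H ^ m = 1 := by
  have := groupLike_finite (H := H)
  let g : GroupLike ℂ H := ⟨dgl H, isGroupLikeElem_dgl⟩
  obtain ⟨m, hm, hgm⟩ := (isOfFinOrder_of_finite g).exists_pow_eq_one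
  have hgm' : dgl H ^ m = 1 := congrArg GroupLike.val hgm
  have key : ∀ k : ℕ, ∀ y : H, y * dgl H ^ k = dgl H ^ k * (antipodeSq H ^ (2 * k)) y := by
    intro k
    induction k with
    | zero => intro y; simp
    | succ k ih =>
      intro y
      have h4 : ∀ y, y * dgl H = dgl H * (antipodeSq H ^ 2) y := fun y => by
        rw [mul_dgl]; rfl
      rw [pow_succ', ← mul_assoc, h4, mul_assoc, ih, ← AlgEquiv.mul_apply, ← pow_add, mul_assoc]
      rfl
  refine ⟨2 * m, by omega, ?_⟩
  ext y
  have := key m y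
  rw [hgm', mul_one, one_mul] at this
  exact this.symm

lemma trace_antipodeSq : LinearMap.trace ℂ H (antipodeSq H).toLinearMap = cointg H 1 := by
  rw [trace_eq_trForm]
  have : ∀ x : H, trForm (antipodeSq H).toLinearMap (comul (R := ℂ) x) =
      counit (R := ℂ) x • cointg H 1 := by
    intro x
    refine cm_ext_apply (f := trForm (antipodeSq H).toLinearMap ∘ₗ comul)
      (g := (counit (R := ℂ)).smulRight (cointg H 1)) (fun i j => ?_) x
    simp only [LinearMap.comp_apply, comul_cm, map_sum, trForm_tmul, AlgEquiv.toLinearMap_apply,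
      antipodeSq_apply, antipodeInv_antipode]
    rw [← map_sum, sum_antipode_cm_mul, LinearMap.smulRight_apply, counit_cm]
    split_ifs <;> simp
  rw [this, counit_intg, one_smul]

lemma one_le_cointg_one : ∃ r : ℝ, 1 ≤ r ∧ cointg H 1 = r := by
  obtain ⟨m, hm, h⟩ := antipodeSq_finite_order (H := H)
  rw [← trace_antipodeSq]
  exact one_le_trace_of_pow_eq_one (antipodeSq H) hm h (e := Bialgebra.counitAlgHom ℂ H)
    (fun x => by simp)

lemma cointg_one_ne_zero : cointg H (1 : H) ≠ 0 := by
  obtain ⟨r, hr, h⟩ := one_le_cointg_one (H := H)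
  rw [h]
  exact_mod_cast (by linarith : r ≠ 0)

lemma dgl_eq_one : dgl H = 1 := by
  have h := ract_cointg (1 : H)
  rw [ract_one] at h
  exact (smul_right_injective H cointg_one_ne_zero h).symm

lemma antipode_pow_four (y : H) : antipode ℂ (antipode ℂ (antipode ℂ (antipode ℂ y))) = y := by
  have := mul_dgl y
  rwa [dgl_eq_one, mul_one, one_mul, eq_comm] at this

lemma regChar_antipodeSq (x : H) : regChar H (antipode ℂ (antipode ℂ x)) = regChar H x := by
  have : LinearMap.mulLeft ℂ (antipode ℂ (antipode ℂ x)) =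
      (antipodeSq H).toLinearEquiv.conj (LinearMap.mulLeft ℂ x) := by
    refine LinearMap.ext fun w => ?_
    obtain ⟨v, rfl⟩ := (antipodeSq H).surjective w
    rw [LinearEquiv.conj_apply_apply]
    have : (antipodeSq H).toLinearEquiv.symm ((antipodeSq H) v) = v :=
      (antipodeSq H).symm_apply_apply v
    rw [this]
    simp [antipode_mul_antidistrib]
  rw [regChar_apply, this, LinearMap.trace_conj', regChar_apply]

/-- **Larson–Radford**: the antipode of a semisimple Hopf algebra is an involution. -/
theorem antipode_antipode (x : H) : antipode ℂ (antipode ℂ x) = x := by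
  set n := Module.finrank ℂ H with hn
  have : Nontrivial H := ⟨⟨0, 1, fun h => by simpa using congrArg (counit (R := ℂ)) h⟩⟩
  have hn0 : (n : ℂ) ≠ 0 := by exact_mod_cast Module.finrank_pos.ne'
  let T : H →ₗ[ℂ] H := (antipodeSq H).toLinearMap
  let P : H →ₗ[ℂ] H := (n : ℂ)⁻¹ • ract (regChar H)
  have hT : T * T = 1 := by ext x; exact antipode_pow_four x
  have hP : P * P = P := by
    ext x
    simp only [P, Module.End.mul_apply, LinearMap.smul_apply, map_smul, ract_ract, conv_regChar_self]
    rw [← ractAt_apply, map_smul, ractAt_apply, ← hn, smul_smul, smul_smul, mul_assoc,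
      inv_mul_cancel₀ hn0, mul_one]
  have hreg : regChar H ∘ₗ antipode ℂ ∘ₗ antipode ℂ = regChar H := by
    ext x; exact regChar_antipodeSq x
  have hPT : P * T = T * P := by
    ext x
    simp only [P, T, Module.End.mul_apply, LinearMap.smul_apply, AlgEquiv.toLinearMap_apply,
      antipodeSq_apply, map_smul]
    rw [ract_antipode, lact_antipode, LinearMap.comp_assoc, hreg]
  obtain ⟨z, hz⟩ := trace_comp_idem_involution hP hT hPT
  have htr : LinearMap.trace ℂ H (P * T) = (n : ℂ)⁻¹ * cointg H 1 := by
    rw [trace_eq_trForm]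
    have : ∀ x : H, trForm (P * T) (comul (R := ℂ) x) =
        ((n : ℂ)⁻¹ * cointg H 1) * regChar H x := by
      intro x
      refine cm_ext_apply (f := trForm (P * T) ∘ₗ comul)
        (g := ((n : ℂ)⁻¹ * cointg H 1) • (regChar H)) (fun i j => ?_) x
      rw [hPT]
      simp only [LinearMap.comp_apply, comul_cm, map_sum, trForm_tmul, P, T, Module.End.mul_apply,
        LinearMap.smul_apply, ract_cm, map_smul, AlgEquiv.toLinearMap_apply,
        antipodeSq_apply, antipodeInv_antipode, Finset.smul_sum, Finset.sum_mul, smul_mul_assoc]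
      rw [Finset.sum_comm]
      simp_rw [← Finset.smul_sum, ← map_sum, sum_antipode_cm_mul]
      simp only [apply_ite, map_zero, smul_eq_mul, mul_ite, mul_zero, Finset.sum_ite_eq',
        Finset.mem_univ, if_true]
      ring
    rw [this, regChar_intg, mul_one]
  obtain ⟨r, hr, hlam⟩ := one_le_cointg_one (H := H)
  obtain ⟨k, hk⟩ : ∃ k : ℕ, LinearMap.trace ℂ H ((1 / 2 : ℂ) • (1 - T)) = k :=
    ⟨_, (LinearMap.IsIdempotentElem.isProj_range _ (by
      change _ * _ = _
      simp only [smul_mul_smul_comm, mul_sub, sub_mul, hT, mul_one, one_mul]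
      module)).trace⟩
  have hk2 : (n : ℂ) - cointg H 1 = 2 * k := by
    rw [← hk, map_smul, map_sub, LinearMap.trace_one, ← trace_antipodeSq, ← hn]
    simp only [smul_eq_mul, T]; ring
  have hz2 : cointg H 1 = n * z := by
    rw [← hz, htr]; field_simp
  have hk0 : k = 0 := by
    rw [hz2] at hk2
    have hi : (n : ℤ) - n * z = 2 * k := by exact_mod_cast hk2
    have hnpos : (0 : ℤ) < n := by exact_mod_cast Module.finrank_pos
    have hzpos : 0 < z := by
      rw [hlam] at hz2
      have : r = n * z := by exact_mod_cast hz2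
      have h3 : (0 : ℝ) < n * z := by linarith
      have h4 : (0 : ℤ) < n * z := by exact_mod_cast h3
      exact (pos_iff_pos_of_mul_pos h4).1 hnpos
    nlinarith
  have hz1 : (1 / 2 : ℂ) • (1 - T) = 0 := by
    apply LinearMap.IsIdempotentElem.eq_zero_of_trace_eq_zero
    · change _ * _ = _
      simp only [smul_mul_smul_comm, mul_sub, sub_mul, hT, mul_one, one_mul]
      module
    · rw [hk, hk0, Nat.cast_zero]
  have h1 : (1 : H →ₗ[ℂ] H) - T = 0 := by simpa using hz1
  have := LinearMap.congr_fun h1 x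
  simp only [LinearMap.sub_apply, Module.End.one_apply, LinearMap.zero_apply, sub_eq_zero] at this
  exact this.symm

lemma antipodeInv_eq (x : H) : antipodeInv H x = antipode ℂ x :=
  antipode_injective (by rw [antipode_antipodeInv, antipode_antipode])

lemma sum_antipode_cm_mul' (i j : Ix H) :
    ∑ k, antipode ℂ (cm k j : H) * cm i k = if i = j then 1 else 0 := by
  simpa only [antipodeInv_eq] using sum_antipodeInv_cm_mul i j

lemma sum_cm_mul_antipode' (i j : Ix H) :
    ∑ k, (cm k j : H) * antipode ℂ (cm i k) = if i = j then 1 else 0 := by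
  simpa only [antipodeInv_eq] using sum_cm_mul_antipodeInv i j

lemma cointg_comm (x y : H) : cointg H (x * y) = cointg H (y * x) := by
  rw [cointg_mul_comm, antipode_antipode]

@[simp] lemma cointg_antipode_eq (x : H) : cointg H (antipode ℂ x) = cointg H x := by
  rw [cointg_antipode, dgl_eq_one, mul_one]

lemma ract_cointg_eq (x : H) : ract (cointg H) x = cointg H x • 1 := by
  rw [ract_cointg, dgl_eq_one]

/-- Trace formula. -/
lemma trace_mulLeft_ract (f : H →ₗ[ℂ] ℂ) (a : H) :
    LinearMap.trace ℂ H (LinearMap.mulLeft ℂ a ∘ₗ ract f) = f (intg H) * cointg H a := by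
  rw [trace_eq_trForm]
  have key : trForm (LinearMap.mulLeft ℂ a ∘ₗ ract f) ∘ₗ comul (R := ℂ) =
      cointg H (antipode ℂ a) • f := by
    refine cm_ext fun i j => ?_
    simp only [LinearMap.comp_apply, comul_cm, map_sum, trForm_tmul, ract_cm,
      LinearMap.mulLeft_apply, map_smul, antipodeInv_eq, antipode_mul_antidistrib,
      Finset.sum_mul, smul_mul_assoc]
    rw [Finset.sum_comm]
    simp_rw [← Finset.smul_sum, mul_assoc, cointg_comm (antipode ℂ (cm _ _)), mul_assoc]
    simp_rw [← map_sum, ← Finset.mul_sum, sum_cm_mul_antipode']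
    simp [apply_ite, mul_comm]
  rw [← LinearMap.comp_apply, key]
  simp [mul_comm]

lemma trace_mulLeft_eq_cointg (a : H) :
    LinearMap.trace ℂ H (LinearMap.mulLeft ℂ a) = cointg H a := by
  have h := trace_mulLeft_ract (counit (R := ℂ)) a
  rw [counit_intg, one_mul] at h
  rw [← h]
  congr 1; ext x; simp

lemma cointg_one : cointg H (1 : H) = Module.finrank ℂ H := by
  rw [← trace_mulLeft_eq_cointg, LinearMap.mulLeft_one, LinearMap.trace_id]

lemma cointg_eq_sum_chi (x : H) : cointg H x = ∑ i : Irr H, deg i * chi i x := by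
  rw [← trace_mulLeft_eq_cointg, trace_mulLeft]

end FinHopf

namespace FinHopf

variable {H : Type*} [Ring H] [HopfAlgebra ℂ H]

namespace Double

variable (H) in
/-- The operators the double is made of. -/
abbrev Op := Module.End ℂ (H →ₗ[ℂ] H)

variable (H) in
/-- The operator `F ↦ F ∘ (z ↦ f(z₁) z₂)`. -/
def jOp :
    (H →ₗ[ℂ] ℂ) →ₗ[ℂ] Op H where
  toFun f := LinearMap.lcomp ℂ H (ract f)
  map_add' f g := by
    ext F z; simp [ract, LinearMap.rTensor_add]
  map_smul' c f := by
    ext F z; simp [ract, LinearMap.rTensor_smul]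

lemma jOp_apply (f : H →ₗ[ℂ] ℂ) (F : H →ₗ[ℂ] H) (z : H) : jOp H f F z = F (ract f z) := rfl

variable (H) in
/-- Precomposition with right multiplication. -/
def rOp : H →ₐ[ℂ] Op H :=
  AlgHom.ofLinearMap
    { toFun := fun a => LinearMap.lcomp ℂ H (LinearMap.mulRight ℂ a)
      map_add' := fun a b => by ext F z; simp [mul_add]
      map_smul' := fun c a => by ext F z; simp }
    (by ext F z; simp) (fun a b => by ext F z; simp [mul_assoc])

variable (H) in
/-- Postcomposition with left multiplication. -/
def lOp : H →ₐ[ℂ] Op H :=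
  AlgHom.ofLinearMap
    { toFun := fun a => LinearMap.llcomp ℂ H H H (LinearMap.mulLeft ℂ a)
      map_add' := fun a b => by ext F z; simp [add_mul]
      map_smul' := fun c a => by ext F z; simp }
    (by ext F z; simp) (fun a b => by ext F z; simp)

variable (H) in
/-- Precomposition with left multiplication by the antipode. -/
def sOp : H →ₐ[ℂ] Op H :=
  AlgHom.ofLinearMap
    { toFun := fun a => LinearMap.lcomp ℂ H (LinearMap.mulLeft ℂ (antipode ℂ a))
      map_add' := fun a b => by ext F z; simp [add_mul]
      map_smul' := fun c a => by ext F z; simp }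
    (by ext F z; simp) (fun a b => by ext F z; simp [antipode_mul_antidistrib])

lemma rOp_apply (a : H) (F : H →ₗ[ℂ] H) (z : H) : rOp H a F z = F (z * a) := rfl
lemma lOp_apply (a : H) (F : H →ₗ[ℂ] H) (z : H) : lOp H a F z = a * F z := rfl
lemma sOp_apply (a : H) (F : H →ₗ[ℂ] H) (z : H) : sOp H a F z = F (antipode ℂ a * z) := rfl

lemma commute_lOp_sOp (a b : H) : Commute (lOp H a) (sOp H b) := by
  change lOp H a * sOp H b = sOp H b * lOp H a
  ext F z; simp [lOp_apply, sOp_apply]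

lemma commute_rOp_lOp (a b : H) : Commute (rOp H a) (lOp H b) := by
  change rOp H a * lOp H b = lOp H b * rOp H a
  ext F z; simp [lOp_apply, rOp_apply]

lemma commute_rOp_sOp (a b : H) : Commute (rOp H a) (sOp H b) := by
  change rOp H a * sOp H b = sOp H b * rOp H a
  ext F z; simp [rOp_apply, sOp_apply, mul_assoc]

variable (H) in
/-- The action `F ↦ (z ↦ x₂ F(S(x₃) z x₁))`. -/
def iOp : H →ₐ[ℂ] Op H :=
  (Algebra.TensorProduct.lift (rOp H) (Algebra.TensorProduct.lift (lOp H) (sOp H)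
    commute_lOp_sOp)
    (fun a b => by
      induction b with
      | zero => simp
      | add x y hx hy => rw [map_add]; exact hx.add_right hy
      | tmul b c =>
        rw [Algebra.TensorProduct.lift_tmul]
        exact (commute_rOp_lOp a b).mul_right (commute_rOp_sOp a c))).comp
    ((Algebra.TensorProduct.map (AlgHom.id ℂ H) (Bialgebra.comulAlgHom ℂ H)).comp
      (Bialgebra.comulAlgHom ℂ H))

end Double

variable [FiniteDimensional ℂ H] [IsSemisimpleRing H]

/-- A pair of an algebra map on `H` and a convolution-multiplicative map on its dual satisfying the
exchange relation of the Drinfeld double. -/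
structure IsExchange {E : Type*} [Ring E] [Algebra ℂ E] (α : H →ₐ[ℂ] E)
    (β : (H →ₗ[ℂ] ℂ) →ₗ[ℂ] E) : Prop where
  map_counit : β (counit (R := ℂ)) = 1
  map_conv : ∀ f g, β (conv f g) = β f * β g
  exchange : ∀ (f : H →ₗ[ℂ] ℂ) (i j : Ix H),
    ∑ k, α (cm i k) * β (f ∘ₗ LinearMap.mulLeft ℂ (cm k j)) =
      ∑ k, β (f ∘ₗ LinearMap.mulRight ℂ (cm i k)) * α (cm k j)

lemma IsExchange.straighten {E : Type*} [Ring E] [Algebra ℂ E] {α : H →ₐ[ℂ] E}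
    {β : (H →ₗ[ℂ] ℂ) →ₗ[ℂ] E} (h : IsExchange α β) (g : H →ₗ[ℂ] ℂ) (i j : Ix H) :
    α (cm i j) * β g = ∑ k, ∑ l, β (g ∘ₗ LinearMap.mulLeft ℂ (antipode ℂ (cm l j)) ∘ₗ
      LinearMap.mulRight ℂ (cm i k)) * α (cm k l) := by
  have h1 : ∀ l, ∑ k, α (cm i k) * β (g ∘ₗ LinearMap.mulLeft ℂ (antipode ℂ (cm l j) * cm k l)) =
      ∑ k, β (g ∘ₗ LinearMap.mulLeft ℂ (antipode ℂ (cm l j)) ∘ₗ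
        LinearMap.mulRight ℂ (cm i k)) * α (cm k l) := by
    intro l
    have := h.exchange (g ∘ₗ LinearMap.mulLeft ℂ (antipode ℂ (cm l j))) i l
    simpa only [LinearMap.comp_assoc, ← LinearMap.mulLeft_mul] using this
  rw [Finset.sum_comm]
  simp_rw [← h1]
  rw [Finset.sum_comm]
  have h2 : ∀ k, ∑ l, g ∘ₗ LinearMap.mulLeft ℂ (antipode ℂ (cm l j) * cm k l) =
      if k = j then g else 0 := by
    intro k
    ext z
    simp only [LinearMap.sum_apply, LinearMap.comp_apply, LinearMap.mulLeft_apply]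
    rw [← map_sum, ← Finset.sum_mul, sum_antipode_cm_mul']
    split_ifs <;> simp
  simp_rw [← Finset.mul_sum, ← map_sum, h2]
  simp [apply_ite]

namespace Double

lemma iOp_cm (i j : Ix H) (F : H →ₗ[ℂ] H) (z : H) :
    iOp H (cm i j) F z =
      ∑ k, ∑ l, cm k l * F (antipode ℂ (cm l j) * z * cm i k) := by
  simp [iOp, comul_cm, tmul_sum, LinearMap.sum_apply, rOp_apply, lOp_apply, sOp_apply, mul_assoc]

lemma evL_comul_mul (g : H →ₗ[ℂ] ℂ) (a z b : H) :
    ract g (a * z * b) = evL g (comul a * comul z * comul b) := by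
  rw [ract_eq_evL, Bialgebra.comul_mul, Bialgebra.comul_mul]

lemma exchange_aux (f : H →ₗ[ℂ] ℂ) (F : H →ₗ[ℂ] H) (i j : Ix H) (t : H ⊗[ℂ] H) :
    ∑ k, ∑ l, ∑ m, cm l m * F (evL (f ∘ₗ LinearMap.mulLeft ℂ (cm k j))
      (comul (antipode ℂ (cm m k)) * t * comul (cm i l))) =
    ∑ k, ∑ l, ∑ m, cm l m * F (antipode ℂ (cm m j) *
      evL (f ∘ₗ LinearMap.mulRight ℂ (cm i k)) t * cm k l) := by
  induction t with
  | zero => simp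
  | add x y hx hy =>
    simp only [mul_add, add_mul, map_add, Finset.sum_add_distrib] at hx hy ⊢
    rw [hx, hy]
  | tmul p q =>
    simp only [antipode_comul_cm, comul_cm, Finset.sum_mul, Finset.mul_sum,
      Algebra.TensorProduct.tmul_mul_tmul, map_sum, evL_tmul, LinearMap.comp_apply,
      LinearMap.mulLeft_apply, LinearMap.mulRight_apply, map_smul, mul_smul_comm, smul_mul_assoc]
    have key : ∀ l m s r, ∑ k, f (cm k j * (antipode ℂ (cm r k) * p * cm i s)) •
        (cm l m * F (antipode ℂ (cm m r) * q * cm s l)) =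
        if r = j then f (p * cm i s) • (cm l m * F (antipode ℂ (cm m r) * q * cm s l)) else 0 := by
      intro l m s r
      rw [← Finset.sum_smul, ← map_sum]
      simp_rw [← mul_assoc, ← Finset.sum_mul, sum_cm_mul_antipode']
      split_ifs <;> simp
    calc _ = ∑ l, ∑ m, ∑ s, ∑ r, ∑ k, f (cm k j * (antipode ℂ (cm r k) * p * cm i s)) •
        (cm l m * F (antipode ℂ (cm m r) * q * cm s l)) := by
          rw [Finset.sum_comm]
          refine Finset.sum_congr rfl fun l _ => ?_
          rw [Finset.sum_comm]
          refine Finset.sum_congr rfl fun m _ => ?_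
          rw [Finset.sum_comm]
          refine Finset.sum_congr rfl fun s _ => ?_
          rw [Finset.sum_comm]
      _ = _ := by
          simp_rw [key]
          simp only [Finset.sum_ite_eq', Finset.mem_univ, if_true]
          rw [Finset.sum_comm]
          conv_rhs => rw [Finset.sum_comm]
          rw [Finset.sum_comm]
          refine Finset.sum_congr rfl fun l _ => ?_
          rw [Finset.sum_comm]

lemma isExchange_op : IsExchange (E := Op H) (iOp H) (jOp H) where
  map_counit := by ext F z; simp [jOp_apply]
  map_conv f g := by
    ext F z; simp [jOp_apply, ract_ract]
  exchange f i j := by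
    ext F z
    simp only [LinearMap.sum_apply, Module.End.mul_apply, iOp_cm, jOp_apply, evL_comul_mul,
      exchange_aux]
    rfl

/-- The linear map `f ⊗ x ↦ β(f) α(x)`. -/
def pairMap {E : Type*} [Ring E] [Algebra ℂ E] (α : H →ₐ[ℂ] E) (β : (H →ₗ[ℂ] ℂ) →ₗ[ℂ] E) :
    (H →ₗ[ℂ] ℂ) ⊗[ℂ] H →ₗ[ℂ] E :=
  TensorProduct.lift ((LinearMap.mul ℂ E).compl₁₂ β α.toLinearMap)

@[simp] lemma pairMap_tmul {E : Type*} [Ring E] [Algebra ℂ E] (α : H →ₐ[ℂ] E)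
    (β : (H →ₗ[ℂ] ℂ) →ₗ[ℂ] E) (f : H →ₗ[ℂ] ℂ) (x : H) : pairMap α β (f ⊗ₜ x) = β f * α x := by
  simp [pairMap]

/-- The structure constants of the double on pure tensors with a comatrix entry. -/
def crossMul (f g : H →ₗ[ℂ] ℂ) (i j : Ix H) (y : H) : (H →ₗ[ℂ] ℂ) ⊗[ℂ] H :=
  ∑ k, ∑ l, conv f (g ∘ₗ LinearMap.mulLeft ℂ (antipode ℂ (cm l j)) ∘ₗ
      LinearMap.mulRight ℂ (cm i k)) ⊗ₜ (cm k l * y)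

lemma pairMap_crossMul {E : Type*} [Ring E] [Algebra ℂ E] {α : H →ₐ[ℂ] E}
    {β : (H →ₗ[ℂ] ℂ) →ₗ[ℂ] E} (h : IsExchange α β) (f g : H →ₗ[ℂ] ℂ) (i j : Ix H) (y : H) :
    pairMap α β (crossMul f g i j y) = pairMap α β (f ⊗ₜ cm i j) * pairMap α β (g ⊗ₜ y) := by
  simp only [crossMul, map_sum, pairMap_tmul, h.map_conv, map_mul]
  rw [mul_assoc, ← mul_assoc (α _), h.straighten]
  simp only [Finset.sum_mul, Finset.mul_sum, mul_assoc]

lemma pairMap_op_injective : Function.Injective (pairMap (E := Op H) (iOp H) (jOp H)) := by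
  let ev : Op H →ₗ[ℂ] (H →ₗ[ℂ] H) :=
    LinearMap.applyₗ ((counit (R := ℂ)).smulRight (1 : H))
  have h1 : ∀ x z : H, iOp H x ((counit (R := ℂ)).smulRight (1 : H)) z = counit (R := ℂ) z • x := by
    intro x z
    refine cm_ext_apply (f := (LinearMap.applyₗ z) ∘ₗ ev ∘ₗ (iOp H).toLinearMap)
      (g := counit (R := ℂ) z • LinearMap.id) (fun i j => ?_) x
    simp [ev, iOp_cm, counit_cm]
  have h2 : ev ∘ₗ pairMap (E := Op H) (iOp H) (jOp H) = dualTensorHom ℂ H H := by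
    ext f x z
    simp [ev, jOp_apply, h1, counit_ract]
  have h3 : Function.Injective (dualTensorHom ℂ H H) := (dualTensorHomEquiv ℂ H H).injective
  rw [← h2] at h3
  rw [LinearMap.coe_comp] at h3
  exact Function.Injective.of_comp h3

lemma pairMap_mul_mem {E : Type*} [Ring E] [Algebra ℂ E] {α : H →ₐ[ℂ] E}
    {β : (H →ₗ[ℂ] ℂ) →ₗ[ℂ] E} (h : IsExchange α β) (a b : (H →ₗ[ℂ] ℂ) ⊗[ℂ] H) :
    pairMap α β a * pairMap α β b ∈ LinearMap.range (pairMap α β) := by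
  induction a with
  | zero => simp
  | add x y hx hy => rw [map_add, add_mul]; exact Submodule.add_mem _ hx hy
  | tmul f x =>
    induction b with
    | zero => simp
    | add x y hx hy => rw [map_add, mul_add]; exact Submodule.add_mem _ hx hy
    | tmul g y =>
      have : ((LinearMap.range (pairMap α β)).mkQ ∘ₗ (LinearMap.mulRight ℂ (pairMap α β (g ⊗ₜ y))) ∘ₗ
          (pairMap α β) ∘ₗ TensorProduct.mk ℂ _ _ f) = 0 := by
        refine cm_ext fun i j => ?_
        simp only [LinearMap.comp_apply, TensorProduct.mk_apply, LinearMap.mulRight_apply,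
          ← pairMap_crossMul h, LinearMap.zero_apply, Submodule.mkQ_apply,
          Submodule.Quotient.mk_eq_zero]
        exact ⟨_, rfl⟩
      have := LinearMap.congr_fun this x
      simpa only [LinearMap.comp_apply, TensorProduct.mk_apply, LinearMap.mulRight_apply,
        LinearMap.zero_apply, Submodule.mkQ_apply, Submodule.Quotient.mk_eq_zero] using this

section range
variable {E : Type*} [Ring E] [Algebra ℂ E] {α : H →ₐ[ℂ] E} {β : (H →ₗ[ℂ] ℂ) →ₗ[ℂ] E}

/-- The subalgebra generated by an exchange pair. -/
def rangeAlg (h : IsExchange α β) : Subalgebra ℂ E where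
  carrier := LinearMap.range (pairMap α β)
  add_mem' := fun ha hb => Submodule.add_mem _ ha hb
  mul_mem' := by
    rintro _ _ ⟨a, rfl⟩ ⟨b, rfl⟩
    exact pairMap_mul_mem h a b
  algebraMap_mem' := fun c => ⟨c • (counit (R := ℂ) ⊗ₜ 1), by
    rw [map_smul, pairMap_tmul, h.map_counit, map_one, mul_one, Algebra.smul_def, mul_one]⟩

/-- The subalgebra generated by an exchange pair, as a type. -/
def RangeAlg (h : IsExchange α β) : Type _ := rangeAlg h

instance (h : IsExchange α β) : Ring (RangeAlg h) := inferInstanceAs (Ring (rangeAlg h))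
instance (h : IsExchange α β) : Algebra ℂ (RangeAlg h) := inferInstanceAs (Algebra ℂ (rangeAlg h))

/-- Corestriction of the first map of an exchange pair. -/
def rangeIncl (h : IsExchange α β) : H →ₐ[ℂ] RangeAlg h :=
  α.codRestrict (rangeAlg h) fun x => ⟨counit (R := ℂ) ⊗ₜ x, by simp [h.map_counit]⟩

/-- Corestriction of the second map of an exchange pair. -/
def rangeDincl (h : IsExchange α β) : (H →ₗ[ℂ] ℂ) →ₗ[ℂ] RangeAlg h :=
  β.codRestrict (Subalgebra.toSubmodule (rangeAlg h)) fun f => ⟨f ⊗ₜ 1, by simp⟩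

lemma isExchange_range (h : IsExchange α β) : IsExchange (rangeIncl h) (rangeDincl h) where
  map_counit := Subtype.ext h.map_counit
  map_conv f g := Subtype.ext (h.map_conv f g)
  exchange f i j := Subtype.ext (by
    have e1 : ∀ s : Ix H → RangeAlg h, (∑ k, s k : RangeAlg h).val = ∑ k, (s k).val := fun s =>
      map_sum (rangeAlg h).val (fun k => (s k : rangeAlg h)) Finset.univ
    rw [e1, e1]; exact h.exchange f i j)

/-- The linear identification of the generated subalgebra with `H* ⊗ H`. -/
def rangeEquiv (h : IsExchange α β) (hi : Function.Injective (pairMap α β)) :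
    (H →ₗ[ℂ] ℂ) ⊗[ℂ] H ≃ₗ[ℂ] RangeAlg h :=
  LinearEquiv.ofInjective (pairMap α β) hi

lemma rangeEquiv_eq (h : IsExchange α β) (hi : Function.Injective (pairMap α β)) :
    (rangeEquiv h hi).toLinearMap = pairMap (rangeIncl h) (rangeDincl h) := by
  ext f x
  exact ((Subtype.ext (pairMap_tmul α β f x) :
    rangeEquiv h hi (f ⊗ₜ x) = rangeDincl h f * rangeIncl h x).trans
    (pairMap_tmul (rangeIncl h) (rangeDincl h) f x).symm)

end range

end Double

variable (H) in
/-- The Drinfeld double of `H`, realized as an algebra of operators. -/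
def Double : Type _ := Double.RangeAlg (Double.isExchange_op (H := H))

namespace Double

instance : Ring (Double H) := inferInstanceAs (Ring (RangeAlg (isExchange_op (H := H))))
instance : Algebra ℂ (Double H) :=
  inferInstanceAs (Algebra ℂ (RangeAlg (isExchange_op (H := H))))

variable (H) in
/-- The linear identification of the double with `H* ⊗ H`. -/
def equiv : (H →ₗ[ℂ] ℂ) ⊗[ℂ] H ≃ₗ[ℂ] Double H := rangeEquiv isExchange_op pairMap_op_injective

variable (H) in
/-- The inclusion of `H` in its double. -/
def incl : H →ₐ[ℂ] Double H := rangeIncl isExchange_op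

variable (H) in
/-- The inclusion of the dual of `H` in the double. -/
def dincl : (H →ₗ[ℂ] ℂ) →ₗ[ℂ] Double H := rangeDincl isExchange_op

lemma isExchange : IsExchange (incl H) (dincl H) := isExchange_range isExchange_op

lemma equiv_eq : (equiv H).toLinearMap = pairMap (incl H) (dincl H) :=
  rangeEquiv_eq isExchange_op pairMap_op_injective

lemma equiv_tmul (f : H →ₗ[ℂ] ℂ) (x : H) : equiv H (f ⊗ₜ x) = dincl H f * incl H x := by
  have := LinearMap.congr_fun (equiv_eq (H := H)) (f ⊗ₜ x)
  rwa [pairMap_tmul] at this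

instance : FiniteDimensional ℂ (Double H) := (equiv H).finiteDimensional

variable (H) in
lemma finrank_eq : Module.finrank ℂ (Double H) = Module.finrank ℂ H ^ 2 := by
  rw [← (equiv H).finrank_eq, Module.finrank_tensorProduct, sq]
  congr 1
  exact Subspace.dual_finrank_eq

lemma induction {P : Double H → Prop} (h0 : P 0) (hadd : ∀ a b, P a → P b → P (a + b))
    (hmul : ∀ f x, P (dincl H f * incl H x)) (d : Double H) : P d := by
  obtain ⟨t, rfl⟩ := (equiv H).surjective d
  induction t with
  | zero => simpa using h0
  | add x y hx hy => rw [map_add]; exact hadd _ _ hx hy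
  | tmul f x => rw [equiv_tmul]; exact hmul f x

section lift
variable {E : Type*} [Ring E] [Algebra ℂ E] {α : H →ₐ[ℂ] E} {β : (H →ₗ[ℂ] ℂ) →ₗ[ℂ] E}

/-- The universal property of the double. -/
def lift (h : IsExchange α β) : Double H →ₐ[ℂ] E :=
  AlgHom.ofLinearMap (pairMap α β ∘ₗ (equiv H).symm.toLinearMap) (by
    have : (1 : Double H) = equiv H (counit (R := ℂ) ⊗ₜ 1) := by
      rw [equiv_tmul, isExchange.map_counit, map_one, one_mul]
    rw [this]; simp [h.map_counit]) (by
    intro a b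
    obtain ⟨a, rfl⟩ := (equiv H).surjective a
    obtain ⟨b, rfl⟩ := (equiv H).surjective b
    simp only [LinearMap.comp_apply, LinearEquiv.coe_coe, LinearEquiv.symm_apply_apply]
    induction a with
    | zero => simp
    | add x y hx hy => simp only [map_add, add_mul, hx, hy]
    | tmul f x =>
      induction b with
      | zero => simp
      | add x y hx hy => simp only [map_add, mul_add, hx, hy]
      | tmul g y =>
        refine cm_ext_apply (f := pairMap α β ∘ₗ (equiv H).symm.toLinearMap ∘ₗ
          LinearMap.mulRight ℂ (equiv H (g ⊗ₜ y)) ∘ₗ (equiv H).toLinearMap ∘ₗ TensorProduct.mk ℂ _ _ f)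
          (g := LinearMap.mulRight ℂ (pairMap α β (g ⊗ₜ y)) ∘ₗ pairMap α β ∘ₗ
            TensorProduct.mk ℂ _ _ f) (fun i j => ?_) x
        simp only [LinearMap.comp_apply, LinearEquiv.coe_coe, TensorProduct.mk_apply,
          LinearMap.mulRight_apply, ← pairMap_crossMul h]
        congr 1
        rw [LinearEquiv.symm_apply_eq]
        have e : ∀ t, equiv H t = pairMap (incl H) (dincl H) t :=
          LinearMap.congr_fun equiv_eq
        rw [e, e, e, pairMap_crossMul isExchange])

lemma lift_mul (h : IsExchange α β) (f : H →ₗ[ℂ] ℂ) (x : H) :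
    lift h (dincl H f * incl H x) = β f * α x := by
  rw [← equiv_tmul]; simp [lift]

@[simp] lemma lift_incl (h : IsExchange α β) (x : H) : lift h (incl H x) = α x := by
  have := lift_mul h (counit (R := ℂ)) x
  rwa [isExchange.map_counit, one_mul, h.map_counit, one_mul] at this

@[simp] lemma lift_dincl (h : IsExchange α β) (f : H →ₗ[ℂ] ℂ) : lift h (dincl H f) = β f := by
  have := lift_mul h f 1
  rwa [map_one, mul_one, map_one, mul_one] at this

lemma algHom_ext {φ ψ : Double H →ₐ[ℂ] E} (h1 : ∀ x, φ (incl H x) = ψ (incl H x))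
    (h2 : ∀ f, φ (dincl H f) = ψ (dincl H f)) : φ = ψ := by
  ext d
  induction d using Double.induction with
  | h0 => simp
  | hadd a b ha hb => rw [map_add, map_add, ha, hb]
  | hmul f x => rw [map_mul, map_mul, h1, h2]

end lift

end Double

end FinHopf

namespace FinHopf

variable {H : Type*} [Ring H] [HopfAlgebra ℂ H] [FiniteDimensional ℂ H]

section canon

variable {X Y : Type*} [AddCommGroup X] [Module ℂ X] [AddCommGroup Y] [Module ℂ Y]

/-- The image `∑ₐ A(bₐ) ⊗ B(bᵃ)` of the canonical element of `H ⊗ H*`. -/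
def canon (A : H →ₗ[ℂ] X) (B : (H →ₗ[ℂ] ℂ) →ₗ[ℂ] Y) : X ⊗[ℂ] Y :=
  ∑ a, A (Module.finBasis ℂ H a) ⊗ₜ B ((Module.finBasis ℂ H).coord a)

lemma sum_coord_smul (f : H →ₗ[ℂ] ℂ) :
    ∑ a, f (Module.finBasis ℂ H a) • (Module.finBasis ℂ H).coord a = f := by
  refine (Module.finBasis ℂ H).ext fun i => ?_
  simp

lemma sum_basis_smul (x : H) :
    ∑ a, (Module.finBasis ℂ H).coord a x • Module.finBasis ℂ H a = x :=
  (Module.finBasis ℂ H).sum_repr x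

lemma canon_move (A : H →ₗ[ℂ] X) (B : (H →ₗ[ℂ] ℂ) →ₗ[ℂ] Y) (φ : H →ₗ[ℂ] H) :
    canon (A ∘ₗ φ) B = ∑ a, A (Module.finBasis ℂ H a) ⊗ₜ[ℂ] B ((Module.finBasis ℂ H).coord a ∘ₗ φ) := by
  set b := Module.finBasis ℂ H
  have h1 : ∀ a, A (φ (b a)) = ∑ c, b.coord c (φ (b a)) • A (b c) := fun a => by
    rw [← sum_basis_smul (φ (b a)), map_sum]; simp [b]
  have h2 : ∀ c, B (b.coord c ∘ₗ φ) = ∑ a, b.coord c (φ (b a)) • B (b.coord a) := fun c => by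
    rw [← sum_coord_smul (b.coord c ∘ₗ φ), map_sum]; simp [b]
  simp only [canon, LinearMap.comp_apply]
  simp_rw [h2, tmul_sum, ← smul_tmul]
  rw [Finset.sum_comm]
  simp_rw [← sum_tmul]
  refine Finset.sum_congr rfl fun a _ => ?_
  rw [← h1]

end canon

/-- Convolution of linear maps into an algebra. -/
def convMap {E : Type*} [Ring E] [Algebra ℂ E] (A B : H →ₗ[ℂ] E) : H →ₗ[ℂ] E :=
  LinearMap.mul' ℂ E ∘ₗ TensorProduct.map A B ∘ₗ comul

@[simp] lemma convMap_cm {E : Type*} [Ring E] [Algebra ℂ E] (A B : H →ₗ[ℂ] E) (i j : Ix H) :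
    convMap A B (cm i j) = ∑ k, A (cm i k) * B (cm k j) := by
  simp [convMap, comul_cm]

lemma canon_mul {E F : Type*} [Ring E] [Algebra ℂ E] [Ring F] [Algebra ℂ F]
    (A A' : H →ₗ[ℂ] E) (B : (H →ₗ[ℂ] ℂ) →ₗ[ℂ] F) (hB : ∀ f g, B (conv f g) = B f * B g) :
    canon A B * canon A' B = canon (convMap A A') B := by
  set b := Module.finBasis ℂ H
  have h1 : ∀ a c, B (b.coord a) * B (b.coord c) =
      ∑ e, conv (b.coord a) (b.coord c) (b e) • B (b.coord e) := fun a c => by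
    rw [← hB, ← sum_coord_smul (conv (b.coord a) (b.coord c)), map_sum]; simp [b]
  have h2 : ∀ t : H ⊗[ℂ] H, ∑ a, ∑ c, (LinearMap.mul' ℂ ℂ
      (TensorProduct.map (b.coord a) (b.coord c) t)) • (A (b a) * A' (b c)) =
      LinearMap.mul' ℂ E (TensorProduct.map A A' t) := by
    intro t
    induction t with
    | zero => simp
    | add x y hx hy => simp only [map_add, add_smul, Finset.sum_add_distrib, hx, hy]
    | tmul x y =>
      simp only [TensorProduct.map_tmul, LinearMap.mul'_apply]
      conv_rhs => rw [← sum_basis_smul x, ← sum_basis_smul y]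
      simp only [map_sum, map_smul, Finset.sum_mul_sum, smul_mul_smul_comm]
      rfl
  have h3 : ∀ e, convMap A A' (b e) =
      ∑ a, ∑ c, conv (b.coord a) (b.coord c) (b e) • (A (b a) * A' (b c)) := fun e => (h2 _).symm
  simp only [canon, Finset.sum_mul_sum, Algebra.TensorProduct.tmul_mul_tmul]
  change ∑ a, ∑ c, (A (b a) * A' (b c)) ⊗ₜ[ℂ] (B (b.coord a) * B (b.coord c)) =
    ∑ e, convMap A A' (b e) ⊗ₜ[ℂ] B (b.coord e)
  simp_rw [h1, h3, tmul_sum, sum_tmul, smul_tmul]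
  rw [Finset.sum_comm_cycle, Finset.sum_comm]

lemma conv_comp_mulLeft_cm (f g : H →ₗ[ℂ] ℂ) (i j : Ix H) :
    conv f g ∘ₗ LinearMap.mulLeft ℂ (cm i j) = ∑ k, conv (f ∘ₗ LinearMap.mulLeft ℂ (cm i k))
      (g ∘ₗ LinearMap.mulLeft ℂ (cm k j)) := by
  refine cm_ext fun a b => ?_
  simp [conv, comul_cm, Finset.sum_mul_sum]

lemma mulRight_comp_mulLeft (x y : H) : LinearMap.mulRight ℂ x ∘ₗ LinearMap.mulLeft ℂ y =
    LinearMap.mulLeft ℂ y ∘ₗ LinearMap.mulRight ℂ x := by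
  ext; simp [mul_assoc]

/-- `z ↦ f ∘ (z * ·)` as a linear map. -/
def precL (f : H →ₗ[ℂ] ℂ) : H →ₗ[ℂ] (H →ₗ[ℂ] ℂ) := (LinearMap.mul ℂ H).compr₂ f

@[simp] lemma precL_apply (f : H →ₗ[ℂ] ℂ) (z : H) : precL f z = f ∘ₗ LinearMap.mulLeft ℂ z := rfl

/-- `z ↦ f ∘ (· * z)` as a linear map. -/
def precR (f : H →ₗ[ℂ] ℂ) : H →ₗ[ℂ] (H →ₗ[ℂ] ℂ) := (LinearMap.mul ℂ H).flip.compr₂ f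

@[simp] lemma precR_apply (f : H →ₗ[ℂ] ℂ) (z : H) : precR f z = f ∘ₗ LinearMap.mulRight ℂ z := rfl

namespace Double

variable [IsSemisimpleRing H]

/-- The comultiplication of the double on the dual of `H`. -/
def dcomul (f : H →ₗ[ℂ] ℂ) : Double H ⊗[ℂ] Double H := canon (dincl H ∘ₗ precL f) (dincl H)

variable (H) in
/-- The comultiplication of the double on the dual of `H`, as a linear map. -/
def dcomulL : (H →ₗ[ℂ] ℂ) →ₗ[ℂ] Double H ⊗[ℂ] Double H where
  toFun := dcomul
  map_add' f g := by
    simp [dcomul, canon, LinearMap.add_comp, add_tmul, Finset.sum_add_distrib]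
  map_smul' c f := by
    simp [dcomul, canon, LinearMap.smul_comp, Finset.smul_sum, smul_tmul']

variable (H) in
/-- The comultiplication of the double on `H`. -/
def hcomul : H →ₐ[ℂ] Double H ⊗[ℂ] Double H :=
  (Algebra.TensorProduct.map (incl H) (incl H)).comp (Bialgebra.comulAlgHom ℂ H)

lemma hcomul_cm (i j : Ix H) : hcomul H (cm i j) = ∑ k, incl H (cm i k) ⊗ₜ[ℂ] incl H (cm k j) := by
  simp [hcomul, comul_cm]

lemma isExchange_comul : IsExchange (hcomul H) (dcomulL H) where
  map_counit := by
    change dcomul _ = 1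
    have h : ∀ z : H, (counit (R := ℂ)) ∘ₗ LinearMap.mulLeft ℂ z = counit (R := ℂ) z • counit := by
      intro z; ext; simp
    simp only [dcomul, canon, LinearMap.comp_apply, precL_apply, h, map_smul, isExchange.map_counit,
      smul_tmul, ← tmul_sum]
    simp_rw [← map_smul, ← map_sum, sum_coord_smul, isExchange.map_counit]; rfl
  map_conv f g := by
    change dcomul _ = dcomul _ * dcomul _
    rw [dcomul, dcomul, dcomul, canon_mul _ _ _ isExchange.map_conv]
    congr 1
    refine cm_ext fun i j => ?_
    simp only [LinearMap.comp_apply, precL_apply, convMap_cm, conv_comp_mulLeft_cm, map_sum,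
      isExchange.map_conv]
  exchange f i j := by
    set b := Module.finBasis ℂ H with hb
    have step1 : ∀ k m, (incl H (cm i m) ⊗ₜ[ℂ] incl H (cm m k)) *
        dcomul (f ∘ₗ LinearMap.mulLeft ℂ (cm k j)) =
        ∑ a, (incl H (cm i m) * dincl H (f ∘ₗ LinearMap.mulLeft ℂ (b a))) ⊗ₜ[ℂ]
          (incl H (cm m k) * dincl H (b.coord a ∘ₗ LinearMap.mulLeft ℂ (cm k j))) := by
      intro k m
      have : dincl H ∘ₗ precL (f ∘ₗ LinearMap.mulLeft ℂ (cm k j)) =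
          (dincl H ∘ₗ precL f) ∘ₗ LinearMap.mulLeft ℂ (cm k j) := by
        ext z : 1
        simp only [LinearMap.comp_apply, precL_apply, LinearMap.comp_assoc, LinearMap.mulLeft_apply]
        rw [← LinearMap.mulLeft_mul]
      rw [dcomul, this, canon_move, Finset.mul_sum]
      simp [b]
    have step2 : ∀ m k, ∑ a, (incl H (cm i m) * dincl H (f ∘ₗ LinearMap.mulLeft ℂ (b a))) ⊗ₜ[ℂ]
        (dincl H (b.coord a ∘ₗ LinearMap.mulRight ℂ (cm m k)) * incl H (cm k j)) =
        ∑ a, (incl H (cm i m) * dincl H ((f ∘ₗ LinearMap.mulLeft ℂ (b a)) ∘ₗ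
          LinearMap.mulLeft ℂ (cm m k))) ⊗ₜ[ℂ] (dincl H (b.coord a) * incl H (cm k j)) := by
      intro m k
      have := canon_move (LinearMap.mulLeft ℂ (incl H (cm i m)) ∘ₗ dincl H ∘ₗ precL f)
        (LinearMap.mulRight ℂ (incl H (cm k j)) ∘ₗ dincl H) (LinearMap.mulRight ℂ (cm m k))
      simp only [LinearMap.comp_apply, precL_apply, LinearMap.mulLeft_apply,
        LinearMap.mulRight_apply] at this
      rw [← this]
      simp only [canon, LinearMap.comp_apply, precL_apply, LinearMap.mulLeft_apply,
        LinearMap.mulRight_apply, LinearMap.mulLeft_mul, LinearMap.comp_assoc, b]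
    change ∑ k, hcomul H (cm i k) * dcomul (f ∘ₗ LinearMap.mulLeft ℂ (cm k j)) =
      ∑ k, dcomul (f ∘ₗ LinearMap.mulRight ℂ (cm i k)) * hcomul H (cm k j)
    simp only [hcomul_cm, Finset.sum_mul, step1]
    calc _ = ∑ m, ∑ a, (incl H (cm i m) * dincl H (f ∘ₗ LinearMap.mulLeft ℂ (b a))) ⊗ₜ[ℂ]
          ∑ k, (incl H (cm m k) * dincl H (b.coord a ∘ₗ LinearMap.mulLeft ℂ (cm k j))) := by
          rw [Finset.sum_comm]
          refine Finset.sum_congr rfl fun m _ => ?_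
          rw [Finset.sum_comm]
          simp_rw [tmul_sum]
      _ = ∑ m, ∑ k, ∑ a, (incl H (cm i m) * dincl H (f ∘ₗ LinearMap.mulLeft ℂ (b a))) ⊗ₜ[ℂ]
        (dincl H (b.coord a ∘ₗ LinearMap.mulRight ℂ (cm m k)) * incl H (cm k j)) := by
          refine Finset.sum_congr rfl fun m _ => ?_
          rw [Finset.sum_comm]
          simp_rw [isExchange.exchange, tmul_sum]
      _ = ∑ k, ∑ a, (∑ m, incl H (cm i m) * dincl H ((f ∘ₗ LinearMap.mulLeft ℂ (b a)) ∘ₗ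
          LinearMap.mulLeft ℂ (cm m k))) ⊗ₜ[ℂ] (dincl H (b.coord a) * incl H (cm k j)) := by
          simp_rw [step2, sum_tmul]
          rw [Finset.sum_comm]
          refine Finset.sum_congr rfl fun m _ => ?_
          rw [Finset.sum_comm]
      _ = _ := by
          simp_rw [isExchange.exchange, sum_tmul, dcomul, canon, Finset.sum_mul, Finset.mul_sum,
            Algebra.TensorProduct.tmul_mul_tmul]
          simp only [LinearMap.comp_apply, precL_apply, LinearMap.comp_assoc, ← hb,
            mulRight_comp_mulLeft]
          rw [Finset.sum_comm]
          conv_rhs => rw [Finset.sum_comm]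
          refine Finset.sum_congr rfl fun m _ => ?_
          rw [Finset.sum_comm]

variable (H) in
/-- The comultiplication of the double. -/
def comulHom : Double H →ₐ[ℂ] Double H ⊗[ℂ] Double H := lift isExchange_comul

lemma isExchange_counit :
    IsExchange (Bialgebra.counitAlgHom ℂ H) (LinearMap.applyₗ (R := ℂ) (1 : H)) where
  map_counit := by simp
  map_conv f g := by simp [conv, Algebra.TensorProduct.one_def]
  exchange f i j := by simp [counit_cm]

variable (H) in
/-- The counit of the double. -/
def counitHom : Double H →ₐ[ℂ] ℂ := lift isExchange_counit

lemma comulHom_incl_cm (i j : Ix H) :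
    comulHom H (incl H (cm i j)) = ∑ k, incl H (cm i k) ⊗ₜ[ℂ] incl H (cm k j) := by
  rw [comulHom, lift_incl, hcomul_cm]

lemma comulHom_dincl (f : H →ₗ[ℂ] ℂ) : comulHom H (dincl H f) =
    ∑ a, dincl H (f ∘ₗ LinearMap.mulLeft ℂ (Module.finBasis ℂ H a)) ⊗ₜ[ℂ]
      dincl H ((Module.finBasis ℂ H).coord a) := by
  rw [comulHom, lift_dincl]; rfl

@[simp] lemma counitHom_incl (x : H) : counitHom H (incl H x) = counit (R := ℂ) x := by
  rw [counitHom, lift_incl]; rfl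

@[simp] lemma counitHom_dincl (f : H →ₗ[ℂ] ℂ) : counitHom H (dincl H f) = f 1 := by
  rw [counitHom, lift_dincl]; rfl

lemma algHom_ext_cm {E : Type*} [Ring E] [Algebra ℂ E] {φ ψ : Double H →ₐ[ℂ] E}
    (h1 : ∀ i j, φ (incl H (cm i j)) = ψ (incl H (cm i j)))
    (h2 : ∀ f, φ (dincl H f) = ψ (dincl H f)) : φ = ψ :=
  algHom_ext (fun x => cm_ext_apply (f := φ.toLinearMap ∘ₗ (incl H).toLinearMap)
    (g := ψ.toLinearMap ∘ₗ (incl H).toLinearMap) h1 x) h2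

lemma assocHom_tmul {A : Type*} [Ring A] [Algebra ℂ A] (a b c : A) :
    (Algebra.TensorProduct.assoc ℂ ℂ ℂ A A A).toAlgHom (a ⊗ₜ b ⊗ₜ c) = a ⊗ₜ (b ⊗ₜ c) := rfl

instance : Bialgebra ℂ (Double H) :=
  Bialgebra.ofAlgHom (comulHom H) (counitHom H)
    (algHom_ext_cm (fun i j => by
      simp only [AlgHom.comp_apply, comulHom_incl_cm, map_sum, Algebra.TensorProduct.map_tmul,
        sum_tmul, tmul_sum, AlgHom.id_apply, assocHom_tmul]
      rw [Finset.sum_comm]) (fun f => by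
      simp only [AlgHom.comp_apply, comulHom_dincl, map_sum, Algebra.TensorProduct.map_tmul,
        sum_tmul, tmul_sum, AlgHom.id_apply, assocHom_tmul]
      conv_rhs => rw [Finset.sum_comm]
      refine Finset.sum_congr rfl fun c _ => ?_
      have := canon_move (dincl H ∘ₗ precL f)
        ((TensorProduct.mk ℂ (Double H) (Double H)).flip
          (dincl H ((Module.finBasis ℂ H).coord c)) ∘ₗ dincl H)
        (LinearMap.mulLeft ℂ (Module.finBasis ℂ H c))
      simp only [LinearMap.comp_apply, precL_apply, LinearMap.mulLeft_apply,
        LinearMap.flip_apply, TensorProduct.mk_apply] at this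
      rw [← this]
      simp only [canon, LinearMap.comp_apply, precL_apply, LinearMap.mulLeft_apply,
        LinearMap.flip_apply, TensorProduct.mk_apply, LinearMap.mulLeft_mul, LinearMap.comp_assoc]))
    (algHom_ext_cm (fun i j => by
      simp [comulHom_incl_cm, counit_cm, ite_tmul]) (fun f => by
      simp only [AlgHom.comp_apply, comulHom_dincl, map_sum, Algebra.TensorProduct.map_tmul,
        AlgHom.id_apply, counitHom_dincl, LinearMap.comp_apply, LinearMap.mulLeft_apply, mul_one]
      change _ = (1 : ℂ) ⊗ₜ[ℂ] dincl H f
      conv_rhs => rw [← sum_coord_smul f, map_sum, tmul_sum]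
      refine Finset.sum_congr rfl fun a _ => ?_
      rw [map_smul, ← smul_tmul, smul_eq_mul, mul_one]))
    (algHom_ext_cm (fun i j => by
      simp [comulHom_incl_cm, counit_cm, tmul_ite]) (fun f => by
      simp only [AlgHom.comp_apply, comulHom_dincl, map_sum, Algebra.TensorProduct.map_tmul,
        AlgHom.id_apply, counitHom_dincl]
      have h : f = ∑ a, (Module.finBasis ℂ H).coord a 1 •
          (f ∘ₗ LinearMap.mulLeft ℂ (Module.finBasis ℂ H a)) := by
        ext z
        have := congrArg (fun w => f (w * z)) (sum_basis_smul (1 : H))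
        simp only [one_mul] at this
        rw [← this, Finset.sum_mul, map_sum]
        simp only [smul_mul_assoc, map_smul, LinearMap.sum_apply, LinearMap.smul_apply,
          LinearMap.comp_apply, LinearMap.mulLeft_apply]
      change _ = dincl H f ⊗ₜ[ℂ] (1 : ℂ)
      conv_rhs => rw [h, map_sum, sum_tmul]
      refine Finset.sum_congr rfl fun a _ => ?_
      rw [map_smul, smul_tmul, smul_eq_mul, mul_one]))

lemma comul_eq (d : Double H) : comul (R := ℂ) d = comulHom H d := rfl
lemma counit_eq (d : Double H) : counit (R := ℂ) d = counitHom H d := rfl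

lemma exchange_comul (f : H →ₗ[ℂ] ℂ) (x : H) :
    LinearMap.mul' ℂ (Double H) (TensorProduct.map (incl H).toLinearMap (dincl H ∘ₗ precL f)
      (comul (R := ℂ) x)) =
    LinearMap.mul' ℂ (Double H) (TensorProduct.map (dincl H ∘ₗ precR f) (incl H).toLinearMap
      (comul (R := ℂ) x)) := by
  refine cm_ext_apply (f := LinearMap.mul' ℂ (Double H) ∘ₗ TensorProduct.map (incl H).toLinearMap
    (dincl H ∘ₗ precL f) ∘ₗ comul) (g := LinearMap.mul' ℂ (Double H) ∘ₗ
    TensorProduct.map (dincl H ∘ₗ precR f) (incl H).toLinearMap ∘ₗ comul) (fun i j => ?_) x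
  simpa [comul_cm] using isExchange.exchange f i j

variable (H) in
/-- The antipode on `H`, valued in the opposite of the double. -/
def hanti : H →ₐ[ℂ] (Double H)ᵐᵒᵖ :=
  AlgHom.ofLinearMap ((MulOpposite.opLinearEquiv ℂ).toLinearMap ∘ₗ (incl H).toLinearMap ∘ₗ antipode ℂ)
    (by simp) (fun x y => by simp [antipode_mul_antidistrib])

variable (H) in
/-- The antipode on the dual of `H`, valued in the opposite of the double. -/
def danti : (H →ₗ[ℂ] ℂ) →ₗ[ℂ] (Double H)ᵐᵒᵖ :=
  (MulOpposite.opLinearEquiv ℂ).toLinearMap ∘ₗ dincl H ∘ₗ LinearMap.lcomp ℂ ℂ (antipode ℂ)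

lemma hanti_apply (x : H) : hanti H x = MulOpposite.op (incl H (antipode ℂ x)) := rfl
lemma danti_apply (f : H →ₗ[ℂ] ℂ) : danti H f = MulOpposite.op (dincl H (f ∘ₗ antipode ℂ)) := rfl

lemma conv_comp_antipode (f g : H →ₗ[ℂ] ℂ) :
    conv f g ∘ₗ antipode ℂ = conv (g ∘ₗ antipode ℂ) (f ∘ₗ antipode ℂ) := by
  refine cm_ext fun i j => ?_
  simp [conv, antipode_comul_cm, comul_cm, mul_comm]

lemma isExchange_antipode : IsExchange (hanti H) (danti H) where
  map_counit := by
    have : (counit (R := ℂ) (A := H)) ∘ₗ antipode ℂ = counit := by ext; simp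
    rw [danti_apply, this, isExchange.map_counit]; rfl
  map_conv f g := by
    rw [danti_apply, danti_apply, danti_apply, conv_comp_antipode, isExchange.map_conv]; rfl
  exchange f i j := by
    simp only [hanti_apply, danti_apply, ← MulOpposite.op_mul]
    have h := exchange_comul (f ∘ₗ antipode ℂ) (antipode ℂ (cm i j))
    simp only [antipode_comul_cm, map_sum, TensorProduct.map_tmul, LinearMap.mul'_apply,
      LinearMap.comp_apply, precL_apply, precR_apply, AlgHom.toLinearMap_apply] at h
    have e1 : ∀ k, (f ∘ₗ LinearMap.mulLeft ℂ (cm k j)) ∘ₗ antipode ℂ =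
        (f ∘ₗ antipode ℂ) ∘ₗ LinearMap.mulRight ℂ (antipode ℂ (cm k j)) := by
      intro k; ext z; simp [antipode_mul_antidistrib, antipode_antipode]
    have e2 : ∀ k, (f ∘ₗ LinearMap.mulRight ℂ (cm i k)) ∘ₗ antipode ℂ =
        (f ∘ₗ antipode ℂ) ∘ₗ LinearMap.mulLeft ℂ (antipode ℂ (cm i k)) := by
      intro k; ext z; simp [antipode_mul_antidistrib, antipode_antipode]
    simp_rw [e1, e2]
    have h2 := congrArg (MulOpposite.opLinearEquiv ℂ) h.symm
    simpa only [map_sum, MulOpposite.coe_opLinearEquiv] using h2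

variable (H) in
/-- The antipode of the double. -/
def anti : Double H →ₗ[ℂ] Double H :=
  (MulOpposite.opLinearEquiv ℂ).symm.toLinearMap ∘ₗ (lift (isExchange_antipode (H := H))).toLinearMap

lemma anti_mul (c d : Double H) : anti H (c * d) = anti H d * anti H c := by
  simp [anti]

@[simp] lemma anti_incl (x : H) : anti H (incl H x) = incl H (antipode ℂ x) := by
  simp [anti, hanti_apply]

@[simp] lemma anti_dincl (f : H →ₗ[ℂ] ℂ) : anti H (dincl H f) = dincl H (f ∘ₗ antipode ℂ) := by
  simp [anti, danti_apply]

lemma sum_conv_antipode_left (f : H →ₗ[ℂ] ℂ) :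
    ∑ a, conv ((f ∘ₗ LinearMap.mulLeft ℂ (Module.finBasis ℂ H a)) ∘ₗ antipode ℂ)
      ((Module.finBasis ℂ H).coord a) = f 1 • counit := by
  refine cm_ext fun i j => ?_
  simp only [LinearMap.sum_apply, conv_cm, LinearMap.comp_apply, LinearMap.mulLeft_apply,
    LinearMap.smul_apply, counit_cm]
  rw [Finset.sum_comm]
  have : ∀ k, ∑ a, f (Module.finBasis ℂ H a * antipode ℂ (cm i k)) *
      (Module.finBasis ℂ H).coord a (cm k j) = f (cm k j * antipode ℂ (cm i k)) := by
    intro k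
    conv_rhs => rw [← sum_basis_smul (cm k j), Finset.sum_mul, map_sum]
    refine Finset.sum_congr rfl fun a _ => ?_
    rw [smul_mul_assoc, map_smul, smul_eq_mul, mul_comm]
  simp_rw [this]
  rw [← map_sum, sum_cm_mul_antipode']
  split_ifs <;> simp

lemma sum_conv_antipode_right (f : H →ₗ[ℂ] ℂ) :
    ∑ a, conv (f ∘ₗ LinearMap.mulLeft ℂ (Module.finBasis ℂ H a))
      ((Module.finBasis ℂ H).coord a ∘ₗ antipode ℂ) = f 1 • counit := by
  refine cm_ext fun i j => ?_
  simp only [LinearMap.sum_apply, conv_cm, LinearMap.comp_apply, LinearMap.mulLeft_apply,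
    LinearMap.smul_apply, counit_cm]
  rw [Finset.sum_comm]
  have : ∀ k, ∑ a, f (Module.finBasis ℂ H a * cm i k) *
      (Module.finBasis ℂ H).coord a (antipode ℂ (cm k j)) = f (antipode ℂ (cm k j) * cm i k) := by
    intro k
    conv_rhs => rw [← sum_basis_smul (antipode ℂ (cm k j)), Finset.sum_mul, map_sum]
    refine Finset.sum_congr rfl fun a _ => ?_
    rw [smul_mul_assoc, map_smul, smul_eq_mul, mul_comm]
  simp_rw [this]
  rw [← map_sum, sum_antipode_cm_mul']
  split_ifs <;> simp

lemma comul_dincl_mul_incl_cm (f : H →ₗ[ℂ] ℂ) (i j : Ix H) :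
    comul (R := ℂ) (dincl H f * incl H (cm i j)) = ∑ k, ∑ a,
      (dincl H (f ∘ₗ LinearMap.mulLeft ℂ (Module.finBasis ℂ H a)) * incl H (cm i k)) ⊗ₜ[ℂ]
        (dincl H ((Module.finBasis ℂ H).coord a) * incl H (cm k j)) := by
  rw [comul_eq, map_mul, comulHom_dincl, comulHom_incl_cm, Finset.mul_sum]
  simp only [Finset.sum_mul, Algebra.TensorProduct.tmul_mul_tmul]

lemma linearMap_ext_cm {W : Type*} [AddCommGroup W] [Module ℂ W] {φ ψ : Double H →ₗ[ℂ] W}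
    (h : ∀ f i j, φ (dincl H f * incl H (cm i j)) = ψ (dincl H f * incl H (cm i j))) : φ = ψ := by
  ext d
  induction d using Double.induction with
  | h0 => simp
  | hadd a b ha hb => rw [map_add, map_add, ha, hb]
  | hmul f x =>
    exact cm_ext_apply (f := φ ∘ₗ LinearMap.mulLeft ℂ (dincl H f) ∘ₗ (incl H).toLinearMap)
      (g := ψ ∘ₗ LinearMap.mulLeft ℂ (dincl H f) ∘ₗ (incl H).toLinearMap) (h f) x

instance : HopfAlgebra ℂ (Double H) where
  antipode := anti H
  mul_antipode_rTensor_comul := linearMap_ext_cm fun f i j => by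
    simp only [LinearMap.comp_apply, comul_dincl_mul_incl_cm, map_sum, LinearMap.rTensor_tmul,
      LinearMap.mul'_apply, anti_mul, anti_incl, anti_dincl]
    have : ∀ k, ∑ a, incl H (antipode ℂ (cm i k)) *
        dincl H ((f ∘ₗ LinearMap.mulLeft ℂ (Module.finBasis ℂ H a)) ∘ₗ antipode ℂ) *
        (dincl H ((Module.finBasis ℂ H).coord a) * incl H (cm k j)) =
        f 1 • incl H (antipode ℂ (cm i k) * cm k j) := by
      intro k
      simp_rw [mul_assoc, ← mul_assoc (dincl H _), ← isExchange.map_conv]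
      rw [← Finset.mul_sum, ← Finset.sum_mul, ← map_sum, sum_conv_antipode_left, map_smul,
        isExchange.map_counit]
      simp
    simp_rw [this]
    rw [← Finset.smul_sum, ← map_sum, sum_antipode_cm_mul, counit_eq, map_mul, counitHom_dincl,
      counitHom_incl, counit_cm]
    split_ifs <;> simp [Algebra.smul_def]
  mul_antipode_lTensor_comul := linearMap_ext_cm fun f i j => by
    simp only [LinearMap.comp_apply, comul_dincl_mul_incl_cm, map_sum, LinearMap.lTensor_tmul,
      LinearMap.mul'_apply, anti_mul, anti_incl, anti_dincl]
    rw [Finset.sum_comm]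
    have : ∀ a, ∑ k, dincl H (f ∘ₗ LinearMap.mulLeft ℂ (Module.finBasis ℂ H a)) * incl H (cm i k) *
        (incl H (antipode ℂ (cm k j)) * dincl H ((Module.finBasis ℂ H).coord a ∘ₗ antipode ℂ)) =
        (if i = j then 1 else 0 : ℂ) • dincl H (conv (f ∘ₗ LinearMap.mulLeft ℂ (Module.finBasis ℂ H a))
          ((Module.finBasis ℂ H).coord a ∘ₗ antipode ℂ)) := by
      intro a
      simp_rw [mul_assoc, ← mul_assoc (incl H _), ← map_mul]
      rw [← Finset.mul_sum, ← Finset.sum_mul, ← map_sum, sum_cm_mul_antipode, isExchange.map_conv]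
      split_ifs <;> simp
    simp_rw [this]
    rw [← Finset.smul_sum, ← map_sum, sum_conv_antipode_right, counit_eq, map_mul, counitHom_dincl,
      counitHom_incl, counit_cm, map_smul, isExchange.map_counit]
    split_ifs <;> simp [Algebra.smul_def]

end Double

end FinHopf

namespace FinHopf

section Maschke

variable {A : Type*} [Ring A] [HopfAlgebra ℂ A] [FiniteDimensional ℂ A]

/-- `a ⊗ b ↦ a q(S(b) m)`. -/
def avgForm (q : A →ₗ[ℂ] A) (m : A) : A ⊗[ℂ] A →ₗ[ℂ] A :=
  LinearMap.mul' ℂ A ∘ₗ TensorProduct.map LinearMap.id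
    (q ∘ₗ LinearMap.mulRight ℂ m ∘ₗ antipode ℂ)

lemma avgForm_tmul (q : A →ₗ[ℂ] A) (m a b : A) :
    avgForm q m (a ⊗ₜ b) = a * q (antipode ℂ b * m) := by
  simp [avgForm]

lemma avgForm_add (q : A →ₗ[ℂ] A) (m m' : A) :
    avgForm q (m + m') = avgForm q m + avgForm q m' := by
  ext a b; simp [avgForm_tmul, mul_add]

lemma avgForm_smul (q : A →ₗ[ℂ] A) (c : ℂ) (m : A) :
    avgForm q (c • m) = c • avgForm q m := by
  ext a b; simp [avgForm_tmul]

lemma avgForm_mem {N : Submodule A A} (q : A →ₗ[ℂ] A) (hq : ∀ a, q a ∈ N) (m : A)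
    (t : A ⊗[ℂ] A) : avgForm q m t ∈ N := by
  induction t with
  | zero => simp
  | add x y hx hy => rw [map_add]; exact N.add_mem hx hy
  | tmul a b => rw [avgForm_tmul]; exact N.smul_mem a (hq _)

lemma avgForm_sum_cm (q : A →ₗ[ℂ] A) (m : A) (i j : Ix A) (t : A ⊗[ℂ] A) :
    ∑ k, avgForm q (cm k j * m) (comul (cm i k) * t) = cm i j * avgForm q m t := by
  induction t with
  | zero => simp
  | add x y hx hy => simp only [mul_add, map_add, Finset.sum_add_distrib, hx, hy]
  | tmul a b =>
    simp only [comul_cm, Finset.sum_mul, Algebra.TensorProduct.tmul_mul_tmul, map_sum, avgForm_tmul,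
      antipode_mul_antidistrib]
    rw [Finset.sum_comm]
    have : ∀ l, ∑ k, cm i l * a * q (antipode ℂ b * antipode ℂ (cm l k) * (cm k j * m)) =
        if l = j then cm i l * a * q (antipode ℂ b * m) else 0 := by
      intro l
      have h1 : ∑ k, antipode ℂ b * antipode ℂ (cm l k) * (cm k j * m) =
          if l = j then antipode ℂ b * m else 0 := by
        calc _ = antipode ℂ b * (∑ k, antipode ℂ (cm l k) * cm k j) * m := by
              simp only [Finset.mul_sum, Finset.sum_mul, mul_assoc]
          _ = _ := by rw [sum_antipode_cm_mul]; split_ifs <;> simp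
      rw [← Finset.mul_sum, ← map_sum, h1]
      split_ifs <;> simp
    simp_rw [this]
    simp [mul_assoc]

/-- Maschke's theorem for Hopf algebras. -/
theorem isSemisimpleRing_of_integral {t : A} (ht : ∀ x, x * t = counit (R := ℂ) x • t)
    (ht1 : counit (R := ℂ) t = 1) : IsSemisimpleRing A := by
  refine (isSemisimpleModule_iff A A).2 ⟨fun N => ?_⟩
  obtain ⟨q, hqN, hq⟩ : ∃ q : A →ₗ[ℂ] A, (∀ a, q a ∈ N) ∧ ∀ a ∈ N, q a = a := by
    obtain ⟨q, hq⟩ := (N.restrictScalars ℂ).subtype.exists_leftInverse_of_injective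
      (LinearMap.ker_eq_bot.2 Subtype.val_injective)
    exact ⟨(N.restrictScalars ℂ).subtype ∘ₗ q, fun a => (q a).2,
      fun a ha => congrArg Subtype.val (LinearMap.congr_fun hq ⟨a, ha⟩)⟩
  have hlin : ∀ x m, avgForm q (x * m) (comul t) = x * avgForm q m (comul t) := by
    intro x m
    refine cm_ext_apply
      (f := LinearMap.mk ⟨fun x => avgForm q (x * m) (comul t), fun a b => by
        rw [add_mul, avgForm_add]; rfl⟩ (fun c a => by
        simp only [smul_mul_assoc, avgForm_smul]; rfl))
      (g := LinearMap.mulRight ℂ (avgForm q m (comul t))) (fun i j => ?_) x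
    change avgForm q (cm i j * m) (comul t) = cm i j * avgForm q m (comul t)
    rw [← avgForm_sum_cm]
    simp_rw [← Bialgebra.comul_mul, ht, map_smul, counit_cm]
    simp
  let P : A →ₗ[A] N :=
    { toFun := fun m => ⟨avgForm q m (comul t), avgForm_mem q hqN m _⟩
      map_add' := fun a b => Subtype.ext (LinearMap.congr_fun (avgForm_add q a b) (comul t))
      map_smul' := fun x m => Subtype.ext (hlin x m) }
  refine ⟨LinearMap.ker P, LinearMap.isCompl_of_proj fun n => Subtype.ext ?_⟩
  change avgForm q n (comul t) = n
  have : ∀ u : A ⊗[ℂ] A, avgForm q n u =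
      LinearMap.mul' ℂ A ((antipode ℂ).lTensor A u) * n := by
    intro u
    induction u with
    | zero => simp
    | add x y hx hy => simp only [map_add, hx, hy, add_mul]
    | tmul y z =>
      have : antipode ℂ z * (n : A) ∈ N := N.smul_mem (antipode ℂ z) n.2
      rw [avgForm_tmul, hq _ this]
      simp [mul_assoc]
  rw [this, mul_antipode_lTensor_comul_apply, ht1, map_one, one_mul]

end Maschke

/-- A quasitriangular structure `R = ∑ sₐ ⊗ tₐ` on a Hopf algebra. -/
structure QT (A : Type*) [Ring A] [HopfAlgebra ℂ A] where
  /-- index type -/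
  κ : Type
  /-- finiteness of the index type -/
  fin : Fintype κ
  /-- left legs -/
  s : κ → A
  /-- right legs -/
  t : κ → A
  comm : ∀ x : A, (∑ a, s a ⊗ₜ[ℂ] t a) * comul (R := ℂ) x =
    Algebra.TensorProduct.comm ℂ A A (comul (R := ℂ) x) * ∑ a, s a ⊗ₜ[ℂ] t a
  comul_left : ∑ a, comul (R := ℂ) (s a) ⊗ₜ[ℂ] t a = ∑ a, ∑ b, (s a ⊗ₜ[ℂ] s b) ⊗ₜ[ℂ] (t a * t b)
  comul_right : ∑ a, s a ⊗ₜ[ℂ] comul (R := ℂ) (t a) =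
    ∑ a, ∑ b, (s a * s b) ⊗ₜ[ℂ] (t b ⊗ₜ[ℂ] t a)
  counit_left : ∑ a, counit (R := ℂ) (s a) • t a = 1
  counit_right : ∑ a, counit (R := ℂ) (t a) • s a = 1

attribute [instance] QT.fin

namespace Double

variable {H : Type*} [Ring H] [HopfAlgebra ℂ H] [FiniteDimensional ℂ H] [IsSemisimpleRing H]

lemma conv_cointg_right (f : H →ₗ[ℂ] ℂ) : conv f (cointg H) = f 1 • cointg H := by
  ext x; rw [← apply_lact, lact_cointg]; simp [mul_comm]

lemma incl_mul_dincl_cointg (x : H) :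
    incl H x * dincl H (cointg H) * incl H (intg H) =
      counit (R := ℂ) x • (dincl H (cointg H) * incl H (intg H)) := by
  refine cm_ext_apply (f := LinearMap.mulRight ℂ (incl H (intg H)) ∘ₗ
    LinearMap.mulRight ℂ (dincl H (cointg H)) ∘ₗ (incl H).toLinearMap)
    (g := (counit (R := ℂ)).smulRight (dincl H (cointg H) * incl H (intg H))) (fun i j => ?_) x
  simp only [LinearMap.comp_apply, LinearMap.mulRight_apply, AlgHom.toLinearMap_apply,
    isExchange.straighten, Finset.sum_mul, mul_assoc, ← map_mul, mul_intg, map_smul, counit_cm]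
  have h1 : ∀ k l, (cointg H) ∘ₗ LinearMap.mulLeft ℂ (antipode ℂ (cm l j)) ∘ₗ
      LinearMap.mulRight ℂ (cm i k) =
      cointg H ∘ₗ LinearMap.mulRight ℂ (cm i k * antipode ℂ (cm l j)) := by
    intro k l; ext z
    simp only [LinearMap.comp_apply, LinearMap.mulLeft_apply, LinearMap.mulRight_apply]
    rw [cointg_comm, mul_assoc]
  simp only [h1, ite_smul, one_smul, zero_smul, mul_ite, mul_zero, Finset.sum_ite_eq,
    Finset.mem_univ, if_true, ← Finset.sum_mul, ← map_sum]
  have h2 : ∑ k, cointg H ∘ₗ LinearMap.mulRight ℂ (cm i k * antipode ℂ (cm k j)) =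
      if i = j then cointg H else 0 := by
    ext z
    simp only [LinearMap.sum_apply, LinearMap.comp_apply, LinearMap.mulRight_apply]
    rw [← map_sum, ← Finset.mul_sum, sum_cm_mul_antipode]
    split_ifs <;> simp
  rw [h2]
  simp only [LinearMap.smulRight_apply, counit_cm]
  split_ifs <;> simp

instance : IsSemisimpleRing (Double H) := by
  have hn : cointg H (1 : H) ≠ 0 := cointg_one_ne_zero
  refine isSemisimpleRing_of_integral
    (t := (cointg H 1)⁻¹ • (dincl H (cointg H) * incl H (intg H))) (fun d => ?_) ?_
  · induction d using Double.induction with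
    | h0 => simp
    | hadd a b ha hb => rw [add_mul, ha, hb, map_add, add_smul]
    | hmul f x =>
      rw [mul_smul_comm, mul_assoc, ← mul_assoc (incl H x), incl_mul_dincl_cointg, mul_smul_comm,
        ← mul_assoc, ← isExchange.map_conv, conv_cointg_right, map_smul, smul_mul_assoc,
        counit_eq, map_mul, counitHom_dincl, counitHom_incl]
      module
  · rw [map_smul, counit_eq, map_mul, counitHom_dincl, counitHom_incl, counit_intg, mul_one,
      smul_eq_mul, inv_mul_cancel₀ hn]

lemma canon_swap {X : Type*} [AddCommGroup X] [Module ℂ X] (B : (H →ₗ[ℂ] ℂ) →ₗ[ℂ] X)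
    (f : H →ₗ[ℂ] ℂ) : ∑ c, B ((Module.finBasis ℂ H).coord c) ⊗ₜ[ℂ]
      B (f ∘ₗ LinearMap.mulLeft ℂ (Module.finBasis ℂ H c)) = canon (B ∘ₗ precR f) B := by
  set b := Module.finBasis ℂ H
  have h1 : ∀ c, B (f ∘ₗ LinearMap.mulLeft ℂ (b c)) = ∑ a, f (b c * b a) • B (b.coord a) := by
    intro c
    conv_lhs => rw [← sum_coord_smul (f ∘ₗ LinearMap.mulLeft ℂ (b c)), map_sum]
    simp [b]
  have h2 : ∀ a, B (f ∘ₗ LinearMap.mulRight ℂ (b a)) = ∑ c, f (b c * b a) • B (b.coord c) := by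
    intro a
    conv_lhs => rw [← sum_coord_smul (f ∘ₗ LinearMap.mulRight ℂ (b a)), map_sum]
    simp [b]
  simp only [canon, LinearMap.comp_apply, precR_apply]
  change ∑ c, B (b.coord c) ⊗ₜ[ℂ] B (f ∘ₗ LinearMap.mulLeft ℂ (b c)) =
    ∑ a, B (f ∘ₗ LinearMap.mulRight ℂ (b a)) ⊗ₜ[ℂ] B (b.coord a)
  simp_rw [h1, h2, tmul_sum, sum_tmul, smul_tmul]
  rw [Finset.sum_comm]

lemma rmat_comm_incl (i j : Ix H) :
    canon (incl H).toLinearMap (dincl H) * comul (R := ℂ) (incl H (cm i j)) =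
      Algebra.TensorProduct.comm ℂ (Double H) (Double H) (comul (R := ℂ) (incl H (cm i j))) *
        canon (incl H).toLinearMap (dincl H) := by
  set b := Module.finBasis ℂ H with hb
  have h1 : ∀ k, canon (incl H).toLinearMap (dincl H) * (incl H (cm i k) ⊗ₜ[ℂ] incl H (cm k j)) =
      ∑ a, incl H (b a) ⊗ₜ[ℂ] (dincl H (b.coord a ∘ₗ LinearMap.mulRight ℂ (cm i k)) *
        incl H (cm k j)) := by
    intro k
    have := canon_move (incl H).toLinearMap (LinearMap.mulRight ℂ (incl H (cm k j)) ∘ₗ dincl H)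
      (LinearMap.mulRight ℂ (cm i k))
    simp only [LinearMap.comp_apply, LinearMap.mulRight_apply, AlgHom.toLinearMap_apply] at this
    rw [← this]
    simp [canon, Finset.sum_mul]
  have h2 : ∀ k, (incl H (cm k j) ⊗ₜ[ℂ] incl H (cm i k)) * canon (incl H).toLinearMap (dincl H) =
      ∑ a, incl H (b a) ⊗ₜ[ℂ] (incl H (cm i k) *
        dincl H (b.coord a ∘ₗ LinearMap.mulLeft ℂ (cm k j))) := by
    intro k
    have := canon_move (incl H).toLinearMap (LinearMap.mulLeft ℂ (incl H (cm i k)) ∘ₗ dincl H)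
      (LinearMap.mulLeft ℂ (cm k j))
    simp only [LinearMap.comp_apply, LinearMap.mulLeft_apply, AlgHom.toLinearMap_apply] at this
    rw [← this]
    simp [canon, Finset.mul_sum]
  simp only [comul_eq, comulHom_incl_cm, map_sum, Algebra.TensorProduct.comm_tmul, Finset.mul_sum,
    Finset.sum_mul, h1, h2]
  rw [Finset.sum_comm]
  conv_rhs => rw [Finset.sum_comm]
  simp_rw [← tmul_sum, isExchange.exchange]

lemma rmat_comm_dincl (f : H →ₗ[ℂ] ℂ) :
    canon (incl H).toLinearMap (dincl H) * comul (R := ℂ) (dincl H f) =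
      Algebra.TensorProduct.comm ℂ (Double H) (Double H) (comul (R := ℂ) (dincl H f)) *
        canon (incl H).toLinearMap (dincl H) := by
  simp only [comul_eq, comulHom_dincl, map_sum, Algebra.TensorProduct.comm_tmul]
  rw [canon_swap, canon_mul _ _ _ isExchange.map_conv]
  change canon _ _ * canon (dincl H ∘ₗ precL f) (dincl H) = _
  rw [canon_mul _ _ _ isExchange.map_conv]
  congr 1
  refine cm_ext fun i j => ?_
  simpa using isExchange.exchange f i j

variable (H) in
/-- The canonical quasitriangular structure of the double. -/
def qt : QT (Double H) where
  κ := Ix H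
  fin := inferInstance
  s a := incl H (Module.finBasis ℂ H a)
  t a := dincl H ((Module.finBasis ℂ H).coord a)
  comm d := by
    change canon (incl H).toLinearMap (dincl H) * _ = _ * canon (incl H).toLinearMap (dincl H)
    induction d using Double.induction with
    | h0 => simp
    | hadd a b ha hb => rw [map_add, mul_add, ha, hb, map_add, add_mul]
    | hmul f x =>
      have hx : canon (incl H).toLinearMap (dincl H) * comul (R := ℂ) (incl H x) =
          Algebra.TensorProduct.comm ℂ (Double H) (Double H) (comul (R := ℂ) (incl H x)) *
            canon (incl H).toLinearMap (dincl H) :=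
        cm_ext_apply (f := LinearMap.mulLeft ℂ (canon (incl H).toLinearMap (dincl H)) ∘ₗ comul ∘ₗ
          (incl H).toLinearMap)
          (g := LinearMap.mulRight ℂ (canon (incl H).toLinearMap (dincl H)) ∘ₗ
            (Algebra.TensorProduct.comm ℂ (Double H) (Double H)).toLinearMap ∘ₗ comul ∘ₗ
              (incl H).toLinearMap) rmat_comm_incl x
      rw [Bialgebra.comul_mul, ← mul_assoc, rmat_comm_dincl, mul_assoc, hx, ← mul_assoc, map_mul]
  comul_left := by
    let A1 : H →ₗ[ℂ] Double H ⊗[ℂ] Double H :=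
      (TensorProduct.mk ℂ (Double H) (Double H)).flip 1 ∘ₗ (incl H).toLinearMap
    let A2 : H →ₗ[ℂ] Double H ⊗[ℂ] Double H :=
      TensorProduct.mk ℂ (Double H) (Double H) 1 ∘ₗ (incl H).toLinearMap
    have h := canon_mul A1 A2 (dincl H) isExchange.map_conv
    have h2 : convMap A1 A2 = comul (R := ℂ) ∘ₗ (incl H).toLinearMap := by
      refine cm_ext fun i j => ?_
      simp only [convMap_cm, A1, A2, LinearMap.comp_apply, LinearMap.flip_apply,
        TensorProduct.mk_apply, AlgHom.toLinearMap_apply, Algebra.TensorProduct.tmul_mul_tmul,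
        one_mul, mul_one, comul_eq, comulHom_incl_cm]
    rw [h2] at h
    refine h.symm.trans ?_
    simp [canon, A1, A2, Finset.sum_mul_sum]
  comul_right := by
    simp only [comul_eq, comulHom_dincl, tmul_sum]
    rw [Finset.sum_comm]
    refine Finset.sum_congr rfl fun c _ => ?_
    have := canon_move (incl H).toLinearMap
      ((TensorProduct.mk ℂ (Double H) (Double H)).flip
          (dincl H ((Module.finBasis ℂ H).coord c)) ∘ₗ dincl H)
      (LinearMap.mulLeft ℂ (Module.finBasis ℂ H c))
    simp only [LinearMap.comp_apply, LinearMap.flip_apply, TensorProduct.mk_apply,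
      AlgHom.toLinearMap_apply] at this
    rw [← this]
    simp [canon]
  counit_left := by
    simp only [counit_eq, counitHom_incl, ← map_smul, ← map_sum, sum_coord_smul,
      isExchange.map_counit]
  counit_right := by
    simp only [counit_eq, counitHom_dincl, ← map_smul, ← map_sum, sum_basis_smul, map_one]

end Double

end FinHopf

namespace FinHopf

lemma conv_eq_map {A : Type*} [Ring A] [HopfAlgebra ℂ A] (f g : A →ₗ[ℂ] ℂ) (x : A) :
    conv f g x = LinearMap.mul' ℂ ℂ (TensorProduct.map f g (comul (R := ℂ) x)) := rfl

/-- `f ⊗ g` as a functional on the tensor square. -/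
def tform {A : Type*} [Ring A] [Algebra ℂ A] (f g : A →ₗ[ℂ] ℂ) : A ⊗[ℂ] A →ₗ[ℂ] ℂ :=
  LinearMap.mul' ℂ ℂ ∘ₗ TensorProduct.map f g

section tform

variable {A : Type*} [Ring A] [Algebra ℂ A]

@[simp] lemma tform_tmul (f g : A →ₗ[ℂ] ℂ) (x y : A) : tform f g (x ⊗ₜ y) = f x * g y := by
  simp [tform]

lemma tform_comm_arg (f g : A →ₗ[ℂ] ℂ) (u : A ⊗[ℂ] A) :
    tform f g (Algebra.TensorProduct.comm ℂ A A u) = tform g f u := by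
  induction u with
  | zero => simp
  | add x y hx hy => simp only [map_add, hx, hy]
  | tmul x y => simp [mul_comm]

lemma tform_mul_comm {f g : A →ₗ[ℂ] ℂ} (hf : ∀ x y, f (x * y) = f (y * x))
    (hg : ∀ x y, g (x * y) = g (y * x)) (u v : A ⊗[ℂ] A) :
    tform f g (u * v) = tform f g (v * u) := by
  induction u with
  | zero => simp
  | add x y hx hy => simp only [add_mul, mul_add, map_add, hx, hy]
  | tmul x y =>
    induction v with
    | zero => simp
    | add x y hx hy => simp only [add_mul, mul_add, map_add, hx, hy]
    | tmul x' y' => simp [hf x, hg y]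

end tform

namespace QT

variable {A : Type*} [Ring A] [HopfAlgebra ℂ A] (R : QT A)

/-- The universal `R`-matrix. -/
def rmat : A ⊗[ℂ] A := ∑ a, R.s a ⊗ₜ[ℂ] R.t a

/-- The flipped `R`-matrix. -/
def rmat' : A ⊗[ℂ] A := ∑ a, R.t a ⊗ₜ[ℂ] R.s a

/-- The monodromy element `R₂₁ R`. -/
def mono : A ⊗[ℂ] A := R.rmat' * R.rmat

lemma comm_rmat : Algebra.TensorProduct.comm ℂ A A R.rmat = R.rmat' := by simp [rmat, rmat']
lemma comm_rmat' : Algebra.TensorProduct.comm ℂ A A R.rmat' = R.rmat := by simp [rmat, rmat']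

lemma comm_comm (u : A ⊗[ℂ] A) :
    Algebra.TensorProduct.comm ℂ A A (Algebra.TensorProduct.comm ℂ A A u) = u := by
  induction u with
  | zero => simp
  | add x y hx hy => simp only [map_add, hx, hy]
  | tmul x y => simp

lemma rmat_mul_comul (x : A) : R.rmat * comul (R := ℂ) x =
    Algebra.TensorProduct.comm ℂ A A (comul (R := ℂ) x) * R.rmat := R.comm x

lemma rmat'_mul_comm_comul (x : A) :
    R.rmat' * Algebra.TensorProduct.comm ℂ A A (comul (R := ℂ) x) = comul (R := ℂ) x * R.rmat' := by
  have := congrArg (Algebra.TensorProduct.comm ℂ A A) (R.rmat_mul_comul x)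
  rwa [map_mul, map_mul, comm_rmat, comm_comm] at this

lemma mono_mul_comul (x : A) : R.mono * comul (R := ℂ) x = comul (R := ℂ) x * R.mono := by
  rw [mono, mul_assoc, rmat_mul_comul, ← mul_assoc, rmat'_mul_comm_comul, mul_assoc]

lemma mono_eq : R.mono = ∑ a, ∑ b, (R.t a * R.s b) ⊗ₜ[ℂ] (R.s a * R.t b) := by
  simp [mono, rmat, rmat', Finset.sum_mul_sum]

/-- `Φ(f) = (f ⊗ 1)(R₂₁ R)`. -/
def drin (f : A →ₗ[ℂ] ℂ) : A := evL f R.mono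

lemma drin_eq (f : A →ₗ[ℂ] ℂ) :
    R.drin f = ∑ a, ∑ b, f (R.t a * R.s b) • (R.s a * R.t b) := by
  simp [drin, mono_eq, evL]

lemma apply_drin (f g : A →ₗ[ℂ] ℂ) : g (R.drin f) = tform f g R.mono := by
  simp [drin_eq, mono_eq]

lemma tform_mono_comm {f g : A →ₗ[ℂ] ℂ} (hf : ∀ x y, f (x * y) = f (y * x))
    (hg : ∀ x y, g (x * y) = g (y * x)) : tform f g R.mono = tform g f R.mono := by
  rw [← tform_comm_arg f g, mono, map_mul (Algebra.TensorProduct.comm ℂ A A), comm_rmat, comm_rmat',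
    tform_mul_comm hf hg]

lemma drin_conv_of_central (f g : A →ₗ[ℂ] ℂ) (hf : ∀ x, x * R.drin f = R.drin f * x) :
    R.drin (conv f g) = R.drin f * R.drin g := by
  have h1 : ∀ b, ∑ a, conv f g (R.t a * R.s b) • (R.s a * R.t b) =
      ∑ a, ∑ c, tform f g ((R.t c ⊗ₜ R.t a) * comul (R := ℂ) (R.s b)) •
        (R.s a * R.s c * R.t b) := by
    intro b
    have := congrArg (LinearMap.mul' ℂ A ∘ₗ TensorProduct.map LinearMap.id
      ((tform f g ∘ₗ LinearMap.mulRight ℂ (comul (R := ℂ) (R.s b))).smulRight (R.t b)))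
      R.comul_right
    simp only [map_sum, LinearMap.comp_apply, TensorProduct.map_tmul, LinearMap.id_apply,
      LinearMap.smulRight_apply, LinearMap.mulRight_apply, LinearMap.mul'_apply,
      mul_smul_comm, ← Bialgebra.comul_mul] at this
    exact this
  have h2 : ∀ a c, ∑ b, tform f g ((R.t c ⊗ₜ R.t a) * comul (R := ℂ) (R.s b)) •
      (R.s a * R.s c * R.t b) = ∑ b, ∑ d, (f (R.t c * R.s b) * g (R.t a * R.s d)) •
        (R.s a * R.s c * (R.t b * R.t d)) := by
    intro a c
    have := congrArg (TensorProduct.lift (((LinearMap.lsmul ℂ A).comp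
      (tform f g ∘ₗ LinearMap.mulLeft ℂ (R.t c ⊗ₜ R.t a))).compr₂
        (LinearMap.mulLeft ℂ (R.s a * R.s c)))) R.comul_left
    simpa [mul_assoc] using this
  rw [drin_eq, Finset.sum_comm]
  simp_rw [h1]
  rw [Finset.sum_comm]
  simp_rw [Finset.sum_comm (s := (Finset.univ : Finset R.κ))
    (f := fun b c => tform f g ((R.t c ⊗ₜ _) * comul (R := ℂ) (R.s b)) • _)]
  simp_rw [h2]
  have h3 : ∀ a d, ∑ c, ∑ b, (f (R.t c * R.s b) * g (R.t a * R.s d)) •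
      (R.s a * R.s c * (R.t b * R.t d)) = g (R.t a * R.s d) • (R.drin f * (R.s a * R.t d)) := by
    intro a d
    rw [← mul_assoc (R.drin f), ← hf, drin_eq]
    simp only [Finset.mul_sum, Finset.sum_mul, Finset.smul_sum, mul_smul_comm, smul_mul_assoc,
      smul_smul, mul_assoc, mul_comm (g _)]
  rw [R.drin_eq g]
  simp_rw [Finset.mul_sum, mul_smul_comm, ← h3]
  refine Finset.sum_congr rfl fun a _ => ?_
  rw [Finset.sum_comm]
  conv_rhs => rw [Finset.sum_comm]
  rw [Finset.sum_comm]
  refine Finset.sum_congr rfl fun c _ => ?_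
  rw [Finset.sum_comm]

lemma sum_antipode_tmul_mul_rmat : (∑ a, antipode ℂ (R.s a) ⊗ₜ[ℂ] R.t a) * R.rmat = 1 := by
  have := congrArg (TensorProduct.map (LinearMap.mul' ℂ A ∘ₗ (antipode ℂ).rTensor A)
    (LinearMap.id : A →ₗ[ℂ] A)) R.comul_left
  simp only [map_sum, TensorProduct.map_tmul, LinearMap.comp_apply,
    mul_antipode_rTensor_comul_apply, LinearMap.id_apply, LinearMap.rTensor_tmul,
    LinearMap.mul'_apply] at this
  simp only [rmat, Finset.sum_mul_sum, Algebra.TensorProduct.tmul_mul_tmul]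
  rw [← this]
  simp only [Algebra.algebraMap_eq_smul_one, smul_tmul, ← tmul_sum, R.counit_left]
  rfl

variable [FiniteDimensional ℂ A] [IsSemisimpleRing A]

lemma mul'_antipode_swap (x : A) : LinearMap.mul' ℂ A ((antipode ℂ).lTensor A
    (Algebra.TensorProduct.comm ℂ A A (comul (R := ℂ) x))) = counit (R := ℂ) x • 1 := by
  refine cm_ext_apply (f := LinearMap.mul' ℂ A ∘ₗ (antipode ℂ).lTensor A ∘ₗ
    (Algebra.TensorProduct.comm ℂ A A).toLinearMap ∘ₗ comul)
    (g := (counit (R := ℂ)).smulRight (1 : A)) (fun i j => ?_) x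
  simp [comul_cm, counit_cm, sum_cm_mul_antipode', ite_smul]

lemma rmat_mul_sum_tmul_antipode : R.rmat * (∑ a, R.s a ⊗ₜ[ℂ] antipode ℂ (R.t a)) = 1 := by
  have := congrArg (TensorProduct.map (LinearMap.id : A →ₗ[ℂ] A)
    (LinearMap.mul' ℂ A ∘ₗ (antipode ℂ).lTensor A ∘ₗ
      (Algebra.TensorProduct.comm ℂ A A).toLinearMap)) R.comul_right
  simp only [map_sum, TensorProduct.map_tmul, LinearMap.comp_apply, AlgEquiv.toLinearMap_apply,
    mul'_antipode_swap, LinearMap.id_apply, LinearMap.lTensor_tmul,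
    LinearMap.mul'_apply, Algebra.TensorProduct.comm_tmul] at this
  simp only [rmat, Finset.sum_mul_sum, Algebra.TensorProduct.tmul_mul_tmul]
  rw [← this]
  simp only [tmul_smul, smul_tmul', ← sum_tmul, R.counit_right]
  rfl

lemma sum_antipode_tmul_eq : ∑ a, antipode ℂ (R.s a) ⊗ₜ[ℂ] R.t a =
    ∑ a, R.s a ⊗ₜ[ℂ] antipode ℂ (R.t a) :=
  left_inv_eq_right_inv R.sum_antipode_tmul_mul_rmat R.rmat_mul_sum_tmul_antipode

lemma sum_antipode_tmul_antipode : ∑ a, antipode ℂ (R.s a) ⊗ₜ[ℂ] antipode ℂ (R.t a) =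
    ∑ a, R.s a ⊗ₜ[ℂ] R.t a := by
  have := congrArg (TensorProduct.map (antipode ℂ) (LinearMap.id : A →ₗ[ℂ] A)) R.sum_antipode_tmul_eq
  simpa [antipode_antipode] using this.symm

/-- The inverse of the `R`-matrix. -/
def rinv : A ⊗[ℂ] A := ∑ a, R.s a ⊗ₜ[ℂ] antipode ℂ (R.t a)

lemma rmat_mul_rinv : R.rmat * R.rinv = 1 := R.rmat_mul_sum_tmul_antipode

lemma rinv_mul_rmat : R.rinv * R.rmat = 1 := by
  rw [rinv, ← sum_antipode_tmul_eq]; exact R.sum_antipode_tmul_mul_rmat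

lemma comul_mul_rinv (x : A) : comul (R := ℂ) x * R.rinv =
    R.rinv * Algebra.TensorProduct.comm ℂ A A (comul (R := ℂ) x) := by
  have h := congrArg (fun z => R.rinv * z * R.rinv) (R.rmat_mul_comul x)
  simp only [← mul_assoc, rinv_mul_rmat, one_mul] at h
  rw [h, mul_assoc _ R.rmat, rmat_mul_rinv, mul_one]

lemma drin_central {f : A →ₗ[ℂ] ℂ} (hf : ∀ x y, f (x * y) = f (y * x)) (x : A) :
    x * R.drin f = R.drin f * x := by
  have h0 : ∀ (u : A ⊗[ℂ] A) (y : A), y * evL f u = evL f ((1 ⊗ₜ y) * u) := by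
    intro u y
    induction u with
    | zero => simp
    | add x y hx hy => simp only [mul_add, map_add, hx, hy]
    | tmul a b => simp
  have h0' : ∀ (u : A ⊗[ℂ] A) (y : A), evL f u * y = evL f (u * (1 ⊗ₜ y)) := by
    intro u y
    induction u with
    | zero => simp
    | add x y hx hy => simp only [add_mul, map_add, hx, hy]
    | tmul a b => simp
  have h1 : ∀ (u : A ⊗[ℂ] A) (y : A), evL f ((y ⊗ₜ 1) * u) = evL f (u * (y ⊗ₜ 1)) := by
    intro u y
    induction u with
    | zero => simp
    | add x y hx hy => simp only [mul_add, add_mul, map_add, hx, hy]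
    | tmul a b => simp [hf a]
  refine cm_ext_apply (f := LinearMap.mulRight ℂ (R.drin f)) (g := LinearMap.mulLeft ℂ (R.drin f))
    (fun i j => ?_) x
  simp only [LinearMap.mulRight_apply, LinearMap.mulLeft_apply, drin]
  rw [h0, h0']
  have e1 : (1 : A) ⊗ₜ[ℂ] (cm i j : A) =
      ∑ k, (antipode ℂ (cm i k) ⊗ₜ[ℂ] 1) * comul (R := ℂ) (cm k j) := by
    simp only [comul_cm, Finset.mul_sum, Algebra.TensorProduct.tmul_mul_tmul, one_mul]
    rw [Finset.sum_comm]
    simp_rw [← sum_tmul, sum_antipode_cm_mul, ite_tmul]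
    simp
  have e2 : (1 : A) ⊗ₜ[ℂ] (cm i j : A) =
      ∑ k, comul (R := ℂ) (cm k j) * (antipode ℂ (cm i k) ⊗ₜ[ℂ] 1) := by
    simp only [comul_cm, Finset.sum_mul, Algebra.TensorProduct.tmul_mul_tmul, mul_one]
    rw [Finset.sum_comm]
    simp_rw [← sum_tmul, sum_cm_mul_antipode', ite_tmul]
    simp
  rw [e1, Finset.sum_mul, map_sum]
  conv_rhs => rw [← e1, e2, Finset.mul_sum, map_sum]
  refine Finset.sum_congr rfl fun k _ => ?_
  rw [mul_assoc, h1, ← mono_mul_comul, mul_assoc]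

lemma drin_conv {f : A →ₗ[ℂ] ℂ} (hf : ∀ x y, f (x * y) = f (y * x)) (g : A →ₗ[ℂ] ℂ) :
    R.drin (conv f g) = R.drin f * R.drin g :=
  R.drin_conv_of_central f g (R.drin_central hf)

include R in
lemma conv_comm_of_trace {f g : A →ₗ[ℂ] ℂ} (hf : ∀ x y, f (x * y) = f (y * x))
    (hg : ∀ x y, g (x * y) = g (y * x)) : conv f g = conv g f := by
  ext x
  change tform f g (comul (R := ℂ) x) = tform g f (comul (R := ℂ) x)
  rw [← tform_comm_arg f g]
  have : Algebra.TensorProduct.comm ℂ A A (comul (R := ℂ) x) =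
      R.rmat * (comul (R := ℂ) x * R.rinv) := by
    rw [comul_mul_rinv, ← mul_assoc, rmat_mul_rinv, one_mul]
  rw [this, tform_mul_comm hf hg, mul_assoc, rinv_mul_rmat, mul_one]

/-- The twist element `∑ sₐ tₐ`. -/
def twist : A := ∑ a, R.s a * R.t a

lemma twist_central (x : A) : x * R.twist = R.twist * x := by
  have h1 : ∀ i j : Ix A, ∑ k, cm i k * R.twist * antipode ℂ (cm k j) =
      if i = j then R.twist else 0 := by
    intro i j
    have h := congrArg (LinearMap.mul' ℂ A ∘ₗ (antipode ℂ).lTensor A) (R.comul_mul_rinv (cm i j))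
    simp only [comul_cm, rinv, map_sum, Algebra.TensorProduct.comm_tmul, Finset.sum_mul_sum,
      Algebra.TensorProduct.tmul_mul_tmul, LinearMap.comp_apply, LinearMap.lTensor_tmul,
      LinearMap.mul'_apply, antipode_mul_antidistrib, antipode_antipode] at h
    rw [Finset.sum_comm] at h
    conv_rhs at h => rw [Finset.sum_comm]
    have e : ∀ a, ∑ k, R.s a * cm k j * (antipode ℂ (cm i k) * R.t a) =
        if i = j then R.s a * R.t a else 0 := by
      intro a
      calc _ = R.s a * (∑ k, cm k j * antipode ℂ (cm i k)) * R.t a := by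
            simp only [Finset.mul_sum, Finset.sum_mul, mul_assoc]
        _ = _ := by rw [sum_cm_mul_antipode']; split_ifs <;> simp
    rw [Finset.sum_comm] at h
    simp only [twist, Finset.mul_sum, Finset.sum_mul]
    have h2 := h
    conv_rhs at h2 => rw [Finset.sum_comm]
    simp_rw [e] at h2
    simp only [mul_assoc] at h2 ⊢
    rw [Finset.sum_comm] at h2
    rw [Finset.sum_comm, h2]
    split_ifs <;> simp
  refine cm_ext_apply (f := LinearMap.mulRight ℂ R.twist) (g := LinearMap.mulLeft ℂ R.twist)
    (fun i j => ?_) x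
  simp only [LinearMap.mulRight_apply, LinearMap.mulLeft_apply]
  calc cm i j * R.twist = ∑ k, cm i k * R.twist * ∑ l, antipode ℂ (cm k l) * cm l j := by
        simp [sum_antipode_cm_mul]
    _ = ∑ l, (∑ k, cm i k * R.twist * antipode ℂ (cm k l)) * cm l j := by
        simp only [Finset.mul_sum, Finset.sum_mul, mul_assoc]
        rw [Finset.sum_comm]
    _ = R.twist * cm i j := by simp [h1]

lemma antipode_twist' : antipode ℂ R.twist = ∑ a, R.t a * R.s a := by
  have := congrArg (LinearMap.mul' ℂ A ∘ₗ (Algebra.TensorProduct.comm ℂ A A).toLinearMap)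
    R.sum_antipode_tmul_antipode
  simp only [map_sum, LinearMap.comp_apply, AlgEquiv.toLinearMap_apply,
    Algebra.TensorProduct.comm_tmul, LinearMap.mul'_apply] at this
  rw [twist, map_sum, ← this]
  simp [antipode_mul_antidistrib]

lemma antipode_twist : antipode ℂ R.twist = R.twist := by
  refine eq_of_central_of_chi (fun z => ?_) R.twist_central fun i => ?_
  · apply antipode_injective
    rw [antipode_mul_antidistrib, antipode_mul_antidistrib, antipode_antipode, twist_central]
  · rw [antipode_twist', twist, map_sum, map_sum]
    exact Finset.sum_congr rfl fun a _ => chi_mul_comm i _ _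

lemma sum_mul_rev : ∑ a, R.t a * R.s a = R.twist := by rw [← antipode_twist', antipode_twist]

lemma sum_tmul_one_mul_comul :
    ∑ a, (R.s a ⊗ₜ[ℂ] (1 : A)) * comul (R := ℂ) (R.t a) = (R.twist ⊗ₜ 1) * R.rmat := by
  have := congrArg (TensorProduct.lift ((LinearMap.mul ℂ (A ⊗[ℂ] A)) ∘ₗ
    (TensorProduct.mk ℂ A A).flip 1)) R.comul_right
  simp only [map_sum, TensorProduct.lift.tmul, LinearMap.comp_apply, LinearMap.flip_apply,
    TensorProduct.mk_apply, LinearMap.mul_apply', Algebra.TensorProduct.tmul_mul_tmul,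
    one_mul] at this
  rw [this]
  simp only [rmat, Finset.mul_sum, Algebra.TensorProduct.tmul_mul_tmul, one_mul]
  refine Finset.sum_congr rfl fun a _ => ?_
  rw [← twist_central, twist, Finset.mul_sum, sum_tmul]
  simp only [mul_assoc]

lemma sum_one_tmul_mul_comul :
    ∑ a, ((1 : A) ⊗ₜ[ℂ] R.s a) * Algebra.TensorProduct.comm ℂ A A (comul (R := ℂ) (R.t a)) =
      (1 ⊗ₜ R.twist) * R.rmat' := by
  have := congrArg (Algebra.TensorProduct.comm ℂ A A) R.sum_tmul_one_mul_comul
  simpa [comm_rmat] using this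

lemma comul_twist : comul (R := ℂ) R.twist = (R.twist ⊗ₜ R.twist) * R.mono := by
  have h1 : comul (R := ℂ) R.twist =
      ∑ a, ∑ b, (R.s a ⊗ₜ[ℂ] R.s b) * (comul (R := ℂ) (R.t a) * comul (R := ℂ) (R.t b)) := by
    have := congrArg (TensorProduct.lift ((LinearMap.mul ℂ (A ⊗[ℂ] A)).compl₂ comul)) R.comul_left
    simp only [map_sum, TensorProduct.lift.tmul, LinearMap.compl₂_apply, LinearMap.mul_apply',
      Bialgebra.comul_mul] at this
    rw [← this, twist, map_sum]
    simp only [Bialgebra.comul_mul]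
  have h2 : ∀ a b, (R.s a ⊗ₜ[ℂ] R.s b) * (comul (R := ℂ) (R.t a) * comul (R := ℂ) (R.t b)) =
      (1 ⊗ₜ R.s b) * ((R.s a ⊗ₜ 1) * comul (R := ℂ) (R.t a)) * comul (R := ℂ) (R.t b) := by
    intro a b
    simp only [← mul_assoc, Algebra.TensorProduct.tmul_mul_tmul, one_mul, mul_one]
  rw [h1, Finset.sum_comm]
  simp_rw [h2, ← Finset.sum_mul, ← Finset.mul_sum, sum_tmul_one_mul_comul]
  have h3 : ∀ b, (1 ⊗ₜ R.s b) * ((R.twist ⊗ₜ 1) * R.rmat) * comul (R := ℂ) (R.t b) =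
      (R.twist ⊗ₜ 1) * ((1 ⊗ₜ R.s b) *
        Algebra.TensorProduct.comm ℂ A A (comul (R := ℂ) (R.t b))) * R.rmat := by
    intro b
    rw [mul_assoc, mul_assoc, rmat_mul_comul]
    simp only [← mul_assoc, Algebra.TensorProduct.tmul_mul_tmul, one_mul, mul_one]
  simp_rw [h3, ← Finset.sum_mul, ← Finset.mul_sum, sum_one_tmul_mul_comul, mono, ← mul_assoc]
  simp

end QT

end FinHopf

namespace FinHopf

open scoped Matrix

lemma exists_nat_trace_of_idem {V : Type*} [AddCommGroup V] [Module ℂ V] [FiniteDimensional ℂ V]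
    {T : V →ₗ[ℂ] V} (hT : T * T = T) :
    ∃ k : ℕ, LinearMap.trace ℂ V T = k ∧ (k = 0 → T = 0) := by
  refine ⟨_, (LinearMap.IsIdempotentElem.isProj_range T hT).trace, fun h => ?_⟩
  exact LinearMap.range_eq_bot.1 (Submodule.finrank_eq_zero.1 h)

lemma mulLeft_mulRight_idem {E : Type*} [Ring E] [Algebra ℂ E] {u v : E} (hu : u * u = u)
    (hv : v * v = v) : (LinearMap.mulLeft ℂ u ∘ₗ LinearMap.mulRight ℂ v) *
      (LinearMap.mulLeft ℂ u ∘ₗ LinearMap.mulRight ℂ v) =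
      LinearMap.mulLeft ℂ u ∘ₗ LinearMap.mulRight ℂ v := by
  ext a
  simp only [Module.End.mul_apply, LinearMap.comp_apply, LinearMap.mulLeft_apply,
    LinearMap.mulRight_apply]
  rw [mul_assoc u (a * v) v, ← mul_assoc u u, hu, mul_assoc a, hv]

section algebra

variable {A : Type*} [Ring A] [Algebra ℂ A] [FiniteDimensional ℂ A] [IsSemisimpleRing A]

lemma trace_mulLeft_mulRight (x y : A) :
    LinearMap.trace ℂ A (LinearMap.mulLeft ℂ x ∘ₗ LinearMap.mulRight ℂ y) =
      ∑ i : Irr A, chi i x * chi i y := by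
  rw [trace_eq_sum_rep]
  refine Finset.sum_congr rfl fun i _ => ?_
  simp only [LinearMap.comp_apply, LinearMap.mulLeft_apply, LinearMap.mulRight_apply, map_mul,
    rep_lift_self, chi_apply, Matrix.trace, Matrix.diag_apply, Finset.sum_mul_sum]
  refine Finset.sum_congr rfl fun a _ => Finset.sum_congr rfl fun b _ => ?_
  simp [Matrix.mul_apply, Matrix.single_apply, ite_and, Finset.sum_ite_eq, Finset.mul_sum]

lemma trace_tensor_mulLeft_mulRight (u : A ⊗[ℂ] A) (y z : A) :
    LinearMap.trace ℂ (A ⊗[ℂ] A)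
      (LinearMap.mulLeft ℂ u ∘ₗ LinearMap.mulRight ℂ (y ⊗ₜ[ℂ] z)) =
      tform (∑ i : Irr A, chi i y • chi i) (∑ i : Irr A, chi i z • chi i) u := by
  induction u with
  | zero => simp
  | add u v hu hv =>
    have : LinearMap.mulLeft ℂ (u + v) = LinearMap.mulLeft ℂ u + LinearMap.mulLeft ℂ v := by
      ext; simp [add_mul]
    rw [this, LinearMap.add_comp, map_add, map_add, hu, hv]
  | tmul a b =>
    have : LinearMap.mulLeft ℂ (a ⊗ₜ[ℂ] b) ∘ₗ LinearMap.mulRight ℂ (y ⊗ₜ[ℂ] z) =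
        TensorProduct.map (LinearMap.mulLeft ℂ a ∘ₗ LinearMap.mulRight ℂ y)
          (LinearMap.mulLeft ℂ b ∘ₗ LinearMap.mulRight ℂ z) := by
      ext c d; simp
    rw [this, LinearMap.trace_tensorProduct', trace_mulLeft_mulRight, trace_mulLeft_mulRight]
    simp [mul_comm]

lemma chi_cidem (i j : Irr A) : chi j (cidem i) = if j = i then (deg i : ℂ) else 0 := by
  rw [chi_apply, rep_cidem]; split_ifs with h
  · subst h; simp
  · simp

lemma cidem_mul_self (i : Irr A) : cidem i * cidem i = (cidem i : A) := by
  rw [cidem, lift_mul_lift, one_mul]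

lemma cidem_mul_cidem (i j : Irr A) : cidem i * cidem j = if i = j then (cidem i : A) else 0 := by
  split_ifs with h
  · rw [← h, cidem_mul_self]
  · exact lift_mul_lift_of_ne h 1 1

lemma exists_nat_tform {u : A ⊗[ℂ] A} (hu : u * u = u) (X Y : Irr A) :
    ∃ k : ℕ, tform (chi X) (chi Y) u = k := by
  have h := trace_tensor_mulLeft_mulRight u (pidem X) (pidem Y)
  simp only [chi_pidem, ite_smul, one_smul, zero_smul, Finset.sum_ite_eq', Finset.mem_univ,
    if_true] at h
  obtain ⟨k, hk, -⟩ := exists_nat_trace_of_idem (T := LinearMap.mulLeft ℂ u ∘ₗ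
    LinearMap.mulRight ℂ (pidem X ⊗ₜ[ℂ] pidem Y)) (mulLeft_mulRight_idem hu (by
      rw [Algebra.TensorProduct.tmul_mul_tmul, pidem_mul_self, pidem_mul_self]))
  exact ⟨k, h ▸ hk⟩

lemma mul_cidem_tmul_eq_zero {u : A ⊗[ℂ] A} (hu : u * u = u) {X Y : Irr A}
    (h0 : tform (chi X) (chi Y) u = 0) : u * (cidem X ⊗ₜ[ℂ] cidem Y) = 0 := by
  have h := trace_tensor_mulLeft_mulRight u (cidem X) (cidem Y)
  simp only [chi_cidem, ite_smul, zero_smul, Finset.sum_ite_eq', Finset.mem_univ,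
    if_true] at h
  have hz : tform ((deg X : ℂ) • chi X) ((deg Y : ℂ) • chi Y) u = 0 := by
    have : tform ((deg X : ℂ) • chi X) ((deg Y : ℂ) • chi Y) =
        ((deg X : ℂ) * deg Y) • tform (chi X) (chi Y) := by
      ext a b
      simp only [AlgebraTensorModule.curry_apply, TensorProduct.curry_apply,
        LinearMap.coe_restrictScalars, tform_tmul, LinearMap.smul_apply, smul_eq_mul]
      ring
    rw [this, LinearMap.smul_apply, h0, smul_zero]
  rw [hz] at h
  obtain ⟨k, hk, hk0⟩ := exists_nat_trace_of_idem (T := LinearMap.mulLeft ℂ u ∘ₗ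
    LinearMap.mulRight ℂ (cidem X ⊗ₜ[ℂ] cidem Y)) (mulLeft_mulRight_idem hu (by
      rw [Algebra.TensorProduct.tmul_mul_tmul, cidem_mul_self, cidem_mul_self]))
  have hk' : k = 0 := by rw [h] at hk; exact_mod_cast hk.symm
  have := LinearMap.congr_fun (hk0 hk') 1
  simpa using this

lemma exists_chi_eq_of_surjective {d : ℕ} [NeZero d] (ρ : A →ₐ[ℂ] Matrix (Fin d) (Fin d) ℂ)
    (hρ : Function.Surjective ρ) : ∃ i : Irr A, deg i = d ∧ ∀ x, (ρ x).trace = chi i x := by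
  have hc : ∀ i : Irr A, ρ (cidem i) = 0 ∨ ρ (cidem i) = 1 := by
    intro i
    obtain ⟨c, hc⟩ := isScalar_of_forall_commute (M := ρ (cidem i)) (fun N => by
      obtain ⟨x, rfl⟩ := hρ N
      rw [← map_mul, ← map_mul, cidem_comm])
    have h1 : ρ (cidem i) * ρ (cidem i) = ρ (cidem i) := by rw [← map_mul, cidem_mul_self]
    rw [hc, smul_mul_smul_comm, one_mul] at h1
    have h2 : c * c = c := by
      have := congrFun (congrFun h1 0) 0
      simpa using this
    rcases (IsIdempotentElem.iff_eq_zero_or_one (p := c)).1 h2 with h | h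
    · left; rw [hc, h, zero_smul]
    · right; rw [hc, h, one_smul]
  obtain ⟨i, hi⟩ : ∃ i : Irr A, ρ (cidem i) = 1 := by
    by_contra! hne
    have h1 : ρ (∑ i, cidem i) = 0 := by
      rw [map_sum]; exact Finset.sum_eq_zero fun i _ => (hc i).resolve_right (hne i)
    rw [sum_cidem, map_one] at h1
    exact one_ne_zero h1
  have hj : ∀ j, j ≠ i → ρ (cidem j) = 0 := by
    intro j hj
    rw [← mul_one (ρ (cidem j)), ← hi, ← map_mul, cidem_mul_cidem, if_neg hj, map_zero]
  have htr := trace_functional_eq (f := Matrix.traceLinearMap (Fin d) ℂ ℂ ∘ₗ ρ.toLinearMap)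
    (fun x y => by simp [Matrix.trace_mul_comm (ρ x)])
  have hp : ∀ j, j ≠ i → ρ (pidem j) = 0 := by
    intro j hji
    have : (pidem j : A) = cidem j * pidem j := by
      rw [cidem, pidem, lift_mul_lift, one_mul]
    rw [this, map_mul, hj j hji, zero_mul]
  have htr' : ∀ x, (ρ x).trace = (ρ (pidem i)).trace * chi i x := by
    intro x
    have := LinearMap.congr_fun htr x
    simp only [LinearMap.comp_apply, Matrix.traceLinearMap_apply, AlgHom.toLinearMap_apply,
      LinearMap.sum_apply, LinearMap.smul_apply, smul_eq_mul] at this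
    rw [this, Finset.sum_eq_single i]
    · intro j _ hji; rw [hp j hji]; simp
    · simp
  obtain ⟨m, hm, -⟩ := exists_nat_trace_of_idem (T := Matrix.toLin' (ρ (pidem i))) (by
    rw [Module.End.mul_eq_comp, ← Matrix.toLin'_mul, ← map_mul, pidem_mul_self])
  rw [Matrix.trace_toLin'_eq] at hm
  have hmd : m * deg i = d := by
    have := htr' 1
    rw [hm, map_one, Matrix.trace_one, chi_one] at this
    simp only [Fintype.card_fin] at this
    exact_mod_cast this.symm
  have hle : d ≤ deg i := by
    have hs : Function.Surjective (ρ.toLinearMap ∘ₗ lift i) := by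
      intro M
      obtain ⟨x, rfl⟩ := hρ M
      refine ⟨rep i x, ?_⟩
      simp only [LinearMap.comp_apply, AlgHom.toLinearMap_apply]
      rw [← cidem_mul_eq_lift, map_mul, hi, one_mul]
    have := LinearMap.finrank_le_finrank_of_surjective hs
    simp only [Module.finrank_matrix, Fintype.card_fin, Module.finrank_self, mul_one] at this
    nlinarith
  have hd := NeZero.pos d
  have hm1 : m = 1 := by
    rcases Nat.lt_or_ge m 2 with h | h
    · interval_cases m
      · omega
      · rfl
    · nlinarith
  subst hm1
  exact ⟨i, by omega, fun x => by rw [htr', hm]; simp⟩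

lemma chi_injective {X Y : Irr A} (h : chi X = chi Y) : X = Y := by
  by_contra hne
  have := LinearMap.congr_fun h (pidem X)
  rw [chi_pidem, chi_pidem, if_pos rfl, if_neg (Ne.symm hne)] at this
  exact one_ne_zero this

end algebra

variable {A : Type*} [Ring A] [HopfAlgebra ℂ A] [FiniteDimensional ℂ A] [IsSemisimpleRing A]

lemma conv_trace {f g : A →ₗ[ℂ] ℂ} (hf : ∀ x y, f (x * y) = f (y * x))
    (hg : ∀ x y, g (x * y) = g (y * x)) (x y : A) : conv f g (x * y) = conv f g (y * x) := by
  change tform f g (comul (x * y)) = tform f g (comul (y * x))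
  rw [Bialgebra.comul_mul, tform_mul_comm hf hg, Bialgebra.comul_mul]

lemma exists_fusion (X Y Z : Irr A) : ∃ k : ℕ, conv (chi X) (chi Y) (pidem Z) = k :=
  exists_nat_tform (u := comul (pidem Z)) (by rw [← Bialgebra.comul_mul, pidem_mul_self]) X Y

/-- Fusion multiplicities. -/
def fus (X Y Z : Irr A) : ℕ := (exists_fusion X Y Z).choose

lemma fus_spec (X Y Z : Irr A) : conv (chi X) (chi Y) (pidem Z) = fus X Y Z :=
  (exists_fusion X Y Z).choose_spec

lemma conv_chi (X Y : Irr A) : conv (chi X) (chi Y) = ∑ Z, (fus X Y Z : ℂ) • chi Z := by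
  rw [trace_functional_eq (conv_trace (chi_mul_comm X) (chi_mul_comm Y))]
  simp only [fus_spec]

lemma comul_cidem_mul_eq_zero {X Y Z : Irr A} (h : fus X Y Z = 0) :
    comul (R := ℂ) (cidem Z : A) * (cidem X ⊗ₜ[ℂ] cidem Y) = 0 := by
  refine mul_cidem_tmul_eq_zero (by rw [← Bialgebra.comul_mul, cidem_mul_self]) ?_
  change conv (chi X) (chi Y) (cidem Z) = 0
  simp [conv_chi, chi_cidem, h]

lemma comul_one_eq : comul (R := ℂ) (1 : A) = 1 ⊗ₜ 1 := Bialgebra.comul_one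

lemma sum_fus_mul_deg (X Y : Irr A) : ∑ Z, fus X Y Z * deg Z = deg X * deg Y := by
  have h := LinearMap.congr_fun (conv_chi X Y) 1
  have h1 : conv (chi X) (chi Y) (1 : A) = deg X * deg Y := by
    change tform (chi X) (chi Y) (comul (R := ℂ) (1 : A)) = _
    rw [comul_one_eq, tform_tmul, chi_one, chi_one]
  rw [h1] at h
  simp only [LinearMap.sum_apply, LinearMap.smul_apply, chi_one, smul_eq_mul] at h
  exact_mod_cast h.symm

variable (A) in
lemma exists_irr_one : ∃ i : Irr A, deg i = 1 ∧ ∀ x, counit (R := ℂ) x = chi i x :=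
  exists_chi_eq_of_algHom (Bialgebra.counitAlgHom ℂ A)

variable (A) in
/-- The trivial representation. -/
def irrOne : Irr A := (exists_irr_one A).choose

@[simp] lemma deg_irrOne : deg (irrOne A) = 1 := (exists_irr_one A).choose_spec.1
lemma chi_irrOne : chi (irrOne A) = counit (R := ℂ) :=
  LinearMap.ext fun x => ((exists_irr_one A).choose_spec.2 x).symm

lemma exists_dual (X : Irr A) : ∃ i : Irr A, deg i = deg X ∧
    ∀ x, chi X (antipode ℂ x) = chi i x := by
  let ρ : A →ₐ[ℂ] Matrix (Fin (deg X)) (Fin (deg X)) ℂ := AlgHom.ofLinearMap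
    ((Matrix.transposeLinearEquiv (Fin (deg X)) (Fin (deg X)) ℂ ℂ).toLinearMap ∘ₗ
      (rep X).toLinearMap ∘ₗ antipode ℂ) (by simp) (by
        intro x y
        simp [antipode_mul_antidistrib, Matrix.transpose_mul])
  have hρ : ∀ x, ρ x = (rep X (antipode ℂ x))ᵀ := fun x => rfl
  obtain ⟨i, hi, h⟩ := exists_chi_eq_of_surjective ρ (fun M => by
    obtain ⟨x, hx⟩ := rep_surjective X Mᵀ
    exact ⟨antipode ℂ x, by rw [hρ, antipode_antipode, hx, Matrix.transpose_transpose]⟩)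
  exact ⟨i, hi, fun x => by rw [← h, hρ, Matrix.trace_transpose]; rfl⟩

/-- The dual representation. -/
def dual (X : Irr A) : Irr A := (exists_dual X).choose

@[simp] lemma deg_dual (X : Irr A) : deg (dual X) = deg X := (exists_dual X).choose_spec.1
lemma chi_dual_apply (X : Irr A) (x : A) : chi (dual X) x = chi X (antipode ℂ x) :=
  ((exists_dual X).choose_spec.2 x).symm
lemma chi_dual (X : Irr A) : chi (dual X) = chi X ∘ₗ antipode ℂ :=
  LinearMap.ext fun x => chi_dual_apply X x

@[simp] lemma dual_dual (X : Irr A) : dual (dual X) = X :=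
  chi_injective (LinearMap.ext fun x => by rw [chi_dual_apply, chi_dual_apply, antipode_antipode])

lemma rep_intg_of_ne {X : Irr A} (h : X ≠ irrOne A) : rep X (intg A) = 0 := by
  have h1 : cidem X * intg A = 0 := by
    rw [mul_intg, ← chi_irrOne, chi_cidem, if_neg (Ne.symm h), zero_smul]
  have h2 := congrArg (rep X) h1
  rwa [map_mul, rep_cidem, if_pos rfl, one_mul, map_zero] at h2

lemma chi_intg (X : Irr A) : chi X (intg A) = if X = irrOne A then 1 else 0 := by
  split_ifs with h
  · rw [h, chi_irrOne, counit_intg]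
  · rw [chi_apply, rep_intg_of_ne h, Matrix.trace_zero]

lemma cointg_mul_cidem (X : Irr A) (z : A) : cointg A (z * cidem X) = deg X * chi X z := by
  have : ∀ Y : Irr A, chi Y (z * cidem X) = if Y = X then chi Y z else 0 := by
    intro Y
    rw [chi_apply, map_mul, rep_cidem]; split_ifs <;> simp [chi_apply]
  simp [cointg_eq_sum_chi, this]

lemma conv_chi_antipode_intg (X Y : Irr A) :
    conv (chi X) (chi Y ∘ₗ antipode ℂ) (intg A) = if X = Y then 1 else 0 := by
  have hd : (deg Y : ℂ) ≠ 0 := by exact_mod_cast (deg_pos Y).ne'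
  have h1 : (deg Y : ℂ) • lact (chi Y ∘ₗ antipode ℂ) (intg A) = cidem Y := by
    conv_rhs => rw [← mul_cointg_eq_self (cidem Y)]
    have : cointg A ∘ₗ LinearMap.mulRight ℂ (antipode ℂ (cidem Y)) =
        (deg Y : ℂ) • (chi Y ∘ₗ antipode ℂ) := by
      ext y
      simp only [LinearMap.comp_apply, LinearMap.mulRight_apply, LinearMap.smul_apply, smul_eq_mul]
      rw [← cointg_antipode_eq, antipode_mul_antidistrib, antipode_antipode, cointg_comm,
        cointg_mul_cidem]
    rw [this]
    exact ((lactAt (intg A)).map_smul _ _).symm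
  rw [← apply_lact]
  apply mul_left_cancel₀ hd
  rw [← smul_eq_mul, ← map_smul, h1, chi_cidem]
  split_ifs <;> simp

lemma fus_irrOne (X Y : Irr A) : fus X Y (irrOne A) = if Y = dual X then 1 else 0 := by
  have h := conv_chi_antipode_intg X (dual Y)
  rw [← chi_dual, dual_dual, conv_chi] at h
  simp only [LinearMap.sum_apply, LinearMap.smul_apply, chi_intg, smul_eq_mul, mul_ite, mul_one,
    mul_zero, Finset.sum_ite_eq', Finset.mem_univ, if_true] at h
  have e : (X = dual Y) ↔ (Y = dual X) :=
    ⟨fun h => by rw [h, dual_dual], fun h => by rw [h, dual_dual]⟩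
  simp only [e] at h
  exact_mod_cast h

lemma conv_sum_left {ι : Type*} (s : Finset ι) (c : ι → ℂ) (f : ι → A →ₗ[ℂ] ℂ) (g : A →ₗ[ℂ] ℂ) :
    conv (∑ i ∈ s, c i • f i) g = ∑ i ∈ s, c i • conv (f i) g := by
  refine cm_ext fun i j => ?_
  simp only [conv_cm, LinearMap.sum_apply, LinearMap.smul_apply, smul_eq_mul, Finset.sum_mul,
    Finset.mul_sum]
  rw [Finset.sum_comm]
  simp only [mul_assoc]

lemma conv_sum_right {ι : Type*} (s : Finset ι) (c : ι → ℂ) (f : ι → A →ₗ[ℂ] ℂ) (g : A →ₗ[ℂ] ℂ) :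
    conv g (∑ i ∈ s, c i • f i) = ∑ i ∈ s, c i • conv g (f i) := by
  refine cm_ext fun i j => ?_
  simp only [conv_cm, LinearMap.sum_apply, LinearMap.smul_apply, smul_eq_mul,
    Finset.mul_sum]
  rw [Finset.sum_comm]
  refine Finset.sum_congr rfl fun _ _ => Finset.sum_congr rfl fun _ _ => by ring

lemma fus_eq_conv_intg (X Y Z : Irr A) :
    (fus X Y Z : ℂ) = conv (conv (chi X) (chi Y)) (chi (dual Z)) (intg A) := by
  rw [conv_chi, conv_sum_left]
  simp only [LinearMap.sum_apply, LinearMap.smul_apply, chi_dual, conv_chi_antipode_intg]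
  simp

lemma conv_apply_antipode (f g : A →ₗ[ℂ] ℂ) (x : A) :
    conv f g (antipode ℂ x) = conv (g ∘ₗ antipode ℂ) (f ∘ₗ antipode ℂ) x :=
  LinearMap.congr_fun (Double.conv_comp_antipode f g) x

section QT

variable (R : QT A)
include R

lemma QT.fus_comm (X Y Z : Irr A) : fus X Y Z = fus Y X Z := by
  have h : (fus X Y Z : ℂ) = fus Y X Z := by
    rw [← fus_spec, ← fus_spec, R.conv_comm_of_trace (chi_mul_comm X) (chi_mul_comm Y)]
  exact_mod_cast h

lemma QT.fus_frobenius (X Y Z : Irr A) : fus X Y Z = fus (dual X) Z Y := by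
  have h : (fus X Y Z : ℂ) = fus (dual X) Z Y := by
    rw [fus_eq_conv_intg, fus_eq_conv_intg]
    conv_lhs => rw [← antipode_intg, conv_apply_antipode, Double.conv_comp_antipode, ← chi_dual,
      ← chi_dual, ← chi_dual, dual_dual, ← conv_assoc,
      R.conv_comm_of_trace (conv_trace (chi_mul_comm _) (chi_mul_comm _)) (chi_mul_comm _),
      ← conv_assoc]
  exact_mod_cast h

end QT

/-- A fusion subcategory, given by its simple objects. -/
structure IsSub (L : Finset (Irr A)) : Prop where
  one_mem : irrOne A ∈ L
  dual_mem : ∀ X ∈ L, dual X ∈ L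
  fus_mem : ∀ X ∈ L, ∀ Y ∈ L, ∀ Z, fus X Y Z ≠ 0 → Z ∈ L

/-- The central idempotent of a set of irreducibles. -/
def supp (L : Finset (Irr A)) : A := ∑ X ∈ L, cidem X

lemma rep_supp (L : Finset (Irr A)) (X : Irr A) : rep X (supp L : A) = if X ∈ L then 1 else 0 := by
  simp [supp, rep_cidem]

lemma supp_central (L : Finset (Irr A)) (x : A) : supp L * x = x * supp L := by
  simp only [supp, Finset.sum_mul, Finset.mul_sum, cidem_comm]

lemma supp_mul_self (L : Finset (Irr A)) : supp L * supp L = (supp L : A) :=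
  rep_ext fun i => by rw [map_mul, rep_supp]; split_ifs <;> simp

lemma one_sub_supp (L : Finset (Irr A)) : 1 - supp L = (∑ X ∈ Lᶜ, cidem X : A) := by
  rw [sub_eq_iff_eq_add, supp, Finset.sum_compl_add_sum, sum_cidem]

lemma cointg_supp (L : Finset (Irr A)) : cointg A (supp L) = ((∑ X ∈ L, deg X ^ 2 : ℕ) : ℂ) := by
  have := fun X : Irr A => cointg_mul_cidem X (1 : A)
  simp only [one_mul, chi_one] at this
  rw [supp, map_sum]
  push_cast
  exact Finset.sum_congr rfl fun X _ => by rw [this, sq]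

lemma comul_one_sub_supp_mul {L : Finset (Irr A)} (hL : IsSub L) :
    comul (R := ℂ) (1 - supp L) * (supp L ⊗ₜ[ℂ] supp L) = 0 := by
  rw [one_sub_supp, map_sum, Finset.sum_mul]
  refine Finset.sum_eq_zero fun Z hZ => ?_
  simp only [supp, sum_tmul, tmul_sum, Finset.mul_sum]
  refine Finset.sum_eq_zero fun X hX => Finset.sum_eq_zero fun Y hY => ?_
  refine comul_cidem_mul_eq_zero ?_
  by_contra hne
  exact (Finset.mem_compl.1 hZ) (hL.fus_mem _ ‹_› _ ‹_› Z hne)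

lemma tform_supp {L : Finset (Irr A)} {f g : A →ₗ[ℂ] ℂ} (hf : ∀ x, f (supp L * x) = f x)
    (hg : ∀ x, g (supp L * x) = g x) (u : A ⊗[ℂ] A) :
    tform f g ((supp L ⊗ₜ supp L) * u) = tform f g u := by
  induction u with
  | zero => simp
  | add x y hx hy => simp only [mul_add, map_add, hx, hy]
  | tmul x y => simp [hf, hg]

lemma supp_tmul_central (L : Finset (Irr A)) (u : A ⊗[ℂ] A) :
    (supp L ⊗ₜ[ℂ] supp L) * u = u * (supp L ⊗ₜ supp L) := by
  induction u with
  | zero => simp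
  | add x y hx hy => simp only [mul_add, add_mul, hx, hy]
  | tmul x y => simp [supp_central]

lemma conv_supp {L : Finset (Irr A)} (hL : IsSub L) {f g : A →ₗ[ℂ] ℂ}
    (hf : ∀ x, f (supp L * x) = f x) (hg : ∀ x, g (supp L * x) = g x) (x : A) :
    conv f g ((1 - supp L) * x) = 0 := by
  change tform f g (comul _) = 0
  rw [← tform_supp hf hg, Bialgebra.comul_mul, ← mul_assoc, supp_tmul_central,
    comul_one_sub_supp_mul hL, zero_mul, map_zero]

lemma cointg_comp_supp (L : Finset (Irr A)) :
    cointg A ∘ₗ LinearMap.mulLeft ℂ (supp L) = ∑ X ∈ L, (deg X : ℂ) • chi X := by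
  ext x
  simp only [LinearMap.comp_apply, LinearMap.mulLeft_apply, LinearMap.sum_apply,
    LinearMap.smul_apply, smul_eq_mul, supp, Finset.sum_mul, map_sum, cidem_comm,
    cointg_mul_cidem]

lemma conv_cointg_supp (R : QT A) {L : Finset (Irr A)} (hL : IsSub L) :
    conv (∑ X ∈ L, (deg X : ℂ) • chi X) (∑ X ∈ L, (deg X : ℂ) • chi X) =
      ((∑ X ∈ L, deg X ^ 2 : ℕ) : ℂ) • (∑ X ∈ L, (deg X : ℂ) • (chi X : A →ₗ[ℂ] ℂ)) := by
  have h1 : ∀ Y ∈ L, conv (chi Y) (∑ X ∈ L, (deg X : ℂ) • chi X) =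
      (deg Y : ℂ) • (∑ X ∈ L, (deg X : ℂ) • (chi X : A →ₗ[ℂ] ℂ)) := by
    intro Y hY
    rw [conv_sum_right]
    simp only [conv_chi, Finset.smul_sum, smul_smul]
    rw [Finset.sum_comm]
    have hsub : ∀ Z : Irr A, ∑ X ∈ L, (deg X * fus Y X Z : ℕ) =
        if Z ∈ L then deg Y * deg Z else 0 := by
      intro Z
      split_ifs with hZ
      · have h2 := sum_fus_mul_deg (dual Y) Z
        rw [deg_dual] at h2
        rw [← h2, ← Finset.sum_subset (Finset.subset_univ L)]
        · exact Finset.sum_congr rfl fun X _ => by rw [R.fus_frobenius Y X Z, mul_comm]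
        · intro X _ hX
          by_contra hne
          exact hX (hL.fus_mem _ (hL.dual_mem Y hY) Z hZ X (left_ne_zero_of_mul hne))
      · refine Finset.sum_eq_zero fun X hX => ?_
        by_contra hne
        exact hZ (hL.fus_mem Y hY X hX Z (right_ne_zero_of_mul hne))
    have : ∀ Z : Irr A, ∑ X ∈ L, ((deg X : ℂ) * fus Y X Z) • (chi Z : A →ₗ[ℂ] ℂ) =
        if Z ∈ L then ((deg Y : ℂ) * deg Z) • chi Z else 0 := by
      intro Z
      rw [← Finset.sum_smul]
      have h3 : ((∑ X ∈ L, (deg X * fus Y X Z) : ℕ) : ℂ) =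
        ((if Z ∈ L then deg Y * deg Z else 0 : ℕ) : ℂ) := by rw [hsub Z]
      push_cast at h3
      rw [h3]; split_ifs <;> simp
    simp_rw [this]
    simp [Finset.sum_ite_mem]
  rw [conv_sum_left]
  rw [Finset.sum_congr rfl fun Y hY => by rw [h1 Y hY, smul_smul]]
  rw [← Finset.sum_smul]
  push_cast
  simp only [sq]

lemma dvd_of_trace {V : Type*} [AddCommGroup V] [Module ℂ V] [FiniteDimensional ℂ V]
    {T : V →ₗ[ℂ] V} {a b : ℕ} (ha : a ≠ 0) (hT : T * T = (a : ℂ) • T)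
    (htr : LinearMap.trace ℂ V T = b) : a ∣ b := by
  have ha' : (a : ℂ) ≠ 0 := by exact_mod_cast ha
  obtain ⟨k, hk, -⟩ := exists_nat_trace_of_idem (T := (a : ℂ)⁻¹ • T) (by
    rw [smul_mul_smul_comm, hT, smul_smul, mul_assoc, inv_mul_cancel₀ ha', mul_one])
  rw [map_smul, htr, smul_eq_mul, inv_mul_eq_iff_eq_mul₀ ha'] at hk
  exact ⟨k, by exact_mod_cast hk⟩

/-- Divisibility of dimensions of fusion subcategories. -/
theorem IsSub.dim_dvd (R : QT A) {L M : Finset (Irr A)} (hL : IsSub L) (hM : IsSub M)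
    (hLM : L ⊆ M) : ∑ X ∈ L, deg X ^ 2 ∣ ∑ X ∈ M, deg X ^ 2 := by
  set f : A →ₗ[ℂ] ℂ := ∑ X ∈ L, (deg X : ℂ) • chi X with hf
  have hf' : f = cointg A ∘ₗ LinearMap.mulLeft ℂ (supp L) := (cointg_comp_supp L).symm
  have hfM : ∀ x, f (supp M * x) = f x := by
    intro x
    simp only [hf', LinearMap.comp_apply, LinearMap.mulLeft_apply, ← mul_assoc]
    congr 2
    refine rep_ext fun i => ?_
    rw [map_mul, rep_supp, rep_supp]
    split_ifs with h1 h2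
    · simp
    · exact absurd (hLM h1) h2
    · simp
    · simp
  have hpos : ∑ X ∈ L, deg X ^ 2 ≠ 0 := by
    have := Finset.single_le_sum (f := fun X : Irr A => deg X ^ 2) (fun _ _ => Nat.zero_le _)
      hL.one_mem
    simp only [deg_irrOne] at this
    omega
  have hE : ∀ x, supp M * ract f ((1 - supp M) * x) = 0 := by
    intro x
    refine eq_of_forall_functional fun g => ?_
    have h1 := apply_ract (g ∘ₗ LinearMap.mulLeft ℂ (supp M)) f ((1 - supp M) * x)
    rw [conv_supp hM hfM (fun y => by
      simp only [LinearMap.comp_apply, LinearMap.mulLeft_apply, ← mul_assoc, supp_mul_self])] at h1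
    rw [map_zero, ← h1]; rfl
  refine dvd_of_trace (T := LinearMap.mulLeft ℂ (supp M) ∘ₗ ract f) hpos ?_ ?_
  · ext x
    simp only [Module.End.mul_apply, LinearMap.comp_apply, LinearMap.mulLeft_apply,
      LinearMap.smul_apply]
    have h1 : supp M * ract f (supp M * ract f x) = supp M * ract f (ract f x) := by
      have h2 := hE (ract f x)
      rw [sub_mul, one_mul, map_sub, mul_sub, sub_eq_zero] at h2
      exact h2.symm
    rw [h1, ract_ract, conv_cointg_supp R hL]
    change supp M * ractAt x (_ • _) = _
    rw [map_smul, mul_smul_comm]; rfl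
  · rw [trace_mulLeft_ract, cointg_supp, hf]
    simp only [LinearMap.sum_apply, LinearMap.smul_apply, chi_intg, smul_eq_mul, mul_ite, mul_one,
      mul_zero]
    rw [Finset.sum_ite_eq' L, if_pos hL.one_mem]
    simp

end FinHopf

namespace FinHopf

section algebra

variable {A : Type*} [Ring A] [Algebra ℂ A] [FiniteDimensional ℂ A] [IsSemisimpleRing A]

lemma deg_ne_zero (X : Irr A) : (deg X : ℂ) ≠ 0 := by exact_mod_cast (deg_pos X).ne'

lemma rep_central {z : A} (hz : ∀ x, x * z = z * x) (X : Irr A) :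
    rep X z = (chi X z / deg X) • 1 := by
  obtain ⟨c, hc⟩ := rep_of_central X hz
  rw [chi_apply, hc, Matrix.trace_smul, Matrix.trace_one]
  simp [deg_ne_zero X]

lemma chi_central_mul {z : A} (hz : ∀ x, x * z = z * x) (X : Irr A) (x : A) :
    chi X (z * x) = chi X z / deg X * chi X x := by
  rw [chi_apply, map_mul, rep_central hz]
  simp [chi_apply]

lemma trace_mul_of_eq_one {d : ℕ} (h : d = 1) (M N : Matrix (Fin d) (Fin d) ℂ) :
    (M * N).trace = M.trace * N.trace := by
  subst h; simp [Matrix.trace, Matrix.mul_apply]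

lemma chi_mul_of_deg_one {X : Irr A} (h : deg X = 1) (x y : A) :
    chi X (x * y) = chi X x * chi X y := by
  rw [chi_apply, map_mul, trace_mul_of_eq_one h]; rfl

lemma tform_central_mul {z z' : A} (hz : ∀ x, x * z = z * x) (hz' : ∀ x, x * z' = z' * x)
    (X Y : Irr A) (u : A ⊗[ℂ] A) : tform (chi X) (chi Y) ((z ⊗ₜ z') * u) =
      chi X z / deg X * (chi Y z' / deg Y) * tform (chi X) (chi Y) u := by
  induction u with
  | zero => simp
  | add x y hx hy => simp only [mul_add, map_add, hx, hy]
  | tmul x y =>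
    simp only [Algebra.TensorProduct.tmul_mul_tmul, tform_tmul, chi_central_mul hz,
      chi_central_mul hz']
    ring

end algebra

variable {A : Type*} [Ring A] [HopfAlgebra ℂ A] [FiniteDimensional ℂ A] [IsSemisimpleRing A]

lemma sum_basis_tmul_evL (u : A ⊗[ℂ] A) :
    ∑ a, Module.finBasis ℂ A a ⊗ₜ[ℂ] evL ((Module.finBasis ℂ A).coord a) u = u := by
  induction u with
  | zero => simp
  | add x y hx hy => simp only [map_add, tmul_add, Finset.sum_add_distrib, hx, hy]
  | tmul x y =>
    simp only [evL_tmul, tmul_smul, smul_tmul', ← sum_tmul]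
    congr 1
    exact (Module.finBasis ℂ A).sum_repr x

lemma eq_of_evL {u v : A ⊗[ℂ] A} (h : ∀ f : A →ₗ[ℂ] ℂ, evL f u = evL f v) : u = v := by
  rw [← sum_basis_tmul_evL u, ← sum_basis_tmul_evL v]
  simp only [h]

lemma evL_mul {f : A →ₗ[ℂ] ℂ} (hf : ∀ x y, f (x * y) = f x * f y) (u v : A ⊗[ℂ] A) :
    evL f (u * v) = evL f u * evL f v := by
  induction u with
  | zero => simp
  | add x y hx hy => simp only [add_mul, map_add, hx, hy]
  | tmul x y =>
    induction v with
    | zero => simp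
    | add x y hx hy => simp only [mul_add, map_add, hx, hy]
    | tmul x' y' => simp [hf, smul_smul, mul_comm]

lemma conv_chi_mul_cidem (X Y Z : Irr A) {w : A} (hw : ∀ x, x * w = w * x) :
    conv (chi X) (chi Y) (w * cidem Z) = fus X Y Z * chi Z w := by
  have : ∀ W : Irr A, chi W (w * cidem Z) = if W = Z then chi Z w else 0 := by
    intro W
    rw [chi_central_mul hw, chi_cidem]
    split_ifs with h
    · subst h; rw [div_mul_cancel₀ _ (deg_ne_zero W)]
    · simp
  simp [conv_chi, this]

namespace QT

variable (R : QT A)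

lemma drin_sum {ι : Type*} (s : Finset ι) (c : ι → ℂ) (f : ι → A →ₗ[ℂ] ℂ) :
    R.drin (∑ i ∈ s, c i • f i) = ∑ i ∈ s, c i • R.drin (f i) := by
  refine eq_of_forall_functional fun g => ?_
  simp only [map_sum, map_smul, apply_drin, mono_eq, tform_tmul, LinearMap.sum_apply,
    LinearMap.smul_apply, smul_eq_mul, Finset.sum_mul, Finset.mul_sum, mul_assoc]
  rw [Finset.sum_congr rfl fun _ _ => Finset.sum_comm, Finset.sum_comm]

lemma drin_counit : R.drin (counit (R := ℂ)) = 1 := by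
  rw [drin_eq]
  simp only [Bialgebra.counit_mul]
  have h : (∑ a, counit (R := ℂ) (R.t a) • R.s a) * (∑ b, counit (R := ℂ) (R.s b) • R.t b) = 1 := by
    rw [R.counit_left, R.counit_right, one_mul]
  rw [Finset.sum_mul_sum] at h
  simpa [smul_smul, mul_comm] using h

/-- The `S`-matrix. -/
def smat (X Y : Irr A) : ℂ := tform (chi X) (chi Y) R.mono

lemma smat_comm (X Y : Irr A) : R.smat X Y = R.smat Y X :=
  R.tform_mono_comm (chi_mul_comm X) (chi_mul_comm Y)

lemma chi_drin (X Y : Irr A) : chi Y (R.drin (chi X)) = R.smat X Y := R.apply_drin _ _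

lemma drin_chi_central (X : Irr A) (x : A) : x * R.drin (chi X) = R.drin (chi X) * x :=
  R.drin_central (chi_mul_comm X) x

lemma smat_one (Y : Irr A) : R.smat (irrOne A) Y = deg Y := by
  rw [← chi_drin, chi_irrOne, drin_counit, chi_one]

lemma smat_mul (X X' Y : Irr A) :
    R.smat X Y * R.smat X' Y = deg Y * ∑ Z, fus X X' Z * R.smat Z Y := by
  have h := congrArg (chi Y) (R.drin_conv (chi_mul_comm X) (chi X'))
  rw [conv_chi, drin_sum, chi_central_mul (R.drin_chi_central X)] at h
  simp only [map_sum, map_smul, chi_drin, smul_eq_mul] at h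
  rw [h]
  field_simp [deg_ne_zero Y]

lemma smat_injective (hR : Function.Injective R.drin) {X X' : Irr A}
    (h : ∀ Y, R.smat X Y / deg X = R.smat X' Y / deg X') : X = X' := by
  have hlin : ∀ (c : ℂ) f, R.drin (c • f) = c • R.drin f := fun c f => by
    simpa using R.drin_sum {()} (fun _ => c) (fun _ => f)
  have h1 : R.drin ((deg X : ℂ)⁻¹ • chi X) = R.drin ((deg X' : ℂ)⁻¹ • chi X') := by
    rw [hlin, hlin]
    refine eq_of_central_of_chi (fun z => ?_) (fun z => ?_) fun Y => ?_
    · rw [mul_smul_comm, smul_mul_assoc, drin_chi_central]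
    · rw [mul_smul_comm, smul_mul_assoc, drin_chi_central]
    · simpa [chi_drin, div_eq_inv_mul] using h Y
  have h2 := LinearMap.congr_fun (hR h1) (pidem X)
  by_contra hne
  simp only [LinearMap.smul_apply, chi_pidem, if_pos, if_neg (Ne.symm hne)] at h2
  simp [deg_ne_zero X] at h2

/-- The scalar by which the twist acts. -/
def th (X : Irr A) : ℂ := chi X R.twist / deg X

lemma th_one : R.th (irrOne A) = 1 := by
  rw [th, chi_irrOne, deg_irrOne, twist, map_sum, Nat.cast_one, div_one]
  simp only [Bialgebra.counit_mul]
  have := congrArg (counit (R := ℂ)) R.counit_left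
  simpa using this

lemma th_dual (X : Irr A) : R.th (dual X) = R.th X := by
  rw [th, th, chi_dual_apply, antipode_twist, deg_dual]

lemma chi_twist (X : Irr A) : chi X R.twist = R.th X * deg X := by
  rw [th, div_mul_cancel₀ _ (deg_ne_zero X)]

lemma th_fus {g Y W : Irr A} (hg : deg g = 1) (h : fus g Y W ≠ 0) :
    R.th W * deg Y = R.th g * R.th Y * R.smat g Y := by
  have h1 := conv_chi_mul_cidem g Y W R.twist_central
  have h2 : conv (chi g) (chi Y) (cidem W) = fus g Y W * deg W := by
    have := conv_chi_mul_cidem g Y W (w := 1) (by simp)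
    rwa [one_mul, chi_one] at this
  change tform (chi g) (chi Y) (comul (R := ℂ) (R.twist * cidem W)) = _ at h1
  rw [Bialgebra.comul_mul, comul_twist, mul_assoc,
    tform_central_mul R.twist_central R.twist_central] at h1
  have h3 : ∀ u : A ⊗[ℂ] A, tform (chi g) (chi Y) u = chi Y (evL (chi g) u) := by
    intro u
    induction u with
    | zero => simp
    | add x y hx hy => simp only [map_add, hx, hy]
    | tmul x y => simp
  rw [h3, evL_mul (chi_mul_of_deg_one hg)] at h1
  change _ * chi Y (R.drin (chi g) * _) = _ at h1
  rw [chi_central_mul (R.drin_chi_central g), ← h3] at h1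
  change _ * (_ * conv (chi g) (chi Y) (cidem W)) = _ at h1
  rw [h2, chi_drin, chi_twist R W] at h1
  change R.th g * R.th Y * _ = _ at h1
  have hN : (fus g Y W : ℂ) ≠ 0 := by exact_mod_cast h
  have hW := deg_ne_zero W
  have hY := deg_ne_zero Y
  have : (fus g Y W : ℂ) * deg W * (R.th g * R.th Y * R.smat g Y) =
      fus g Y W * deg W * (R.th W * deg Y) := by
    calc _ = R.th g * R.th Y * (R.smat g Y / deg Y * (fus g Y W * deg W)) * deg Y := by
          field_simp
      _ = _ := by rw [h1]; ring
  exact (mul_left_cancel₀ (mul_ne_zero hN hW) this).symm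

lemma mono_eq_one_of_smat (h : ∀ X Y : Irr A, R.smat X Y = deg X * deg Y) : R.mono = 1 := by
  have hchi : ∀ X : Irr A, R.drin (chi X) = (deg X : ℂ) • 1 := by
    intro X
    refine eq_of_central_of_chi (R.drin_chi_central X) (by simp) fun Y => ?_
    rw [chi_drin, h, map_smul, chi_one, smul_eq_mul]
  have hlam : cointg A = ∑ X : Irr A, (deg X : ℂ) • (chi X : A →ₗ[ℂ] ℂ) :=
    LinearMap.ext fun x => by simp [cointg_eq_sum_chi]
  have hn := cointg_one_ne_zero (H := A)
  have hdl : R.drin (cointg A) = (cointg A 1) • 1 := by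
    rw [hlam, drin_sum]
    simp only [hchi, smul_smul, ← Finset.sum_smul, LinearMap.sum_apply, LinearMap.smul_apply,
      chi_one, smul_eq_mul]
  have hf : ∀ f : A →ₗ[ℂ] ℂ, R.drin f = f 1 • 1 := by
    intro f
    have h1 := R.drin_conv (cointg_comm (H := A)) f
    rw [conv_cointg, dgl_eq_one, hdl] at h1
    have h2 : R.drin (f 1 • cointg A) = f 1 • R.drin (cointg A) := by
      simpa using R.drin_sum {()} (fun _ => f 1) (fun _ => cointg A)
    rw [h2, hdl, smul_one_mul, smul_comm] at h1
    exact (smul_right_injective A hn h1).symm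
  refine eq_of_evL fun f => ?_
  rw [Algebra.TensorProduct.one_def, evL_tmul]
  exact hf f

lemma th_mul_of_mono_eq_one (h : R.mono = 1) {X Y Z : Irr A} (hN : fus X Y Z ≠ 0) :
    R.th Z = R.th X * R.th Y := by
  have h1 := conv_chi_mul_cidem X Y Z R.twist_central
  have h2 : conv (chi X) (chi Y) (cidem Z) = fus X Y Z * deg Z := by
    have := conv_chi_mul_cidem X Y Z (w := 1) (by simp)
    rwa [one_mul, chi_one] at this
  change tform (chi X) (chi Y) (comul (R := ℂ) (R.twist * cidem Z)) = _ at h1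
  rw [Bialgebra.comul_mul, comul_twist, h, mul_one,
    tform_central_mul R.twist_central R.twist_central] at h1
  change R.th X * R.th Y * conv (chi X) (chi Y) (cidem Z) = _ at h1
  rw [h2, chi_twist] at h1
  have hN' : (fus X Y Z : ℂ) * deg Z ≠ 0 :=
    mul_ne_zero (by exact_mod_cast hN) (deg_ne_zero Z)
  apply mul_right_cancel₀ hN'
  rw [h1]; ring

end QT

section pull

variable {B : Type*} [Ring B] [HopfAlgebra ℂ B]

lemma map_comul (π : A →ₐc[ℂ] B) (x : A) :
    comul (R := ℂ) (π x) = TensorProduct.map π.toLinearMap π.toLinearMap (comul (R := ℂ) x) :=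
  (CoalgHomClass.map_comp_comul_apply π x).symm

lemma map_comul' (π : A →ₐc[ℂ] B) (x : A) : comul (R := ℂ) (π x) =
    Algebra.TensorProduct.map (π : A →ₐ[ℂ] B) (π : A →ₐ[ℂ] B) (comul (R := ℂ) x) :=
  map_comul π x

/-- Transport of a quasitriangular structure along a surjection. -/
def QT.map (R : QT A) (π : A →ₐc[ℂ] B) (hπ : Function.Surjective π) : QT B where
  κ := R.κ
  fin := R.fin
  s a := π (R.s a)
  t a := π (R.t a)
  comm y := by
    obtain ⟨x, rfl⟩ := hπ y
    have h := congrArg (Algebra.TensorProduct.map (π : A →ₐ[ℂ] B) (π : A →ₐ[ℂ] B)) (R.comm x)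
    have hc : ∀ u : A ⊗[ℂ] A, Algebra.TensorProduct.map (π : A →ₐ[ℂ] B) (π : A →ₐ[ℂ] B)
        (Algebra.TensorProduct.comm ℂ A A u) = Algebra.TensorProduct.comm ℂ B B
          (Algebra.TensorProduct.map (π : A →ₐ[ℂ] B) (π : A →ₐ[ℂ] B) u) := by
      intro u
      induction u with
      | zero => simp
      | add x y hx hy => simp only [map_add, hx, hy]
      | tmul x y => simp
    rw [map_mul, map_mul, hc, ← map_comul', map_sum] at h
    simpa using h
  comul_left := by
    have h := congrArg (TensorProduct.map (TensorProduct.map π.toLinearMap π.toLinearMap)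
      π.toLinearMap) R.comul_left
    simp only [map_sum, TensorProduct.map_tmul, ← map_comul] at h
    simp only [show ∀ x, π.toLinearMap x = π x from fun _ => rfl, map_mul] at h
    exact h
  comul_right := by
    have h := congrArg (TensorProduct.map π.toLinearMap
      (TensorProduct.map π.toLinearMap π.toLinearMap)) R.comul_right
    simp only [map_sum, TensorProduct.map_tmul, ← map_comul] at h
    simp only [show ∀ x, π.toLinearMap x = π x from fun _ => rfl, map_mul] at h
    exact h
  counit_left := by
    have h := congrArg π R.counit_left
    simpa using h
  counit_right := by
    have h := congrArg π R.counit_right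
    simpa using h

lemma conv_comp_bialgHom (π : A →ₐc[ℂ] B) (f g : B →ₗ[ℂ] ℂ) (x : A) :
    conv (f ∘ₗ π.toLinearMap) (g ∘ₗ π.toLinearMap) x = conv f g (π x) := by
  rw [conv_eq_map, conv_eq_map, map_comul, TensorProduct.map_comp]; rfl

variable [FiniteDimensional ℂ B] [IsSemisimpleRing B]
variable (π : A →ₐc[ℂ] B) (hπ : Function.Surjective π)

include hπ in
lemma exists_pull (i : Irr B) : ∃ X : Irr A, deg X = deg i ∧ ∀ x, chi i (π x) = chi X x :=
  exists_chi_eq_of_surjective ((rep i).comp (π : A →ₐ[ℂ] B)) ((rep_surjective i).comp hπ)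

/-- Inflation of irreducible representations along a surjection. -/
def pull (i : Irr B) : Irr A := (exists_pull π hπ i).choose

@[simp] lemma deg_pull (i : Irr B) : deg (pull π hπ i) = deg i := (exists_pull π hπ i).choose_spec.1
lemma chi_pull (i : Irr B) : chi (pull π hπ i) = chi i ∘ₗ π.toLinearMap :=
  LinearMap.ext fun x => ((exists_pull π hπ i).choose_spec.2 x).symm

lemma pull_injective : Function.Injective (pull π hπ) := by
  intro i j h
  refine chi_injective (LinearMap.ext fun y => ?_)
  obtain ⟨x, rfl⟩ := hπ y
  have h1 := LinearMap.congr_fun (chi_pull π hπ i) x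
  rw [h, chi_pull] at h1
  exact h1.symm

lemma fus_pull (i j : Irr B) (Z : Irr A) : fus (pull π hπ i) (pull π hπ j) Z =
    ∑ k, if pull π hπ k = Z then fus i j k else 0 := by
  have h : (fus (pull π hπ i) (pull π hπ j) Z : ℂ) =
      ((∑ k, if pull π hπ k = Z then fus i j k else 0 : ℕ) : ℂ) := by
    rw [← fus_spec, chi_pull, chi_pull, conv_comp_bialgHom, conv_chi, LinearMap.sum_apply,
      Nat.cast_sum]
    refine Finset.sum_congr rfl fun k _ => ?_
    have h1 := LinearMap.congr_fun (chi_pull π hπ k) (pidem Z)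
    rw [chi_pidem] at h1
    rw [LinearMap.smul_apply, smul_eq_mul]
    change _ * (chi k ∘ₗ π.toLinearMap) (pidem Z) = _
    rw [← h1]
    simp
  exact_mod_cast h

lemma fus_pull_pull (i j k : Irr B) :
    fus (pull π hπ i) (pull π hπ j) (pull π hπ k) = fus i j k := by
  simp [fus_pull, (pull_injective π hπ).eq_iff]

lemma smat_pull (R : QT A) (i j : Irr B) :
    (R.map π hπ).smat i j = R.smat (pull π hπ i) (pull π hπ j) := by
  rw [QT.smat, QT.smat, QT.mono_eq, QT.mono_eq, chi_pull, chi_pull]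
  simp only [map_sum, tform_tmul, QT.map, LinearMap.comp_apply, ← map_mul]
  rfl

lemma twist_map (R : QT A) : (R.map π hπ).twist = π R.twist := by
  simp only [QT.twist, map_sum, map_mul]
  rfl

lemma th_pull (R : QT A) (i : Irr B) : (R.map π hπ).th i = R.th (pull π hπ i) := by
  rw [QT.th, QT.th, twist_map, deg_pull, chi_pull]; rfl

lemma pull_irrOne : pull π hπ (irrOne B) = irrOne A := by
  refine chi_injective (LinearMap.ext fun x => ?_)
  rw [chi_pull, chi_irrOne, chi_irrOne]
  exact CoalgHomClass.counit_comp_apply π x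

end pull

lemma exists_hopfIdeal {L : Finset (Irr A)} (hL : IsSub L) :
    ∃ (I : Ideal A) (_ : I.IsTwoSided) (_ : I.IsHopfIdeal ℂ), ∀ x, x ∈ I ↔ supp L * x = 0 := by
  let I : Ideal A :=
    { carrier := {x | supp L * x = 0}
      add_mem' := fun {a b} ha hb => by
        simp only [Set.mem_ofPred_eq] at *; rw [mul_add, ha, hb, add_zero]
      zero_mem' := by simp
      smul_mem' := fun c x hx => by
        simp only [Set.mem_ofPred_eq, smul_eq_mul] at *
        rw [← mul_assoc, supp_central, mul_assoc, hx, mul_zero] }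
  have hI : ∀ x, x ∈ I ↔ supp L * x = 0 := fun x => Iff.rfl
  have h2 : I.IsTwoSided := ⟨fun {a} b ha => by rw [hI] at *; rw [← mul_assoc, ha, zero_mul]⟩
  have hx : ∀ x ∈ I, x = (1 - supp L) * x := fun x hx => by
    rw [sub_mul, (hI x).1 hx, one_mul, sub_zero]
  have hq : (I.restrictScalars ℂ).mkQ (supp L) = (I.restrictScalars ℂ).mkQ 1 := by
    rw [← sub_eq_zero, ← map_sub, Submodule.mkQ_apply, Submodule.Quotient.mk_eq_zero]
    change supp L * (supp L - 1) = 0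
    rw [mul_sub, supp_mul_self, mul_one, sub_self]
  have hq' : ∀ a, (I.restrictScalars ℂ).mkQ (supp L * a) = (I.restrictScalars ℂ).mkQ a := by
    intro a
    rw [← sub_eq_zero, ← map_sub, Submodule.mkQ_apply, Submodule.Quotient.mk_eq_zero]
    change supp L * (supp L * a - a) = 0
    rw [mul_sub, ← mul_assoc, supp_mul_self, sub_self]
  have hmap : ∀ u : A ⊗[ℂ] A, TensorProduct.map (I.restrictScalars ℂ).mkQ (I.restrictScalars ℂ).mkQ
      ((supp L ⊗ₜ supp L) * u) =
      TensorProduct.map (I.restrictScalars ℂ).mkQ (I.restrictScalars ℂ).mkQ u := by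
    intro u
    induction u with
    | zero => simp
    | add x y hx hy => simp only [mul_add, map_add, hx, hy]
    | tmul x y =>
      rw [Algebra.TensorProduct.tmul_mul_tmul, TensorProduct.map_tmul, TensorProduct.map_tmul,
        hq', hq']
  have hco : (I.restrictScalars ℂ).IsCoideal := by
    refine (Submodule.isCoideal_iff _).2 ⟨fun x hxI => ?_, fun x hxI => ?_⟩
    · rw [hx x hxI, Bialgebra.counit_mul, ← chi_irrOne, one_sub_supp, map_sum,
        Finset.sum_eq_zero, zero_mul]
      intro Z hZ
      rw [chi_cidem, if_neg]
      rintro rfl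
      exact Finset.mem_compl.1 hZ hL.one_mem
    · rw [hx x hxI, Bialgebra.comul_mul, ← hmap, ← mul_assoc, supp_tmul_central,
        comul_one_sub_supp_mul hL, zero_mul, map_zero]
  have hS : antipode ℂ (supp L) = (supp L : A) := by
    refine eq_of_central_of_chi (fun z => ?_) (fun z => (supp_central L z).symm) fun X => ?_
    · apply antipode_injective
      rw [antipode_mul_antidistrib, antipode_mul_antidistrib, antipode_antipode, supp_central]
    · rw [← chi_dual_apply, chi_apply, chi_apply, rep_supp, rep_supp]
      have : dual X ∈ L ↔ X ∈ L := ⟨fun h => by simpa using hL.dual_mem _ h, hL.dual_mem X⟩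
      simp only [this]
      split_ifs <;> simp
  refine ⟨I, h2, { toIsCoideal := hco, antipode_mem := fun x hxI => ?_ }, hI⟩
  rw [hI] at *
  rw [supp_central, ← hS, ← antipode_mul_antidistrib, hxI, map_zero]

section quotient

variable {L : Finset (Irr A)} {I : Ideal A} [I.IsTwoSided] [I.IsHopfIdeal ℂ]

instance finiteDimensional_quotient : FiniteDimensional ℂ (A ⧸ I) :=
  Module.Finite.of_surjective (Ideal.Quotient.mkₐ ℂ I).toLinearMap Ideal.Quotient.mk_surjective

instance isSemisimpleRing_quotient : IsSemisimpleRing (A ⧸ I) :=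
  (Ideal.Quotient.mk I).isSemisimpleRing_of_surjective Ideal.Quotient.mk_surjective

variable (I) in
/-- The quotient map, as a bialgebra morphism. -/
def quo : A →ₐc[ℂ] A ⧸ I := Bialgebra.Quotient.mkBialgHom (R := ℂ) I

lemma quo_surjective : Function.Surjective (quo I) := Ideal.Quotient.mk_surjective

lemma mem_iff_exists_pull (hI : ∀ x, x ∈ I ↔ supp L * x = 0) (X : Irr A) :
    X ∈ L ↔ ∃ i, pull (quo I) quo_surjective i = X := by
  constructor
  · intro hX
    let ρ : A ⧸ I →ₐ[ℂ] Matrix (Fin (deg X)) (Fin (deg X)) ℂ :=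
      Ideal.Quotient.liftₐ I (rep X) (fun x hx => by
        have h := congrArg (rep X) ((hI x).1 hx)
        rwa [map_mul, rep_supp, if_pos hX, one_mul, map_zero] at h)
    have hρ : ∀ x, ρ (quo I x) = rep X x := fun x => rfl
    obtain ⟨i, hi, h⟩ := exists_chi_eq_of_surjective ρ (fun M => by
      obtain ⟨x, hx⟩ := rep_surjective X M
      exact ⟨quo I x, by rw [hρ, hx]⟩)
    refine ⟨i, chi_injective (LinearMap.ext fun x => ?_)⟩
    rw [chi_pull]
    exact (h (quo I x)).symm
  · rintro ⟨i, rfl⟩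
    by_contra hX
    set X := pull (quo I) quo_surjective i with hXd
    have h1 : cidem X ∈ I := by
      rw [hI]
      refine rep_ext fun Y => ?_
      rw [map_mul, rep_supp, rep_cidem, map_zero]
      split_ifs with h1 h2
      · exact absurd (h2 ▸ h1) hX
      all_goals simp
    have h2 := LinearMap.congr_fun (chi_pull (quo I) quo_surjective i) (cidem X)
    rw [← hXd, chi_cidem, if_pos rfl] at h2
    have h3 : quo I (cidem X) = 0 := Ideal.Quotient.eq_zero_iff_mem.2 h1
    have h4 : (chi i ∘ₗ (quo I).toLinearMap) (cidem X) = chi i (quo I (cidem X)) := rfl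
    rw [h4, h3, map_zero] at h2
    exact deg_ne_zero X h2

lemma finrank_quotient (hI : ∀ x, x ∈ I ↔ supp L * x = 0) :
    Module.finrank ℂ (A ⧸ I) = ∑ X ∈ L, deg X ^ 2 := by
  rw [finrank_eq_sum_deg_sq]
  refine Finset.sum_nbij (pull (quo I) quo_surjective) (fun i _ => ?_) ?_ ?_ (fun i _ => ?_)
  · exact (mem_iff_exists_pull hI _).2 ⟨i, rfl⟩
  · exact (pull_injective _ _).injOn
  · intro X hX
    obtain ⟨i, hi⟩ := (mem_iff_exists_pull hI X).1 hX
    exact ⟨i, by simp, hi⟩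
  · rw [deg_pull]

end quotient

end FinHopf

namespace FinHopf

lemma exists_monoidHom_ne_one_of_squarefree {G : Type*} [Group G] (hG : Squarefree (Nat.card G))
    (h1 : Nat.card G ≠ 1) : ∃ φ : G →* ℂˣ, φ ≠ 1 := by
  have : Finite G := Nat.finite_of_card_ne_zero hG.ne_zero
  have : IsZGroup G := IsZGroup.of_squarefree hG
  have : Nontrivial G := by
    rw [← not_subsingleton_iff_nontrivial]
    intro h
    exact h1 (Nat.card_of_subsingleton (1 : G))
  have h := IsZGroup.commutator_lt G
  obtain ⟨g, -, hg⟩ := SetLike.exists_of_lt h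
  have hg' : (Abelianization.of g : Abelianization G) ≠ 1 := by
    intro hn
    exact hg ((QuotientGroup.eq_one_iff g).1 hn)
  have : NeZero (Monoid.exponent (Abelianization G)) := ⟨Monoid.exponent_ne_zero_of_finite⟩
  obtain ⟨φ, hφ⟩ := CommGroup.exists_apply_ne_one_of_hasEnoughRootsOfUnity (Abelianization G) ℂ hg'
  refine ⟨φ.comp Abelianization.of, fun hn => hφ ?_⟩
  exact DFunLike.congr_fun hn g

lemma exists_int_trace_of_pow_four {V : Type*} [AddCommGroup V] [Module ℂ V]
    [FiniteDimensional ℂ V] {U : V →ₗ[ℂ] V} (hU : U * U * (U * U) = U * U) :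
    ∃ k : ℤ, LinearMap.trace ℂ V U = k := by
  set P := U * U with hP
  have hPU : P * U = U * P := by rw [hP, mul_assoc]
  have hV : (P * U) * (P * U) = P := by
    rw [mul_assoc, ← mul_assoc U, ← hPU, mul_assoc P U U, ← hP, hU, hU]
  have hPV : P * (P * U) = P * U := by rw [← mul_assoc, hU]
  have hVP : P * U * P = P * U := by rw [hPU, mul_assoc, hU]
  obtain ⟨a, ha, -⟩ := exists_nat_trace_of_idem (T := (1 / 2 : ℂ) • (P + P * U)) (by
    rw [smul_mul_smul_comm, mul_add, add_mul, add_mul, hU, hVP, hPV, hV]; module)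
  obtain ⟨b, hb, -⟩ := exists_nat_trace_of_idem (T := (1 / 2 : ℂ) • (P - P * U)) (by
    rw [smul_mul_smul_comm, mul_sub, sub_mul, sub_mul, hU, hVP, hPV, hV]; module)
  have hn : IsNilpotent (U - P * U) := by
    refine ⟨2, ?_⟩
    rw [sq, mul_sub, sub_mul, sub_mul, hV, ← hP, mul_assoc P U U, ← hP, hU,
      show U * (P * U) = P by rw [← mul_assoc, ← hPU, mul_assoc, ← hP, hU]]
    abel
  have h0 : LinearMap.trace ℂ V (U - P * U) = 0 :=
    (LinearMap.isNilpotent_trace_of_isNilpotent hn).eq_zero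
  refine ⟨a - b, ?_⟩
  have : U = ((1 / 2 : ℂ) • (P + P * U) - (1 / 2 : ℂ) • (P - P * U)) + (U - P * U) := by module
  rw [this, map_add, map_sub, ha, hb, h0]
  push_cast; ring

variable {B : Type*} [Ring B] [HopfAlgebra ℂ B] [FiniteDimensional ℂ B] [IsSemisimpleRing B]

section cocomm

lemma deg_eq_one_of_comm {C : Type*} [Ring C] [Algebra ℂ C] [FiniteDimensional ℂ C]
    [IsSemisimpleRing C] (h : ∀ x y : C, x * y = y * x) (i : Irr C) : deg i = 1 := by
  by_contra hne
  have hd : 1 < deg i := by have := deg_pos i; omega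
  have hcomm : ∀ M N : Matrix (Fin (deg i)) (Fin (deg i)) ℂ, M * N = N * M := by
    intro M N
    obtain ⟨x, rfl⟩ := rep_surjective i M
    obtain ⟨y, rfl⟩ := rep_surjective i N
    rw [← map_mul, h, map_mul]
  have h1 := hcomm (Matrix.single ⟨0, by omega⟩ ⟨1, hd⟩ 1) (Matrix.single ⟨1, hd⟩ ⟨0, by omega⟩ 1)
  have h2 := congrFun (congrFun h1 ⟨0, by omega⟩) ⟨0, by omega⟩
  simp [Matrix.single_apply] at h2

lemma trace_ract (f : B →ₗ[ℂ] ℂ) :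
    LinearMap.trace ℂ B (ract f) = f (intg B) * Module.finrank ℂ B := by
  have h := trace_mulLeft_ract f (1 : B)
  rwa [cointg_one, LinearMap.mulLeft_one, LinearMap.id_comp] at h

lemma finrank_le_card_groupLike
    (hc : ∀ x : B, Algebra.TensorProduct.comm ℂ B B (comul (R := ℂ) x) = comul (R := ℂ) x) :
    Module.finrank ℂ B ≤ Nat.card (GroupLike ℂ B) := by
  have hcc : Coalgebra.IsCocomm ℂ B := ⟨LinearMap.ext fun x => hc x⟩
  let C := WithConv (B →ₗ[ℂ] ℂ)
  have hmul : ∀ f g : C, (f * g).ofConv = conv f.ofConv g.ofConv := fun f g => rfl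
  have : FiniteDimensional ℂ C :=
    Module.Finite.equiv (WithConv.linearEquiv ℂ (B →ₗ[ℂ] ℂ)).symm
  have hpow : ∀ (f : C) (k : ℕ), ract (f ^ (k + 1)).ofConv = ract f.ofConv ^ (k + 1) := by
    intro f k
    induction k with
    | zero => simp
    | succ k ih =>
      rw [pow_succ (ract f.ofConv) (k + 1), ← ih, pow_succ' f (k + 1), hmul]
      ext x
      rw [Module.End.mul_apply, ract_ract]
  have hnil : ∀ f : C, IsNilpotent f → f.ofConv (intg B) = 0 := by
    rintro f ⟨k, hk⟩
    have h1 : IsNilpotent (ract f.ofConv) := by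
      refine ⟨k + 1, ?_⟩
      rw [← hpow, pow_succ, hk, zero_mul]
      ext x
      change ractAt x (0 : B →ₗ[ℂ] ℂ) = 0
      rw [map_zero]
    have h2 := (LinearMap.isNilpotent_trace_of_isNilpotent h1).eq_zero
    rw [trace_ract] at h2
    rcases mul_eq_zero.1 h2 with h | h
    · exact h
    · rw [← cointg_one] at h
      exact absurd h cointg_one_ne_zero
  have : IsReduced C := by
    refine ⟨fun f hf => ?_⟩
    have h1 : ract f.ofConv (intg B) = ract 0 (intg B) := by
      refine eq_of_forall_functional fun g => ?_
      rw [apply_ract, apply_ract]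
      have h2 := hnil (f * WithConv.toConv g) ((Commute.all _ _).isNilpotent_mul_right hf)
      rw [hmul] at h2
      rw [h2]
      change _ = tform 0 g _
      simp [tform]
    exact WithConv.ofConv_injective (ract_intg_injective h1)
  have : IsArtinianRing C := IsArtinianRing.of_finite ℂ C
  have : IsSemisimpleRing C := IsArtinianRing.isSemisimpleRing_of_isReduced C
  have hdeg : ∀ i : Irr C, deg i = 1 := deg_eq_one_of_comm fun x y => mul_comm x y
  have hcard : Fintype.card (Irr C) = Module.finrank ℂ B := by
    have h1 := finrank_eq_sum_deg_sq C
    simp only [hdeg, one_pow, Finset.sum_const, Finset.card_univ, smul_eq_mul, mul_one] at h1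
    rw [← h1, LinearEquiv.finrank_eq (WithConv.linearEquiv ℂ (B →ₗ[ℂ] ℂ))]
    exact Subspace.dual_finrank_eq
  have hx : ∀ i : Irr C, ∃ x : B, ∀ f : B →ₗ[ℂ] ℂ, chi i (WithConv.toConv f) = f x := by
    intro i
    obtain ⟨x, hx⟩ := (Module.evalEquiv ℂ B).surjective
      (chi i ∘ₗ (WithConv.linearEquiv ℂ (B →ₗ[ℂ] ℂ)).symm.toLinearMap)
    refine ⟨x, fun f => ?_⟩
    have := LinearMap.congr_fun hx f
    simpa using this.symm
  choose x hx using hx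
  have hgl : ∀ i, IsGroupLikeElem ℂ (x i) := by
    intro i
    refine isGroupLikeElem_of_conv ?_ fun f k => ?_
    · rw [← hx]
      have : (WithConv.toConv (counit (R := ℂ)) : C) = 1 := by
        rw [LinearMap.convOne_def]; rfl
      rw [this, chi_one, hdeg, Nat.cast_one]
    · rw [← hx, ← hx, ← hx, ← chi_mul_of_deg_one (hdeg i)]; rfl
  have hinj : Function.Injective fun i => (⟨x i, hgl i⟩ : GroupLike ℂ B) := by
    intro i j hij
    have h1 : x i = x j := congrArg GroupLike.val hij
    refine chi_injective (LinearMap.ext fun f => ?_)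
    have := hx i f.ofConv
    rw [h1, ← hx] at this
    simpa using this
  have := groupLike_finite (H := B)
  have h2 := Nat.card_le_card_of_injective _ hinj
  rwa [Nat.card_eq_fintype_card, hcard] at h2

lemma exists_algHom_of_cocomm
    (hc : ∀ x : B, Algebra.TensorProduct.comm ℂ B B (comul (R := ℂ) x) = comul (R := ℂ) x)
    (hsq : Squarefree (Module.finrank ℂ B)) (h1 : Module.finrank ℂ B ≠ 1) :
    ∃ η : B →ₐ[ℂ] ℂ, η ≠ Bialgebra.counitAlgHom ℂ B := by
  have := groupLike_finite (H := B)
  have : Fintype (GroupLike ℂ B) := Fintype.ofFinite _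
  have hli := linearIndep_groupLikeVal (R := ℂ) (A := B)
  have hcard : Fintype.card (GroupLike ℂ B) = Module.finrank ℂ B := by
    refine le_antisymm hli.fintype_card_le_finrank ?_
    rw [← Nat.card_eq_fintype_card]; exact finrank_le_card_groupLike hc
  have : Nonempty (GroupLike ℂ B) := ⟨1⟩
  let b := basisOfLinearIndependentOfCardEqFinrank hli hcard
  have hb : ∀ g, b g = g.val := fun g => by simp [b]
  rw [← hcard, ← Nat.card_eq_fintype_card] at hsq h1
  obtain ⟨φ, hφ⟩ := exists_monoidHom_ne_one_of_squarefree hsq h1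
  let F : B →ₗ[ℂ] ℂ := b.constr ℂ fun g => (φ g : ℂ)
  have hF : ∀ g : GroupLike ℂ B, F g.val = φ g := fun g => by
    rw [← hb]; exact b.constr_basis ℂ _ g
  have hmul : (LinearMap.mul ℂ B).compr₂ F = (LinearMap.mul ℂ ℂ).compl₁₂ F F := by
    refine b.ext fun g => b.ext fun h => ?_
    simp only [LinearMap.compr₂_apply, LinearMap.mul_apply', LinearMap.compl₁₂_apply, hb, hF]
    rw [← GroupLike.val_mul, hF, map_mul, Units.val_mul]
  let η : B →ₐ[ℂ] ℂ := AlgHom.ofLinearMap F (by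
    rw [← GroupLike.val_one (R := ℂ), hF, map_one, Units.val_one]) (fun x y => by
    have := LinearMap.congr_fun₂ hmul x y
    simpa using this)
  refine ⟨η, fun he => hφ ?_⟩
  ext g
  have h2 : η g.val = Bialgebra.counitAlgHom ℂ B g.val := by rw [he]
  have h3 : η g.val = φ g := hF g
  rw [← h3, h2]
  simp

end cocomm

namespace QT

variable (R : QT B)

/-- `φ(f) = (f ⊗ 1)(R)`. -/
def rphi (f : B →ₗ[ℂ] ℂ) : B := ∑ a, f (R.s a) • R.t a

lemma rphi_eq_evL (f : B →ₗ[ℂ] ℂ) : R.rphi f = evL f R.rmat := by simp [rphi, rmat]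

lemma rphi_conv (f g : B →ₗ[ℂ] ℂ) : R.rphi (conv f g) = R.rphi f * R.rphi g := by
  have h := congrArg (TensorProduct.lift ((LinearMap.lsmul ℂ B).comp (tform f g))) R.comul_left
  simp only [map_sum, TensorProduct.lift.tmul, LinearMap.comp_apply, LinearMap.lsmul_apply,
    tform_tmul] at h
  simp only [rphi, Finset.sum_mul_sum, smul_mul_smul_comm]
  exact h

lemma rphi_smul (c : ℂ) (f : B →ₗ[ℂ] ℂ) : R.rphi (c • f) = c • R.rphi f := by
  simp [rphi, Finset.smul_sum, smul_smul]

lemma rphi_cointg_mul (f : B →ₗ[ℂ] ℂ) : R.rphi (cointg B) * R.rphi f = f 1 • R.rphi (cointg B) := by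
  rw [← rphi_conv, conv_cointg, dgl_eq_one, rphi_smul]

lemma antipode_rphi (f : B →ₗ[ℂ] ℂ) : antipode ℂ (R.rphi f) = R.rphi (f ∘ₗ antipode ℂ) := by
  have h := congrArg (evL f) R.sum_antipode_tmul_eq
  simp only [map_sum, evL_tmul] at h
  simp only [rphi, map_sum, map_smul, LinearMap.comp_apply]
  exact h.symm

end QT

lemma ract_cointg_mul (i j : Ix B) (y : B) :
    ract (cointg B ∘ₗ LinearMap.mulLeft ℂ (cm i j)) y =
      ∑ k, cointg B (cm i k * y) • antipode ℂ (cm k j) := by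
  have h1 : ∀ k, cointg B (cm i k * y) • (1 : B) =
      ∑ l, cm l k * ract (cointg B ∘ₗ LinearMap.mulLeft ℂ (cm i l)) y := by
    intro k
    rw [← ract_cointg_eq, ract_eq_evL, Bialgebra.comul_mul, comul_cm, Finset.sum_mul, map_sum]
    refine Finset.sum_congr rfl fun l _ => ?_
    rw [ract_eq_evL]
    generalize comul (R := ℂ) y = u
    induction u with
    | zero => simp
    | add x y hx hy => simp only [mul_add, map_add, hx, hy]
    | tmul a b => simp
  have h2 : ∀ k, cointg B (cm i k * y) • antipode ℂ (cm k j : B) =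
      antipode ℂ (cm k j) * (cointg B (cm i k * y) • (1 : B)) := by
    intro k; simp
  simp_rw [h2, h1, Finset.mul_sum, ← mul_assoc]
  rw [Finset.sum_comm]
  simp_rw [← Finset.sum_mul, sum_antipode_cm_mul']
  simp

/-- `x ⊗ x' ↦ λ(x y) S(x')`. -/
def cointgMap (y : B) : B ⊗[ℂ] B →ₗ[ℂ] B :=
  TensorProduct.lift ((LinearMap.lsmul ℂ B).comp (cointg B ∘ₗ LinearMap.mulRight ℂ y) |>.compl₂
    (antipode ℂ))

lemma cointgMap_tmul (x x' y : B) :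
    cointgMap y (x ⊗ₜ x') = cointg B (x * y) • antipode ℂ x' := by simp [cointgMap]

lemma ract_cointg_mulLeft (x y : B) :
    ract (cointg B ∘ₗ LinearMap.mulLeft ℂ x) y = cointgMap y (comul (R := ℂ) x) := by
  refine cm_ext_apply (f := ractAt y ∘ₗ ((LinearMap.mul ℂ B).compr₂ (cointg B)))
    (g := cointgMap y ∘ₗ comul) (fun i j => ?_) x
  simp only [LinearMap.comp_apply, comul_cm, map_sum, cointgMap_tmul, ← ract_cointg_mul]
  rfl

namespace QT

variable (R : QT B)

/-- The functional `λ(φ(λ) ·)`. -/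
def gfun : B →ₗ[ℂ] ℂ := cointg B ∘ₗ LinearMap.mulLeft ℂ (R.rphi (cointg B))

lemma sum_cointg_smul :
    ∑ a, cointg B (R.rphi (cointg B) * antipode ℂ (R.t a)) • R.s a =
      cointg B (R.rphi (cointg B)) • 1 := by
  refine eq_of_forall_functional fun f => ?_
  simp only [map_sum, map_smul, smul_eq_mul]
  have h : cointg B (R.rphi (cointg B) * antipode ℂ (R.rphi f)) =
      f 1 * cointg B (R.rphi (cointg B)) := by
    rw [antipode_rphi, rphi_cointg_mul]; simp
  change cointg B (R.rphi (cointg B) * antipode ℂ (∑ a, f (R.s a) • R.t a)) = _ at h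
  simp only [map_sum, map_smul, Finset.mul_sum, mul_smul_comm, smul_eq_mul] at h
  rw [mul_comm _ (f 1), ← h]
  exact Finset.sum_congr rfl fun a _ => mul_comm _ _

lemma comul_rphi (f : B →ₗ[ℂ] ℂ) :
    comul (R := ℂ) (R.rphi f) = ∑ a, ∑ b, f (R.s a * R.s b) • (R.t b ⊗ₜ[ℂ] R.t a) := by
  have h := congrArg (TensorProduct.lift ((LinearMap.lsmul ℂ (B ⊗[ℂ] B)).comp f)) R.comul_right
  simp only [map_sum, TensorProduct.lift.tmul, LinearMap.comp_apply, LinearMap.lsmul_apply] at h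
  rw [← h, rphi, map_sum]
  simp

lemma conv_gfun : conv R.gfun R.gfun = cointg B (R.rphi (cointg B)) • R.gfun := by
  ext y
  rw [← apply_ract]
  conv_lhs => rw [gfun, ract_cointg_mulLeft, comul_rphi]
  simp only [map_sum, map_smul, cointgMap_tmul, LinearMap.comp_apply, LinearMap.mulLeft_apply,
    mul_smul_comm, smul_eq_mul, LinearMap.smul_apply]
  have h := congrArg (fun z => ∑ b, cointg B (z * R.s b) * cointg B (R.t b * y)) R.sum_cointg_smul
  simp only [Finset.sum_mul, smul_mul_assoc, map_sum, map_smul, one_mul, smul_eq_mul] at h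
  have h2 : cointg B (R.rphi (cointg B) * y) = ∑ b, cointg B (R.s b) * cointg B (R.t b * y) := by
    simp [rphi, Finset.sum_mul]
  rw [gfun, LinearMap.comp_apply, LinearMap.mulLeft_apply, h2, Finset.mul_sum]
  simp only [← mul_assoc]
  rw [← h, Finset.sum_comm]
  refine Finset.sum_congr rfl fun b _ => Finset.sum_congr rfl fun a _ => by ring

/-- `y ↦ ∑ λ(tₐ y) sₐ`. -/
def umap : B →ₗ[ℂ] B :=
  ∑ a, (cointg B ∘ₗ LinearMap.mulLeft ℂ (R.t a)).smulRight (R.s a)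

lemma umap_apply (y : B) : R.umap y = ∑ a, cointg B (R.t a * y) • R.s a := by
  simp [umap]

lemma trace_umap : LinearMap.trace ℂ B R.umap = cointg B R.twist := by
  rw [umap, map_sum, ← sum_mul_rev, map_sum]
  refine Finset.sum_congr rfl fun a _ => ?_
  rw [LinearMap.trace_smulRight]; rfl

lemma umap_umap (h : R.mono = 1) (y : B) : R.umap (R.umap y) = ract R.gfun y := by
  have e1 : ∀ b, cointg B (R.t b * y) • (1 : B) = evL (cointg B)
      (comul (R := ℂ) (R.t b) * comul (R := ℂ) y) := by
    intro b; rw [← ract_cointg_eq, ract_eq_evL, Bialgebra.comul_mul]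
  have e2 : ∀ a, ∑ b, cointg B (R.t a * R.s b) • (R.s a * evL (cointg B)
      (comul (R := ℂ) (R.t b) * comul (R := ℂ) y)) =
      ∑ b, ∑ c, cointg B (R.t a * (R.s b * R.s c)) • (R.s a * evL (cointg B)
        ((R.t c ⊗ₜ R.t b) * comul (R := ℂ) y)) := by
    intro a
    have h := congrArg (TensorProduct.lift (((LinearMap.lsmul ℂ B).comp (cointg B ∘ₗ
      LinearMap.mulLeft ℂ (R.t a))).compl₂ (LinearMap.mulLeft ℂ (R.s a) ∘ₗ evL (cointg B) ∘ₗ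
        LinearMap.mulRight ℂ (comul (R := ℂ) y)))) R.comul_right
    simpa only [map_sum, TensorProduct.lift.tmul, LinearMap.compl₂_apply, LinearMap.comp_apply,
      LinearMap.lsmul_apply, LinearMap.mulLeft_apply, LinearMap.mulRight_apply] using h
  have e3 : ∀ c (u : B ⊗[ℂ] B), ∑ a, ∑ b, cointg B (R.t a * (R.s b * R.s c)) •
      (R.s a * evL (cointg B) ((R.t c ⊗ₜ R.t b) * u)) =
      cointg B (R.s c) • evL (cointg B) ((R.t c ⊗ₜ 1) * u) := by
    intro c u
    induction u with
    | zero => simp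
    | add x y hx hy => simp only [mul_add, map_add, smul_add, Finset.sum_add_distrib, hx, hy]
    | tmul x z =>
      have h' := congrArg (TensorProduct.lift (((LinearMap.lsmul ℂ B).comp (cointg B ∘ₗ
        LinearMap.mulRight ℂ (R.s c))).compl₂ (LinearMap.mulRight ℂ z))) (R.mono_eq.symm.trans h)
      simp only [map_sum, TensorProduct.lift.tmul, LinearMap.compl₂_apply, LinearMap.comp_apply,
        LinearMap.lsmul_apply, LinearMap.mulRight_apply, Algebra.TensorProduct.one_def,
        one_mul] at h'
      simp only [Algebra.TensorProduct.tmul_mul_tmul, evL_tmul, mul_smul_comm, one_mul]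
      simp_rw [smul_comm _ (cointg B (R.t c * x)), ← Finset.smul_sum, ← mul_assoc]
      rw [h']
  calc R.umap (R.umap y) = ∑ a, ∑ b, cointg B (R.t a * R.s b) • (R.s a *
        (cointg B (R.t b * y) • (1 : B))) := by
        rw [umap_apply R y, map_sum]
        simp only [map_smul, umap_apply, Finset.smul_sum, smul_smul, mul_smul_comm, mul_one]
        rw [Finset.sum_comm]
        simp only [mul_comm (cointg B (R.t _ * y))]
    _ = ∑ c, ∑ a, ∑ b, cointg B (R.t a * (R.s b * R.s c)) • (R.s a * evL (cointg B)
        ((R.t c ⊗ₜ R.t b) * comul (R := ℂ) y)) := by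
        simp_rw [e1, e2]
        rw [Finset.sum_congr rfl fun _ _ => Finset.sum_comm, Finset.sum_comm]
    _ = ∑ c, cointg B (R.s c) • evL (cointg B) ((R.t c ⊗ₜ 1) * comul (R := ℂ) y) := by
        simp_rw [e3]
    _ = ract R.gfun y := by
        rw [ract_eq_evL]
        generalize comul (R := ℂ) y = u
        induction u with
        | zero => simp
        | add x y hx hy => simp only [mul_add, map_add, smul_add, Finset.sum_add_distrib, hx, hy]
        | tmul x z =>
          simp [gfun, rphi, Finset.sum_mul, Finset.sum_smul, smul_smul]

/-- A quasitriangular Hopf algebra of squarefree dimension with trivial monodromy and trivial twist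
is cocommutative. -/
lemma rmat_eq_one (hm : R.mono = 1) (ht : R.twist = 1)
    (hsq : Squarefree (Module.finrank ℂ B)) : R.rmat = 1 := by
  set n := Module.finrank ℂ B with hn
  have hn0 : (n : ℂ) ≠ 0 := by rw [hn, ← cointg_one]; exact cointg_one_ne_zero
  set p := R.rphi (cointg B) with hp
  have hpp : p * p = (n : ℂ) • p := by rw [hp, rphi_cointg_mul, cointg_one]
  set q := (n : ℂ)⁻¹ • p with hq
  have hqq : q * q = q := by
    rw [hq, smul_mul_smul_comm, hpp, smul_smul, mul_assoc, inv_mul_cancel₀ hn0, mul_one]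
  have hlq : LinearMap.mulLeft ℂ q * LinearMap.mulLeft ℂ q = LinearMap.mulLeft ℂ q := by
    ext x; simp [← mul_assoc, hqq]
  obtain ⟨m, hmt, hm0⟩ := exists_nat_trace_of_idem hlq
  rw [trace_mulLeft_eq_cointg] at hmt
  have hcp : cointg B p = n * m := by
    rw [← hmt, hq, map_smul, smul_eq_mul, mul_inv_cancel_left₀ hn0]
  have hepsp : counit (R := ℂ) p = n := by
    rw [hp, rphi, map_sum, hn, ← cointg_one]
    have := congrArg (cointg B) R.counit_right
    simpa [mul_comm] using this
  have hm1 : m ≠ 0 := by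
    intro h0
    have h1 := LinearMap.congr_fun (hm0 h0) 1
    rw [LinearMap.mulLeft_apply, mul_one, LinearMap.zero_apply] at h1
    have h2 := congrArg (counit (R := ℂ)) h1
    rw [hq, map_smul, hepsp, map_zero, smul_eq_mul, inv_mul_cancel₀ hn0] at h2
    exact one_ne_zero h2
  have hc0 : cointg B p ≠ 0 := by
    rw [hcp]; exact mul_ne_zero hn0 (by exact_mod_cast hm1)
  obtain ⟨γ, hγ⟩ : ∃ γ : ℂ, γ ^ 2 = cointg B p := IsAlgClosed.exists_pow_nat_eq _ (by norm_num)
  have hγ0 : γ ≠ 0 := by rintro rfl; exact hc0 (by rw [← hγ]; simp)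
  have hUU : R.umap * R.umap = ract R.gfun := LinearMap.ext fun y => R.umap_umap hm y
  have hE : ract R.gfun * ract R.gfun = cointg B p • ract R.gfun := by
    ext y
    rw [Module.End.mul_apply, ract_ract, conv_gfun]
    change ractAt y (_ • _) = _
    rw [map_smul]; rfl
  obtain ⟨k, hk⟩ := exists_int_trace_of_pow_four (U := γ⁻¹ • R.umap) (by
    simp only [smul_mul_smul_comm, hUU, hE, smul_smul]
    congr 1
    rw [← hγ]; field_simp)
  rw [map_smul, trace_umap, ht, cointg_one, smul_eq_mul, inv_mul_eq_iff_eq_mul₀ hγ0] at hk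
  have hnk : (n : ℂ) * n = n * m * (k * k) := by
    rw [← hcp, ← hγ]
    calc (n : ℂ) * n = (γ * k) * (γ * k) := by rw [← hk]
      _ = _ := by ring
  have hnk' : (n : ℤ) = m * (k * k) := by
    have : (n : ℂ) = m * (k * k) := mul_left_cancel₀ hn0 (by rw [hnk]; ring)
    exact_mod_cast this
  have hnat : n = m * (k.natAbs * k.natAbs) := by
    have := congrArg Int.natAbs hnk'
    simpa [Int.natAbs_mul] using this
  have hu : k.natAbs = 1 := Nat.isUnit_iff.1 (hsq _ (Dvd.intro_left m hnat.symm))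
  have hmn : m = n := by rw [hnat, hu]; ring
  have hq1 : q = 1 := by
    have hl : LinearMap.mulLeft ℂ (1 - q) * LinearMap.mulLeft ℂ (1 - q) =
        LinearMap.mulLeft ℂ (1 - q) := by
      ext x; simp [← mul_assoc, mul_sub, sub_mul, hqq]
    obtain ⟨m', hm', hm0'⟩ := exists_nat_trace_of_idem hl
    rw [trace_mulLeft_eq_cointg, map_sub, hmt, cointg_one, hmn, sub_self] at hm'
    have h1 := LinearMap.congr_fun (hm0' (by exact_mod_cast hm'.symm)) 1
    rw [LinearMap.mulLeft_apply, mul_one, LinearMap.zero_apply, sub_eq_zero] at h1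
    exact h1.symm
  have hp1 : p = (n : ℂ) • 1 := by
    rw [← hq1, hq, smul_smul, mul_inv_cancel₀ hn0, one_smul]
  refine eq_of_evL fun f => ?_
  have h1 := R.rphi_cointg_mul f
  rw [← hp, hp1, smul_one_mul, smul_comm] at h1
  rw [← rphi_eq_evL, smul_right_injective B hn0 h1, Algebra.TensorProduct.one_def, evL_tmul]

include R in
theorem exists_algHom_ne_counit (hm : R.mono = 1) (ht : R.twist = 1)
    (hsq : Squarefree (Module.finrank ℂ B)) (h1 : Module.finrank ℂ B ≠ 1) :
    ∃ η : B →ₐ[ℂ] ℂ, η ≠ Bialgebra.counitAlgHom ℂ B := by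
  refine exists_algHom_of_cocomm (fun x => ?_) hsq h1
  have := R.rmat_mul_comul x
  rw [R.rmat_eq_one hm ht hsq, one_mul, mul_one] at this
  exact this.symm

end QT

end FinHopf

namespace FinHopf

open scoped ComplexConjugate

section integrality

lemma dvd_of_isIntegral {a b : ℕ} (hb : b ≠ 0) (h : IsIntegral ℤ ((a : ℂ) / b)) : b ∣ a := by
  have h1 : IsIntegral ℤ ((a : ℚ) / b) := by
    have : ((a : ℂ) / b) = algebraMap ℚ ℂ ((a : ℚ) / b) := by simp
    rw [this] at h
    exact (isIntegral_algebraMap_iff (algebraMap ℚ ℂ).injective).1 h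
  obtain ⟨z, hz⟩ := IsIntegrallyClosed.isIntegral_iff.1 h1
  have hb' : (b : ℚ) ≠ 0 := by exact_mod_cast hb
  have h2 : (a : ℚ) = z * b := by
    rw [eq_div_iff hb', eq_intCast] at hz
    exact hz.symm
  have h3 : (a : ℤ) = z * b := by exact_mod_cast h2
  exact Int.natCast_dvd_natCast.1 ⟨z, by rw [h3, mul_comm]⟩

lemma one_le_prod_embeddings (K : IntermediateField ℚ ℂ) [FiniteDimensional ℚ K] {x : K}
    (hx : x ≠ 0) (hi : IsIntegral ℤ (x : ℂ)) : 1 ≤ ∏ φ : K →ₐ[ℚ] ℂ, ‖φ x‖ := by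
  have hi' : IsIntegral ℤ x :=
    (isIntegral_algebraMap_iff (A := K) (B := ℂ) (algebraMap K ℂ).injective).1 hi
  have h1 := Algebra.isIntegral_norm ℚ hi'
  obtain ⟨z, hz⟩ := IsIntegrallyClosed.isIntegral_iff.1 h1
  have h2 := Algebra.norm_eq_prod_embeddings ℚ ℂ x
  rw [← norm_prod, ← h2, ← hz]
  have hz0 : z ≠ 0 := by
    rintro rfl
    rw [map_zero] at hz
    exact hx (Algebra.norm_eq_zero_iff.1 hz.symm)
  simp only [algebraMap_int_eq, eq_intCast, map_intCast, Complex.norm_intCast]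
  exact_mod_cast Int.one_le_abs hz0

lemma exists_one_le_embedding (K : IntermediateField ℚ ℂ) [FiniteDimensional ℚ K] {x : K}
    (hx : x ≠ 0) (hi : IsIntegral ℤ (x : ℂ)) : ∃ φ : K →ₐ[ℚ] ℂ, 1 ≤ ‖φ x‖ := by
  by_contra! hlt
  have h1 := one_le_prod_embeddings K hx hi
  have hne : Nonempty (K →ₐ[ℚ] ℂ) := ⟨K.val⟩
  have h2 : ∏ φ : K →ₐ[ℚ] ℂ, ‖φ x‖ < ∏ _φ : K →ₐ[ℚ] ℂ, (1 : ℝ) :=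
    Finset.prod_lt_prod_of_nonempty (fun φ _ => norm_pos_iff.2 ((map_ne_zero φ).2 hx))
      (fun φ _ => hlt φ) Finset.univ_nonempty
  simp only [Finset.prod_const_one] at h2
  linarith

lemma one_le_norm_of_embeddings (K : IntermediateField ℚ ℂ) [FiniteDimensional ℚ K] {x : K}
    (hx : x ≠ 0) (hi : IsIntegral ℤ (x : ℂ)) (hle : ∀ φ : K →ₐ[ℚ] ℂ, ‖φ x‖ ≤ 1) :
    1 ≤ ‖(x : ℂ)‖ := by
  have h1 := one_le_prod_embeddings K hx hi
  classical
  rw [← Finset.mul_prod_erase Finset.univ (fun φ : K →ₐ[ℚ] ℂ => ‖φ x‖)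
    (Finset.mem_univ K.val)] at h1
  have h2 : ∏ φ ∈ Finset.univ.erase K.val, ‖φ x‖ ≤ 1 :=
    Finset.prod_le_one (fun _ _ => norm_nonneg _) fun φ _ => hle φ
  calc (1 : ℝ) ≤ _ := h1
    _ ≤ ‖K.val x‖ * 1 := mul_le_mul_of_nonneg_left h2 (norm_nonneg _)
    _ = ‖(x : ℂ)‖ := mul_one _

end integrality

variable {A : Type*} [Ring A] [HopfAlgebra ℂ A] [FiniteDimensional ℂ A] [IsSemisimpleRing A]

/-- Characters of the fusion ring. -/
structure IsChar (w : Irr A → ℂ) : Prop where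
  one : w (irrOne A) = 1
  mul : ∀ X Y, w X * w Y = ∑ Z, fus X Y Z * w Z

lemma isChar_deg : IsChar (fun X : Irr A => (deg X : ℂ)) where
  one := by simp
  mul X Y := by exact_mod_cast (sum_fus_mul_deg X Y).symm

lemma IsChar.comp {w : Irr A → ℂ} (hw : IsChar w) (K : IntermediateField ℚ ℂ)
    (hK : ∀ X, w X ∈ K) (φ : K →ₐ[ℚ] ℂ) : IsChar fun X => φ ⟨w X, hK X⟩ where
  one := by
    rw [← map_one φ]; congr 1; exact Subtype.ext hw.one
  mul X Y := by
    have : (⟨w X, hK X⟩ * ⟨w Y, hK Y⟩ : K) = ∑ Z, (fus X Y Z : K) * ⟨w Z, hK Z⟩ := by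
      apply Subtype.ext
      have h1 := hw.mul X Y
      push_cast
      simpa using h1
    rw [← map_mul, this]
    simp

lemma isSub_univ : IsSub (Finset.univ : Finset (Irr A)) :=
  ⟨Finset.mem_univ _, fun _ _ => Finset.mem_univ _, fun _ _ _ _ _ _ => Finset.mem_univ _⟩

lemma IsSub.inter {L M : Finset (Irr A)} (hL : IsSub L) (hM : IsSub M) : IsSub (L ∩ M) where
  one_mem := Finset.mem_inter.2 ⟨hL.one_mem, hM.one_mem⟩
  dual_mem X hX := by
    rw [Finset.mem_inter] at *; exact ⟨hL.dual_mem X hX.1, hM.dual_mem X hX.2⟩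
  fus_mem X hX Y hY Z hZ := by
    rw [Finset.mem_inter] at *
    exact ⟨hL.fus_mem X hX.1 Y hY.1 Z hZ, hM.fus_mem X hX.2 Y hY.2 Z hZ⟩

lemma isIntegral_of_isChar {w : Irr A → ℂ} (hw : IsChar w) (Y : Irr A) : IsIntegral ℤ (w Y) := by
  let N : Submodule ℤ ℂ := Submodule.span ℤ (Set.range w)
  have h1 : (1 : ℂ) ∈ N := Submodule.subset_span ⟨irrOne A, hw.one⟩
  have hfg : N.FG := Submodule.fg_span (Set.finite_range w)
  refine isIntegral_of_smul_mem_submodule (N := N) ?_ hfg (w Y) ?_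
  · intro hbot
    rw [hbot, Submodule.mem_bot] at h1
    exact one_ne_zero h1
  · intro n hn
    induction hn using Submodule.span_induction with
    | mem x hx =>
      obtain ⟨X, rfl⟩ := hx
      rw [smul_eq_mul, hw.mul]
      refine N.sum_mem fun Z _ => ?_
      have : (fus Y X Z : ℂ) * w Z = (fus Y X Z : ℤ) • w Z := by simp
      rw [this]
      exact N.smul_mem _ (Submodule.subset_span ⟨Z, rfl⟩)
    | zero => simp
    | add x y _ _ hx hy => rw [smul_add]; exact N.add_mem hx hy
    | smul a x _ hx => rw [smul_comm]; exact N.smul_mem a hx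

section QT

variable (R : QT A)
include R

lemma IsSub.mul_sum_eq {L : Finset (Irr A)} (hL : IsSub L) {w w' : Irr A → ℂ} (hw : IsChar w)
    (hw' : IsChar w') {Y : Irr A} (hY : Y ∈ L) :
    w Y * ∑ X ∈ L, w X * conj (w' X) = conj (w' (dual Y)) * ∑ X ∈ L, w X * conj (w' X) := by
  have h1 : ∀ X ∈ L, w Y * w X = ∑ Z ∈ L, fus Y X Z * w Z := by
    intro X hX
    rw [hw.mul]
    refine (Finset.sum_subset (Finset.subset_univ L) fun Z _ hZ => ?_).symm
    have : fus Y X Z = 0 := by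
      by_contra hne; exact hZ (hL.fus_mem Y hY X hX Z hne)
    simp [this]
  have h2 : ∀ Z ∈ L, w' (dual Y) * w' Z = ∑ X ∈ L, fus Y X Z * w' X := by
    intro Z hZ
    rw [hw'.mul]
    simp_rw [← R.fus_frobenius]
    refine (Finset.sum_subset (Finset.subset_univ L) fun X _ hX => ?_).symm
    have : fus Y X Z = 0 := by
      by_contra hne
      rw [R.fus_frobenius] at hne
      exact hX (hL.fus_mem _ (hL.dual_mem Y hY) Z hZ X hne)
    simp [this]
  calc w Y * ∑ X ∈ L, w X * conj (w' X) = ∑ X ∈ L, (∑ Z ∈ L, fus Y X Z * w Z) * conj (w' X) := by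
        rw [Finset.mul_sum]
        exact Finset.sum_congr rfl fun X hX => by rw [← h1 X hX, mul_assoc]
    _ = ∑ Z ∈ L, w Z * conj (∑ X ∈ L, fus Y X Z * w' X) := by
        simp only [Finset.sum_mul, map_sum, map_mul, Finset.mul_sum, Complex.conj_natCast]
        rw [Finset.sum_comm]
        refine Finset.sum_congr rfl fun _ _ => Finset.sum_congr rfl fun _ _ => by ring
    _ = _ := by
        rw [Finset.mul_sum]
        refine Finset.sum_congr rfl fun Z hZ => ?_
        rw [← h2 Z hZ, map_mul]; ring

omit R in
lemma sum_normSq_ne_zero {w : Irr A → ℂ} (hw : IsChar w) :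
    ∑ X, w X * conj (w X) ≠ 0 := by
  simp_rw [Complex.mul_conj]
  rw [← Complex.ofReal_sum]
  norm_cast
  have := Finset.single_le_sum (f := fun X => Complex.normSq (w X))
    (fun _ _ => Complex.normSq_nonneg _) (Finset.mem_univ (irrOne A))
  simp only [hw.one, map_one] at this
  linarith

lemma IsChar.dual_eq {w : Irr A → ℂ} (hw : IsChar w) (Y : Irr A) : w (dual Y) = conj (w Y) := by
  have h := isSub_univ.mul_sum_eq R hw hw (Finset.mem_univ Y)
  rw [mul_right_cancel₀ (sum_normSq_ne_zero hw) h, Complex.conj_conj]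

lemma IsSub.orthogonal {L : Finset (Irr A)} (hL : IsSub L) {w w' : Irr A → ℂ} (hw : IsChar w)
    (hw' : IsChar w') {Y : Irr A} (hY : Y ∈ L) (hne : w Y ≠ w' Y) :
    ∑ X ∈ L, w X * conj (w' X) = 0 := by
  have h := hL.mul_sum_eq R hw hw' hY
  rw [hw'.dual_eq R, Complex.conj_conj] at h
  by_contra h0
  exact hne (mul_right_cancel₀ h0 h)

lemma IsChar.norm_le {w : Irr A → ℂ} (hw : IsChar w) (Y : Irr A) : ‖w Y‖ ≤ deg Y := by
  have hne : (Finset.univ : Finset (Irr A)).Nonempty := ⟨irrOne A, Finset.mem_univ _⟩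
  obtain ⟨X, -, hX⟩ := Finset.exists_max_image Finset.univ (fun X : Irr A => ‖w X‖ / deg X) hne
  have hd : ∀ Z : Irr A, (0 : ℝ) < deg Z := fun Z => by exact_mod_cast deg_pos Z
  set m := ‖w X‖ / deg X with hm
  have hle : ∀ Z, ‖w Z‖ ≤ m * deg Z := fun Z => (div_le_iff₀ (hd Z)).1 (hX Z (Finset.mem_univ Z))
  have hm0 : 0 ≤ m := div_nonneg (norm_nonneg _) (hd X).le
  have h1 : ‖w X‖ * ‖w X‖ ≤ m * (deg X * deg X) := by
    calc ‖w X‖ * ‖w X‖ = ‖w X * w (dual X)‖ := by rw [norm_mul, hw.dual_eq R, Complex.norm_conj]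
      _ ≤ ∑ Z, ‖fus X (dual X) Z * w Z‖ := by rw [hw.mul]; exact norm_sum_le _ _
      _ ≤ ∑ Z, fus X (dual X) Z * (m * deg Z) := by
          refine Finset.sum_le_sum fun Z _ => ?_
          rw [norm_mul, Complex.norm_natCast]
          exact mul_le_mul_of_nonneg_left (hle Z) (Nat.cast_nonneg _)
      _ = m * ((∑ Z, fus X (dual X) Z * deg Z : ℕ) : ℝ) := by
          push_cast; rw [Finset.mul_sum]
          exact Finset.sum_congr rfl fun Z _ => by ring
      _ = _ := by rw [sum_fus_mul_deg, deg_dual]; push_cast; ring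
  have hwX : ‖w X‖ = m * deg X := by rw [hm, div_mul_cancel₀ _ (hd X).ne']
  have hm1 : m ≤ 1 := by
    rw [hwX] at h1
    by_contra! hlt
    have : 0 < m * (deg X * deg X) := by have := hd X; positivity
    nlinarith
  calc ‖w Y‖ ≤ m * deg Y := hle Y
    _ ≤ 1 * deg Y := mul_le_mul_of_nonneg_right hm1 (hd Y).le
    _ = _ := one_mul _

lemma IsChar.eq_deg_of_fus {w : Irr A → ℂ} (hw : IsChar w) {X Y Z : Irr A}
    (h : w X * w Y = deg X * deg Y) (hN : fus X Y Z ≠ 0) : w Z = deg Z := by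
  have h1 : ∑ Z, (fus X Y Z : ℝ) * (deg Z - (w Z).re) = 0 := by
    have e1 := congrArg Complex.re (hw.mul X Y)
    rw [h] at e1
    have e2 : ((∑ Z, fus X Y Z * deg Z : ℕ) : ℝ) = deg X * deg Y := by
      rw [sum_fus_mul_deg]; push_cast; rfl
    simp only [mul_sub, Finset.sum_sub_distrib]
    push_cast at e2
    rw [e2, sub_eq_zero]
    have e3 : ((deg X : ℂ) * deg Y).re = deg X * deg Y := by
      rw [← Nat.cast_mul, Complex.natCast_re]; push_cast; rfl
    rw [← e3, e1, Complex.re_sum]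
    refine Finset.sum_congr rfl fun Z _ => ?_
    rw [← Complex.ofReal_natCast, Complex.re_ofReal_mul]
  have hnn : ∀ Z, 0 ≤ (deg Z : ℝ) - (w Z).re := fun Z =>
    sub_nonneg.2 ((Complex.re_le_norm _).trans (hw.norm_le R Z))
  have h2 := (Finset.sum_eq_zero_iff_of_nonneg fun Z _ =>
    mul_nonneg (Nat.cast_nonneg (fus X Y Z)) (hnn Z)).1 h1 Z (Finset.mem_univ Z)
  have hre : (w Z).re = deg Z := by
    rcases mul_eq_zero.1 h2 with h | h
    · exact absurd (by exact_mod_cast h) hN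
    · linarith
  have hnorm : (w Z).re = ‖w Z‖ :=
    le_antisymm (Complex.re_le_norm _) (by rw [hre]; exact hw.norm_le R Z)
  have := Complex.re_eq_norm.1 hnorm
  apply Complex.ext
  · rw [hre, Complex.natCast_re]
  · rw [← (Complex.nonneg_iff.1 this).2, Complex.natCast_im]

lemma IsChar.isSub_ker {w : Irr A → ℂ} (hw : IsChar w) :
    IsSub (Finset.univ.filter fun X => w X = deg X) where
  one_mem := by simp [hw.one]
  dual_mem X hX := by
    simp only [Finset.mem_filter, Finset.mem_univ, true_and] at *
    rw [hw.dual_eq R, hX]; simp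
  fus_mem X hX Y hY Z hZ := by
    simp only [Finset.mem_filter, Finset.mem_univ, true_and] at *
    exact hw.eq_deg_of_fus R (by rw [hX, hY]) hZ

end QT

namespace QT

variable (R : QT A)

/-- `ω_X(Y) = s_{XY} / d_X`. -/
def om (X Y : Irr A) : ℂ := R.smat X Y / deg X

lemma smat_eq_om (X Y : Irr A) : R.smat X Y = deg X * R.om X Y := by
  rw [om, mul_div_cancel₀ _ (deg_ne_zero X)]

lemma isChar_om (X : Irr A) : IsChar (R.om X) where
  one := by rw [om, smat_comm, smat_one, div_self (deg_ne_zero X)]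
  mul Y Y' := by
    have h := R.smat_mul Y Y' X
    have hd := deg_ne_zero X
    simp only [om, R.smat_comm X]
    rw [div_mul_div_comm, h, mul_div_mul_left _ _ hd, Finset.sum_div]
    simp only [mul_div_assoc]

/-- The centralizer. -/
def cent (L : Finset (Irr A)) : Finset (Irr A) :=
  Finset.univ.filter fun Y => ∀ X ∈ L, R.om X Y = deg Y

lemma mem_cent {L : Finset (Irr A)} {Y : Irr A} : Y ∈ R.cent L ↔ ∀ X ∈ L, R.om X Y = deg Y := by
  simp [cent]

lemma om_eq_deg_iff (X Y : Irr A) : R.om X Y = deg Y ↔ R.smat X Y = deg X * deg Y := by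
  rw [smat_eq_om]
  exact ⟨fun h => by rw [h], fun h => mul_left_cancel₀ (deg_ne_zero X) h⟩

lemma om_eq_deg_comm {X Y : Irr A} : R.om X Y = deg Y ↔ R.om Y X = deg X := by
  rw [om_eq_deg_iff, om_eq_deg_iff, smat_comm, mul_comm]

lemma isSub_cent (L : Finset (Irr A)) : IsSub (R.cent L) where
  one_mem := R.mem_cent.2 fun X _ => by rw [(R.isChar_om X).one]; simp
  dual_mem Y hY := R.mem_cent.2 fun X hX => by
    have := (R.isChar_om X).isSub_ker R |>.dual_mem Y (by simpa using R.mem_cent.1 hY X hX)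
    simpa using this
  fus_mem Y hY Y' hY' Z hZ := R.mem_cent.2 fun X hX => by
    have := (R.isChar_om X).isSub_ker R |>.fus_mem Y (by simpa using R.mem_cent.1 hY X hX)
      Y' (by simpa using R.mem_cent.1 hY' X hX) Z hZ
    simpa using this

lemma sum_om_mul_deg {L : Finset (Irr A)} (hL : IsSub L) (X : Irr A) :
    ∑ Y ∈ L, R.om X Y * deg Y = if X ∈ R.cent L then ((∑ Y ∈ L, deg Y ^ 2 : ℕ) : ℂ) else 0 := by
  split_ifs with h
  · push_cast
    refine Finset.sum_congr rfl fun Y hY => ?_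
    rw [R.om_eq_deg_comm.1 (R.mem_cent.1 h Y hY), sq]
  · rw [mem_cent] at h
    push Not at h
    obtain ⟨Y, hY, hne⟩ := h
    have := hL.orthogonal R (R.isChar_om X) isChar_deg hY (fun h => hne (R.om_eq_deg_comm.1 h))
    simpa using this

variable (hR : Function.Injective R.drin)
include hR

lemma sum_smat_conj {X X' : Irr A} (hne : X ≠ X') :
    ∑ Y, R.smat X Y * conj (R.smat X' Y) = 0 := by
  obtain ⟨Y, hY⟩ : ∃ Y, R.om X Y ≠ R.om X' Y := by
    by_contra! h
    exact hne (R.smat_injective hR h)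
  have h := isSub_univ.orthogonal R (R.isChar_om X) (R.isChar_om X') (Finset.mem_univ Y) hY
  simp_rw [R.smat_eq_om]
  have e : ∀ Z, (deg X : ℂ) * R.om X Z * conj (deg X' * R.om X' Z) =
      deg X * deg X' * (R.om X Z * conj (R.om X' Z)) := by
    intro Z; rw [map_mul, Complex.conj_natCast]; ring
  simp_rw [e, ← Finset.mul_sum, h, mul_zero]

lemma sum_smat_normSq (X : Irr A) :
    ∑ Y, R.smat X Y * conj (R.smat X Y) = Module.finrank ℂ A := by
  let c : Irr A → ℂ := fun X => ∑ Y, R.smat X Y * conj (R.smat X Y)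
  let S : Matrix (Irr A) (Irr A) ℂ := Matrix.of R.smat
  have h1 : S * S.conjTranspose = Matrix.diagonal c := by
    ext X X'
    rw [Matrix.mul_apply, Matrix.diagonal_apply]
    split_ifs with h
    · subst h; rfl
    · exact R.sum_smat_conj hR h
  have h2 : S.conjTranspose * S = Matrix.diagonal c := by
    ext X X'
    rw [Matrix.mul_apply, Matrix.diagonal_apply]
    have : ∀ Y, S.conjTranspose X Y * S Y X' = R.smat X' Y * conj (R.smat X Y) := by
      intro Y
      change conj (R.smat Y X) * R.smat Y X' = _
      rw [R.smat_comm Y X, R.smat_comm Y X', mul_comm]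
    simp_rw [this]
    split_ifs with h
    · subst h; rfl
    · exact R.sum_smat_conj hR (Ne.symm h)
  have h3 : S * Matrix.diagonal c = Matrix.diagonal c * S := by
    rw [← h2, ← mul_assoc, h1, h2]
  have h4 := congrFun (congrFun h3 (irrOne A)) X
  rw [Matrix.mul_diagonal, Matrix.diagonal_mul] at h4
  change R.smat (irrOne A) X * c X = c (irrOne A) * R.smat (irrOne A) X at h4
  rw [smat_one, mul_comm] at h4
  have h5 := mul_right_cancel₀ (deg_ne_zero X) h4
  have h6 : c (irrOne A) = Module.finrank ℂ A := by
    simp only [c, smat_one]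
    rw [finrank_eq_sum_deg_sq]
    push_cast
    refine Finset.sum_congr rfl fun Y _ => ?_
    rw [Complex.conj_natCast, sq]
  rw [← h6, ← h5]

lemma sum_om_normSq (X : Irr A) :
    ∑ Y, R.om X Y * conj (R.om X Y) = Module.finrank ℂ A / (deg X : ℂ) ^ 2 := by
  rw [← R.sum_smat_normSq hR X, Finset.sum_div]
  refine Finset.sum_congr rfl fun Y _ => ?_
  rw [om, map_div₀, Complex.conj_natCast]
  field_simp

omit hR in
lemma isIntegral_om (X Y : Irr A) : IsIntegral ℤ (R.om X Y) :=
  isIntegral_of_isChar (R.isChar_om X) Y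

omit hR in
lemma isIntegral_conj_om (X Y : Irr A) : IsIntegral ℤ (conj (R.om X Y)) := by
  rw [← (R.isChar_om X).dual_eq R]; exact R.isIntegral_om X _

lemma dim_mul_dim_cent {L : Finset (Irr A)} (hL : IsSub L) :
    (∑ X ∈ L, deg X ^ 2) * ∑ X ∈ R.cent L, deg X ^ 2 = Module.finrank ℂ A := by
  have h1 : ∑ X, (deg X : ℂ) * ∑ Y ∈ L, R.smat X Y * deg Y =
      ((∑ X ∈ L, deg X ^ 2 : ℕ) : ℂ) * ((∑ X ∈ R.cent L, deg X ^ 2 : ℕ) : ℂ) := by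
    have : ∀ X, (deg X : ℂ) * ∑ Y ∈ L, R.smat X Y * deg Y =
        if X ∈ R.cent L then ((∑ Y ∈ L, deg Y ^ 2 : ℕ) : ℂ) * deg X ^ 2 else 0 := by
      intro X
      simp_rw [R.smat_eq_om, mul_assoc, ← Finset.mul_sum, R.sum_om_mul_deg hL]
      split_ifs
      · ring
      · simp
    simp_rw [this]
    rw [Finset.sum_ite_mem, Finset.univ_inter, ← Finset.mul_sum]
    push_cast; rfl
  have h2 : ∑ X, (deg X : ℂ) * ∑ Y ∈ L, R.smat X Y * deg Y = Module.finrank ℂ A := by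
    simp_rw [Finset.mul_sum]
    rw [Finset.sum_comm, Finset.sum_eq_single_of_mem (irrOne A) hL.one_mem]
    · rw [finrank_eq_sum_deg_sq]
      push_cast
      refine Finset.sum_congr rfl fun X _ => ?_
      rw [smat_comm, smat_one, deg_irrOne]; push_cast; ring
    · intro Y _ hY
      have h := R.sum_smat_conj hR hY
      simp only [smat_one, Complex.conj_natCast] at h
      calc _ = deg Y * ∑ X, R.smat Y X * deg X := by
            rw [Finset.mul_sum]
            exact Finset.sum_congr rfl fun X _ => by rw [R.smat_comm X Y]; ring
        _ = 0 := by rw [h, mul_zero]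
  rw [h1] at h2
  exact_mod_cast h2

omit hR in
/-- The number field generated by the values of a character. -/
lemma exists_field (w : Irr A → ℂ) (hw : IsChar w) :
    ∃ K : IntermediateField ℚ ℂ, FiniteDimensional ℚ K ∧ ∀ X, w X ∈ K := by
  refine ⟨IntermediateField.adjoin ℚ (Set.range w), ?_, fun X =>
    IntermediateField.subset_adjoin ℚ _ ⟨X, rfl⟩⟩
  have := Set.finite_range w
  refine IntermediateField.finiteDimensional_adjoin (S := Set.range w) ?_
  rintro _ ⟨X, rfl⟩
  exact (isIntegral_of_isChar hw X).tower_top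

omit hR in
/-- If `d_X` and `d_Y` are coprime then `s_{XY}` is zero or of maximal modulus. -/
lemma norm_om_of_coprime {X Y : Irr A} (hc : (deg X).Coprime (deg Y)) (hs : R.smat X Y ≠ 0) :
    ‖R.om X Y‖ = deg Y := by
  refine le_antisymm ((R.isChar_om X).norm_le R Y) ?_
  obtain ⟨K, hfd, hK⟩ := exists_field _ (R.isChar_om X)
  have hdX := deg_ne_zero X
  have hdY := deg_ne_zero Y
  have hintg : IsIntegral ℤ (R.om X Y / deg Y) := by
    obtain ⟨u, v, huv⟩ : ∃ u v : ℤ, u * deg X + v * deg Y = 1 :=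
      ⟨(deg X).gcdA (deg Y), (deg X).gcdB (deg Y), by
        have := Nat.gcd_eq_gcd_ab (deg X) (deg Y)
        rw [hc] at this; push_cast at this; linarith⟩
    have huv' : (u : ℂ) * deg X + v * deg Y = 1 := by exact_mod_cast huv
    have e : R.om X Y / deg Y = u * R.om Y X + v * R.om X Y := by
      have h1 : R.om Y X = deg X * R.om X Y / deg Y := by
        rw [← smat_eq_om, om, R.smat_comm]
      rw [h1]
      calc R.om X Y / deg Y = (u * deg X + v * deg Y) * (R.om X Y / deg Y) := by rw [huv', one_mul]
        _ = _ := by field_simp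
    rw [e]
    have hz : ∀ z : ℤ, IsIntegral ℤ (z : ℂ) := fun z => isIntegral_algebraMap (x := z)
    exact ((hz u).mul (R.isIntegral_om Y X)).add ((hz v).mul (R.isIntegral_om X Y))
  let x : K := ⟨R.om X Y, hK Y⟩ / (deg Y : K)
  have hx : (x : ℂ) = R.om X Y / deg Y := by simp [x]
  have hx0 : x ≠ 0 := by
    intro h0
    have : (x : ℂ) = 0 := by rw [h0]; rfl
    rw [hx, div_eq_zero_iff, or_iff_left hdY] at this
    exact hs (by rw [smat_eq_om, this, mul_zero])
  have hdpos : (0 : ℝ) < deg Y := by exact_mod_cast deg_pos Y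
  have h := one_le_norm_of_embeddings K hx0 (by rw [hx]; exact hintg) (fun φ => by
    have h1 := ((R.isChar_om X).comp K hK φ).norm_le R Y
    simp only [x, map_div₀, map_natCast, norm_div, Complex.norm_natCast]
    exact (div_le_one hdpos).2 h1)
  rw [hx, norm_div, Complex.norm_natCast, le_div_iff₀ hdpos, one_mul] at h
  exact h

/-- Vanishing of `s_{XY}` when `n / d_X` and `n / d_Y` are coprime. -/
lemma smat_eq_zero_of_coprime {n : ℕ} (hn : Module.finrank ℂ A = n ^ 2) {X Y : Irr A} {a b : ℕ}
    (ha : deg X * a = n) (hb : deg Y * b = n) (hab : a.Coprime b) (hY : Y ≠ irrOne A) :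
    R.smat X Y = 0 := by
  by_contra hs
  obtain ⟨K, hfd, hK⟩ := exists_field _ (R.isChar_om X)
  have hdX := deg_ne_zero X
  have hdY := deg_ne_zero Y
  have hn0 : (n : ℂ) ≠ 0 := by
    have : cointg A (1 : A) ≠ 0 := cointg_one_ne_zero
    rw [cointg_one, hn] at this
    push_cast at this
    exact fun h => this (by rw [h]; ring)
  have ha' : (deg X : ℂ) * a = n := by exact_mod_cast ha
  have hb' : (deg Y : ℂ) * b = n := by exact_mod_cast hb
  have hintg : IsIntegral ℤ (deg X * R.om X Y / n) := by
    obtain ⟨u, v, huv⟩ : ∃ u v : ℤ, u * a + v * b = 1 :=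
      ⟨a.gcdA b, a.gcdB b, by
        have := Nat.gcd_eq_gcd_ab a b
        rw [hab] at this; push_cast at this; linarith⟩
    have huv' : (u : ℂ) * a + v * b = 1 := by exact_mod_cast huv
    have e : deg X * R.om X Y / n = u * R.om X Y + v * R.om Y X := by
      have h1 : R.om Y X = deg X * R.om X Y / deg Y := by
        rw [← smat_eq_om, om, R.smat_comm]
      rw [h1]
      calc deg X * R.om X Y / n = (u * a + v * b) * (deg X * R.om X Y / n) := by
            rw [huv', one_mul]
        _ = u * (R.om X Y * (deg X * a) / n) + v * (deg X * R.om X Y / deg Y * (deg Y * b) / n) := by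
            field_simp
        _ = _ := by rw [ha', hb', mul_div_assoc, div_self hn0, mul_div_assoc _ (n : ℂ) n,
                      div_self hn0, mul_one, mul_one]
    rw [e]
    have hz : ∀ z : ℤ, IsIntegral ℤ (z : ℂ) := fun z => isIntegral_algebraMap (x := z)
    exact ((hz u).mul (R.isIntegral_om X Y)).add ((hz v).mul (R.isIntegral_om Y X))
  let x : K := (deg X : K) * ⟨R.om X Y, hK Y⟩ / (n : K)
  have hx : (x : ℂ) = deg X * R.om X Y / n := by simp [x]
  have hx0 : x ≠ 0 := by
    intro h0
    have : (x : ℂ) = 0 := by rw [h0]; rfl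
    rw [hx, ← smat_eq_om, div_eq_zero_iff, or_iff_left hn0] at this
    exact hs this
  obtain ⟨φ, hφ⟩ := exists_one_le_embedding K hx0 (by rw [hx]; exact hintg)
  have hch := (R.isChar_om X).comp K hK φ
  set w : Irr A → ℂ := fun Z => φ ⟨R.om X Z, hK Z⟩ with hw
  have hsum : ∑ Z, w Z * conj (w Z) = n ^ 2 / (deg X : ℂ) ^ 2 := by
    have h1 : ∑ Z, (⟨R.om X Z, hK Z⟩ * ⟨R.om X (dual Z), hK (dual Z)⟩ : K) =
        (n : K) ^ 2 / (deg X : K) ^ 2 := by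
      apply Subtype.ext
      have h2 := R.sum_om_normSq hR X
      rw [hn] at h2
      push_cast at h2 ⊢
      simpa [(R.isChar_om X).dual_eq R] using h2
    have h3 := congrArg φ h1
    simp only [map_sum, map_mul, map_div₀, map_pow, map_natCast] at h3
    rw [← h3]
    exact Finset.sum_congr rfl fun Z _ => by rw [← hch.dual_eq R]
  have hsum' : ∑ Z, ‖w Z‖ ^ 2 = (n : ℝ) ^ 2 / (deg X : ℝ) ^ 2 := by
    simp_rw [Complex.mul_conj, Complex.normSq_eq_norm_sq] at hsum
    apply Complex.ofReal_injective
    push_cast at hsum ⊢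
    exact hsum
  have hle : ‖w Y‖ ^ 2 + 1 ≤ ∑ Z, ‖w Z‖ ^ 2 := by
    have h1 := Finset.add_le_sum (f := fun Z => ‖w Z‖ ^ 2) (s := Finset.univ)
      (fun Z _ => sq_nonneg ‖w Z‖) (Finset.mem_univ Y) (Finset.mem_univ (irrOne A)) hY
    rwa [hch.one, norm_one, one_pow] at h1
  have hdpos : (0 : ℝ) < deg X := by exact_mod_cast deg_pos X
  have hnpos : (0 : ℝ) < n := by
    have : n ≠ 0 := by exact_mod_cast hn0
    exact_mod_cast Nat.pos_of_ne_zero this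
  have hxn : ‖φ x‖ = deg X * ‖w Y‖ / n := by
    simp only [x, map_div₀, map_mul, map_natCast, norm_div, norm_mul, Complex.norm_natCast]
    rfl
  rw [hxn, le_div_iff₀ hnpos, one_mul] at hφ
  rw [hsum', le_div_iff₀ (by positivity)] at hle
  nlinarith

end QT

end FinHopf

namespace FinHopf

open scoped ComplexConjugate

variable {A : Type*} [Ring A] [HopfAlgebra ℂ A] [FiniteDimensional ℂ A] [IsSemisimpleRing A]

lemma exists_fus_ne_zero (X Y : Irr A) : ∃ Z, fus X Y Z ≠ 0 := by
  by_contra! h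
  have := sum_fus_mul_deg X Y
  simp only [h, zero_mul, Finset.sum_const_zero] at this
  exact (Nat.mul_pos (deg_pos X) (deg_pos Y)).ne this

lemma deg_eq_one_of_fus_dual {X : Irr A} (h : ∀ W, fus X (dual X) W ≠ 0 → W = irrOne A) :
    deg X = 1 := by
  have h1 := sum_fus_mul_deg X (dual X)
  rw [Finset.sum_eq_single (irrOne A), fus_irrOne, if_pos rfl, deg_irrOne, deg_dual] at h1
  · exact Nat.eq_one_of_mul_eq_one_left h1.symm
  · intro W _ hW
    have : fus X (dual X) W = 0 := by by_contra hne; exact hW (h W hne)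
    rw [this, zero_mul]
  · simp

variable (A) in
/-- The invertible simple objects. -/
def invs : Finset (Irr A) := Finset.univ.filter fun X => deg X = 1

lemma mem_invs {X : Irr A} : X ∈ invs A ↔ deg X = 1 := by simp [invs]

lemma isSub_invs : IsSub (invs A) where
  one_mem := by simp [mem_invs]
  dual_mem X hX := by simpa [mem_invs] using hX
  fus_mem X hX Y hY Z hZ := by
    rw [mem_invs] at *
    have h := Finset.single_le_sum (f := fun Z => fus X Y Z * deg Z) (fun _ _ => Nat.zero_le _)
      (Finset.mem_univ Z)
    simp only [sum_fus_mul_deg, hX, hY] at h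
    have := deg_pos Z
    have := Nat.pos_of_ne_zero hZ
    nlinarith

lemma sum_deg_sq_invs : ∑ X ∈ invs A, deg X ^ 2 = (invs A).card := by
  rw [Finset.card_eq_sum_ones]
  exact Finset.sum_congr rfl fun X hX => by rw [mem_invs.1 hX, one_pow]

namespace QT

variable (R : QT A)

lemma th_ne_zero (X : Irr A) : R.th X ≠ 0 := by
  intro h0
  have h1 := conv_chi_mul_cidem X (dual X) (irrOne A) R.twist_central
  rw [fus_irrOne, if_pos rfl, chi_twist, th_one] at h1
  change tform (chi X) (chi (dual X)) (comul (R := ℂ) _) = _ at h1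
  rw [Bialgebra.comul_mul, comul_twist, mul_assoc,
    tform_central_mul R.twist_central R.twist_central] at h1
  change R.th X * _ * _ = _ at h1
  rw [h0] at h1
  simp at h1

section symm

variable {L : Finset (Irr A)} (hL : IsSub L) (hs : ∀ X ∈ L, ∀ Y ∈ L, R.om X Y = deg Y)
include hL hs

lemma th_mul_of_symm {X Y Z : Irr A} (hX : X ∈ L) (hY : Y ∈ L) (hN : fus X Y Z ≠ 0) :
    R.th Z = R.th X * R.th Y := by
  obtain ⟨I, _, _, hI⟩ := exists_hopfIdeal hL
  have hm : (R.map (quo I) quo_surjective).mono = 1 := mono_eq_one_of_smat _ fun i j => by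
    rw [smat_pull, (R.om_eq_deg_iff _ _).1 (hs _ ((mem_iff_exists_pull hI _).2 ⟨i, rfl⟩) _
      ((mem_iff_exists_pull hI _).2 ⟨j, rfl⟩)), deg_pull, deg_pull]
  obtain ⟨i, rfl⟩ := (mem_iff_exists_pull hI X).1 hX
  obtain ⟨j, rfl⟩ := (mem_iff_exists_pull hI Y).1 hY
  obtain ⟨k, rfl⟩ := (mem_iff_exists_pull hI Z).1 (hL.fus_mem _ hX _ hY _ hN)
  rw [fus_pull_pull] at hN
  rw [← th_pull, ← th_pull, ← th_pull]
  exact th_mul_of_mono_eq_one _ hm hN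

lemma exists_invertible_of_symm (ht : ∀ X ∈ L, R.th X = 1)
    (hsq : Squarefree (∑ X ∈ L, deg X ^ 2)) (h1 : ∑ X ∈ L, deg X ^ 2 ≠ 1) :
    ∃ X ∈ L, X ≠ irrOne A ∧ deg X = 1 := by
  obtain ⟨I, _, _, hI⟩ := exists_hopfIdeal hL
  have hmem : ∀ i, pull (quo I) quo_surjective i ∈ L := fun i =>
    (mem_iff_exists_pull hI _).2 ⟨i, rfl⟩
  set R' := R.map (quo I) quo_surjective
  have hm : R'.mono = 1 := mono_eq_one_of_smat _ fun i j => by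
    rw [smat_pull, (R.om_eq_deg_iff _ _).1 (hs _ (hmem i) _ (hmem j)), deg_pull, deg_pull]
  have htw : R'.twist = 1 := by
    refine eq_of_central_of_chi R'.twist_central (by simp) fun i => ?_
    rw [chi_twist, th_pull, ht _ (hmem i), one_mul, chi_one]
  rw [← finrank_quotient hI] at hsq h1
  obtain ⟨η, hη⟩ := R'.exists_algHom_ne_counit hm htw hsq h1
  obtain ⟨i, hi, h⟩ := exists_chi_eq_of_algHom η
  refine ⟨pull (quo I) quo_surjective i, hmem i, fun hone => hη ?_, by rw [deg_pull, hi]⟩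
  rw [← pull_irrOne (quo I) quo_surjective] at hone
  have := pull_injective _ _ hone
  ext x
  rw [h, this, chi_irrOne]; rfl

end symm

variable (hR : Function.Injective R.drin)

section analysis

variable (hiso : ∀ g : Irr A, deg g = 1 → R.th g = 1 → g = irrOne A)
include hiso

lemma th_invs_mul {f Y W : Irr A} (hf : f ∈ invs A) (hY : Y ∈ R.cent (invs A))
    (hN : fus f Y W ≠ 0) : R.th W = R.th f * R.th Y := by
  have h := R.th_fus (mem_invs.1 hf) hN
  rw [(R.om_eq_deg_iff _ _).1 (R.mem_cent.1 hY f hf), mem_invs.1 hf] at h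
  apply mul_right_cancel₀ (deg_ne_zero Y)
  rw [h]; push_cast; ring

lemma th_eq_neg_one {f : Irr A} (hf : f ∈ invs A) (hf' : f ∈ R.cent (invs A))
    (hne : f ≠ irrOne A) : R.th f = -1 := by
  have h := R.th_invs_mul hiso (W := irrOne A) hf ((R.isSub_cent _).dual_mem f hf')
    (by rw [fus_irrOne, if_pos rfl]; exact one_ne_zero)
  rw [th_one, th_dual] at h
  rcases mul_self_eq_one_iff.1 h.symm with h1 | h1
  · exact absurd (hiso f (mem_invs.1 hf) h1) hne
  · exact h1

lemma eq_of_mem_invs_cent {f g : Irr A} (hf : f ∈ invs A) (hf' : f ∈ R.cent (invs A))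
    (hfne : f ≠ irrOne A) (hg : g ∈ invs A) (hg' : g ∈ R.cent (invs A)) (hgne : g ≠ irrOne A) :
    f = g := by
  have key : ∀ g : Irr A, g ∈ invs A → g ∈ R.cent (invs A) → g ≠ irrOne A → g = dual f := by
    intro g hg hg' hgne
    obtain ⟨W, hW⟩ := exists_fus_ne_zero f g
    have h1 := R.th_invs_mul hiso hf hg' hW
    rw [R.th_eq_neg_one hiso hf hf' hfne, R.th_eq_neg_one hiso hg hg' hgne] at h1
    have h2 := hiso W (mem_invs.1 (isSub_invs.fus_mem f hf g hg W hW)) (by rw [h1]; ring)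
    rw [h2, fus_irrOne] at hW
    by_contra hne
    simp [hne] at hW
  rw [key f hf hf' hfne, key g hg hg' hgne]

lemma fus_self_eq_zero {f Y : Irr A} (hf : f ∈ invs A) (hf' : f ∈ R.cent (invs A))
    (hY : Y ∈ R.cent (invs A)) (hN : fus f Y Y ≠ 0) : f = irrOne A := by
  by_contra hne
  have h := R.th_invs_mul hiso hf hY hN
  rw [R.th_eq_neg_one hiso hf hf' hne] at h
  have h0 : R.th Y = 0 := by linear_combination h / 2
  exact R.th_ne_zero Y h0

lemma eq_one_of_fus_dual {X Z : Irr A} (hX : X ∈ R.cent (invs A)) (hZ : Z ∈ invs A)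
    (hN : fus X (dual X) Z ≠ 0) : Z = irrOne A := by
  have hdX := (R.isSub_cent _).dual_mem X hX
  have hZ' := (R.isSub_cent _).fus_mem X hX _ hdX Z hN
  rw [R.fus_frobenius, R.fus_comm] at hN
  exact R.fus_self_eq_zero hiso hZ hZ' hdX hN

lemma card_inter_le_two {L : Finset (Irr A)} (hLK : L ⊆ R.cent (invs A)) :
    (L ∩ invs A).card ≤ 2 := by
  by_contra! h
  obtain ⟨f, hf, hf1⟩ : ∃ f ∈ (L ∩ invs A).erase (irrOne A), True := by
    have : 0 < ((L ∩ invs A).erase (irrOne A)).card := by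
      have := Finset.pred_card_le_card_erase (s := L ∩ invs A) (a := irrOne A); omega
    obtain ⟨f, hf⟩ := Finset.card_pos.1 this
    exact ⟨f, hf, trivial⟩
  have hsub : (L ∩ invs A).erase (irrOne A) ⊆ {f} := by
    intro g hg
    simp only [Finset.mem_erase, Finset.mem_inter] at hf hg
    rw [Finset.mem_singleton]
    exact R.eq_of_mem_invs_cent hiso hg.2.2 (hLK hg.2.1) hg.1 hf.2.2 (hLK hf.2.1) hf.1
  have h1 := Finset.card_le_card hsub
  have := Finset.pred_card_le_card_erase (s := L ∩ invs A) (a := irrOne A)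
  simp at h1
  omega

include hR

lemma not_cent_subset_invs {n : ℕ} (hn : Module.finrank ℂ A = n ^ 2) (h1 : 1 < n)
    (hG : (invs A).card ≤ n) : ¬ R.cent (invs A) ⊆ invs A := by
  intro hsub
  have hc := R.card_inter_le_two hiso (Finset.Subset.refl (R.cent (invs A)))
  rw [Finset.inter_eq_left.2 hsub] at hc
  have hdim := R.dim_mul_dim_cent hR (isSub_invs (A := A))
  have hK : ∑ X ∈ R.cent (invs A), deg X ^ 2 = (R.cent (invs A)).card := by
    rw [Finset.card_eq_sum_ones]
    exact Finset.sum_congr rfl fun X hX => by rw [mem_invs.1 (hsub hX), one_pow]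
  rw [sum_deg_sq_invs, hK, hn] at hdim
  have hn2 : n = 2 := by nlinarith
  subst hn2
  have hG2 : (invs A).card = 2 := by nlinarith
  have hsum := finrank_eq_sum_deg_sq A
  rw [hn] at hsum
  have hall : ∀ X : Irr A, deg X = 1 := by
    intro X
    by_contra hX
    have hX1 : X ≠ irrOne A := fun h => hX (by rw [h, deg_irrOne])
    have h3 := Finset.add_le_sum (f := fun Z : Irr A => deg Z ^ 2) (s := Finset.univ)
      (fun Z _ => Nat.zero_le _) (Finset.mem_univ X) (Finset.mem_univ (irrOne A)) hX1
    rw [← hsum, deg_irrOne] at h3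
    have := deg_pos X
    have : 2 ≤ deg X := by omega
    nlinarith
  have : (invs A) = Finset.univ := by ext X; simp [mem_invs, hall]
  rw [this] at hG2
  simp only [hall, one_pow, Finset.sum_const, smul_eq_mul, mul_one, hG2] at hsum
  omega

lemma not_symm {n : ℕ} (hn : Module.finrank ℂ A = n ^ 2) (hsq : Squarefree n)
    {L : Finset (Irr A)} (hL : IsSub L) (hLi : ¬ L ⊆ invs A)
    (hmin : ∀ M, IsSub M → M ⊆ L → M ≠ L → M ⊆ invs A) : ¬ L ⊆ R.cent L := by
  intro hsymm
  have hs : ∀ X ∈ L, ∀ Y ∈ L, R.om X Y = deg Y := fun X hX Y hY => R.mem_cent.1 (hsymm hY) X hX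
  have hth2 : ∀ X ∈ L, R.th X * R.th X = 1 := by
    intro X hX
    have := R.th_mul_of_symm hL hs hX (hL.dual_mem X hX) (Z := irrOne A)
      (by rw [fus_irrOne, if_pos rfl]; exact one_ne_zero)
    rw [th_one, th_dual] at this
    exact this.symm
  have hL0 : IsSub (L.filter fun X => R.th X = 1) :=
    { one_mem := by simp [hL.one_mem, th_one]
      dual_mem := fun X hX => by
        rw [Finset.mem_filter] at *
        exact ⟨hL.dual_mem X hX.1, by rw [th_dual, hX.2]⟩
      fus_mem := fun X hX Y hY Z hZ => by
        rw [Finset.mem_filter] at *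
        exact ⟨hL.fus_mem X hX.1 Y hY.1 Z hZ, by
          rw [R.th_mul_of_symm hL hs hX.1 hY.1 hZ, hX.2, hY.2, one_mul]⟩ }
  have hall : (L.filter fun X => R.th X = 1) = L := by
    by_contra hne
    have h1 := hmin _ hL0 (Finset.filter_subset _ _) hne
    refine hLi fun X hX => mem_invs.2 (deg_eq_one_of_fus_dual fun W hW => ?_)
    have hWt := R.th_mul_of_symm hL hs hX (hL.dual_mem X hX) hW
    rw [th_dual, hth2 X hX] at hWt
    have hWL := hL.fus_mem X hX _ (hL.dual_mem X hX) W hW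
    exact hiso W (mem_invs.1 (h1 (Finset.mem_filter.2 ⟨hWL, hWt⟩))) hWt
  have ht : ∀ X ∈ L, R.th X = 1 := fun X hX => by
    rw [← hall] at hX; exact (Finset.mem_filter.1 hX).2
  have hdim := R.dim_mul_dim_cent hR hL
  obtain ⟨c, hc⟩ := hL.dim_dvd R (R.isSub_cent L) hsymm
  rw [hc, hn, ← mul_assoc, ← sq] at hdim
  have hdvd : ∑ X ∈ L, deg X ^ 2 ∣ n := (Nat.pow_dvd_pow_iff two_ne_zero).1 ⟨c, hdim.symm⟩
  obtain ⟨X, hX, hX1, hXd⟩ := R.exists_invertible_of_symm hL hs ht (hsq.squarefree_of_dvd hdvd) (by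
    intro h1
    refine hLi fun X hX => mem_invs.2 ?_
    have := Finset.single_le_sum (f := fun X : Irr A => deg X ^ 2) (fun _ _ => Nat.zero_le _) hX
    simp only [h1] at this
    have := deg_pos X
    nlinarith)
  exact hX1 (hiso X hXd (ht X hX))

section minimal

variable {L : Finset (Irr A)} (hL : IsSub L) (hLK : L ⊆ R.cent (invs A))
  (hE : L ∩ R.cent L ⊆ invs A)
include hL hLK hE

omit hR in
lemma sum_om_normSq_sub {X : Irr A} (hX : X ∈ L) :
    ∑ Y ∈ L, R.om X Y * conj (R.om X Y) =
      ((∑ Y ∈ L, deg Y ^ 2 : ℕ) : ℂ) / ((deg X ^ 2 : ℕ) : ℂ) := by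
  have hdX := deg_ne_zero X
  have e : ∀ Y, R.smat X Y * R.smat (dual X) Y =
      (deg X : ℂ) ^ 2 * (R.om X Y * conj (R.om X Y)) := by
    intro Y
    have h1 : R.smat (dual X) Y = conj (R.smat X Y) := by
      rw [R.smat_comm (dual X), R.smat_comm X, R.smat_eq_om, R.smat_eq_om,
        (R.isChar_om Y).dual_eq R, map_mul, Complex.conj_natCast]
    rw [h1, R.smat_eq_om, map_mul, Complex.conj_natCast]; ring
  have h2 : ∑ Y ∈ L, R.smat X Y * R.smat (dual X) Y = ((∑ Y ∈ L, deg Y ^ 2 : ℕ) : ℂ) := by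
    simp_rw [R.smat_mul, Finset.mul_sum]
    rw [Finset.sum_comm]
    have h3 : ∀ Z, ∑ Y ∈ L, (deg Y : ℂ) * (fus X (dual X) Z * R.smat Z Y) =
        fus X (dual X) Z * deg Z *
          if Z ∈ R.cent L then ((∑ Y ∈ L, deg Y ^ 2 : ℕ) : ℂ) else 0 := by
      intro Z
      rw [← R.sum_om_mul_deg hL, Finset.mul_sum]
      refine Finset.sum_congr rfl fun Y _ => ?_
      rw [R.smat_eq_om]; ring
    simp_rw [h3]
    rw [Finset.sum_eq_single (irrOne A)]
    · rw [fus_irrOne, if_pos rfl, if_pos (R.isSub_cent L).one_mem]; simp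
    · intro Z _ hZ
      by_cases hN : fus X (dual X) Z = 0
      · simp [hN]
      · rw [if_neg, mul_zero]
        intro hc
        exact hZ (R.eq_one_of_fus_dual hiso (hLK hX) (hE (Finset.mem_inter.2
          ⟨hL.fus_mem X hX _ (hL.dual_mem X hX) Z hN, hc⟩)) hN)
    · simp
  simp_rw [e, ← Finset.mul_sum] at h2
  rw [← h2]
  push_cast
  field_simp

omit hR in
lemma deg_sq_dvd {X : Irr A} (hX : X ∈ L) : deg X ^ 2 ∣ ∑ Y ∈ L, deg Y ^ 2 := by
  refine dvd_of_isIntegral (pow_ne_zero 2 (deg_pos X).ne') ?_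
  rw [← R.sum_om_normSq_sub hiso hL hLK hE hX]
  exact IsIntegral.sum _ fun Y _ => (R.isIntegral_om X Y).mul (R.isIntegral_conj_om X Y)

omit hiso hR hE in
lemma om_invs {X Y : Irr A} (hX : X ∈ L) (hY : Y ∈ invs A) : R.om X Y = 1 := by
  have h := R.om_eq_deg_comm.1 (R.mem_cent.1 (hLK hX) Y hY)
  rw [h, mem_invs.1 hY, Nat.cast_one]

omit hR in
lemma dvd_card_inter_invs {X : Irr A} (hX : X ∈ L) (hXE : X ∉ R.cent L) {m : ℕ} (hm : m ≠ 0)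
    (h : ∀ Y ∈ L, deg Y ≠ 1 → m ∣ deg Y ∨ R.smat X Y = 0) : m ∣ (L ∩ invs A).card := by
  have h0 := R.sum_om_mul_deg hL X
  rw [if_neg hXE] at h0
  have hl0 : (m : ℂ) ≠ 0 := by exact_mod_cast hm
  rw [← Finset.sum_filter_add_sum_filter_not L (fun Y => Y ∈ invs A)] at h0
  have h1 : ∑ Y ∈ L.filter (fun Y => Y ∈ invs A), R.om X Y * deg Y = (L ∩ invs A).card := by
    rw [Finset.filter_mem_eq_inter, Finset.card_eq_sum_ones]
    push_cast
    refine Finset.sum_congr rfl fun Y hY => ?_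
    have hY' := (Finset.mem_inter.1 hY).2
    rw [R.om_invs hL hLK hX hY', mem_invs.1 hY']; simp
  rw [h1] at h0
  refine dvd_of_isIntegral hm ?_
  have : ((L ∩ invs A).card : ℂ) / m =
      -∑ Y ∈ L.filter (fun Y => Y ∉ invs A), R.om X Y * deg Y / m := by
    rw [← Finset.sum_div, eq_neg_of_add_eq_zero_left h0, neg_div]
  rw [this]
  refine (IsIntegral.sum _ fun Y hY => ?_).neg
  rw [Finset.mem_filter, mem_invs] at hY
  rcases h Y hY.1 hY.2 with ⟨c, hc⟩ | h2
  · have : R.om X Y * deg Y / m = R.om X Y * (c : ℤ) := by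
      rw [hc]; push_cast; field_simp
    rw [this]
    exact (R.isIntegral_om X Y).mul (isIntegral_algebraMap (x := (c : ℤ)))
  · have : R.om X Y = 0 := by rw [om, h2, zero_div]
    rw [this]; simpa using isIntegral_zero

/-- A simple object of prime degree `l` pairs nontrivially with a noninvertible simple object of
degree prime to `l`. -/
lemma exists_coprime {n : ℕ} (hn : Module.finrank ℂ A = n ^ 2) (hsq : Squarefree n)
    {X : Irr A} (hX : X ∈ L) {l : ℕ} (hl : l.Prime) (hXl : deg X = l) :
    ∃ Y ∈ L, ¬ l ∣ deg Y ∧ deg Y ≠ 1 ∧ R.smat X Y ≠ 0 := by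
  by_contra! hcon
  have hXE : X ∉ R.cent L := fun h => by
    have := mem_invs.1 (hE (Finset.mem_inter.2 ⟨hX, h⟩))
    rw [hXl] at this
    exact hl.one_lt.ne' this
  have hdvd : l ∣ (L ∩ invs A).card :=
    R.dvd_card_inter_invs hiso hL hLK hE hX hXE hl.ne_zero fun Y hY hY1 =>
      or_iff_not_imp_left.2 fun h => hcon Y hY h hY1
  have hone : 0 < (L ∩ invs A).card := Finset.card_pos.2
    ⟨irrOne A, Finset.mem_inter.2 ⟨hL.one_mem, isSub_invs.one_mem⟩⟩
  have hle := R.card_inter_le_two hiso hLK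
  have hl2 : l = 2 ∧ (L ∩ invs A).card = 2 := by
    have := Nat.le_of_dvd hone hdvd
    have := hl.two_le
    omega
  have hsub := hL.inter (isSub_invs (A := A))
  have hdim := R.dim_mul_dim_cent hR hsub
  have hcard : ∑ Y ∈ L ∩ invs A, deg Y ^ 2 = 2 := by
    rw [← hl2.2, Finset.card_eq_sum_ones]
    exact Finset.sum_congr rfl fun Y hY => by
      rw [mem_invs.1 (Finset.mem_inter.1 hY).2, one_pow]
  have hLM : L ⊆ R.cent (L ∩ invs A) := fun Y hY => R.mem_cent.2 fun g hg =>
    R.mem_cent.1 (hLK hY) g (Finset.mem_inter.1 hg).2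
  have hd1 := hL.dim_dvd R (R.isSub_cent _) hLM
  have hd2 := R.deg_sq_dvd hiso hL hLK hE hX
  rw [hXl, hl2.1] at hd2
  rw [hcard, hn] at hdim
  have h8 : 2 * 2 ^ 2 ∣ n ^ 2 := by
    rw [← hdim]; exact Nat.mul_dvd_mul_left 2 (hd2.trans hd1)
  have h4 : 2 * 2 ∣ n := by
    have h2n : 2 ∣ n := Nat.prime_two.dvd_of_dvd_pow (Dvd.dvd.trans ⟨4, by norm_num⟩ h8)
    obtain ⟨m, rfl⟩ := h2n
    have : 2 ∣ m ^ 2 := by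
      have h : 4 * 2 ∣ 4 * m ^ 2 := by
        have e : (2 * m) ^ 2 = 4 * m ^ 2 := by ring
        rw [← e]; exact h8
      exact (Nat.mul_dvd_mul_iff_left (by norm_num)).1 h
    exact Nat.mul_dvd_mul_left 2 (Nat.prime_two.dvd_of_dvd_pow this)
  exact absurd (Nat.isUnit_iff.1 (hsq 2 h4)) (by norm_num)

lemma not_prime_deg {n : ℕ} (hn : Module.finrank ℂ A = n ^ 2) (hsq : Squarefree n)
    (hmin : ∀ M, IsSub M → M ⊆ L → M ≠ L → M ⊆ invs A)
    {X : Irr A} (hX : X ∈ L) : ¬ (deg X).Prime := by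
  intro hl
  obtain ⟨Y, hY, hlY, hY1, hs⟩ := R.exists_coprime hR hiso hL hLK hE hn hsq hX hl rfl
  have hcop : (deg Y).Coprime (deg X) := ((Nat.Prime.coprime_iff_not_dvd hl).2 hlY).symm
  have hnorm := R.norm_om_of_coprime hcop (by rwa [R.smat_comm])
  have hM := hL.inter ((R.isChar_om Y).isSub_ker R)
  have hMi : L ∩ (Finset.univ.filter fun W => R.om Y W = deg W) ⊆ invs A := by
    refine hmin _ hM Finset.inter_subset_left fun heq => ?_
    have : Y ∈ R.cent L := R.mem_cent.2 fun W hW => by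
      rw [← heq] at hW
      simp only [Finset.mem_inter, Finset.mem_filter, Finset.mem_univ, true_and] at hW
      exact R.om_eq_deg_comm.1 hW.2
    exact hY1 (mem_invs.1 (hE (Finset.mem_inter.2 ⟨hY, this⟩)))
  have h1 : deg X = 1 := deg_eq_one_of_fus_dual fun W hW => by
    have hww : R.om Y X * R.om Y (dual X) = deg X * deg (dual X) := by
      rw [(R.isChar_om Y).dual_eq R, Complex.mul_conj, Complex.normSq_eq_norm_sq, hnorm, deg_dual]
      push_cast; ring
    have hW1 := (R.isChar_om Y).eq_deg_of_fus R hww hW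
    have hWL := hL.fus_mem X hX _ (hL.dual_mem X hX) W hW
    exact R.eq_one_of_fus_dual hiso (hLK hX) (hMi (by
      simp only [Finset.mem_inter, Finset.mem_filter, Finset.mem_univ, true_and]
      exact ⟨hWL, hW1⟩)) hW
  exact hl.one_lt.ne' h1

end minimal

end analysis

include hR in
/-- Under the numerical assumptions there is a nontrivial isotropic invertible object. -/
theorem exists_isotropic {n : ℕ} (hn : Module.finrank ℂ A = n ^ 2) (hsq : Squarefree n)
    (h1 : 1 < n) (h3 : n.primeFactors.card ≤ 3) (hG : (invs A).card ≤ n) :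
    ∃ g : Irr A, deg g = 1 ∧ R.th g = 1 ∧ g ≠ irrOne A := by
  by_contra! hiso
  obtain ⟨L, ⟨hL, hLK, hLi⟩, hLmin⟩ := (Finset.isWellFounded_ssubset (α := Irr A)).wf.has_min
    {L | IsSub L ∧ L ⊆ R.cent (invs A) ∧ ¬ L ⊆ invs A}
    ⟨_, R.isSub_cent _, Finset.Subset.refl _, R.not_cent_subset_invs hR hiso hn h1 hG⟩
  have hmin : ∀ M, IsSub M → M ⊆ L → M ≠ L → M ⊆ invs A := fun M hM hML hne => by
    by_contra hMi
    exact hLmin M ⟨hM, hML.trans hLK, hMi⟩ (hML.ssubset_of_ne hne)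
  have hE : L ∩ R.cent L ⊆ invs A := hmin _ (hL.inter (R.isSub_cent L)) Finset.inter_subset_left
    fun h => R.not_symm hR hiso hn hsq hL hLi hmin (Finset.inter_eq_left.1 h)
  have hnp : ∀ X ∈ L, ¬ (deg X).Prime := fun X hX =>
    R.not_prime_deg hR hiso hL hLK hE hn hsq hmin hX
  have hdL : ∑ X ∈ L, deg X ^ 2 ∣ n ^ 2 := by
    rw [← hn, finrank_eq_sum_deg_sq A]
    exact hL.dim_dvd R isSub_univ (Finset.subset_univ L)
  have hdn : ∀ X ∈ L, deg X ∣ n := fun X hX =>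
    (Nat.pow_dvd_pow_iff two_ne_zero).1 ((R.deg_sq_dvd hiso hL hLK hE hX).trans hdL)
  have hcard := R.card_inter_le_two hiso hLK
  have hpos : 0 < (L ∩ invs A).card := Finset.card_pos.2
    ⟨irrOne A, Finset.mem_inter.2 ⟨hL.one_mem, isSub_invs.one_mem⟩⟩
  obtain ⟨X, hX, hX1⟩ := Finset.not_subset.1 hLi
  obtain ⟨a, ha, haX⟩ := Nat.exists_prime_and_dvd (mt mem_invs.2 hX1)
  obtain ⟨Y, hY, hY1, haY⟩ : ∃ Y ∈ L, deg Y ≠ 1 ∧ ¬ a ∣ deg Y := by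
    by_contra! hcon
    have h2 : a ^ 2 ∣ ∑ X ∈ L, deg X ^ 2 :=
      (pow_dvd_pow_of_dvd haX 2).trans (R.deg_sq_dvd hiso hL hLK hE hX)
    rw [← Finset.sum_filter_add_sum_filter_not L (fun Y => Y ∈ invs A),
      Finset.filter_mem_eq_inter, Nat.dvd_add_left (Finset.dvd_sum fun Y hY => by
        rw [Finset.mem_filter, mem_invs] at hY
        exact pow_dvd_pow_of_dvd (hcon Y hY.1 hY.2) 2),
      Finset.sum_congr rfl (g := fun _ => 1) (fun Y hY => by
        rw [mem_invs.1 (Finset.mem_inter.1 hY).2, one_pow]), ← Finset.card_eq_sum_ones] at h2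
    have := Nat.le_of_dvd hpos h2
    have := ha.two_le
    nlinarith
  obtain ⟨b, hb, k, hk⟩ := Nat.exists_prime_and_dvd hY1
  obtain ⟨c, hc, hck⟩ := Nat.exists_prime_and_dvd (n := k) (by
    rintro rfl
    exact hnp Y hY (by rw [hk, mul_one]; exact hb))
  have hbcY : b * c ∣ deg Y := hk ▸ Nat.mul_dvd_mul_left b hck
  have hYn := hdn Y hY
  have hbc : b ≠ c := by
    rintro rfl
    exact hb.one_lt.ne' (Nat.isUnit_iff.1 (hsq b (hbcY.trans hYn)))
  have hab : a ≠ b := fun h => haY (h ▸ (Dvd.intro _ rfl).trans hbcY)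
  have hac : a ≠ c := fun h => haY (h ▸ (Dvd.intro_left _ rfl).trans hbcY)
  have hn0 : n ≠ 0 := by omega
  have hpf : {a, b, c} = n.primeFactors := by
    refine Finset.eq_of_subset_of_card_le ?_ (h3.trans ?_)
    · intro l hl
      simp only [Finset.mem_insert, Finset.mem_singleton] at hl
      rcases hl with rfl | rfl | rfl
      · exact Nat.mem_primeFactors.2 ⟨ha, haX.trans (hdn X hX), hn0⟩
      · exact Nat.mem_primeFactors.2 ⟨hb, (Dvd.intro _ rfl).trans (hbcY.trans hYn), hn0⟩
      · exact Nat.mem_primeFactors.2 ⟨hc, (Dvd.intro_left _ rfl).trans (hbcY.trans hYn), hn0⟩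
    · rw [Finset.card_eq_three.2 ⟨a, b, c, hab, hac, hbc, rfl⟩]
  have hnabc : n = a * (b * c) := by
    rw [← Nat.prod_primeFactors_of_squarefree hsq, ← hpf, Finset.prod_insert (by simp [hab, hac]),
      Finset.prod_insert (by simp [hbc]), Finset.prod_singleton]
  have hcop : ∀ W : Irr A, ¬ a ∣ deg W → deg W ∣ n → deg W ∣ b * c := fun W hW h =>
    Nat.Coprime.dvd_of_dvd_mul_left ((Nat.Prime.coprime_iff_not_dvd ha).2 hW).symm (hnabc ▸ h)
  have hYbc : deg Y = b * c := Nat.dvd_antisymm (hcop Y haY hYn) hbcY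
  have hYE : Y ∉ R.cent L := fun h => hY1 (mem_invs.1 (hE (Finset.mem_inter.2 ⟨hY, h⟩)))
  have hdvd : b * c ∣ (L ∩ invs A).card := by
    refine R.dvd_card_inter_invs hiso hL hLK hE hY hYE
      (Nat.mul_ne_zero hb.ne_zero hc.ne_zero) fun W hW hW1 => ?_
    by_cases haW : a ∣ deg W
    · right
      obtain ⟨e, he⟩ := hdn W hW
      refine R.smat_eq_zero_of_coprime hR hn (a := a) (b := e) (by rw [hYbc, hnabc, mul_comm])
        he.symm ((Nat.Prime.coprime_iff_not_dvd ha).2 fun h => ?_) fun h => hW1 (by simp [h])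
      exact ha.one_lt.ne' (Nat.isUnit_iff.1 (hsq a (he ▸ Nat.mul_dvd_mul haW h)))
    · left
      obtain ⟨k₁, k₂, hk₁, hk₂, hk⟩ := (Nat.dvd_mul).1 (hcop W haW (hdn W hW))
      have hnW := hnp W hW
      rw [← hk] at hnW hW1 ⊢
      rcases (Nat.dvd_prime hb).1 hk₁ with rfl | rfl <;>
        rcases (Nat.dvd_prime hc).1 hk₂ with rfl | rfl
      · simp at hW1
      · rw [one_mul] at hnW; exact absurd hc hnW
      · rw [mul_one] at hnW; exact absurd hb hnW
      · exact dvd_rfl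
  have := Nat.le_of_dvd hpos hdvd
  have := hb.two_le
  have := hc.two_le
  nlinarith

end QT

end FinHopf

namespace FinHopf

variable {H : Type*} [Ring H] [HopfAlgebra ℂ H] [FiniteDimensional ℂ H]

variable (H) in
/-- The one-dimensional representations of `H`, with the convolution product. -/
abbrev Chr : Type _ := WithConv (H →ₐ[ℂ] ℂ)

/-- The functional underlying a one-dimensional representation. -/
def chl (η : Chr H) : H →ₗ[ℂ] ℂ := η.ofConv.toLinearMap

@[simp] lemma chl_one_fun : chl (1 : Chr H) = counit (R := ℂ) := rfl

lemma chl_mul_fun (η η' : Chr H) : chl (η * η') = conv (chl η) (chl η') := rfl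

lemma chl_injective : Function.Injective (chl (H := H)) := fun _ _ h =>
  WithConv.ofConv_injective (AlgHom.toLinearMap_injective h)

@[simp] lemma chl_mul (η : Chr H) (x y : H) : chl η (x * y) = chl η x * chl η y :=
  map_mul η.ofConv x y

@[simp] lemma chl_one (η : Chr H) : chl η 1 = 1 := map_one η.ofConv

lemma chl_pow (η : Chr H) (x : H) (k : ℕ) : chl η (x ^ k) = chl η x ^ k := map_pow η.ofConv x k

instance : Group (Chr H) :=
  { (inferInstance : Monoid (Chr H)) with
    inv := fun η => WithConv.toConv (AlgHom.ofLinearMap (chl η ∘ₗ antipode ℂ) (by simp)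
      (fun x y => by simp [antipode_mul_antidistrib, mul_comm]))
    inv_mul_cancel := fun η => by
      apply chl_injective
      rw [chl_mul_fun]
      refine cm_ext fun i j => ?_
      rw [conv_cm]
      change ∑ k, chl η (antipode ℂ (cm i k)) * chl η (cm k j) = counit (R := ℂ) (cm i j)
      simp_rw [← chl_mul]
      rw [← map_sum, sum_antipode_cm_mul, counit_cm]
      split_ifs <;> simp }

variable [IsSemisimpleRing H]

lemma ract_chl_mul (η : Chr H) (x y : H) :
    ract (chl η) (x * y) = ract (chl η) x * ract (chl η) y := by
  have h : ∀ s t : H ⊗[ℂ] H, evL (chl η) (s * t) = evL (chl η) s * evL (chl η) t := by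
    intro s t
    induction s with
    | zero => simp
    | add a b ha hb => rw [add_mul, map_add, ha, hb, map_add, add_mul]
    | tmul a b =>
      induction t with
      | zero => simp
      | add c d hc hd => rw [mul_add, map_add, hc, hd, map_add, mul_add]
      | tmul c d => simp [smul_smul, mul_comm]
  simp only [ract_eq_evL, Bialgebra.comul_mul, h]

lemma ract_chl_ract (η η' : Chr H) (x : H) :
    ract (chl η) (ract (chl η') x) = ract (chl (η' * η)) x := by rw [ract_ract, chl_mul_fun]

lemma lact_chl_lact (η η' : Chr H) (x : H) :
    lact (chl η) (lact (chl η') x) = lact (chl (η * η')) x := by rw [lact_lact, chl_mul_fun]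

/-- Translation by a one-dimensional representation, as an algebra automorphism. -/
def trans (η : Chr H) : H ≃ₐ[ℂ] H :=
  AlgEquiv.ofLinearEquiv
    (LinearEquiv.ofLinearMap (ract (chl η)) (ract (chl η⁻¹))
      (LinearMap.ext fun x => by simp [ract_chl_ract])
      (LinearMap.ext fun x => by simp [ract_chl_ract]))
    (by change ract (chl η) 1 = 1; simp) (ract_chl_mul η)

lemma trans_apply (η : Chr H) (x : H) : trans η x = ract (chl η) x := rfl

lemma trans_pow (η : Chr H) (k : ℕ) (x : H) : (trans η ^ k) x = ract (chl (η ^ k)) x := by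
  induction k with
  | zero => simp
  | succ k ih => rw [pow_succ', AlgEquiv.mul_apply, ih, trans_apply, ract_chl_ract, pow_succ]

lemma ract_groupLike (f : H →ₗ[ℂ] ℂ) (g : GroupLike ℂ H) : ract f g.val = f g.val • g.val := by
  rw [ract_eq_evL, g.isGroupLikeElem_val.comul_eq_tmul_self, evL_tmul]

lemma lact_groupLike (f : H →ₗ[ℂ] ℂ) (g : GroupLike ℂ H) : lact f g.val = f g.val • g.val := by
  rw [lact_eq_evR, g.isGroupLikeElem_val.comul_eq_tmul_self, evR_tmul]

lemma groupLike_val_mul_inv (g : GroupLike ℂ H) : g.val * (g⁻¹).val = 1 := by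
  rw [← GroupLike.val_mul, mul_inv_cancel, GroupLike.val_one]

lemma groupLike_val_inv_mul (g : GroupLike ℂ H) : (g⁻¹).val * g.val = 1 := by
  rw [← GroupLike.val_mul, inv_mul_cancel, GroupLike.val_one]

lemma exists_irr_chl (η : Chr H) : ∃ i : Irr H, deg i = 1 ∧ chi i = chl η := by
  obtain ⟨i, hi, h⟩ := exists_chi_eq_of_algHom η.ofConv
  exact ⟨i, hi, LinearMap.ext fun x => (h x).symm⟩

/-- The simple module given by a one-dimensional representation. -/
def chrIrr (η : Chr H) : Irr H := (exists_irr_chl η).choose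

lemma chi_chrIrr (η : Chr H) : chi (chrIrr η) = chl η := (exists_irr_chl η).choose_spec.2

lemma chrIrr_injective : Function.Injective (chrIrr (H := H)) := fun η η' h =>
  chl_injective (by rw [← chi_chrIrr, h, chi_chrIrr])

instance : Finite (Chr H) := Finite.of_injective _ chrIrr_injective

instance : Finite (GroupLike ℂ H) := groupLike_finite

lemma chl_intg_of_ne {η : Chr H} (h : η ≠ 1) : chl η (intg H) = 0 := by
  rw [← chi_chrIrr, chi_intg, if_neg]
  intro h1
  apply h
  apply chl_injective
  rw [← chi_chrIrr, h1, chi_irrOne]; rfl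

lemma cointg_groupLike_of_ne {g : GroupLike ℂ H} (h : g ≠ 1) : cointg H g.val = 0 := by
  have h1 := lact_cointg g.val
  rw [lact_groupLike] at h1
  by_contra h0
  exact h (GroupLike.val_injective (by
    rw [GroupLike.val_one]; exact smul_right_injective H h0 h1))

/-- Convolution average of the powers of a one-dimensional representation. -/
def chrAvg (η : Chr H) : H →ₗ[ℂ] ℂ :=
  (orderOf η : ℂ)⁻¹ • ∑ k ∈ Finset.range (orderOf η), chl (η ^ k)

lemma orderOf_ne_zero_complex {G : Type*} [Group G] [Finite G] (g : G) : (orderOf g : ℂ) ≠ 0 := by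
  exact_mod_cast (orderOf_pos g).ne'

lemma ract_chrAvg (η : Chr H) (x : H) : ract (chrAvg η) x =
    (orderOf η : ℂ)⁻¹ • ∑ k ∈ Finset.range (orderOf η), ract (chl (η ^ k)) x := by
  rw [← ractAt_apply, chrAvg, map_smul, map_sum]; rfl

lemma chrAvg_intg (η : Chr H) : chrAvg η (intg H) = (orderOf η : ℂ)⁻¹ := by
  rw [chrAvg, LinearMap.smul_apply, LinearMap.sum_apply, Finset.sum_eq_single 0]
  · simp
  · intro k hk hk0
    apply chl_intg_of_ne
    intro h
    exact hk0 (Nat.eq_zero_of_dvd_of_lt (orderOf_dvd_of_pow_eq_one h) (Finset.mem_range.1 hk))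
  · intro h
    exact absurd (orderOf_pos η) (by simpa using h)

lemma sum_range_mod {M : Type*} [AddCommMonoid M] {G : Type*} [Group G] [Finite G] (g : G)
    (F : G → M) : ∑ k ∈ Finset.range (orderOf g), F (g ^ k * g) =
      ∑ k ∈ Finset.range (orderOf g), F (g ^ k) := by
  obtain ⟨m, hm⟩ := Nat.exists_eq_succ_of_ne_zero (orderOf_pos g).ne'
  rw [hm]
  simp_rw [← pow_succ]
  rw [Finset.sum_range_succ, Finset.sum_range_succ' (fun k => F (g ^ k)), ← Nat.succ_eq_add_one,
    ← hm, pow_orderOf_eq_one, pow_zero]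

lemma ract_chl_chrAvg (η : Chr H) (x : H) :
    ract (chl η) (ract (chrAvg η) x) = ract (chrAvg η) x := by
  rw [ract_chrAvg, map_smul, map_sum]
  simp_rw [ract_chl_ract]
  rw [sum_range_mod η (fun η' => ract (chl η') x)]

lemma ract_pow_of_fixed {η : Chr H} {x : H} (h : ract (chl η) x = x) (k : ℕ) :
    ract (chl (η ^ k)) x = x := by
  induction k with
  | zero => simp
  | succ k ih => rw [pow_succ, ← ract_chl_ract, ih, h]

lemma ract_chrAvg_of_fixed {η : Chr H} {x : H} (h : ract (chl η) x = x) :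
    ract (chrAvg η) x = x := by
  rw [ract_chrAvg, Finset.sum_congr rfl fun k _ => ract_pow_of_fixed h k, Finset.sum_const,
    Finset.card_range, ← Nat.cast_smul_eq_nsmul ℂ, smul_smul,
    inv_mul_cancel₀ (orderOf_ne_zero_complex η), one_smul]

/-- The spectral idempotent of a group-like element for the eigenvalue `ω`. -/
def glIdem (g : GroupLike ℂ H) (ω : ℂ) : H :=
  (orderOf g : ℂ)⁻¹ • ∑ k ∈ Finset.range (orderOf g), ω⁻¹ ^ k • g.val ^ k

section glIdem

variable {g : GroupLike ℂ H} {ω : ℂ} (hω : ω ^ orderOf g = 1)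
include hω

lemma glIdem_mul : glIdem g ω * g.val = ω • glIdem g ω := by
  have hω0 : ω ≠ 0 := by
    rintro rfl
    rw [zero_pow (orderOf_pos g).ne'] at hω
    exact zero_ne_one hω
  have h1 := Finset.sum_range_succ (fun k => ω⁻¹ ^ k • g.val ^ k) (orderOf g)
  have hp : g.val ^ orderOf g = 1 := by
    rw [← GroupLike.val_pow, pow_orderOf_eq_one, GroupLike.val_one]
  rw [Finset.sum_range_succ', hp, inv_pow ω (orderOf g), hω] at h1
  simp only [pow_zero, inv_one, add_left_inj] at h1
  have h2 : (∑ k ∈ Finset.range (orderOf g), ω⁻¹ ^ k • g.val ^ k) * g.val =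
      ω • ∑ k ∈ Finset.range (orderOf g), ω⁻¹ ^ k • g.val ^ k := by
    rw [← h1, Finset.smul_sum, h1, Finset.sum_mul]
    refine Finset.sum_congr rfl fun k _ => ?_
    rw [smul_mul_assoc, ← pow_succ, smul_smul, pow_succ' ω⁻¹, ← mul_assoc, mul_inv_cancel₀ hω0,
      one_mul]
  rw [glIdem, smul_mul_assoc, h2, smul_comm]

lemma glIdem_mul_self : glIdem g ω * glIdem g ω = glIdem g ω := by
  have hω0 : ω ≠ 0 := by
    rintro rfl
    rw [zero_pow (orderOf_pos g).ne'] at hω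
    exact zero_ne_one hω
  have h : ∀ k, glIdem g ω * (ω⁻¹ ^ k • g.val ^ k) = glIdem g ω := by
    intro k
    induction k with
    | zero => simp
    | succ k ih =>
      rw [pow_succ, pow_succ, mul_comm, ← smul_smul, ← smul_mul_assoc, mul_smul_comm, ← mul_assoc,
        ih, glIdem_mul hω, smul_smul, inv_mul_cancel₀ hω0, one_smul]
  nth_rewrite 2 [glIdem]
  rw [mul_smul_comm, Finset.mul_sum, Finset.sum_congr rfl fun k _ => h k, Finset.sum_const,
    Finset.card_range, ← Nat.cast_smul_eq_nsmul ℂ, smul_smul,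
    inv_mul_cancel₀ (orderOf_ne_zero_complex g), one_smul]

end glIdem

lemma cointg_glIdem (g : GroupLike ℂ H) (ω : ℂ) :
    cointg H (glIdem g ω) = (orderOf g : ℂ)⁻¹ * Module.finrank ℂ H := by
  rw [glIdem, map_smul, map_sum, Finset.sum_eq_single 0, pow_zero, pow_zero, one_smul, cointg_one,
    smul_eq_mul]
  · intro k hk hk0
    rw [map_smul, ← GroupLike.val_pow, cointg_groupLike_of_ne, smul_zero]
    intro h
    exact hk0 (Nat.eq_zero_of_dvd_of_lt (orderOf_dvd_of_pow_eq_one h) (Finset.mem_range.1 hk))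
  · intro h
    exact absurd (orderOf_pos g) (by simpa using h)

lemma ract_glIdem {f : H →ₗ[ℂ] ℂ} {g : GroupLike ℂ H} (h : ∀ k, f (g.val ^ k) = 1) (ω : ℂ) :
    ract f (glIdem g ω) = glIdem g ω := by
  rw [glIdem, map_smul, map_sum]
  congr 1
  refine Finset.sum_congr rfl fun k _ => ?_
  rw [map_smul, ← GroupLike.val_pow, ract_groupLike, GroupLike.val_pow, h, one_smul]

/-- If `η(g) = 1` then the product of the orders of `g` and `η` divides the dimension. -/
lemma orderOf_mul_orderOf_dvd {g : GroupLike ℂ H} {η : Chr H} (h : chl η g.val = 1) :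
    orderOf g * orderOf η ∣ Module.finrank ℂ H := by
  have hg : ract (chl η) (glIdem g 1) = glIdem g 1 :=
    ract_glIdem (fun k => by rw [chl_pow, h, one_pow]) 1
  have hc : ∀ x, ract (chrAvg η) (glIdem g 1 * x) = glIdem g 1 * ract (chrAvg η) x := by
    intro x
    rw [ract_chrAvg, ract_chrAvg, mul_smul_comm, Finset.mul_sum]
    congr 1
    refine Finset.sum_congr rfl fun k _ => ?_
    rw [ract_chl_mul, ract_pow_of_fixed hg]
  obtain ⟨m, hm, -⟩ := exists_nat_trace_of_idem
    (T := LinearMap.mulLeft ℂ (glIdem g 1) ∘ₗ ract (chrAvg η)) (LinearMap.ext fun x => by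
      simp only [Module.End.mul_apply, LinearMap.comp_apply, LinearMap.mulLeft_apply, hc]
      rw [ract_chrAvg_of_fixed (ract_chl_chrAvg η x), ← mul_assoc, glIdem_mul_self (one_pow _)])
  rw [trace_mulLeft_ract, chrAvg_intg, cointg_glIdem] at hm
  refine ⟨m, ?_⟩
  have h1 := orderOf_ne_zero_complex g
  have h2 := orderOf_ne_zero_complex η
  have : (Module.finrank ℂ H : ℂ) = orderOf g * orderOf η * m := by
    rw [← hm]; field_simp
  exact_mod_cast this

namespace Double

lemma span_incl_mul_dincl : Submodule.span ℂ (Set.range fun p : Ix H × Ix H =>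
    incl H (Module.finBasis ℂ H p.1) * dincl H ((Module.finBasis ℂ H).coord p.2)) = ⊤ := by
  rw [eq_top_iff]
  rintro d -
  obtain ⟨d, rfl⟩ := antipode_bijective (H := Double H).2 d
  induction d using Double.induction with
  | h0 => simp
  | hadd a b ha hb => rw [map_add]; exact Submodule.add_mem _ ha hb
  | hmul f x =>
    rw [antipode_mul_antidistrib]
    change anti H (incl H x) * anti H (dincl H f) ∈ _
    rw [anti_incl, anti_dincl, ← sum_basis_smul (antipode ℂ x),
      ← sum_coord_smul (f ∘ₗ antipode ℂ), map_sum, map_sum, Finset.sum_mul_sum]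
    refine Submodule.sum_mem _ fun a _ => Submodule.sum_mem _ fun b _ => ?_
    rw [map_smul, map_smul, smul_mul_smul_comm]
    exact Submodule.smul_mem _ _ (Submodule.subset_span ⟨(a, b), rfl⟩)

lemma drin_injective : Function.Injective (qt H).drin := by
  intro f f' h
  have hli : LinearIndependent ℂ (fun p : Ix H × Ix H =>
      incl H (Module.finBasis ℂ H p.1) * dincl H ((Module.finBasis ℂ H).coord p.2)) :=
    linearIndependent_of_top_le_span_of_card_eq_finrank span_incl_mul_dincl.ge (by
      rw [finrank_eq]; simp [sq])
  rw [QT.drin_eq, QT.drin_eq, ← sub_eq_zero, ← Finset.sum_sub_distrib] at h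
  simp_rw [← Finset.sum_sub_distrib, ← sub_smul] at h
  change ∑ a : Ix H, ∑ b : Ix H, (f (dincl H ((Module.finBasis ℂ H).coord a) *
    incl H (Module.finBasis ℂ H b)) - f' (dincl H ((Module.finBasis ℂ H).coord a) *
    incl H (Module.finBasis ℂ H b))) • (incl H (Module.finBasis ℂ H a) *
      dincl H ((Module.finBasis ℂ H).coord b)) = 0 at h
  rw [← Fintype.sum_prod_type'] at h
  have h2 := Fintype.linearIndependent_iff.1 hli _ h
  refine LinearMap.ext fun d => ?_
  induction d using Double.induction with
  | h0 => simp
  | hadd a b ha hb => rw [map_add, ha, hb, map_add]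
  | hmul φ x =>
    rw [← sum_basis_smul x, ← sum_coord_smul φ, map_sum, map_sum, Finset.sum_mul_sum,
      map_sum, map_sum]
    refine Finset.sum_congr rfl fun a _ => ?_
    rw [map_sum, map_sum]
    refine Finset.sum_congr rfl fun b _ => ?_
    rw [map_smul, map_smul, smul_mul_smul_comm, map_smul, map_smul, sub_eq_zero.1 (h2 (a, b))]

/-- An invertible object of the double consists of a group-like element and a one-dimensional
representation. -/
lemma exists_pair {X : Irr (Double H)} (hX : deg X = 1) : ∃ (g : GroupLike ℂ H) (η : Chr H),
    (∀ x, chi X (incl H x) = chl η x) ∧ (∀ f, chi X (dincl H f) = f g.val) ∧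
    (∀ x, ract (chl η) x * g.val = g.val * lact (chl η) x) ∧ (qt H).th X = chl η g.val := by
  have h1 : chi X 1 = 1 := by rw [chi_one, hX, Nat.cast_one]
  set b := Module.finBasis ℂ H with hb
  let g : H := ∑ a, chi X (dincl H (b.coord a)) • b a
  have hg : ∀ f, chi X (dincl H f) = f g := fun f => by
    conv_lhs => rw [← sum_coord_smul f]
    simp only [g, map_sum, map_smul, smul_eq_mul, ← hb]
    exact Finset.sum_congr rfl fun a _ => mul_comm _ _
  let η : Chr H := WithConv.toConv (AlgHom.ofLinearMap (chi X ∘ₗ (incl H).toLinearMap)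
    (by simp [h1]) (fun x y => by simp [chi_mul_of_deg_one hX]))
  have hη : ∀ x, chi X (incl H x) = chl η x := fun x => rfl
  have hgl : IsGroupLikeElem ℂ g := by
    refine isGroupLikeElem_of_conv ?_ fun f k => ?_
    · rw [← hg, isExchange.map_counit, h1]
    · rw [← hg, ← hg, ← hg, isExchange.map_conv, chi_mul_of_deg_one hX]
  refine ⟨⟨g, hgl⟩, η, hη, hg, fun x => ?_, ?_⟩
  · refine cm_ext_apply (f := LinearMap.mulRight ℂ g ∘ₗ ract (chl η))
      (g := LinearMap.mulLeft ℂ g ∘ₗ lact (chl η)) (fun i j => ?_) x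
    refine eq_of_forall_functional fun f => ?_
    have h := congrArg (chi X) (isExchange.exchange f i j)
    simp only [map_sum, chi_mul_of_deg_one hX, hη, hg, LinearMap.comp_apply,
      LinearMap.mulLeft_apply, LinearMap.mulRight_apply] at h
    simp only [LinearMap.comp_apply, LinearMap.mulLeft_apply, LinearMap.mulRight_apply, ract_cm,
      lact_cm, Finset.sum_mul, Finset.mul_sum, map_sum, smul_mul_assoc, mul_smul_comm, map_smul,
      smul_eq_mul]
    rw [h]
    exact Finset.sum_congr rfl fun k _ => mul_comm _ _
  · rw [QT.th, hX, Nat.cast_one, div_one, QT.twist, map_sum]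
    change ∑ a : Ix H, chi X (incl H (b a) * dincl H (b.coord a)) = chl η g
    simp_rw [chi_mul_of_deg_one hX, hη]
    simp only [g, map_sum, map_smul, smul_eq_mul]
    exact Finset.sum_congr rfl fun a _ => mul_comm _ _

end Double

lemma pair_pow {g : GroupLike ℂ H} {η : Chr H}
    (h : ∀ x, ract (chl η) x * g.val = g.val * lact (chl η) x) (k : ℕ) (x : H) :
    ract (chl (η ^ k)) x * (g ^ k).val = (g ^ k).val * lact (chl (η ^ k)) x := by
  induction k generalizing x with
  | zero => simp
  | succ k ih =>
    rw [pow_succ η, ← ract_chl_ract, pow_succ' g, GroupLike.val_mul, ← mul_assoc, h, mul_assoc,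
      lact_ract, mul_assoc, ih, lact_chl_lact, ← mul_assoc]

/-- A semisimple Hopf algebra of squarefree dimension with at most three prime factors has a
nontrivial central group-like element or a nontrivial central one-dimensional representation. -/
theorem exists_central (h1 : 1 < Module.finrank ℂ H) (hsq : Squarefree (Module.finrank ℂ H))
    (h3 : (Module.finrank ℂ H).primeFactors.card ≤ 3) :
    (∃ g : GroupLike ℂ H, (orderOf g).Prime ∧ ∀ x, g.val * x = x * g.val) ∨
      ∃ η : Chr H, (orderOf η).Prime ∧ ∀ x, ract (chl η) x = lact (chl η) x := by
  by_cases hc : ∃ g : GroupLike ℂ H, g ≠ 1 ∧ ∀ x, g.val * x = x * g.val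
  · left
    obtain ⟨g, hg, hgc⟩ := hc
    obtain ⟨l, hl, hlg⟩ := Nat.exists_prime_and_dvd (mt orderOf_eq_one_iff.1 hg)
    refine ⟨g ^ (orderOf g / l), ?_, fun x => ?_⟩
    · rwa [orderOf_pow_orderOf_div (orderOf_pos g).ne' hlg]
    · rw [GroupLike.val_pow]
      exact (Commute.pow_left (show Commute g.val x from hgc x) _).eq
  push Not at hc
  have hcard : (invs (Double H)).card ≤ Module.finrank ℂ H := by
    choose! g η hη hg hx hth using fun (X : Irr (Double H)) (hX : deg X = 1) =>
      Double.exists_pair hX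
    have hinj : Set.InjOn (fun X => chrIrr (η X)) (invs (Double H) : Set (Irr (Double H))) := by
      intro X hX Y hY hXY
      rw [Finset.mem_coe, mem_invs] at hX hY
      have he : η X = η Y := chrIrr_injective hXY
      have hgg : g X * (g Y)⁻¹ = 1 := by
        by_contra hne
        obtain ⟨x, hx'⟩ := hc _ hne
        apply hx'
        obtain ⟨y, rfl⟩ := (trans (η X)).surjective x
        have e1 := hx X hX y
        have e2 := hx Y hY y
        rw [he] at e1
        rw [trans_apply, he, GroupLike.val_mul]
        calc (g X).val * ((g Y)⁻¹).val * ract (chl (η Y)) y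
            = (g X).val * ((g Y)⁻¹).val * (ract (chl (η Y)) y * (g Y).val) * ((g Y)⁻¹).val := by
              rw [mul_assoc _ (_ * _), mul_assoc _ (g Y).val, groupLike_val_mul_inv, mul_one]
          _ = (g X).val * (((g Y)⁻¹).val * (g Y).val) * lact (chl (η Y)) y * ((g Y)⁻¹).val := by
              rw [e2]; simp only [mul_assoc]
          _ = _ := by rw [groupLike_val_inv_mul, mul_one, ← e1, mul_assoc]
      have hgXY : g X = g Y := mul_inv_eq_one.1 hgg
      refine chi_injective (LinearMap.ext fun d => ?_)
      induction d using Double.induction with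
      | h0 => simp
      | hadd a b ha hb => rw [map_add, ha, hb, map_add]
      | hmul f x =>
        rw [chi_mul_of_deg_one hX, chi_mul_of_deg_one hY, hg X hX, hg Y hY, hη X hX, hη Y hY,
          hgXY, he]
    have h4 := Finset.card_le_card_of_injOn (t := Finset.univ) (fun X => chrIrr (η X))
      (fun _ _ => Finset.mem_univ _) hinj
    refine h4.trans ?_
    rw [finrank_eq_sum_deg_sq H, Finset.card_eq_sum_ones]
    exact Finset.sum_le_sum fun i _ => Nat.one_le_pow _ _ (deg_pos i)
  obtain ⟨X, hX, hth, hX1⟩ := (Double.qt H).exists_isotropic Double.drin_injective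
    (Double.finrank_eq H) hsq h1 h3 hcard
  obtain ⟨g, η, hη, hg, hx, hth'⟩ := Double.exists_pair hX
  rw [hth] at hth'
  have hne : (g, η) ≠ 1 := by
    intro h
    apply hX1
    refine chi_injective (LinearMap.ext fun d => ?_)
    rw [Prod.mk_eq_one] at h
    rw [chi_irrOne]
    induction d using Double.induction with
    | h0 => simp
    | hadd a b ha hb => rw [map_add, ha, hb, map_add]
    | hmul f x =>
      rw [chi_mul_of_deg_one hX, hg, hη, h.1, h.2, Double.counit_eq, map_mul,
        Double.counitHom_dincl, Double.counitHom_incl]; rfl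
  obtain ⟨l, hl, hlg⟩ := Nat.exists_prime_and_dvd (mt orderOf_eq_one_iff.1 hne)
  have ho := orderOf_pow_orderOf_div (orderOf_pos (g, η)).ne' hlg
  set k := orderOf (g, η) / l
  have hx' := pair_pow hx k
  rw [Prod.pow_mk] at ho
  have hth2 : chl (η ^ k) (g ^ k).val = 1 := by
    have : ∀ m, chl (η ^ m) (g ^ k).val = 1 := by
      intro m
      induction m with
      | zero => exact (g ^ k).isGroupLikeElem_val.counit_eq_one
      | succ m ih =>
        rw [pow_succ, chl_mul_fun, ← apply_ract, ract_groupLike, ih, one_smul, GroupLike.val_pow,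
          chl_pow, ← hth', one_pow]
    exact this k
  have hpow : (g ^ k, η ^ k) ^ l = 1 := by rw [← ho]; exact pow_orderOf_eq_one _
  rw [Prod.pow_mk, Prod.mk_eq_one] at hpow
  have hη1 : η ^ k ≠ 1 := by
    intro h
    rw [h] at hx' ho
    refine absurd hx' ?_
    have hgk : g ^ k ≠ 1 := fun h' => by
      rw [h'] at ho
      exact hl.one_lt.ne (by rw [← ho]; exact orderOf_one.symm)
    obtain ⟨x, hx⟩ := hc _ hgk
    intro h2
    have := h2 x
    simp at this
    exact hx (by simpa using this.symm)
  have := Fact.mk hl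
  have hoη : orderOf (η ^ k) = l := orderOf_eq_prime hpow.2 hη1
  by_cases hg1 : g ^ k = 1
  · right
    refine ⟨η ^ k, by rwa [hoη], fun x => ?_⟩
    have := hx' x
    rwa [hg1, GroupLike.val_one, mul_one, one_mul] at this
  · exfalso
    have hog : orderOf (g ^ k) = l := orderOf_eq_prime hpow.1 hg1
    have hd := orderOf_mul_orderOf_dvd hth2
    rw [hog, hoη] at hd
    exact hl.one_lt.ne' (Nat.isUnit_iff.1 (hsq l hd))

end FinHopf

namespace FinHopf

variable {H : Type*} [Ring H] [HopfAlgebra ℂ H] [FiniteDimensional ℂ H] [IsSemisimpleRing H]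

/-- The subalgebra of elements fixed by translation by `η`. -/
def fixedSub (η : Chr H) : Subalgebra ℂ H where
  carrier := {x | ract (chl η) x = x}
  mul_mem' {x y} hx hy := by
    rw [Set.mem_ofPred_eq] at *
    rw [ract_chl_mul, hx, hy]
  add_mem' {x y} hx hy := by
    rw [Set.mem_ofPred_eq] at *
    rw [map_add, hx, hy]
  algebraMap_mem' c := by
    rw [Set.mem_ofPred_eq, Algebra.algebraMap_eq_smul_one, map_smul, ract_one, chl_one, one_smul]

lemma mem_fixedSub {η : Chr H} {x : H} : x ∈ fixedSub η ↔ ract (chl η) x = x := Iff.rfl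

lemma ract_coe {η : Chr H} (x : fixedSub η) : ract (chl η) (x : H) = x := x.2

lemma chrAvg_one (η : Chr H) : chrAvg η 1 = 1 := by
  have := orderOf_ne_zero_complex η
  simp [chrAvg, this]

lemma ract_chrAvg_mul_coe {η : Chr H} (k : fixedSub η) (x : H) :
    ract (chrAvg η) (x * k) = ract (chrAvg η) x * k := by
  rw [ract_chrAvg, ract_chrAvg, smul_mul_assoc, Finset.sum_mul]
  congr 1
  refine Finset.sum_congr rfl fun j _ => ?_
  rw [ract_chl_mul, ract_pow_of_fixed k.2]

/-- The averaging projection onto the fixed subalgebra. -/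
def proj (η : Chr H) : H →ₗ[ℂ] fixedSub η where
  toFun x := ⟨ract (chrAvg η) x, ract_chl_chrAvg η x⟩
  map_add' x y := Subtype.ext (map_add _ x y)
  map_smul' c x := Subtype.ext (map_smul _ c x)

lemma coe_proj (η : Chr H) (x : H) : (proj η x : H) = ract (chrAvg η) x := rfl

@[simp] lemma proj_coe {η : Chr H} (x : fixedSub η) : proj η x = x :=
  Subtype.ext (ract_chrAvg_of_fixed x.2)

lemma trace_fixed_mulLeft {η : Chr H} (a : fixedSub η) :
    LinearMap.trace ℂ (fixedSub η) (LinearMap.mulLeft ℂ a) =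
      (orderOf η : ℂ)⁻¹ * cointg H a := by
  have h := LinearMap.trace_comp_comm' (R := ℂ) (proj η)
    ((fixedSub η).val.toLinearMap ∘ₗ LinearMap.mulLeft ℂ a)
  have h1 : proj η ∘ₗ (fixedSub η).val.toLinearMap ∘ₗ LinearMap.mulLeft ℂ a =
      LinearMap.mulLeft ℂ a := LinearMap.ext fun x => proj_coe (a * x)
  have h2 : ((fixedSub η).val.toLinearMap ∘ₗ LinearMap.mulLeft ℂ a) ∘ₗ proj η =
      LinearMap.mulLeft ℂ (a : H) ∘ₗ ract (chrAvg η) := LinearMap.ext fun x => rfl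
  rw [h1, h2, trace_mulLeft_ract, chrAvg_intg] at h
  exact h.symm

lemma finrank_fixedSub (η : Chr H) :
    orderOf η * Module.finrank ℂ (fixedSub η) = Module.finrank ℂ H := by
  have h := trace_fixed_mulLeft (1 : fixedSub η)
  rw [LinearMap.mulLeft_one, LinearMap.trace_id] at h
  have h1 := orderOf_ne_zero_complex η
  have : (orderOf η : ℂ) * Module.finrank ℂ (fixedSub η) = Module.finrank ℂ H := by
    rw [h]
    change (orderOf η : ℂ) * (_ * cointg H (1 : H)) = _
    rw [cointg_one]
    field_simp
  exact_mod_cast this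

instance (η : Chr H) : IsSemisimpleRing (fixedSub η) := by
  have : IsArtinianRing (fixedSub η) := IsArtinianRing.of_finite ℂ _
  rw [IsArtinianRing.isSemisimpleRing_iff_jacobson, eq_bot_iff]
  intro x hx
  have hnil : ∀ y ∈ Ring.jacobson (fixedSub η), IsNilpotent y := by
    intro y hy
    obtain ⟨m, hm⟩ := IsArtinianRing.isNilpotent_jacobson_bot (R := fixedSub η)
    rw [Ring.jacobson_eq_sInf_isMaximal] at hy
    refine ⟨m, ?_⟩
    have h := Ideal.pow_mem_pow (I := Ideal.jacobson ⊥) (x := y)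
      (by rw [Ideal.jacobson_bot, Ring.jacobson_eq_sInf_isMaximal]; exact hy) m
    rw [hm] at h
    exact h
  have h0 : (x : H) = 0 := cointg_nondeg fun a => by
    have h1 : cointg H (a * x) = cointg H ((proj η a * x : fixedSub η) : H) := by
      change _ = cointg H (ract (chrAvg η) a * x)
      rw [← ract_chrAvg_mul_coe, apply_ract, ← apply_lact, lact_cointg, map_smul, chrAvg_one,
        smul_eq_mul, mul_one]
    have h2 := trace_fixed_mulLeft (proj η a * x)
    obtain ⟨m, hm⟩ := hnil _ (Ideal.mul_mem_left _ (proj η a) hx)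
    rw [(LinearMap.isNilpotent_trace_of_isNilpotent (f := LinearMap.mulLeft ℂ (proj η a * x))
      ⟨m, by rw [LinearMap.pow_mulLeft, hm, LinearMap.mulLeft_zero_eq_zero]⟩).eq_zero] at h2
    rw [mul_zero, map_zero, h1]
    exact (mul_eq_zero.1 h2.symm).resolve_left (inv_ne_zero (orderOf_ne_zero_complex η))
  exact (Submodule.mem_bot _).2 (Subtype.ext h0)

/-- A representation commuting with an idempotent `p` and containing the corner of `p` surjects
onto a matrix algebra of size `tr p`. -/
lemma exists_surjective_corner {B : Type*} [Ring B] [Algebra ℂ B] {D d : ℕ}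
    (ρ : B →ₐ[ℂ] Matrix (Fin D) (Fin D) ℂ) {p : Matrix (Fin D) (Fin D) ℂ} (hp : p * p = p)
    (hd : p.trace = d) (hc : ∀ x, ρ x * p = p * ρ x) (hs : ∀ M, p * M = M → M * p = M → ∃ x, ρ x = M) :
    ∃ φ : B →ₐ[ℂ] Matrix (Fin d) (Fin d) ℂ, Function.Surjective φ := by
  let P := Matrix.toLinAlgEquiv' p
  have hP : P * P = P := by rw [← map_mul, hp]
  let W := LinearMap.range P
  have hW : Module.finrank ℂ W = d := by
    have := (LinearMap.IsIdempotentElem.isProj_range P hP).trace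
    rw [LinearMap.trace_eq_matrix_trace ℂ (Pi.basisFun ℂ (Fin D))] at this
    change (LinearMap.toMatrix' (Matrix.toLin' p)).trace = _ at this
    rw [LinearMap.toMatrix'_toLin', hd] at this
    exact_mod_cast this.symm
  have hfix : ∀ w : W, P w = w := by
    rintro ⟨_, v, rfl⟩
    exact LinearMap.congr_fun hP v
  have hinv : ∀ x, ∀ w ∈ W, Matrix.toLinAlgEquiv' (ρ x) w ∈ W := by
    rintro x _ ⟨v, rfl⟩
    refine ⟨Matrix.toLinAlgEquiv' (ρ x) v, ?_⟩
    rw [← Module.End.mul_apply, ← Module.End.mul_apply, ← map_mul, ← map_mul, hc]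
  let φ : B →ₐ[ℂ] Module.End ℂ W := AlgHom.ofLinearMap
    { toFun := fun x => (Matrix.toLinAlgEquiv' (ρ x)).restrict (hinv x)
      map_add' := fun x y => by ext w : 2; simp
      map_smul' := fun c x => by ext w : 2; simp }
    (by ext w : 2; simp)
    (fun x y => by ext w : 2; simp)
  have hφ : Function.Surjective φ := by
    intro N
    let M := W.subtype ∘ₗ N ∘ₗ P.rangeRestrict
    have hPM : P * M = M := LinearMap.ext fun v => hfix (N (P.rangeRestrict v))
    have hMP : M * P = M := LinearMap.ext fun v => by
      have : P.rangeRestrict (P v) = P.rangeRestrict v := Subtype.ext (LinearMap.congr_fun hP v)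
      simp [M, this]
    obtain ⟨x, hx⟩ := hs (Matrix.toLinAlgEquiv'.symm M)
      (Matrix.toLinAlgEquiv'.injective (by rw [map_mul]; simpa using hPM))
      (Matrix.toLinAlgEquiv'.injective (by rw [map_mul]; simpa using hMP))
    refine ⟨x, LinearMap.ext fun w => Subtype.ext ?_⟩
    change Matrix.toLinAlgEquiv' (ρ x) w = _
    rw [hx, AlgEquiv.apply_symm_apply]
    change ((N (P.rangeRestrict w) : W) : Fin D → ℂ) = _
    rw [show P.rangeRestrict (w : Fin D → ℂ) = w from Subtype.ext (hfix w)]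
  exact ⟨(LinearMap.toMatrixAlgEquiv (Module.finBasisOfFinrankEq ℂ W hW)).toAlgHom.comp φ,
    (LinearMap.toMatrixAlgEquiv _).surjective.comp hφ⟩

lemma rep_proj_lift_of_moved {η : Chr H} {i : Irr H}
    (h : ∀ k, 0 < k → k < orderOf η → rep i ((trans η ^ k) (cidem i)) = 0)
    (M : Matrix (Fin (deg i)) (Fin (deg i)) ℂ) :
    rep i (proj η (lift i M) : H) = (orderOf η : ℂ)⁻¹ • M := by
  rw [coe_proj, ract_chrAvg, map_smul, map_sum, Finset.sum_eq_single 0]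
  · simp
  · intro k hk hk0
    have hM : lift i M = cidem i * lift i M := by rw [cidem, lift_mul_lift, one_mul]
    rw [hM, ← trans_pow, map_mul, map_mul, h k (Nat.pos_of_ne_zero hk0) (Finset.mem_range.1 hk),
      zero_mul]
  · intro h0
    exact absurd (orderOf_pos η) (by simpa using h0)

/-- The implementing matrix of an inner translation can be normalized to have finite order. -/
lemma exists_normalized {η : Chr H} {i : Irr H}
    {t : (Matrix (Fin (deg i)) (Fin (deg i)) ℂ)ˣ}
    (ht : ∀ x, rep i (trans η x) = t.val * rep i x * t⁻¹.val) :
    ∃ u : (Matrix (Fin (deg i)) (Fin (deg i)) ℂ)ˣ, u ^ orderOf η = 1 ∧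
      ∀ x, rep i (trans η x) = u.val * rep i x * u⁻¹.val := by
  obtain ⟨c, hc⟩ := isScalar_of_forall_commute (M := t.val ^ orderOf η) (fun N => by
    obtain ⟨x, rfl⟩ := rep_surjective i N
    have := rep_aut_pow ht (orderOf η) x
    rw [trans_pow, pow_orderOf_eq_one, chl_one_fun, ract_counit] at this
    rw [← Units.val_pow_eq_pow_val]
    conv_lhs => rw [this]
    simp [mul_assoc])
  have hc0 : c ≠ 0 := by
    rintro rfl
    rw [zero_smul, ← Units.val_pow_eq_pow_val] at hc
    exact (t ^ orderOf η).ne_zero hc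
  obtain ⟨z, hz⟩ := IsAlgClosed.exists_pow_nat_eq c (orderOf_pos η)
  have hz0 : z ≠ 0 := by
    rintro rfl
    exact hc0 (by rw [← hz, zero_pow (orderOf_pos η).ne'])
  refine ⟨⟨z⁻¹ • t.val, z • t⁻¹.val, ?_, ?_⟩, ?_, fun x => ?_⟩
  · rw [smul_mul_smul_comm, inv_mul_cancel₀ hz0, Units.mul_inv, one_smul]
  · rw [smul_mul_smul_comm, mul_inv_cancel₀ hz0, Units.inv_mul, one_smul]
  · ext1
    rw [Units.val_pow_eq_pow_val, smul_pow, hc, ← hz, smul_smul, ← mul_pow,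
      inv_mul_cancel₀ hz0, one_pow, one_smul, Units.val_one]
  · change _ = (z⁻¹ • t.val) * rep i x * (z • t⁻¹.val)
    rw [smul_mul_assoc, smul_mul_smul_comm, inv_mul_cancel₀ hz0, one_smul, ht]

lemma trace_pow_eq_zero {η : Chr H} {i : Irr H}
    {u : (Matrix (Fin (deg i)) (Fin (deg i)) ℂ)ˣ} (hu : u ^ orderOf η = 1)
    (h : ∀ x, rep i (trans η x) = u.val * rep i x * u⁻¹.val) {k : ℕ} (hk : 0 < k)
    (hk' : k < orderOf η) : (u.val ^ k).trace = 0 := by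
  have h1 := trace_mulLeft_ract (chl (η ^ k)) (cidem i)
  rw [chl_intg_of_ne (η := η ^ k) (fun h => hk.ne'
    (Nat.eq_zero_of_dvd_of_lt (orderOf_dvd_of_pow_eq_one h) hk')), zero_mul,
    trace_eq_sum_rep, Finset.sum_eq_single i] at h1
  · have h2 : (u ^ k).val.trace * (u ^ k)⁻¹.val.trace = 0 := by
      rw [← h1]
      simp only [LinearMap.comp_apply, LinearMap.mulLeft_apply, map_mul, rep_cidem, if_true,
        one_mul, ← trans_pow, rep_aut_pow h, rep_lift_self]
      simp [Matrix.trace, Finset.sum_mul_sum, Matrix.mul_apply, Matrix.single_apply, ite_and]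
    rw [trace_inv_of_pow_eq_one (u ^ k) (orderOf_pos η).ne'
      (by rw [← pow_mul, mul_comm, pow_mul, hu, one_pow])] at h2
    rw [← Units.val_pow_eq_pow_val]
    rcases mul_eq_zero.1 h2 with h3 | h3
    · exact h3
    · exact star_eq_zero.1 h3
  · intro j _ hj
    refine Finset.sum_eq_zero fun a _ => Finset.sum_eq_zero fun b _ => ?_
    rw [LinearMap.comp_apply, LinearMap.mulLeft_apply, map_mul, rep_cidem, if_neg hj, zero_mul]
    rfl
  · simp

lemma exists_deg_of_inner {η : Chr H} {i : Irr H}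
    {t : (Matrix (Fin (deg i)) (Fin (deg i)) ℂ)ˣ}
    (ht : ∀ x, rep i (trans η x) = t.val * rep i x * t⁻¹.val) :
    ∃ d, deg i = orderOf η * d ∧
      ∃ φ : fixedSub η →ₐ[ℂ] Matrix (Fin d) (Fin d) ℂ, Function.Surjective φ := by
  obtain ⟨u, hu, h⟩ := exists_normalized ht
  have hl := orderOf_ne_zero_complex η
  set l := orderOf η with hl_def
  let p : Matrix (Fin (deg i)) (Fin (deg i)) ℂ := (l : ℂ)⁻¹ • ∑ k ∈ Finset.range l, u.val ^ k
  have hup : u.val * p = p := by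
    have h1 : ∑ k ∈ Finset.range l, u.val ^ (k + 1) = ∑ k ∈ Finset.range l, u.val ^ k := by
      have h2 := Finset.sum_range_succ (fun k => u.val ^ k) l
      rw [Finset.sum_range_succ', ← Units.val_pow_eq_pow_val u l, hu] at h2
      simpa using h2
    simp only [p, mul_smul_comm, Finset.mul_sum, ← pow_succ', h1]
  have hpu : p * u.val = p := by
    conv_rhs => rw [← hup]
    simp only [p, mul_smul_comm, smul_mul_assoc, Finset.mul_sum, Finset.sum_mul, ← pow_succ,
      ← pow_succ']
  have hukp : ∀ k, u.val ^ k * p = p := by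
    intro k
    induction k with
    | zero => simp
    | succ k ih => rw [pow_succ, mul_assoc, hup, ih]
  have hpp : p * p = p := by
    conv_lhs => enter [1]; simp only [p]
    rw [smul_mul_assoc, Finset.sum_mul, Finset.sum_congr rfl fun k _ => hukp k, Finset.sum_const,
      Finset.card_range, ← Nat.cast_smul_eq_nsmul ℂ, smul_smul, inv_mul_cancel₀ hl, one_smul]
  have htr : p.trace = (l : ℂ)⁻¹ * deg i := by
    simp only [p, Matrix.trace_smul, Matrix.trace_sum, smul_eq_mul]
    rw [Finset.sum_eq_single 0]
    · simp
    · intro k hk hk0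
      exact trace_pow_eq_zero hu h (Nat.pos_of_ne_zero hk0) (Finset.mem_range.1 hk)
    · intro h0
      exact absurd (orderOf_pos η) (by rw [← hl_def]; simpa using h0)
  obtain ⟨d, hd, -⟩ := exists_nat_trace_of_idem (T := Matrix.toLin' p)
    ((Matrix.toLin'_mul p p).symm.trans (by rw [hpp]))
  rw [LinearMap.trace_eq_matrix_trace ℂ (Pi.basisFun ℂ (Fin (deg i)))] at hd
  change (LinearMap.toMatrix' (Matrix.toLin' p)).trace = _ at hd
  rw [LinearMap.toMatrix'_toLin'] at hd
  refine ⟨d, ?_, exists_surjective_corner ((rep i).comp (fixedSub η).val) hpp hd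
    (fun x => ?_) (fun M hpM hMp => ?_)⟩
  · rw [htr] at hd
    have : (deg i : ℂ) = l * d := by rw [← hd]; field_simp
    exact_mod_cast this
  · change rep i (x : H) * p = p * rep i (x : H)
    have hx := h x
    rw [trans_apply, ract_coe] at hx
    have hcomm : Commute (rep i (x : H)) u.val := by
      change _ * _ = _ * _
      conv_lhs => rw [hx]
      simp [mul_assoc]
    exact (Commute.sum_right _ _ _ fun k _ => hcomm.pow_right k).smul_right _
  · refine ⟨proj η (lift i M), ?_⟩
    change rep i (proj η (lift i M) : H) = M
    have huM : ∀ k, u.val ^ k * M = M := fun k => by rw [← hpM, ← mul_assoc, hukp]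
    have hMu : ∀ k, M * u.val ^ k = M := fun k => by
      have : p * u.val ^ k = p := by
        induction k with
        | zero => simp
        | succ k ih => rw [pow_succ, ← mul_assoc, ih, hpu]
      rw [← hMp, mul_assoc, this]
    rw [coe_proj, ract_chrAvg, map_smul, map_sum, Finset.sum_congr rfl (g := fun _ => M),
      Finset.sum_const, Finset.card_range, ← Nat.cast_smul_eq_nsmul ℂ, smul_smul,
      inv_mul_cancel₀ hl, one_smul]
    intro k _
    rw [← trans_pow, rep_aut_pow h, rep_lift_self, Units.val_pow_eq_pow_val, huM]
    conv_lhs => enter [1]; rw [← hMu k]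
    rw [mul_assoc, ← Units.val_pow_eq_pow_val, Units.mul_inv, mul_one]

/-- A simple module restricts to the subalgebra fixed by a one-dimensional representation of prime
order as a sum of one or `l` simple modules of equal degree. -/
theorem exists_deg_fixedSub {η : Chr H} (hη : η = 1 ∨ (orderOf η).Prime) (i : Irr H) :
    ∃ j : Irr (fixedSub η), deg i = deg j ∨ deg i = orderOf η * deg j := by
  suffices h : ∃ d, (deg i = d ∨ deg i = orderOf η * d) ∧
      ∃ φ : fixedSub η →ₐ[ℂ] Matrix (Fin d) (Fin d) ℂ, Function.Surjective φ by
    obtain ⟨d, hd, φ, hφ⟩ := h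
    have : NeZero d := ⟨by
      rintro rfl
      have := deg_pos i
      simp at hd
      omega⟩
    obtain ⟨j, hj, -⟩ := exists_chi_eq_of_surjective φ hφ
    exact ⟨j, hj ▸ hd⟩
  by_cases hm : ∀ k, 0 < k → k < orderOf η → rep i ((trans η ^ k) (cidem i)) = 0
  · refine ⟨deg i, Or.inl rfl, (rep i).comp (fixedSub η).val, fun M => ?_⟩
    refine ⟨proj η (lift i ((orderOf η : ℂ) • M)), ?_⟩
    change rep i (proj η _ : H) = M
    rw [rep_proj_lift_of_moved hm, smul_smul, inv_mul_cancel₀ (orderOf_ne_zero_complex η),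
      one_smul]
  · push Not at hm
    obtain ⟨k, hk, hkl, hne⟩ := hm
    have hp : (orderOf η).Prime := hη.resolve_left (by
      rintro rfl
      rw [orderOf_one] at hkl
      omega)
    obtain ⟨t, ht⟩ := (aut_block_dichotomy (trans η ^ k) i).resolve_left hne
    have hcop : (orderOf η).Coprime k :=
      (Nat.Prime.coprime_iff_not_dvd hp).2 (Nat.not_dvd_of_pos_of_lt hk hkl)
    have ho : orderOf (η ^ k) = orderOf η := hcop.orderOf_pow
    have hfix : fixedSub (η ^ k) = fixedSub η := by
      ext x
      rw [mem_fixedSub, mem_fixedSub]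
      refine ⟨fun h => ?_, fun h => ract_pow_of_fixed h k⟩
      obtain ⟨m, hm⟩ := exists_pow_eq_self_of_coprime hcop.symm
      have := ract_pow_of_fixed h m
      rwa [hm] at this
    obtain ⟨d, hd, φ, hφ⟩ := exists_deg_of_inner (η := η ^ k) (i := i) (t := t)
      (fun x => by rw [← ht, trans_pow, trans_apply])
    refine ⟨d, Or.inr (ho ▸ hd), φ.comp (Subalgebra.inclusion hfix.ge), fun M => ?_⟩
    obtain ⟨x, rfl⟩ := hφ M
    exact ⟨⟨x, hfix ▸ x.2⟩, rfl⟩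

end FinHopf

namespace FinHopf

variable {H : Type*} [Ring H] [HopfAlgebra ℂ H] [FiniteDimensional ℂ H] [IsSemisimpleRing H]

lemma map_ract_id_comul (f : H →ₗ[ℂ] ℂ) (x : H) :
    TensorProduct.map (ract f) LinearMap.id (comul (R := ℂ) x) = comul (R := ℂ) (ract f x) := by
  refine cm_ext_apply (f := TensorProduct.map (ract f) LinearMap.id ∘ₗ comul)
    (g := comul ∘ₗ ract f) (fun i j => ?_) x
  simp only [LinearMap.comp_apply, comul_cm, ract_cm, map_sum, map_smul, TensorProduct.map_tmul,
    LinearMap.id_apply, sum_tmul, Finset.smul_sum, smul_tmul']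
  rw [Finset.sum_comm]

lemma map_id_ract_comul (f : H →ₗ[ℂ] ℂ) (x : H) :
    TensorProduct.map LinearMap.id (ract f) (comul (R := ℂ) x) =
      TensorProduct.map (lact f) LinearMap.id (comul (R := ℂ) x) := by
  refine cm_ext_apply (f := TensorProduct.map LinearMap.id (ract f) ∘ₗ comul)
    (g := TensorProduct.map (lact f) LinearMap.id ∘ₗ comul) (fun i j => ?_) x
  simp only [LinearMap.comp_apply, comul_cm, ract_cm, lact_cm, map_sum, TensorProduct.map_tmul,
    LinearMap.id_apply, sum_tmul, tmul_sum, smul_tmul]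
  rw [Finset.sum_comm]

lemma chl_inv_fun (η : Chr H) : chl η⁻¹ = chl η ∘ₗ antipode ℂ := rfl

section central

variable {η : Chr H} (hc : ∀ x, ract (chl η) x = lact (chl η) x)
include hc

lemma ract_chrAvg_eq_lact (x : H) : ract (chrAvg η) x = lact (chrAvg η) x := by
  rw [ract_chrAvg, ← lactAt_apply, chrAvg, map_smul, map_sum]
  congr 1
  refine Finset.sum_congr rfl fun k _ => ?_
  have := pair_pow (g := 1) (fun x => by rw [GroupLike.val_one, mul_one, one_mul, hc]) k x
  rwa [one_pow, GroupLike.val_one, mul_one, one_mul] at this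

lemma map_ract_chrAvg_comul {x : H} (hx : x ∈ fixedSub η) :
    TensorProduct.map (ract (chrAvg η)) (ract (chrAvg η)) (comul (R := ℂ) x) =
      comul (R := ℂ) x := by
  have h1 : TensorProduct.map (ract (chrAvg η)) (ract (chrAvg η)) =
      TensorProduct.map (ract (chrAvg η)) LinearMap.id ∘ₗ
        TensorProduct.map LinearMap.id (ract (chrAvg η)) := by
    rw [← TensorProduct.map_comp, LinearMap.comp_id, LinearMap.id_comp]
  have h2 : lact (chrAvg η) = ract (chrAvg η) :=
    LinearMap.ext fun x => (ract_chrAvg_eq_lact hc x).symm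
  rw [h1, LinearMap.comp_apply, map_id_ract_comul, h2, map_ract_id_comul,
    ract_chrAvg_of_fixed hx, map_ract_id_comul, ract_chrAvg_of_fixed hx]

lemma antipode_mem_fixedSub {x : H} (hx : x ∈ fixedSub η) : antipode ℂ x ∈ fixedSub η := by
  rw [mem_fixedSub, ract_antipode, ← chl_inv_fun]
  congr 1
  rw [mem_fixedSub, hc] at hx
  conv_lhs => rw [← hx]
  rw [lact_chl_lact, inv_mul_cancel, chl_one_fun, lact_counit]

omit hc

/-- The inclusion of the fixed subalgebra. -/
abbrev fixedVal (η : Chr H) : fixedSub η →ₗ[ℂ] H := (fixedSub η).val.toLinearMap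

lemma proj_comp_fixedVal : proj η ∘ₗ fixedVal η = LinearMap.id := LinearMap.ext proj_coe

lemma map_fixedVal_injective :
    Function.Injective (TensorProduct.map (fixedVal η) (fixedVal η)) := by
  refine Function.LeftInverse.injective (g := TensorProduct.map (proj η) (proj η)) fun y => ?_
  rw [← LinearMap.comp_apply, ← TensorProduct.map_comp, proj_comp_fixedVal, TensorProduct.map_id,
    LinearMap.id_apply]

lemma map_map_fixedVal_injective : Function.Injective
    (TensorProduct.map (fixedVal η) (TensorProduct.map (fixedVal η) (fixedVal η))) := by
  refine Function.LeftInverse.injective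
    (g := TensorProduct.map (proj η) (TensorProduct.map (proj η) (proj η))) fun y => ?_
  rw [← LinearMap.comp_apply, ← TensorProduct.map_comp, ← TensorProduct.map_comp,
    proj_comp_fixedVal, TensorProduct.map_id, TensorProduct.map_id, LinearMap.id_apply]

/-- The comultiplication of the fixed subalgebra of a central one-dimensional representation. -/
def fixedComul (η : Chr H) : fixedSub η →ₗ[ℂ] fixedSub η ⊗[ℂ] fixedSub η :=
  TensorProduct.map (proj η) (proj η) ∘ₗ comul ∘ₗ fixedVal η

include hc

lemma map_fixedVal_fixedComul (x : fixedSub η) :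
    TensorProduct.map (fixedVal η) (fixedVal η) (fixedComul η x) = comul (R := ℂ) (x : H) := by
  rw [fixedComul, LinearMap.comp_apply, ← LinearMap.comp_apply, ← TensorProduct.map_comp]
  exact map_ract_chrAvg_comul hc x.2

set_option synthInstance.maxHeartbeats 200000 in
/-- The coalgebra structure of the fixed subalgebra. -/
abbrev fixedCoalgebra : Coalgebra ℂ (fixedSub η) where
  comul := fixedComul η
  counit := counit ∘ₗ fixedVal η
  coassoc := by
    refine LinearMap.ext fun x => map_map_fixedVal_injective ?_
    have h1 : ∀ y : fixedSub η ⊗[ℂ] fixedSub η,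
        TensorProduct.map (fixedVal η) (TensorProduct.map (fixedVal η) (fixedVal η))
          (TensorProduct.assoc ℂ _ _ _ ((fixedComul η).rTensor _ y)) =
        TensorProduct.assoc ℂ _ _ _ ((comul (R := ℂ) (A := H)).rTensor _
          (TensorProduct.map (fixedVal η) (fixedVal η) y)) := by
      intro y
      induction y with
      | zero => simp only [map_zero]
      | add a b ha hb => simp only [map_add, ha, hb]
      | tmul a b =>
        rw [LinearMap.rTensor_tmul, TensorProduct.map_tmul, LinearMap.rTensor_tmul]
        change _ = TensorProduct.assoc ℂ _ _ _ (comul (R := ℂ) (a : H) ⊗ₜ _)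
        rw [← map_fixedVal_fixedComul hc a, ← TensorProduct.map_tmul]
        exact LinearMap.congr_fun (TensorProduct.map_map_comp_assoc_eq (fixedVal η) (fixedVal η)
          (fixedVal η)) _
    have h2 : ∀ y : fixedSub η ⊗[ℂ] fixedSub η,
        TensorProduct.map (fixedVal η) (TensorProduct.map (fixedVal η) (fixedVal η))
          ((fixedComul η).lTensor _ y) = (comul (R := ℂ) (A := H)).lTensor _
          (TensorProduct.map (fixedVal η) (fixedVal η) y) := by
      intro y
      induction y with
      | zero => simp
      | add a b ha hb => simp only [map_add, ha, hb]
      | tmul a b =>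
        rw [LinearMap.lTensor_tmul, TensorProduct.map_tmul, map_fixedVal_fixedComul hc,
          TensorProduct.map_tmul, LinearMap.lTensor_tmul]
        rfl
    have h := coassoc_apply (R := ℂ) (x : H)
    rw [← map_fixedVal_fixedComul hc x, ← h1, ← h2] at h
    exact h
  rTensor_counit_comp_comul := by
    refine LinearMap.ext fun x => ?_
    have h1 : ∀ y : fixedSub η ⊗[ℂ] fixedSub η, (fixedVal η).lTensor ℂ
        ((counit (R := ℂ) ∘ₗ fixedVal η).rTensor _ y) = (counit (R := ℂ) (A := H)).rTensor _
          (TensorProduct.map (fixedVal η) (fixedVal η) y) := by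
      intro y
      induction y with
      | zero => simp
      | add a b ha hb => simp only [map_add, ha, hb]
      | tmul a b => simp
    have h := rTensor_counit_comul (R := ℂ) (x : H)
    rw [← map_fixedVal_fixedComul hc x, ← h1] at h
    have h2 := congrArg ((proj η).lTensor ℂ) h
    rw [← LinearMap.comp_apply, ← LinearMap.lTensor_comp, proj_comp_fixedVal,
      LinearMap.lTensor_id, LinearMap.id_apply, LinearMap.lTensor_tmul, proj_coe] at h2
    exact h2
  lTensor_counit_comp_comul := by
    refine LinearMap.ext fun x => ?_
    have h1 : ∀ y : fixedSub η ⊗[ℂ] fixedSub η, (fixedVal η).rTensor ℂ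
        ((counit (R := ℂ) ∘ₗ fixedVal η).lTensor _ y) = (counit (R := ℂ) (A := H)).lTensor _
          (TensorProduct.map (fixedVal η) (fixedVal η) y) := by
      intro y
      induction y with
      | zero => simp
      | add a b ha hb => simp only [map_add, ha, hb]
      | tmul a b => simp
    have h := lTensor_counit_comul (R := ℂ) (x : H)
    rw [← map_fixedVal_fixedComul hc x, ← h1] at h
    have h2 := congrArg ((proj η).rTensor ℂ) h
    rw [← LinearMap.comp_apply, ← LinearMap.rTensor_comp, proj_comp_fixedVal,
      LinearMap.rTensor_id, LinearMap.id_apply, LinearMap.rTensor_tmul, proj_coe] at h2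
    exact h2

/-- The bialgebra structure of the fixed subalgebra. -/
abbrev fixedBialgebra : Bialgebra ℂ (fixedSub η) :=
  letI := fixedCoalgebra hc
  Bialgebra.mk' ℂ (fixedSub η)
    (show counit (R := ℂ) (1 : H) = 1 from Bialgebra.counit_one)
    (fun {a b} => show counit (R := ℂ) ((a : H) * b) = _ from Bialgebra.counit_mul _ _)
    (map_fixedVal_injective (by
      change TensorProduct.map _ _ (fixedComul η 1) =
        Algebra.TensorProduct.map (fixedSub η).val (fixedSub η).val 1
      rw [map_fixedVal_fixedComul hc, map_one]
      exact Bialgebra.comul_one))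
    (fun {a b} => map_fixedVal_injective (by
      change TensorProduct.map _ _ (fixedComul η (a * b)) =
        Algebra.TensorProduct.map (fixedSub η).val (fixedSub η).val
          (fixedComul η a * fixedComul η b)
      rw [map_fixedVal_fixedComul hc, map_mul]
      change _ = TensorProduct.map (fixedVal η) (fixedVal η) _ *
        TensorProduct.map (fixedVal η) (fixedVal η) _
      rw [map_fixedVal_fixedComul hc, map_fixedVal_fixedComul hc, ← Bialgebra.comul_mul]
      rfl))

lemma coe_proj_antipode (x : fixedSub η) :
    (proj η (antipode ℂ (x : H)) : H) = antipode ℂ (x : H) :=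
  congrArg Subtype.val (proj_coe ⟨_, antipode_mem_fixedSub hc x.2⟩)

/-- The fixed subalgebra of a central one-dimensional representation is a Hopf algebra. -/
abbrev fixedHopf : HopfAlgebra ℂ (fixedSub η) :=
  { fixedBialgebra hc with
    antipode := proj η ∘ₗ antipode ℂ ∘ₗ fixedVal η
    mul_antipode_rTensor_comul := by
      refine LinearMap.ext fun x => Subtype.ext ?_
      have h1 : ∀ y : fixedSub η ⊗[ℂ] fixedSub η,
          ((LinearMap.mul' ℂ (fixedSub η) ((proj η ∘ₗ antipode ℂ ∘ₗ fixedVal η).rTensor _ y) :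
            fixedSub η) : H) = LinearMap.mul' ℂ H ((antipode ℂ).rTensor _
              (TensorProduct.map (fixedVal η) (fixedVal η) y)) := by
        intro y
        induction y with
        | zero => simp
        | add a b ha hb => simp only [map_add, ← ha, ← hb]; rfl
        | tmul a b =>
          rw [LinearMap.rTensor_tmul, TensorProduct.map_tmul, LinearMap.rTensor_tmul,
            LinearMap.mul'_apply, LinearMap.mul'_apply]
          exact congrArg (· * (b : H)) (coe_proj_antipode hc a)
      refine (h1 (fixedComul η x)).trans ?_
      rw [map_fixedVal_fixedComul hc, mul_antipode_rTensor_comul_apply]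
      rfl
    mul_antipode_lTensor_comul := by
      refine LinearMap.ext fun x => Subtype.ext ?_
      have h1 : ∀ y : fixedSub η ⊗[ℂ] fixedSub η,
          ((LinearMap.mul' ℂ (fixedSub η) ((proj η ∘ₗ antipode ℂ ∘ₗ fixedVal η).lTensor _ y) :
            fixedSub η) : H) = LinearMap.mul' ℂ H ((antipode ℂ).lTensor _
              (TensorProduct.map (fixedVal η) (fixedVal η) y)) := by
        intro y
        induction y with
        | zero => simp
        | add a b ha hb => simp only [map_add, ← ha, ← hb]; rfl
        | tmul a b =>
          rw [LinearMap.lTensor_tmul, TensorProduct.map_tmul, LinearMap.lTensor_tmul,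
            LinearMap.mul'_apply, LinearMap.mul'_apply]
          exact congrArg ((a : H) * ·) (coe_proj_antipode hc b)
      refine (h1 (fixedComul η x)).trans ?_
      rw [map_fixedVal_fixedComul hc, mul_antipode_lTensor_comul_apply]
      rfl }

end central

end FinHopf

namespace FinHopf

section degIdem

variable {A : Type*} [Ring A] [Algebra ℂ A] [FiniteDimensional ℂ A] [IsSemisimpleRing A]

variable (A) in
/-- The central idempotent of all blocks of a given degree. -/
def degIdem (d : ℕ) : A := ∑ i ∈ Finset.univ.filter (fun i : Irr A => deg i = d), cidem i

lemma rep_degIdem (d : ℕ) (i : Irr A) : rep i (degIdem A d) = if deg i = d then 1 else 0 := by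
  rw [degIdem, map_sum]
  simp only [rep_cidem]
  rw [Finset.sum_ite_eq]
  simp

lemma degIdem_comm (d : ℕ) (x : A) : x * degIdem A d = degIdem A d * x := by
  refine rep_ext fun i => ?_
  rw [map_mul, map_mul, rep_degIdem]
  split_ifs <;> simp

lemma map_degIdem {T : A →ₐ[ℂ] A} (hT : Function.Surjective T) (d : ℕ) :
    T (degIdem A d) = degIdem A d := by
  refine eq_of_central_of_chi (fun x => ?_) (degIdem_comm d) fun i => ?_
  · obtain ⟨y, rfl⟩ := hT x
    rw [← map_mul, ← map_mul, degIdem_comm]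
  · obtain ⟨j, hj, h⟩ := exists_chi_eq_of_surjective ((rep i).comp T) ((rep_surjective i).comp hT)
    have h1 : chi i (T (degIdem A d)) = chi j (degIdem A d) := h _
    rw [h1, chi_apply, chi_apply, rep_degIdem, rep_degIdem, hj]

end degIdem

variable {H : Type*} [Ring H] [HopfAlgebra ℂ H] [FiniteDimensional ℂ H] [IsSemisimpleRing H]
variable {B : Type*} [Ring B] [HopfAlgebra ℂ B] [FiniteDimensional ℂ B] [IsSemisimpleRing B]

lemma ract_chrAvg_chl (η : Chr H) (x : H) :
    ract (chrAvg η) (ract (chl η) x) = ract (chrAvg η) x := by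
  rw [ract_chrAvg, ract_chrAvg]
  simp_rw [ract_chl_ract, ← pow_succ', pow_succ]
  rw [sum_range_mod η (fun η' => ract (chl η') x)]

/-- The extension of a character of the fixed subalgebra by the averaging projection. -/
def extChar {η : Chr B} (χ : fixedSub η →ₐ[ℂ] ℂ) : B →ₗ[ℂ] ℂ := χ.toLinearMap ∘ₗ proj η

section extChar

variable {η : Chr B} (χ : fixedSub η →ₐ[ℂ] ℂ)

lemma extChar_coe (a : fixedSub η) : extChar χ a = χ a := by
  change χ (proj η a) = _
  rw [proj_coe]

lemma extChar_coe_mul (a b : fixedSub η) :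
    extChar χ ((a : B) * b) = extChar χ a * extChar χ b := by
  rw [extChar_coe, extChar_coe, ← map_mul, ← extChar_coe]; rfl

lemma extChar_one : extChar χ 1 = 1 := (extChar_coe χ 1).trans (map_one χ)

variable (hc : ∀ x, ract (chl η) x = lact (chl η) x)
include hc

lemma conv_extChar : conv (extChar χ) (chl η) = extChar χ := by
  refine LinearMap.ext fun x => ?_
  rw [← apply_lact, ← hc]
  change χ (proj η (ract (chl η) x)) = χ (proj η x)
  congr 1
  exact Subtype.ext (ract_chrAvg_chl η x)

lemma conv_extChar_antipode (y : fixedSub η) :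
    conv (extChar χ) (extChar χ ∘ₗ antipode ℂ) (y : B) = counit (R := ℂ) (y : B) := by
  have h : ∀ s : B ⊗[ℂ] B, LinearMap.mul' ℂ ℂ (TensorProduct.map (extChar χ)
      (extChar χ ∘ₗ antipode ℂ) (TensorProduct.map (ract (chrAvg η)) (ract (chrAvg η)) s)) =
      extChar χ (LinearMap.mul' ℂ B ((antipode ℂ).lTensor B
        (TensorProduct.map (ract (chrAvg η)) (ract (chrAvg η)) s))) := by
    intro s
    induction s with
    | zero => simp
    | add a b ha hb => simp only [map_add, ha, hb]
    | tmul a b =>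
      simp only [TensorProduct.map_tmul, LinearMap.mul'_apply, LinearMap.lTensor_tmul,
        LinearMap.comp_apply]
      exact (extChar_coe_mul χ (proj η a)
        ⟨_, antipode_mem_fixedSub hc (ract_chl_chrAvg η b)⟩).symm
  have h2 := h (comul (R := ℂ) (y : B))
  rw [map_ract_chrAvg_comul hc y.2, mul_antipode_lTensor_comul_apply,
    Algebra.algebraMap_eq_smul_one, map_smul, extChar_one, smul_eq_mul, mul_one] at h2
  exact h2

end extChar

/-- Slicing the first tensor factor by a functional. -/
def slice (f : B →ₗ[ℂ] ℂ) : B ⊗[ℂ] H →ₗ[ℂ] H :=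
  (TensorProduct.lid ℂ H).toLinearMap ∘ₗ f.rTensor H

@[simp] lemma slice_tmul (f : B →ₗ[ℂ] ℂ) (b : B) (x : H) : slice f (b ⊗ₜ[ℂ] x) = f b • x := by
  simp [slice]

variable (π : H →ₐc[ℂ] B)

/-- The coaction of a quotient. -/
def coact : H →ₐ[ℂ] B ⊗[ℂ] H :=
  (Algebra.TensorProduct.map (π : H →ₐ[ℂ] B) (AlgHom.id ℂ H)).comp (Bialgebra.comulAlgHom ℂ H)

lemma coact_cm (i j : Ix H) : coact π (cm i j) = ∑ k, π (cm i k) ⊗ₜ[ℂ] cm k j := by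
  simp [coact, comul_cm]

lemma slice_coact (f : B →ₗ[ℂ] ℂ) (x : H) :
    slice f (coact π x) = ract (f ∘ₗ π.toLinearMap) x := by
  refine cm_ext_apply (f := slice f ∘ₗ (coact π).toLinearMap) (fun i j => ?_) x
  simp only [LinearMap.comp_apply, AlgHom.toLinearMap_apply, coact_cm, map_sum, slice_tmul, ract_cm]
  rfl

lemma ract_map (f : B →ₗ[ℂ] ℂ) (x : H) : ract f (π x) = π (ract (f ∘ₗ π.toLinearMap) x) := by
  refine cm_ext_apply (f := ract f ∘ₗ π.toLinearMap)
    (g := π.toLinearMap ∘ₗ ract (f ∘ₗ π.toLinearMap)) (fun i j => ?_) x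
  rw [LinearMap.comp_apply, show ∀ x, π.toLinearMap x = π x from fun _ => rfl, ract_eq_evL,
    map_comul, comul_cm]
  simp

lemma map_ract_coact (f : B →ₗ[ℂ] ℂ) (x : H) :
    TensorProduct.map (ract f) LinearMap.id (coact π x) =
      coact π (ract (f ∘ₗ π.toLinearMap) x) := by
  refine cm_ext_apply (f := TensorProduct.map (ract f) LinearMap.id ∘ₗ (coact π).toLinearMap)
    (g := (coact π).toLinearMap ∘ₗ ract (f ∘ₗ π.toLinearMap)) (fun i j => ?_) x
  simp only [LinearMap.comp_apply, AlgHom.toLinearMap_apply, coact_cm, map_sum, map_smul,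
    TensorProduct.map_tmul, LinearMap.id_apply, ract_map, ract_cm, sum_tmul, Finset.smul_sum,
    smul_tmul']
  rw [Finset.sum_comm]

/-- Pulling back one-dimensional representations. -/
def chrPull : Chr B →* Chr H where
  toFun η := WithConv.toConv (η.ofConv.comp (π : H →ₐ[ℂ] B))
  map_one' := chl_injective (LinearMap.ext fun x => CoalgHomClass.counit_comp_apply π x)
  map_mul' _ _ := chl_injective (LinearMap.ext fun x => (conv_comp_bialgHom π _ _ x).symm)

lemma chl_chrPull (η : Chr B) : chl (chrPull π η) = chl η ∘ₗ π.toLinearMap := rfl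

variable (hπ : Function.Surjective π)
include hπ

lemma chrPull_injective : Function.Injective (chrPull π) := fun _ _ h => by
  apply chl_injective
  refine LinearMap.ext fun y => ?_
  obtain ⟨x, rfl⟩ := hπ y
  exact LinearMap.congr_fun (congrArg chl h) x

lemma chrAvg_chrPull (η : Chr B) : chrAvg (chrPull π η) = chrAvg η ∘ₗ π.toLinearMap := by
  refine LinearMap.ext fun x => ?_
  simp only [chrAvg, orderOf_injective _ (chrPull_injective π hπ), LinearMap.smul_apply,
    LinearMap.sum_apply, LinearMap.comp_apply, ← map_pow, chl_chrPull]

lemma map_intg : π (intg H) = intg B := by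
  have h1 : intg B * π (intg H) = π (intg H) := by
    obtain ⟨x, hx⟩ := hπ (intg B)
    have h2 : counit (R := ℂ) x = 1 := by
      rw [← CoalgHomClass.counit_comp_apply π x, hx, counit_intg]
    rw [← hx, ← map_mul, mul_intg, h2, one_smul]
  rw [← h1, intg_mul, CoalgHomClass.counit_comp_apply, counit_intg, one_smul]

section action

variable {η : Chr B} (hc : ∀ x, ract (chl η) x = lact (chl η) x) (χ : fixedSub η →ₐ[ℂ] ℂ)

omit hπ in
include hc in
lemma ract_extChar_mem (x : H) :
    ract (extChar χ ∘ₗ π.toLinearMap) x ∈ fixedSub (chrPull π η) := by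
  rw [mem_fixedSub, ract_ract, chl_chrPull]
  congr 2
  refine LinearMap.ext fun y => ?_
  rw [conv_comp_bialgHom, conv_extChar χ hc]
  rfl

lemma map_ract_coact_of_fixed {x : H} (hx : x ∈ fixedSub (chrPull π η)) :
    TensorProduct.map (ract (chrAvg η)) LinearMap.id (coact π x) = coact π x := by
  rw [map_ract_coact, ← chrAvg_chrPull π hπ, ract_chrAvg_of_fixed hx]

lemma ract_extChar_mul {x y : H} (hx : x ∈ fixedSub (chrPull π η))
    (hy : y ∈ fixedSub (chrPull π η)) :
    ract (extChar χ ∘ₗ π.toLinearMap) (x * y) =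
      ract (extChar χ ∘ₗ π.toLinearMap) x * ract (extChar χ ∘ₗ π.toLinearMap) y := by
  have h : ∀ s t : B ⊗[ℂ] H, slice (extChar χ)
      (TensorProduct.map (ract (chrAvg η)) LinearMap.id s *
        TensorProduct.map (ract (chrAvg η)) LinearMap.id t) =
      slice (extChar χ) (TensorProduct.map (ract (chrAvg η)) LinearMap.id s) *
        slice (extChar χ) (TensorProduct.map (ract (chrAvg η)) LinearMap.id t) := by
    intro s t
    induction s with
    | zero => simp
    | add a b ha hb => simp only [map_add, add_mul, ha, hb]
    | tmul a b =>
      induction t with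
      | zero => simp
      | add c d hc hd => simp only [map_add, mul_add, hc, hd]
      | tmul c d =>
        simp only [TensorProduct.map_tmul, Algebra.TensorProduct.tmul_mul_tmul, slice_tmul,
          LinearMap.id_apply, smul_mul_smul_comm]
        rw [← coe_proj, ← coe_proj, extChar_coe_mul]
  rw [← slice_coact, ← slice_coact, ← slice_coact, map_mul, ← map_ract_coact_of_fixed π hπ hx,
    ← map_ract_coact_of_fixed π hπ hy, h]

include hc in
lemma ract_extChar_inv {x : H} (hx : x ∈ fixedSub (chrPull π η)) :
    ract ((extChar χ ∘ₗ antipode ℂ) ∘ₗ π.toLinearMap)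
      (ract (extChar χ ∘ₗ π.toLinearMap) x) = x := by
  have h : ∀ s : B ⊗[ℂ] H, slice (conv (extChar χ) (extChar χ ∘ₗ antipode ℂ))
      (TensorProduct.map (ract (chrAvg η)) LinearMap.id s) =
      slice (counit (R := ℂ)) (TensorProduct.map (ract (chrAvg η)) LinearMap.id s) := by
    intro s
    induction s with
    | zero => simp
    | add a b ha hb => simp only [map_add, ha, hb]
    | tmul a b =>
      simp only [TensorProduct.map_tmul, slice_tmul]
      rw [← coe_proj, conv_extChar_antipode χ hc]
  have h1 : conv (extChar χ ∘ₗ π.toLinearMap) ((extChar χ ∘ₗ antipode ℂ) ∘ₗ π.toLinearMap) =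
      conv (extChar χ) (extChar χ ∘ₗ antipode ℂ) ∘ₗ π.toLinearMap :=
    LinearMap.ext fun y => conv_comp_bialgHom π _ _ y
  have h2 : counit (R := ℂ) ∘ₗ π.toLinearMap = counit (R := ℂ) (A := H) :=
    LinearMap.ext fun y => CoalgHomClass.counit_comp_apply π y
  rw [ract_ract, h1, ← slice_coact, ← map_ract_coact_of_fixed π hπ hx, h,
    map_ract_coact_of_fixed π hπ hx, slice_coact, h2, ract_counit]

/-- The action of a character of the fixed subalgebra of a quotient on the fixed subalgebra. -/
def charAct : fixedSub (chrPull π η) →ₐ[ℂ] fixedSub (chrPull π η) :=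
  AlgHom.ofLinearMap
    { toFun := fun x => ⟨ract (extChar χ ∘ₗ π.toLinearMap) (x : H), ract_extChar_mem π hc χ x⟩
      map_add' := fun x y => Subtype.ext (map_add _ _ _)
      map_smul' := fun c x => Subtype.ext (map_smul _ _ _) }
    (Subtype.ext (by
      change ract (extChar χ ∘ₗ π.toLinearMap) (1 : H) = 1
      rw [ract_one, LinearMap.comp_apply, show π.toLinearMap (1 : H) = 1 from map_one π,
        extChar_one, one_smul]))
    (fun x y => Subtype.ext (ract_extChar_mul π hπ χ x.2 y.2))

lemma coe_charAct (x : fixedSub (chrPull π η)) :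
    (charAct π hπ hc χ x : H) = ract (extChar χ ∘ₗ π.toLinearMap) (x : H) := rfl

lemma charAct_surjective : Function.Surjective (charAct π hπ hc χ) := by
  refine (LinearMap.injective_iff_surjective (f := (charAct π hπ hc χ).toLinearMap)).1
    fun x y h => Subtype.ext ?_
  rw [← ract_extChar_inv π hπ hc χ x.2, ← ract_extChar_inv π hπ hc χ y.2]
  exact congrArg _ (congrArg Subtype.val h)

end action

omit hπ in
lemma ract_mul_of_groupLike {g : GroupLike ℂ H} (hg : π g.val = 1) (f : B →ₗ[ℂ] ℂ) (x : H) :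
    ract (f ∘ₗ π.toLinearMap) (g.val * x) = g.val * ract (f ∘ₗ π.toLinearMap) x := by
  have h : ∀ s : B ⊗[ℂ] H, slice f ((1 ⊗ₜ[ℂ] g.val) * s) = g.val * slice f s := by
    intro s
    induction s with
    | zero => simp
    | add a b ha hb => simp only [mul_add, map_add, ha, hb]
    | tmul a b => simp
  have h1 : coact π g.val = 1 ⊗ₜ[ℂ] g.val := by
    simp [coact, g.isGroupLikeElem_val.comul_eq_tmul_self, hg]
  rw [← slice_coact, ← slice_coact, map_mul, h1, h]

variable {g : GroupLike ℂ H} (hg : π g.val = 1)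
  (hdim : Module.finrank ℂ B * orderOf g = Module.finrank ℂ H)
include hg hdim

/-- The coinvariants in a spectral block of `g` are the scalars. -/
lemma exists_smul_glIdem {ω : ℂ} (hω : ω ^ orderOf g = 1) {x : H} (hx : glIdem g ω * x = x)
    (hx' : ract (((Module.finrank ℂ B : ℂ)⁻¹ • cointg B) ∘ₗ π.toLinearMap) x = x) :
    ∃ c : ℂ, x = c • glIdem g ω := by
  set ν := (Module.finrank ℂ B : ℂ)⁻¹ • cointg B with hν
  have hB : (Module.finrank ℂ B : ℂ) ≠ 0 := by rw [← cointg_one]; exact cointg_one_ne_zero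
  have hν1 : ν 1 = 1 := by
    rw [hν, LinearMap.smul_apply, cointg_one, smul_eq_mul, inv_mul_cancel₀ hB]
  have hνν : conv ν ν = ν := by
    refine LinearMap.ext fun y => ?_
    rw [← apply_lact, ← lactAt_apply, hν, map_smul, lactAt_apply, lact_cointg, ← hν, map_smul,
      map_smul, hν1]
    simp [hν]
  set f := ν ∘ₗ π.toLinearMap with hf
  have hff : ∀ y, ract f (ract f y) = ract f y := fun y => by
    rw [ract_ract]
    congr 2
    refine LinearMap.ext fun z => ?_
    rw [hf, conv_comp_bialgHom, hνν]
    rfl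
  have hcomm : ∀ y, ract f (glIdem g ω * y) = glIdem g ω * ract f y := by
    have h : ∀ k y, ract f (g.val ^ k * y) = g.val ^ k * ract f y := by
      intro k
      induction k with
      | zero => simp
      | succ k ih => intro y; rw [pow_succ, mul_assoc, ih, ract_mul_of_groupLike π hg, mul_assoc]
    intro y
    simp only [glIdem, smul_mul_assoc, Finset.sum_mul, map_smul, map_sum, h]
  let E := LinearMap.mulLeft ℂ (glIdem g ω) ∘ₗ ract f
  have hE : E * E = E := LinearMap.ext fun y => by
    change glIdem g ω * ract f (glIdem g ω * ract f y) = glIdem g ω * ract f y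
    rw [hcomm, hff, ← mul_assoc, glIdem_mul_self hω]
  have htr : LinearMap.trace ℂ H E = 1 := by
    have h0 := orderOf_ne_zero_complex g
    rw [trace_mulLeft_ract, cointg_glIdem, ← hdim]
    have : f (intg H) = (Module.finrank ℂ B : ℂ)⁻¹ := by
      change ν (π (intg H)) = _
      rw [map_intg π hπ, hν, LinearMap.smul_apply, cointg_intg, smul_eq_mul, mul_one]
    rw [this]
    push_cast
    field_simp
  rw [(LinearMap.IsIdempotentElem.isProj_range E hE).trace] at htr
  have hr : Module.finrank ℂ (LinearMap.range E) = 1 := by exact_mod_cast htr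
  have hfg : ∀ k, f (g.val ^ k) = 1 := fun k => by
    change ν (π (g.val ^ k)) = 1
    rw [map_pow, hg, one_pow, hν1]
  have he : E (glIdem g ω) = glIdem g ω := by
    change glIdem g ω * ract f (glIdem g ω) = _
    rw [ract_glIdem hfg, glIdem_mul_self hω]
  have hxE : E x = x := by
    change glIdem g ω * ract f x = _
    rw [hx', hx]
  have hne : glIdem g ω ≠ 0 := by
    intro h
    have h1 := cointg_glIdem g ω
    rw [h, map_zero, ← cointg_one] at h1
    exact mul_ne_zero (inv_ne_zero (orderOf_ne_zero_complex g)) cointg_one_ne_zero h1.symm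
  obtain ⟨c, hc⟩ := (finrank_eq_one_iff_of_nonzero' (⟨glIdem g ω, _, he⟩ : LinearMap.range E)
    (fun h => hne (congrArg Subtype.val h))).1 hr ⟨x, _, hxE⟩
  exact ⟨c, (congrArg Subtype.val hc).symm⟩

/-- If the fixed subalgebra of a central one-dimensional representation of `H/(g-1)` is
commutative, so is the fixed subalgebra of its pullback to `H`. -/
theorem deg_fixedSub_chrPull (hgc : ∀ x, g.val * x = x * g.val)
    (hsq : Squarefree (Module.finrank ℂ H)) {η : Chr B}
    (hc : ∀ x, ract (chl η) x = lact (chl η) x) (hdeg : ∀ j : Irr (fixedSub η), deg j = 1)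
    (i : Irr (fixedSub (chrPull π η))) : deg i = 1 := by
  have hgk : ∀ (f : B →ₗ[ℂ] ℂ), f 1 = 1 → ∀ k, (f ∘ₗ π.toLinearMap) (g.val ^ k) = 1 :=
    fun f hf k => by
      change f (π (g.val ^ k)) = 1
      rw [map_pow, hg, one_pow, hf]
  let gK : fixedSub (chrPull π η) := ⟨g.val, by
    have := hgk (chl η) (chl_one η) 1
    rw [pow_one] at this
    rw [mem_fixedSub, ract_groupLike, chl_chrPull, this, one_smul]⟩
  obtain ⟨ω, hω'⟩ := rep_of_central i (z := gK) (fun x => Subtype.ext (hgc x).symm)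
  have hgl : gK ^ orderOf g = 1 := Subtype.ext (by
    change g.val ^ orderOf g = 1
    rw [← GroupLike.val_pow, pow_orderOf_eq_one, GroupLike.val_one])
  have hω : ω ^ orderOf g = 1 := by
    have h := congrArg (rep i) hgl
    rw [map_pow, hω', smul_pow, one_pow, map_one] at h
    have := congrFun (congrFun h 0) 0
    simpa using this
  have hω0 : ω ≠ 0 := by
    rintro rfl
    rw [zero_pow (orderOf_pos g).ne'] at hω
    exact zero_ne_one hω
  let e : fixedSub (chrPull π η) := (orderOf g : ℂ)⁻¹ • ∑ k ∈ Finset.range (orderOf g), ω⁻¹ ^ k • gK ^ k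
  have he : (e : H) = glIdem g ω := by
    simp only [e, glIdem]
    push_cast
    rfl
  have hrep : rep i e = 1 := by
    simp only [e, map_smul, map_sum, map_pow, hω', smul_pow, one_pow, smul_smul, ← mul_pow,
      inv_mul_cancel₀ hω0, one_smul, Finset.sum_const, Finset.card_range]
    rw [← Nat.cast_smul_eq_nsmul ℂ, smul_smul, inv_mul_cancel₀ (orderOf_ne_zero_complex g),
      one_smul]
  have hee : e * e = e := Subtype.ext (by
    change (e : H) * e = e
    rw [he, glIdem_mul_self hω])
  have hec : ∀ x, x * e = e * x := fun x => Subtype.ext (by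
    change (x : H) * e = e * x
    rw [he, glIdem]
    simp only [mul_smul_comm, smul_mul_assoc, Finset.mul_sum, Finset.sum_mul]
    congr 1
    refine Finset.sum_congr rfl fun k _ => ?_
    congr 1
    exact ((show Commute g.val (x : H) from hgc x).pow_left k).symm.eq)
  set z := e * degIdem (fixedSub (chrPull π η)) (deg i) with hz
  have hrz : rep i z = 1 := by rw [hz, map_mul, hrep, rep_degIdem, if_pos rfl, one_mul]
  have hTz : ∀ χ : fixedSub η →ₐ[ℂ] ℂ, ract (extChar χ ∘ₗ π.toLinearMap) (z : H) = z := by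
    intro χ
    rw [← coe_charAct π hπ hc χ, hz, map_mul, map_degIdem (charAct_surjective π hπ hc χ)]
    congr 2
    refine Subtype.ext ?_
    rw [coe_charAct, he, ract_glIdem (hgk _ (extChar_one χ))]
  have hchar : ∀ j : Irr (fixedSub η), ∃ χ : fixedSub η →ₐ[ℂ] ℂ, χ.toLinearMap = chi j := fun j =>
    ⟨AlgHom.ofLinearMap (chi j) (by rw [chi_one, hdeg j, Nat.cast_one])
      (fun x y => by
        have : Subsingleton (Fin (deg j)) := by rw [hdeg j]; infer_instance
        simp only [chi_apply, map_mul, Matrix.trace, Matrix.diag_apply, Matrix.mul_apply]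
        rw [Fintype.sum_subsingleton _ 0, Fintype.sum_subsingleton _ 0,
          Fintype.sum_subsingleton _ 0, Fintype.sum_subsingleton _ 0]), rfl⟩
  have hB : (Module.finrank ℂ B : ℂ) ≠ 0 := by rw [← cointg_one]; exact cointg_one_ne_zero
  have hνz : ract (((Module.finrank ℂ B : ℂ)⁻¹ • cointg B) ∘ₗ π.toLinearMap) (z : H) = z := by
    choose χ hχ using hchar
    set ν := (Module.finrank ℂ B : ℂ)⁻¹ • cointg B with hν
    have hν1 : ν 1 = 1 := by
      rw [hν, LinearMap.smul_apply, cointg_one, smul_eq_mul, inv_mul_cancel₀ hB]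
    have h1 := trace_functional_eq (f := ν ∘ₗ fixedVal η) (fun x y => by
      change ν ((x : B) * y) = ν ((y : B) * x)
      rw [hν, LinearMap.smul_apply, LinearMap.smul_apply, cointg_comm])
    set c : Irr (fixedSub η) → ℂ := fun j => (ν ∘ₗ fixedVal η) (pidem j) with hc'
    have hsum : ∑ j, c j = 1 := by
      have h2 := LinearMap.congr_fun h1 1
      rw [LinearMap.sum_apply] at h2
      simp only [LinearMap.smul_apply, chi_one, hdeg, Nat.cast_one, smul_eq_mul, mul_one] at h2
      rw [← hν1]
      exact h2.symm
    have h3 : ν = ∑ j, c j • extChar (χ j) := by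
      refine LinearMap.ext fun y => ?_
      have h4 := LinearMap.congr_fun h1 (proj η y)
      have h5 : ν y = (ν ∘ₗ fixedVal η) (proj η y) := by
        change ν y = ν (ract (chrAvg η) y)
        rw [apply_ract, ← apply_lact, ← lactAt_apply, hν, map_smul, lactAt_apply, lact_cointg,
          map_smul, map_smul, chrAvg_one]
        simp
      rw [h5, h4]
      simp only [LinearMap.sum_apply, LinearMap.smul_apply, extChar, hχ]
      rfl
    have h6 : ν ∘ₗ π.toLinearMap = ∑ j, c j • (extChar (χ j) ∘ₗ π.toLinearMap) := by
      rw [h3]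
      refine LinearMap.ext fun y => ?_
      simp
    rw [h6, ← ractAt_apply, map_sum]
    simp_rw [map_smul, ractAt_apply, hTz]
    rw [← Finset.sum_smul, hsum, one_smul]
  obtain ⟨c, hcz⟩ := exists_smul_glIdem π hπ hg hdim hω (x := (z : H)) (by
    rw [← he]
    change ((e * z : fixedSub (chrPull π η)) : H) = z
    rw [hz, ← mul_assoc, hee]) hνz
  have hzc : z = c • e := Subtype.ext (by rw [hcz, ← he]; rfl)
  have hc1 : c = 1 := by
    have h := congrArg (rep i) hzc
    rw [hrz, map_smul, hrep] at h
    have := congrFun (congrFun h 0) 0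
    simpa using this.symm
  rw [hc1, one_smul] at hzc
  have htr := trace_fixed_mulLeft z
  rw [trace_mulLeft, hzc, he, cointg_glIdem, ← hzc] at htr
  have hchi : ∀ j : Irr (fixedSub (chrPull π η)), ∃ m : ℕ, deg j * chi j z = ((deg i ^ 2 * m : ℕ) : ℂ) := by
    intro j
    by_cases hj : deg j = deg i
    · obtain ⟨a, ha⟩ := rep_of_central j hec
      have ha2 : a * a = a := by
        have h := congrArg (rep j) hee
        rw [map_mul, ha] at h
        have := congrFun (congrFun h 0) 0
        simpa using this
      have hcj : chi j z = a * deg i := by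
        rw [hzc, chi_apply, ha, Matrix.trace_smul, Matrix.trace_one, Fintype.card_fin, hj,
          smul_eq_mul]
      rcases (IsIdempotentElem.iff_eq_zero_or_one (p := a)).1 ha2 with h0 | h1
      · exact ⟨0, by rw [hcj, h0]; simp⟩
      · exact ⟨1, by rw [hcj, h1, hj]; push_cast; ring⟩
    · refine ⟨0, ?_⟩
      rw [hz, chi_apply, map_mul, rep_degIdem, if_neg hj]
      simp
  choose m hm using hchi
  have h1 := orderOf_ne_zero_complex g
  have h2 := orderOf_ne_zero_complex (chrPull π η)
  simp_rw [hm] at htr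
  rw [← Nat.cast_sum, ← Finset.mul_sum] at htr
  have hn : Module.finrank ℂ H = deg i * deg i * ((∑ j, m j) * orderOf g * orderOf (chrPull π η)) := by
    have : (Module.finrank ℂ H : ℂ) =
        ((deg i ^ 2 * ∑ j, m j : ℕ) : ℂ) * orderOf g * orderOf (chrPull π η) := by
      rw [htr]; field_simp
    have h3 : Module.finrank ℂ H = (deg i ^ 2 * ∑ j, m j) * orderOf g * orderOf (chrPull π η) := by
      exact_mod_cast this
    rw [h3]; ring
  exact Nat.isUnit_iff.1 (hsq _ ⟨_, hn⟩)

end FinHopf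

namespace FinHopf

variable {H : Type*} [Ring H] [HopfAlgebra ℂ H] [FiniteDimensional ℂ H] [IsSemisimpleRing H]

section quotient

variable {g : GroupLike ℂ H} (hgc : ∀ x, g.val * x = x * g.val)

/-- The simple modules on which `g` acts trivially. -/
def trivOn (g : GroupLike ℂ H) : Finset (Irr H) :=
  Finset.univ.filter fun X => chi X g.val = deg X

lemma mem_trivOn {X : Irr H} : X ∈ trivOn g ↔ chi X g.val = deg X := by simp [trivOn]

include hgc

lemma rep_of_mem_trivOn {X : Irr H} (hX : X ∈ trivOn g) : rep X g.val = 1 := by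
  obtain ⟨c, hc⟩ := rep_of_central X (z := g.val) (fun x => (hgc x).symm)
  rw [mem_trivOn, chi_apply, hc, Matrix.trace_smul, Matrix.trace_one, Fintype.card_fin,
    smul_eq_mul, mul_eq_right₀ (deg_ne_zero X)] at hX
  rw [hc, hX, one_smul]

lemma isSub_trivOn : IsSub (trivOn g) where
  one_mem := by
    rw [mem_trivOn, chi_irrOne, deg_irrOne, g.isGroupLikeElem_val.counit_eq_one, Nat.cast_one]
  dual_mem X hX := by
    have h : rep X (antipode ℂ g.val) = 1 := by
      have := congrArg (rep X) g.isGroupLikeElem_val.antipode_mul_cancel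
      rwa [map_mul, rep_of_mem_trivOn hgc hX, mul_one, map_one] at this
    rw [mem_trivOn, chi_dual_apply, chi_apply, h, Matrix.trace_one, Fintype.card_fin, deg_dual]
  fus_mem X hX Y hY Z hZ := by
    rw [mem_trivOn] at *
    have h1 := conv_chi_mul_cidem X Y Z (w := g.val) (fun x => (hgc x).symm)
    have h2 := conv_chi_mul_cidem X Y Z (w := 1) (by simp)
    change tform (chi X) (chi Y) (comul (R := ℂ) _) = _ at h1
    rw [Bialgebra.comul_mul, g.isGroupLikeElem_val.comul_eq_tmul_self,
      tform_central_mul (fun x => (hgc x).symm) (fun x => (hgc x).symm), hX, hY,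
      div_self (deg_ne_zero X), div_self (deg_ne_zero Y), one_mul, one_mul] at h1
    rw [one_mul] at h2
    change tform (chi X) (chi Y) (comul (R := ℂ) _) = _ at h2
    rw [h2, chi_one] at h1
    exact (mul_left_cancel₀ (Nat.cast_ne_zero.2 hZ) h1).symm

/-- The quotient by `g - 1` for a central group-like element `g`. -/
lemma exists_quotient : ∃ (I : Ideal H) (_ : I.IsTwoSided) (_ : I.IsHopfIdeal ℂ),
    quo I g.val = 1 ∧ Module.finrank ℂ (H ⧸ I) * orderOf g = Module.finrank ℂ H := by
  obtain ⟨I, _, _, hI⟩ := exists_hopfIdeal (isSub_trivOn hgc)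
  refine ⟨I, ‹_›, ‹_›, ?_, ?_⟩
  · change Ideal.Quotient.mk I g.val = 1
    rw [← map_one (Ideal.Quotient.mk I), Ideal.Quotient.eq, hI]
    refine rep_ext fun X => ?_
    rw [map_mul, rep_supp, map_sub, map_zero, map_one]
    split_ifs with hX
    · rw [rep_of_mem_trivOn hgc hX, sub_self, mul_zero]
    · rw [zero_mul]
  · have h1 := cointg_glIdem g 1
    have hX : ∀ X : Irr H, chi X (glIdem g 1) = if X ∈ trivOn g then (deg X : ℂ) else 0 := by
      intro X
      split_ifs with hX
      · rw [chi_apply, glIdem]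
        simp only [map_smul, map_sum, map_pow, rep_of_mem_trivOn hgc hX, one_pow, inv_one,
          one_smul, Finset.sum_const, Finset.card_range]
        rw [← Nat.cast_smul_eq_nsmul ℂ, smul_smul, inv_mul_cancel₀ (orderOf_ne_zero_complex g),
          one_smul, Matrix.trace_one, Fintype.card_fin]
      · obtain ⟨c, hc⟩ := rep_of_central X (z := g.val) (fun x => (hgc x).symm)
        have hc1 : c ≠ 1 := by
          rintro rfl
          apply hX
          rw [mem_trivOn, chi_apply, hc, one_smul, Matrix.trace_one, Fintype.card_fin]
        have h2 := congrArg (rep X) (glIdem_mul (g := g) (one_pow _))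
        rw [one_smul, map_mul, hc, mul_smul_comm, mul_one] at h2
        have h3 : (c - 1) • rep X (glIdem g 1) = 0 := by rw [sub_smul, h2, one_smul, sub_self]
        rw [chi_apply, (smul_eq_zero.1 h3).resolve_left (sub_ne_zero.2 hc1), Matrix.trace_zero]
    rw [cointg_eq_sum_chi] at h1
    simp only [hX, mul_ite, mul_zero, ← Finset.sum_filter, Finset.filter_mem_eq_inter,
      Finset.univ_inter] at h1
    have h0 := orderOf_ne_zero_complex g
    have : ((∑ X ∈ trivOn g, deg X ^ 2 : ℕ) : ℂ) * orderOf g = Module.finrank ℂ H := by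
      push_cast
      simp only [sq]
      rw [h1]
      field_simp
    rw [finrank_quotient hI]
    exact_mod_cast this

end quotient

lemma deg_sq_le_finrank {A : Type*} [Ring A] [Algebra ℂ A] [FiniteDimensional ℂ A]
    [IsSemisimpleRing A] (i : Irr A) : deg i ^ 2 ≤ Module.finrank ℂ A := by
  rw [finrank_eq_sum_deg_sq]
  exact Finset.single_le_sum (f := fun i : Irr A => deg i ^ 2) (fun _ _ => Nat.zero_le _)
    (Finset.mem_univ i)

lemma deg_eq_one_of_finrank {A : Type*} [Ring A] [Algebra ℂ A] [FiniteDimensional ℂ A]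
    [IsSemisimpleRing A] (h : Module.finrank ℂ A = 1) (i : Irr A) : deg i = 1 := by
  have h1 := deg_sq_le_finrank i
  have := deg_pos i
  rw [h] at h1
  nlinarith

lemma mul_comm_of_deg {A : Type*} [Ring A] [Algebra ℂ A] [FiniteDimensional ℂ A]
    [IsSemisimpleRing A] (h : ∀ i : Irr A, deg i = 1) (x y : A) : x * y = y * x := by
  refine rep_ext fun i => ?_
  have : Subsingleton (Fin (deg i)) := by rw [h i]; infer_instance
  rw [map_mul, map_mul]
  ext a b
  rw [Matrix.mul_apply, Matrix.mul_apply, Fintype.sum_subsingleton _ a,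
    Fintype.sum_subsingleton _ a, Subsingleton.elim b a, mul_comm]

lemma deg_fixedSub_of_deg (h : ∀ i : Irr H, deg i = 1) (η : Chr H) (j : Irr (fixedSub η)) :
    deg j = 1 :=
  deg_eq_one_of_comm (fun x y => Subtype.ext (mul_comm_of_deg h (x : H) y)) j

lemma deg_of_fixedSub_one (h : ∀ j : Irr (fixedSub (1 : Chr H)), deg j = 1) (i : Irr H) :
    deg i = 1 := by
  obtain ⟨j, hj⟩ := exists_deg_fixedSub (Or.inl rfl) i
  simpa [h j] using hj

lemma squarefree_of_prime_mul {l m n k : ℕ} (hl : l.Prime) (h : l * m = n) (hsq : Squarefree n)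
    (hk : n.primeFactors.card ≤ k + 1) : Squarefree m ∧ m.primeFactors.card ≤ k := by
  subst h
  obtain ⟨hc, -, hm⟩ := Nat.squarefree_mul_iff.1 hsq
  refine ⟨hm, ?_⟩
  rw [Nat.primeFactors_mul hl.ne_zero hm.ne_zero, Finset.card_union_of_disjoint
    hc.disjoint_primeFactors, hl.primeFactors, Finset.card_singleton] at hk
  omega

section dimensions

variable (hsq : Squarefree (Module.finrank ℂ H))
include hsq

/-- A semisimple Hopf algebra of prime (or trivial) dimension is commutative. -/
theorem deg_eq_one_of_card_le_one (hk : (Module.finrank ℂ H).primeFactors.card ≤ 1) (i : Irr H) :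
    deg i = 1 := by
  by_cases h1 : Module.finrank ℂ H = 1
  · exact deg_eq_one_of_finrank h1 i
  have hlt : 1 < Module.finrank ℂ H := by
    have := hsq.ne_zero
    omega
  have hone : ∀ m : ℕ, Squarefree m → m.primeFactors.card ≤ 0 → m = 1 := fun m hm h => by
    rw [Nat.le_zero, Finset.card_eq_zero, Nat.primeFactors_eq_empty] at h
    exact h.resolve_left hm.ne_zero
  rcases exists_central hlt hsq (hk.trans (by norm_num)) with ⟨g, hg, hgc⟩ | ⟨η, hη, hc⟩
  · obtain ⟨I, _, _, hgI, hdim⟩ := exists_quotient hgc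
    obtain ⟨h2, h3⟩ := squarefree_of_prime_mul (m := Module.finrank ℂ (H ⧸ I)) hg
      (by rw [mul_comm, hdim]) hsq hk
    refine deg_of_fixedSub_one (fun j => ?_) i
    have h4 := deg_fixedSub_chrPull (quo I) quo_surjective hgI hdim hgc hsq (η := 1)
      (fun x => by simp) (deg_fixedSub_of_deg (deg_eq_one_of_finrank (hone _ h2 h3)) 1)
    rw [map_one] at h4
    exact h4 j
  · have hdim := finrank_fixedSub η
    obtain ⟨h2, h3⟩ := squarefree_of_prime_mul hη hdim hsq hk
    have hK := hone _ h2 h3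
    rw [hK, mul_one] at hdim
    obtain ⟨j, hj⟩ := exists_deg_fixedSub (Or.inr hη) i
    rw [deg_eq_one_of_finrank hK j, mul_one] at hj
    refine hj.resolve_right fun h => ?_
    have h4 := deg_sq_le_finrank i
    rw [h, hdim] at h4
    nlinarith

/-- A semisimple Hopf algebra of squarefree dimension with at most two prime factors has a central
one-dimensional representation with commutative fixed subalgebra. -/
theorem exists_chr_of_card_le_two (hk : (Module.finrank ℂ H).primeFactors.card ≤ 2) :
    ∃ η : Chr H, (η = 1 ∨ (orderOf η).Prime) ∧ (∀ x, ract (chl η) x = lact (chl η) x) ∧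
      ∀ j : Irr (fixedSub η), deg j = 1 := by
  by_cases h1 : Module.finrank ℂ H = 1
  · exact ⟨1, Or.inl rfl, fun x => by simp, deg_fixedSub_of_deg (deg_eq_one_of_finrank h1) 1⟩
  have hlt : 1 < Module.finrank ℂ H := by
    have := hsq.ne_zero
    omega
  rcases exists_central hlt hsq (hk.trans (by norm_num)) with ⟨g, hg, hgc⟩ | ⟨η, hη, hc⟩
  · obtain ⟨I, _, _, hgI, hdim⟩ := exists_quotient hgc
    obtain ⟨h2, h3⟩ := squarefree_of_prime_mul (m := Module.finrank ℂ (H ⧸ I)) hg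
      (by rw [mul_comm, hdim]) hsq hk
    have h4 := deg_fixedSub_chrPull (quo I) quo_surjective hgI hdim hgc hsq (η := 1)
      (fun x => by simp) (deg_fixedSub_of_deg (deg_eq_one_of_card_le_one h2 h3) 1)
    rw [map_one] at h4
    exact ⟨1, Or.inl rfl, fun x => by simp, h4⟩
  · obtain ⟨h2, h3⟩ := squarefree_of_prime_mul hη (finrank_fixedSub η) hsq hk
    let _ := fixedHopf hc
    exact ⟨η, Or.inr hη, hc, deg_eq_one_of_card_le_one (H := fixedSub η) h2 h3⟩

theorem deg_dvd_of_card_le_two (hk : (Module.finrank ℂ H).primeFactors.card ≤ 2) (i : Irr H) :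
    deg i ∣ Module.finrank ℂ H := by
  obtain ⟨η, hη, -, h⟩ := exists_chr_of_card_le_two hsq hk
  obtain ⟨j, hj⟩ := exists_deg_fixedSub hη i
  rw [h j, mul_one] at hj
  rcases hj with hj | hj
  · rw [hj]; exact one_dvd _
  · rw [hj]; exact ⟨_, (finrank_fixedSub η).symm⟩

theorem deg_dvd_of_card_le_three (hk : (Module.finrank ℂ H).primeFactors.card ≤ 3) (i : Irr H) :
    deg i ∣ Module.finrank ℂ H := by
  by_cases h1 : Module.finrank ℂ H = 1
  · rw [deg_eq_one_of_finrank h1]; exact one_dvd _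
  have hlt : 1 < Module.finrank ℂ H := by
    have := hsq.ne_zero
    omega
  rcases exists_central hlt hsq hk with ⟨g, hg, hgc⟩ | ⟨η, hη, hc⟩
  · obtain ⟨I, _, _, hgI, hdim⟩ := exists_quotient hgc
    obtain ⟨h2, h3⟩ := squarefree_of_prime_mul (m := Module.finrank ℂ (H ⧸ I)) hg
      (by rw [mul_comm, hdim]) hsq hk
    obtain ⟨η, hη, hc, hdeg⟩ := exists_chr_of_card_le_two h2 h3
    have hη' : chrPull (quo I) η = 1 ∨ (orderOf (chrPull (quo I) η)).Prime := by
      rw [orderOf_injective _ (chrPull_injective (quo I) quo_surjective)]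
      exact hη.imp_left fun h => by rw [h, map_one]
    obtain ⟨j, hj⟩ := exists_deg_fixedSub hη' i
    rw [deg_fixedSub_chrPull (quo I) quo_surjective hgI hdim hgc hsq hc hdeg j, mul_one] at hj
    rcases hj with hj | hj
    · rw [hj]; exact one_dvd _
    · rw [hj]; exact ⟨_, (finrank_fixedSub _).symm⟩
  · have hdim := finrank_fixedSub η
    obtain ⟨h2, h3⟩ := squarefree_of_prime_mul hη hdim hsq hk
    obtain ⟨j, hj⟩ := exists_deg_fixedSub (Or.inr hη) i
    have hd : deg j ∣ Module.finrank ℂ (fixedSub η) := by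
      let _ := fixedHopf hc
      exact deg_dvd_of_card_le_two (H := fixedSub η) h2 h3 j
    rw [← hdim]
    rcases hj with hj | hj
    · rw [hj]; exact hd.mul_left _
    · rw [hj]; exact Nat.mul_dvd_mul_left _ hd

end dimensions

end FinHopf

namespace FinHopf

section simpleModules

lemma finiteDimensional_of_isSimpleModule (A V : Type*) [Ring A] [Algebra ℂ A]
    [FiniteDimensional ℂ A] [AddCommGroup V] [Module ℂ V] [Module A V] [IsScalarTower ℂ A V]
    [IsSimpleModule A V] : FiniteDimensional ℂ V := by
  have := IsSimpleModule.nontrivial A V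
  obtain ⟨v, hv⟩ := exists_ne (0 : V)
  exact Module.Finite.of_surjective ((LinearMap.toSpanSingleton A V v).restrictScalars ℂ)
    (IsSimpleModule.toSpanSingleton_surjective A hv)

variable (A V : Type*) [Ring A] [Algebra ℂ A] [FiniteDimensional ℂ A] [IsSemisimpleRing A]
  [AddCommGroup V] [Module ℂ V] [Module A V] [IsScalarTower ℂ A V] [IsSimpleModule A V]

lemma lsmul_surjective_of_isSimpleModule :
    Function.Surjective (Algebra.lsmul ℂ ℂ V : A →ₐ[ℂ] Module.End ℂ V) := by
  have := finiteDimensional_of_isSimpleModule A V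
  classical
  intro f
  let F : Module.End (Module.End A V) V :=
    { toFun := f
      map_add' := map_add f
      map_smul' := fun φ v => by
        obtain ⟨c, rfl⟩ := (IsSimpleModule.algebraMap_end_bijective_of_isAlgClosed
          (A := A) (V := V) ℂ).2 φ
        simp }
  obtain ⟨a, ha⟩ := jacobson_density F (Finset.univ.image (Module.finBasis ℂ V))
  refine ⟨a, (Module.finBasis ℂ V).ext fun k => ?_⟩
  exact (ha _ (by simp)).symm

lemma exists_deg_eq_finrank : ∃ i : Irr A, deg i = Module.finrank ℂ V := by
  have := finiteDimensional_of_isSimpleModule A V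
  have := IsSimpleModule.nontrivial A V
  have : NeZero (Module.finrank ℂ V) := ⟨Module.finrank_pos.ne'⟩
  let e := LinearMap.toMatrixAlgEquiv (Module.finBasis ℂ V)
  obtain ⟨i, hi, -⟩ := exists_chi_eq_of_surjective
    (e.toAlgHom.comp (Algebra.lsmul ℂ ℂ V : A →ₐ[ℂ] Module.End ℂ V))
    (e.surjective.comp (lsmul_surjective_of_isSimpleModule A V))
  exact ⟨i, hi⟩

end simpleModules

end FinHopf

end

/-- For a semisimple Hopf algebra over ℂ of dimension `p * q * r` with `p < q < r`
primes, the dimension of any simple module divides `p * q * r`. -/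
theorem kaplansky_sixth_for_dim_pqr
    (p q r : ℕ) (hp : p.Prime) (hq : q.Prime) (hr : r.Prime)
    (hpq : p < q) (hqr : q < r)
    (H : Type*) [Ring H] [HopfAlgebra ℂ H]
    [FiniteDimensional ℂ H] [IsSemisimpleRing H]
    (hdim : Module.finrank ℂ H = p * q * r)
    (V : Type*) [AddCommGroup V] [Module ℂ V] [Module H V] [IsScalarTower ℂ H V]
    [IsSimpleModule H V] :
    Module.finrank ℂ V ∣ p * q * r := by
  obtain ⟨i, hi⟩ := FinHopf.exists_deg_eq_finrank H V
  have hcpq : p.Coprime q := (Nat.coprime_primes hp hq).2 hpq.ne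
  have hcpr : p.Coprime r := (Nat.coprime_primes hp hr).2 (hpq.trans hqr).ne
  have hcqr : q.Coprime r := (Nat.coprime_primes hq hr).2 hqr.ne
  have hsq : Squarefree (p * q * r) :=
    (Nat.squarefree_mul (hcpr.mul_left hcqr)).2
      ⟨(Nat.squarefree_mul hcpq).2 ⟨hp.prime.squarefree, hq.prime.squarefree⟩, hr.prime.squarefree⟩
  have hk : (p * q * r).primeFactors.card ≤ 3 := by
    rw [Nat.primeFactors_mul (mul_ne_zero hp.ne_zero hq.ne_zero) hr.ne_zero,
      Nat.primeFactors_mul hp.ne_zero hq.ne_zero, hp.primeFactors, hq.primeFactors,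
      hr.primeFactors]
    exact (Finset.card_union_le _ _).trans (Nat.add_le_add (Finset.card_union_le _ _) le_rfl)
  rw [← hdim] at hsq hk ⊢
  rw [← hi]
  exact FinHopf.deg_dvd_of_card_le_three hsq hk i
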